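/- For every θ > 0 there exist γ > 0 and N = N(θ) ≥ 1 such that, setting γ_k := γ^{k−1} and N_k := N^{2^{k−1}}, for every integer k ≥ 1, every ρ ∈ (θ, 1/θ), every integer n ≥ N_k, and every t > 0: P_{R(ρ)}( |P(H_{R(ρ,1/4)}|η) − P_{R(ρ)}(H_{R(ρ,1/4)})| ≥ t ) ≤ 4·exp(−t·γ_k·(log n)^k). -/

import Mathlib

open MeasureTheory Set
open scoped Classical ENNReal

namespace VoronoiTest

/-- Squared Euclidean distance between two points of the plane. -/
def sqDist (p q : ℝ × ℝ) : ℝ := (p.1 - q.1) ^ 2 + (p.2 - q.2) ^ 2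

/-- The closed axis-parallel rectangle `[x₁, x₂] × [y₁, y₂]`. -/
def rect (x₁ x₂ y₁ y₂ : ℝ) : Set (ℝ × ℝ) := Icc x₁ x₂ ×ˢ Icc y₁ y₂

/-- The Voronoi cell (inside the region `R`) of the `i`-th point of the configuration `η`:
all points of `R` that are (Euclidean-)closer to `η i` than to any other point of `η`. -/
def cell {n : ℕ} (R : Set (ℝ × ℝ)) (η : Fin n → ℝ × ℝ) (i : Fin n) : Set (ℝ × ℝ) :=
  {p ∈ R | ∀ j : Fin n, sqDist p (η i) ≤ sqDist p (η j)}

/-- The union of the red Voronoi cells, for the colouring `c` (`true` = red). -/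
def redSet {n : ℕ} (R : Set (ℝ × ℝ)) (η : Fin n → ℝ × ℝ) (c : Fin n → Bool) : Set (ℝ × ℝ) :=
  ⋃ i ∈ {i : Fin n | c i = true}, cell R η i

/-- The event `H_{R'}` that the rectangle `R' = [x₁,x₂] × [y₁,y₂]` is crossed horizontally
by a continuous path contained in the union of the red Voronoi cells. -/
def Crossing {n : ℕ} (R : Set (ℝ × ℝ)) (x₁ x₂ y₁ y₂ : ℝ)
    (η : Fin n → ℝ × ℝ) (c : Fin n → Bool) : Prop :=
  ∃ γ : ℝ → ℝ × ℝ, ContinuousOn γ (Icc 0 1) ∧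
    (∀ t ∈ Icc (0 : ℝ) 1, γ t ∈ redSet R η c ∩ rect x₁ x₂ y₁ y₂) ∧
    (γ 0).1 = x₁ ∧ (γ 1).1 = x₂

/-- The conditional probability `P(H_{R'} | η)` of a red horizontal crossing of
`R' = [x₁,x₂] × [y₁,y₂]`, given the point configuration `η`: the proportion of the `2 ^ n`
(uniformly likely) colourings that produce a red crossing. -/
noncomputable def condProb {n : ℕ} (R : Set (ℝ × ℝ)) (x₁ x₂ y₁ y₂ : ℝ)
    (η : Fin n → ℝ × ℝ) : ℝ :=
  (Finset.univ.filter fun c : Fin n → Bool => Crossing R x₁ x₂ y₁ y₂ η c).card / 2 ^ n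

/-- The conditional influence `Inf_j(H_{R'} | η)` of the `j`-th point: the probability, over a
uniform random colouring, that flipping the colour of the `j`-th point changes the occurrence
of the crossing event. -/
noncomputable def influence {n : ℕ} (R : Set (ℝ × ℝ)) (x₁ x₂ y₁ y₂ : ℝ)
    (η : Fin n → ℝ × ℝ) (j : Fin n) : ℝ :=
  (Finset.univ.filter fun c : Fin n → Bool =>
      Crossing R x₁ x₂ y₁ y₂ η c ≠
        Crossing R x₁ x₂ y₁ y₂ η (Function.update c j (!c j))).card / 2 ^ n

/-- The uniform probability measure on the region `R ⊆ ℝ²`. -/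
noncomputable def unif (R : Set (ℝ × ℝ)) : Measure (ℝ × ℝ) :=
  (volume R)⁻¹ • volume.restrict R

/-- The law of the point configuration `η` in the binomial model `P_R`:
`n` points placed independently and uniformly at random in `R`. -/
noncomputable def pts (R : Set (ℝ × ℝ)) (n : ℕ) : Measure (Fin n → ℝ × ℝ) :=
  Measure.pi fun _ => unif R

/-- The annealed probability `P_R(H_{R'})` of a red horizontal crossing of
`R' = [x₁,x₂] × [y₁,y₂]` in the binomial model on `R` with `n` points: the average of
`P(H_{R'} | η)` over the point configuration. -/
noncomputable def annealed (R : Set (ℝ × ℝ)) (x₁ x₂ y₁ y₂ : ℝ) (n : ℕ) : ℝ :=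
  ∫ η, condProb R x₁ x₂ y₁ y₂ η ∂(pts R n)

/-- The rectangle `R(ρ, s)` of aspect ratio `ρ` and area `s`, centred at the origin,
given as the 4-tuple `(x₁, x₂, y₁, y₂)` of coordinates of its sides. -/
noncomputable def Rco (ρ s : ℝ) : ℝ × ℝ × ℝ × ℝ :=
  (-(Real.sqrt (ρ * s)) / 2, Real.sqrt (ρ * s) / 2,
    -(Real.sqrt (s / ρ)) / 2, Real.sqrt (s / ρ) / 2)

/-- The rectangle `R(ρ, s)` of aspect ratio `ρ` and area `s`, centred at the origin. -/
noncomputable def Rrect (ρ s : ℝ) : Set (ℝ × ℝ) :=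
  rect (Rco ρ s).1 (Rco ρ s).2.1 (Rco ρ s).2.2.1 (Rco ρ s).2.2.2

/-- The unit square `S = [-1/2, 1/2]²`. -/
def unitSq : Set (ℝ × ℝ) := rect (-(1/2)) (1/2) (-(1/2)) (1/2)

/-- A lift of a nonvanishing map on a simply connected space through `exp`. -/
theorem exists_log_lift {X : Type*} [TopologicalSpace X] [SimplyConnectedSpace X]
    [LocallyPathConnectedSpace X] (F : C(X, ℂ)) (hF : ∀ x, F x ≠ 0) :
    ∃ L : C(X, ℂ), ∀ x, Complex.exp (L x) = F x := by
  obtain ⟨a₀⟩ : Nonempty X := inferInstance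
  obtain ⟨L, ⟨-, hL⟩, -⟩ := Complex.isCoveringMap_exp.existsUnique_continuousMap_lifts
    (A := X) ⟨fun x => ⟨F x, hF x⟩, by fun_prop⟩ a₀ (Complex.log (F a₀))
    (by simp [Complex.exp_log (hF a₀)])
  exact ⟨L, fun x => congrArg Subtype.val (congrFun hL x)⟩

theorem exists_branch (φ : ℝ → ℝ) (hφ : Continuous φ) (a : ℝ)
    (h : ∀ t, 0 ≤ Real.cos (φ t - a)) :
    ∃ k : ℤ, ∀ t, |φ t - a - 2 * Real.pi * k| ≤ Real.pi / 2 := by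
  have hpi := Real.pi_pos
  set k : ℤ := round ((φ 0 - a) / (2 * Real.pi)) with hk
  have hcos : ∀ t, 0 ≤ Real.cos (φ t - a - 2 * Real.pi * k) := fun t => by
    have := Real.cos_sub_int_mul_two_pi (φ t - a) k
    rw [show φ t - a - 2 * Real.pi * k = φ t - a - k * (2 * Real.pi) by ring, this]
    exact h t
  have hneg : ∀ x : ℝ, Real.pi / 2 < |x| → |x| ≤ Real.pi → Real.cos x < 0 := fun x h1 h2 => by
    rw [← Real.cos_abs]
    exact Real.cos_neg_of_pi_div_two_lt_of_lt h1 (by linarith)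
  have h0 : |φ 0 - a - 2 * Real.pi * k| ≤ Real.pi / 2 := by
    by_contra! hc
    have hr := abs_sub_round ((φ 0 - a) / (2 * Real.pi))
    have : |φ 0 - a - 2 * Real.pi * k| ≤ Real.pi := by
      have e : φ 0 - a - 2 * Real.pi * k
          = (2 * Real.pi) * ((φ 0 - a) / (2 * Real.pi) - k) := by field_simp
      rw [e, abs_mul, abs_of_pos (by positivity : (0:ℝ) < 2 * Real.pi)]
      nlinarith
    exact absurd (hcos 0) (not_le.2 (hneg _ hc this))
  refine ⟨k, fun t => ?_⟩
  by_contra! hc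
  set ψ : ℝ → ℝ := fun t => |φ t - a - 2 * Real.pi * k| with hψ
  have hψc : Continuous ψ := by fun_prop
  have hmem : min (ψ t) Real.pi ∈ uIcc (ψ 0) (ψ t) := by
    rw [uIcc_of_le (h0.trans hc.le)]
    exact ⟨le_min (h0.trans hc.le) (h0.trans (by linarith)), min_le_left _ _⟩
  obtain ⟨s, -, hs⟩ := intermediate_value_uIcc (a := 0) (b := t) hψc.continuousOn hmem
  refine absurd (hcos s) (not_le.2 (hneg _ ?_ ?_))
  · change _ < ψ s
    rw [hs]; exact lt_min hc (by linarith)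
  · change ψ s ≤ _
    rw [hs]; exact min_le_right _ _

/-- The two-dimensional Poincaré–Miranda theorem. -/
theorem poincare_miranda (f g : ℝ × ℝ → ℝ)
    (hf : ContinuousOn f (Icc 0 1 ×ˢ Icc 0 1)) (hg : ContinuousOn g (Icc 0 1 ×ˢ Icc 0 1))
    (hl : ∀ t ∈ Icc (0 : ℝ) 1, f (0, t) ≤ 0) (hr : ∀ t ∈ Icc (0 : ℝ) 1, 0 ≤ f (1, t))
    (hb : ∀ s ∈ Icc (0 : ℝ) 1, 0 ≤ g (s, 0)) (ht : ∀ s ∈ Icc (0 : ℝ) 1, g (s, 1) ≤ 0) :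
    ∃ p ∈ Icc (0 : ℝ) 1 ×ˢ Icc (0 : ℝ) 1, f p = 0 ∧ g p = 0 := by
  have hpi := Real.pi_pos
  by_contra! hno
  let c : ℝ → ℝ := fun t => max 0 (min t 1)
  have hc : Continuous c := by fun_prop
  have hcm : ∀ t, c t ∈ Icc (0:ℝ) 1 := fun t =>
    ⟨le_max_left _ _, max_le zero_le_one (min_le_right _ _)⟩
  have c0 : c 0 = 0 := by simp [c]
  have c1 : c 1 = 1 := by simp [c]
  let P : ℝ × ℝ → ℝ × ℝ := fun p => (c p.1, c p.2)
  have hP : Continuous P := by fun_prop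
  have hPm : ∀ p, P p ∈ Icc (0:ℝ) 1 ×ˢ Icc (0:ℝ) 1 := fun p => ⟨hcm _, hcm _⟩
  have hfP : Continuous fun p => f (P p) := hf.comp_continuous hP hPm
  have hgP : Continuous fun p => g (P p) := hg.comp_continuous hP hPm
  let F : C(ℝ × ℝ, ℂ) := ⟨fun p => (f (P p) : ℂ) + g (P p) * Complex.I,
    (Complex.continuous_ofReal.comp hfP).add
      ((Complex.continuous_ofReal.comp hgP).mul continuous_const)⟩
  have hF : ∀ p, F p ≠ 0 := fun p h => by
    have h1 := congrArg Complex.re h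
    have h2 := congrArg Complex.im h
    simp [F] at h1 h2
    exact hno (P p) (hPm p) h1 h2
  have : SimplyConnectedSpace (ℝ × ℝ) := inferInstance
  have : LocallyPathConnectedSpace (ℝ × ℝ) := inferInstance
  obtain ⟨L, hL⟩ := exists_log_lift F hF
  have hre : ∀ p, f (P p) = Real.exp (L p).re * Real.cos (L p).im := fun p => by
    have := congrArg Complex.re (hL p)
    rw [Complex.exp_re] at this
    simpa [F] using this.symm
  have him : ∀ p, g (P p) = Real.exp (L p).re * Real.sin (L p).im := fun p => by
    have := congrArg Complex.im (hL p)
    rw [Complex.exp_im] at this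
    simpa [F] using this.symm
  have hLc : Continuous fun p => (L p).im := Complex.continuous_im.comp L.continuous
  obtain ⟨k1, h1⟩ := exists_branch (fun t => (L (0, t)).im)
    (hLc.comp (by fun_prop : Continuous fun t : ℝ => ((0:ℝ), t))) Real.pi fun t => by
    have := hl (c t) (hcm t)
    have h2 := hre (0, t)
    simp only [P, c0] at h2
    rw [h2] at this
    rw [Real.cos_sub_pi]
    have hh := Real.exp_pos (L (0, t)).re
    by_contra! h
    nlinarith
  obtain ⟨k3, h3⟩ := exists_branch (fun t => (L (1, t)).im)
    (hLc.comp (by fun_prop : Continuous fun t : ℝ => ((1:ℝ), t))) 0 fun t => by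
    have := hr (c t) (hcm t)
    have h2 := hre (1, t)
    simp only [P, c1] at h2
    rw [h2] at this
    rw [sub_zero]
    exact (mul_nonneg_iff_of_pos_left (Real.exp_pos _)).1 this
  obtain ⟨k4, h4⟩ := exists_branch (fun t => (L (t, 0)).im)
    (hLc.comp (by fun_prop : Continuous fun t : ℝ => (t, (0:ℝ)))) (Real.pi / 2) fun t => by
    have := hb (c t) (hcm t)
    have h2 := him (t, 0)
    simp only [P, c0] at h2
    rw [h2] at this
    rw [Real.cos_sub_pi_div_two]
    exact (mul_nonneg_iff_of_pos_left (Real.exp_pos _)).1 this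
  obtain ⟨k2, h2⟩ := exists_branch (fun t => (L (t, 1)).im)
    (hLc.comp (by fun_prop : Continuous fun t : ℝ => (t, (1:ℝ)))) (-(Real.pi / 2)) fun t => by
    have := ht (c t) (hcm t)
    have h2 := him (t, 1)
    simp only [P, c1] at h2
    rw [h2] at this
    rw [sub_neg_eq_add, Real.cos_add_pi_div_two]
    have := Real.exp_pos (L (t, 1)).re
    by_contra! h
    nlinarith
  have key : ∀ (x a b : ℝ) (k l : ℤ), |x - a * Real.pi - 2 * Real.pi * k| ≤ Real.pi / 2 →
      |x - b * Real.pi - 2 * Real.pi * l| ≤ Real.pi / 2 →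
      |(a - b) + 2 * ((k - l : ℤ) : ℝ)| ≤ 1 := fun x a b k l h h' => by
    rw [abs_le] at *
    push_cast
    constructor <;> nlinarith
  have q1 := key (L (0, 0)).im 1 (1/2) k1 k4 (by simpa using h1 0)
    (by simpa [div_eq_inv_mul] using h4 0)
  have q2 := key (L (0, 1)).im 1 (-(1/2)) k1 k2 (by simpa using h1 1)
    (by simpa [div_eq_inv_mul] using h2 0)
  have q3 := key (L (1, 0)).im (1/2) 0 k4 k3 (by simpa [div_eq_inv_mul] using h4 1)
    (by simpa using h3 0)
  have q4 := key (L (1, 1)).im 0 (-(1/2)) k3 k2 (by simpa using h3 1)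
    (by simpa [div_eq_inv_mul] using h2 1)
  rw [abs_le] at q1 q2 q3 q4
  have e1 : -1 < k1 - k4 ∧ k1 - k4 < 1 := by
    constructor <;> rify <;> push_cast at q1 <;> linarith
  have e2 : -2 < k1 - k2 ∧ k1 - k2 < 0 := by
    constructor <;> rify <;> push_cast at q2 <;> linarith
  have e3 : -1 < k4 - k3 ∧ k4 - k3 < 1 := by
    constructor <;> rify <;> push_cast at q3 <;> linarith
  have e4 : -1 < k3 - k2 ∧ k3 - k2 < 1 := by
    constructor <;> rify <;> push_cast at q4 <;> linarith
  omega

theorem mem_rect {x₁ x₂ y₁ y₂ : ℝ} {p : ℝ × ℝ} :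
    p ∈ rect x₁ x₂ y₁ y₂ ↔ (x₁ ≤ p.1 ∧ p.1 ≤ x₂) ∧ (y₁ ≤ p.2 ∧ p.2 ≤ y₂) := Iff.rfl

theorem isCompact_rect (a b c d : ℝ) : IsCompact (rect a b c d) := isCompact_Icc.prod isCompact_Icc

theorem convex_rect (a b c d : ℝ) : Convex ℝ (rect a b c d) :=
  (convex_Icc _ _).prod (convex_Icc _ _)

/-- If `S` joins a point to the left of `T` to a point to the right of `T`, and `T` joins a point
below `S` to a point above `S`, then `S` and `T` intersect. -/
theorem inter_nonempty_of_joinedIn {S T : Set (ℝ × ℝ)} {A B C D : ℝ × ℝ}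
    (hS : JoinedIn S A B) (hT : JoinedIn T C D)
    (h1 : ∀ z ∈ T, A.1 ≤ z.1 ∧ z.1 ≤ B.1) (h2 : ∀ z ∈ S, C.2 ≤ z.2 ∧ z.2 ≤ D.2) :
    (S ∩ T).Nonempty := by
  obtain ⟨p, hp⟩ := hS
  obtain ⟨q, hq⟩ := hT
  have hp' : ∀ s, p.extend s ∈ S := fun s => by
    rw [Path.extend]; exact hp _
  have hq' : ∀ s, q.extend s ∈ T := fun s => by
    rw [Path.extend]; exact hq _
  have hpc : Continuous p.extend := p.continuous_extend
  have hqc : Continuous q.extend := q.continuous_extend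
  obtain ⟨⟨s, t⟩, -, hz1, hz2⟩ := poincare_miranda
    (fun x => (p.extend x.1).1 - (q.extend x.2).1) (fun x => (p.extend x.1).2 - (q.extend x.2).2)
    (by fun_prop) (by fun_prop)
    (fun t _ => by have := h1 _ (hq' t); simp only [Path.extend_zero]; linarith)
    (fun t _ => by have := h1 _ (hq' t); simp only [Path.extend_one]; linarith)
    (fun t _ => by have := h2 _ (hp' t); simp only [Path.extend_zero]; linarith)
    (fun t _ => by have := h2 _ (hp' t); simp only [Path.extend_one]; linarith)
  refine ⟨p.extend s, hp' s, ?_⟩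
  have : p.extend s = q.extend t := Prod.ext (by simpa [sub_eq_zero] using hz1)
    (by simpa [sub_eq_zero] using hz2)
  rw [this]; exact hq' t

theorem joinedIn_of_cross {F S T : Set (ℝ × ℝ)} {A B C D : ℝ × ℝ}
    (hS : JoinedIn S A B) (hT : JoinedIn T C D) (hSF : S ⊆ F) (hTF : T ⊆ F)
    (h1 : ∀ z ∈ T, A.1 ≤ z.1 ∧ z.1 ≤ B.1) (h2 : ∀ z ∈ S, C.2 ≤ z.2 ∧ z.2 ≤ D.2) :
    JoinedIn F A C := by
  obtain ⟨p, hp⟩ := hS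
  obtain ⟨q, hq⟩ := hT
  have jp : JoinedIn (range p) A B := ⟨p, fun t => mem_range_self t⟩
  have jq : JoinedIn (range q) C D := ⟨q, fun t => mem_range_self t⟩
  have hpS : range p ⊆ S := by rintro _ ⟨t, rfl⟩; exact hp t
  have hqT : range q ⊆ T := by rintro _ ⟨t, rfl⟩; exact hq t
  obtain ⟨z, ⟨s, hs⟩, ⟨t, ht⟩⟩ := inter_nonempty_of_joinedIn jp jq (fun z hz => h1 z (hqT hz))
    (fun z hz => h2 z (hpS hz))
  have : PathConnectedSpace unitInterval := isPathConnected_iff_pathConnectedSpace.1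
    ((convex_Icc (0 : ℝ) 1).isPathConnected ⟨0, by simp⟩)
  have hp1 : JoinedIn F A z :=
    ((isPathConnected_range p.continuous).joinedIn _ ⟨0, p.source⟩ _ ⟨s, hs⟩).mono (hpS.trans hSF)
  have hq1 : JoinedIn F z C :=
    ((isPathConnected_range q.continuous).joinedIn _ ⟨t, ht⟩ _ ⟨0, q.source⟩).mono (hqT.trans hTF)
  exact hp1.trans hq1

theorem poincare_miranda_rect {a b c d : ℝ} (hab : a < b) (hcd : c < d) (f g : ℝ × ℝ → ℝ)
    (hf : Continuous f) (hg : Continuous g)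
    (hl : ∀ p ∈ rect a b c d, p.1 = a → f p ≤ 0) (hr : ∀ p ∈ rect a b c d, p.1 = b → 0 ≤ f p)
    (hb : ∀ p ∈ rect a b c d, p.2 = c → 0 ≤ g p) (ht : ∀ p ∈ rect a b c d, p.2 = d → g p ≤ 0) :
    ∃ p ∈ rect a b c d, f p = 0 ∧ g p = 0 := by
  let A : ℝ × ℝ → ℝ × ℝ := fun p => (a + (b - a) * p.1, c + (d - c) * p.2)
  have hA : Continuous A := by fun_prop
  have hm : ∀ p ∈ Icc (0:ℝ) 1 ×ˢ Icc (0:ℝ) 1, A p ∈ rect a b c d := by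
    rintro ⟨s, t⟩ ⟨⟨h1, h2⟩, h3, h4⟩
    simp only at h1 h2 h3 h4
    refine ⟨⟨?_, ?_⟩, ?_, ?_⟩ <;> simp only [A] <;> nlinarith
  obtain ⟨p, hp, h⟩ := poincare_miranda (fun p => f (A p)) (fun p => g (A p))
    (hf.comp hA).continuousOn (hg.comp hA).continuousOn
    (fun t ht' => hl _ (hm (0, t) ⟨by simp, ht'⟩) (by simp [A]))
    (fun t ht' => hr _ (hm (1, t) ⟨by simp, ht'⟩) (by simp [A]))
    (fun t ht' => hb _ (hm (t, 0) ⟨ht', by simp⟩) (by simp [A]))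
    (fun t ht' => ht _ (hm (t, 1) ⟨ht', by simp⟩) (by simp [A]))
  exact ⟨A p, hm p hp, h⟩

theorem exists_separating {X : Type*} [TopologicalSpace X] [NormalSpace X] {s t : Set X}
    (hs : IsClosed s) (ht : IsClosed t) (hd : Disjoint s t) :
    ∃ f : X → ℝ, Continuous f ∧ (∀ x ∈ s, f x = -1) ∧ ∀ x ∈ t, f x = 1 := by
  obtain ⟨f, h0, h1, -⟩ := exists_continuous_zero_one_of_isClosed hs ht hd
  exact ⟨fun x => 2 * f x - 1, by fun_prop, fun x hx => by simp [h0 hx],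
    fun x hx => by simp [h1 hx]; norm_num⟩

/-- The points of a finite union of convex closed sets that are joined to a given set within
the union form a closed set, and so do the remaining ones. -/
theorem isClosed_joined_of_convex {ι : Type*} [Finite ι] (C : ι → Set (ℝ × ℝ))
    (hC : ∀ i, Convex ℝ (C i)) (hcl : ∀ i, IsClosed (C i))
    (T : Set (ℝ × ℝ)) :
    IsClosed {x ∈ ⋃ i, C i | ∃ y ∈ T, JoinedIn (⋃ i, C i) x y} ∧
      IsClosed {x ∈ ⋃ i, C i | ¬ ∃ y ∈ T, JoinedIn (⋃ i, C i) x y} := by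
  set F := ⋃ i, C i with hF
  have key : ∀ i, ∀ x ∈ C i, ∀ y ∈ C i, JoinedIn F x y := fun i x hx y hy =>
    ((hC i).isPathConnected ⟨x, hx⟩ |>.joinedIn x hx y hy).mono (subset_iUnion C i)
  have h1 : {x ∈ F | ∃ y ∈ T, JoinedIn F x y}
      = ⋃ i ∈ {i | ∃ x ∈ C i, ∃ y ∈ T, JoinedIn F x y}, C i := by
    ext x
    simp only [mem_ofPred_eq, mem_iUnion, exists_prop]
    constructor
    · rintro ⟨hx, y, hy, h⟩
      obtain ⟨i, hi⟩ := mem_iUnion.1 hx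
      exact ⟨i, ⟨x, hi, y, hy, h⟩, hi⟩
    · rintro ⟨i, ⟨x', hx', y, hy, h⟩, hx⟩
      exact ⟨mem_iUnion.2 ⟨i, hx⟩, y, hy, (key i x hx x' hx').trans h⟩
  have h2 : {x ∈ F | ¬ ∃ y ∈ T, JoinedIn F x y}
      = ⋃ i ∈ {i | ∃ x ∈ C i, ¬ ∃ y ∈ T, JoinedIn F x y}, C i := by
    ext x
    simp only [mem_ofPred_eq, mem_iUnion, exists_prop]
    constructor
    · rintro ⟨hx, h⟩
      obtain ⟨i, hi⟩ := mem_iUnion.1 hx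
      exact ⟨i, ⟨x, hi, h⟩, hi⟩
    · rintro ⟨i, ⟨x', hx', h⟩, hx⟩
      exact ⟨mem_iUnion.2 ⟨i, hx⟩, fun ⟨y, hy, h'⟩ => h ⟨y, hy, (key i x' hx' x hx).trans h'⟩⟩
  rw [h1, h2]
  exact ⟨(toFinite _).isClosed_biUnion fun i _ => hcl i,
    (toFinite _).isClosed_biUnion fun i _ => hcl i⟩

theorem joinedIn_nhds {a b c d : ℝ} {U : Set (ℝ × ℝ)} (hU : IsOpen U) {z : ℝ × ℝ}
    (hz : z ∈ U) : ∃ V ∈ nhds z, ∀ x ∈ V, ∀ y ∈ V, x ∈ rect a b c d → y ∈ rect a b c d →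
      JoinedIn (U ∩ rect a b c d) x y := by
  obtain ⟨r, hr, hb⟩ := Metric.isOpen_iff.1 hU z hz
  refine ⟨Metric.ball z r, Metric.ball_mem_nhds _ hr, fun x hx y hy hx' hy' => ?_⟩
  have hcx : Convex ℝ (Metric.ball z r ∩ rect a b c d) := (convex_ball z r).inter (convex_rect ..)
  exact ((hcx.isPathConnected ⟨x, hx, hx'⟩).joinedIn x ⟨hx, hx'⟩ y ⟨hy, hy'⟩).mono
    (inter_subset_inter_left _ hb)

/-- Planar duality in a rectangle: if an open set has no left-right crossing, then its complement
(a finite union of convex closed sets) has a bottom-top crossing. -/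
theorem rect_duality {a b c d : ℝ} (hab : a < b) (hcd : c < d) {U : Set (ℝ × ℝ)} (hU : IsOpen U)
    {ι : Type*} [Finite ι] (C : ι → Set (ℝ × ℝ)) (hC : ∀ i, Convex ℝ (C i))
    (hcl : ∀ i, IsClosed (C i)) (hF : rect a b c d \ U = ⋃ i, C i)
    (hno : ¬ ∃ x y, x.1 = a ∧ y.1 = b ∧ JoinedIn (U ∩ rect a b c d) x y) :
    ∃ x y, x.2 = c ∧ y.2 = d ∧ JoinedIn (rect a b c d \ U) x y := by
  by_contra hno'
  set Q := rect a b c d with hQ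
  have hQc : IsClosed Q := (isCompact_rect a b c d).isClosed
  obtain ⟨c1, c2⟩ := isClosed_joined_of_convex C hC hcl {y | y.2 = c}
  rw [← hF] at c1 c2
  set F1 := {x ∈ Q \ U | ∃ y ∈ {y : ℝ × ℝ | y.2 = c}, JoinedIn (Q \ U) x y}
  set F2 := {x ∈ Q \ U | ¬ ∃ y ∈ {y : ℝ × ℝ | y.2 = c}, JoinedIn (Q \ U) x y}
  have hlev1 : ∀ r : ℝ, IsClosed (Q ∩ {p | p.1 = r}) := fun r =>
    hQc.inter (isClosed_eq continuous_fst continuous_const)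
  have hlev2 : ∀ r : ℝ, IsClosed (Q ∩ {p | p.2 = r}) := fun r =>
    hQc.inter (isClosed_eq continuous_snd continuous_const)
  obtain ⟨v, hv, hv1, hv2⟩ := exists_separating (c2.union (hlev2 d)) (c1.union (hlev2 c)) (by
    rw [Set.disjoint_left]
    rintro x (hx | hx) (hx' | hx')
    · exact hx.2 hx'.2
    · exact hx.2 ⟨x, hx'.2, JoinedIn.refl hx.1⟩
    · obtain ⟨y, hy, hj⟩ := hx'.2
      exact hno' ⟨y, x, hy, hx.2, hj.symm⟩
    · exact hcd.ne (hx'.2.symm.trans hx.2))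
  set Z := Q ∩ {p | v p = 0} with hZ
  have hZU : Z ⊆ U := fun x hx => by
    by_contra hxU
    by_cases h : ∃ y ∈ {y : ℝ × ℝ | y.2 = c}, JoinedIn (Q \ U) x y
    · have := hv2 x (Or.inl ⟨⟨hx.1, hxU⟩, h⟩)
      rw [hx.2] at this; norm_num at this
    · have := hv1 x (Or.inl ⟨⟨hx.1, hxU⟩, h⟩)
      rw [hx.2] at this; norm_num at this
  have hZc : IsClosed Z := hQc.inter (isClosed_eq hv continuous_const)
  let J : ℝ × ℝ → Prop := fun z => ∃ x : ℝ × ℝ, x.1 = a ∧ JoinedIn (U ∩ Q) x z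
  have hloc : ∀ z ∈ Z, ∃ V ∈ nhds z, ∀ x ∈ V, x ∈ Z → (J x ↔ J z) := fun z hz => by
    obtain ⟨V, hV, h⟩ := joinedIn_nhds (a := a) (b := b) (c := c) (d := d) hU (hZU hz)
    refine ⟨V, hV, fun x hx hxZ => ⟨?_, ?_⟩⟩
    · rintro ⟨w, hw, hj⟩
      exact ⟨w, hw, hj.trans (h x hx z (mem_of_mem_nhds hV) hxZ.1 hz.1)⟩
    · rintro ⟨w, hw, hj⟩
      exact ⟨w, hw, hj.trans (h z (mem_of_mem_nhds hV) x hx hz.1 hxZ.1)⟩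
  have hcls : ∀ K : Prop → Prop, IsClosed {z ∈ Z | K (J z)} := fun K => by
    rw [← isOpen_compl_iff, isOpen_iff_mem_nhds]
    intro z hz
    by_cases hzZ : z ∈ Z
    · obtain ⟨V, hV, h⟩ := hloc z hzZ
      filter_upwards [hV] with x hx hxm
      refine hz ⟨hzZ, ?_⟩
      rw [← propext (h x hx hxm.1)]; exact hxm.2
    · filter_upwards [hZc.isOpen_compl.mem_nhds hzZ] with x hx hxm
      exact hx hxm.1
  obtain ⟨u, hu, hu1, hu2⟩ := exists_separating ((hcls id).union (hlev1 a))
    ((hcls Not).union (hlev1 b)) (by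
    rw [Set.disjoint_left]
    rintro x (hx | hx) (hx' | hx')
    · exact hx'.2 hx.2
    · obtain ⟨w, hw, hj⟩ := hx.2
      exact hno ⟨w, x, hw, hx'.2, hj⟩
    · exact hx'.2 ⟨x, hx.2, JoinedIn.refl ⟨hZU hx'.1, hx.1⟩⟩
    · exact hab.ne (hx.2.symm.trans hx'.2))
  obtain ⟨p, hp, h1, h2⟩ := poincare_miranda_rect hab hcd u v hu hv
    (fun p hp h => by rw [hu1 p (Or.inr ⟨hp, h⟩)]; norm_num)
    (fun p hp h => by rw [hu2 p (Or.inr ⟨hp, h⟩)]; norm_num)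
    (fun p hp h => by rw [hv2 p (Or.inr ⟨hp, h⟩)]; norm_num)
    (fun p hp h => by rw [hv1 p (Or.inr ⟨hp, h⟩)]; norm_num)
  by_cases hJ : J p
  · have := hu1 p (Or.inl ⟨⟨hp, h2⟩, hJ⟩)
    rw [h1] at this; norm_num at this
  · have := hu2 p (Or.inl ⟨⟨hp, h2⟩, hJ⟩)
    rw [h1] at this; norm_num at this

/-- Extraction of the part of a path between two levels of a continuous function. -/
theorem joinedIn_exists_level {F : Set (ℝ × ℝ)} {x y : ℝ × ℝ} (h : JoinedIn F x y)
    {φ : ℝ × ℝ → ℝ} (hφ : Continuous φ) {a b : ℝ} (hab : a ≤ b) (hx : φ x ≤ a) (hy : b ≤ φ y) :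
    ∃ x' y', φ x' = a ∧ φ y' = b ∧ JoinedIn (F ∩ {p | a ≤ φ p ∧ φ p ≤ b}) x' y' ∧
      JoinedIn F x x' := by
  obtain ⟨p, hp⟩ := h
  have hpF : ∀ s, p.extend s ∈ F := fun s => by rw [Path.extend]; exact hp _
  set f : ℝ → ℝ := fun s => φ (p.extend s) with hf
  have hfc : Continuous f := hφ.comp p.continuous_extend
  have f0 : f 0 ≤ a := by simpa [hf] using hx
  have f1 : b ≤ f 1 := by simpa [hf] using hy
  obtain ⟨s1, ⟨hs1, hs1'⟩, hmax⟩ := (isCompact_Icc.inter_right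
    (isClosed_le hfc continuous_const) : IsCompact (Icc (0 : ℝ) 1 ∩ {s | f s ≤ a})).exists_isGreatest
    ⟨0, by simp, f0⟩
  obtain ⟨s2, ⟨hs2, hs2'⟩, hmin⟩ := (isCompact_Icc.inter_right
    (isClosed_le continuous_const hfc) : IsCompact (Icc s1 1 ∩ {s | b ≤ f s})).exists_isLeast
    ⟨1, ⟨hs1.2, le_rfl⟩, f1⟩
  have e1 : f s1 = a := by
    refine le_antisymm hs1' ?_
    by_contra! hc
    obtain ⟨u, hu, hfu⟩ := intermediate_value_Icc hs1.2 hfc.continuousOn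
      (show a ∈ Icc (f s1) (f 1) from ⟨hc.le, hab.trans f1⟩)
    have := hmax ⟨⟨hs1.1.trans hu.1, hu.2⟩, hfu.le⟩
    have hu1 : u = s1 := le_antisymm this hu.1
    rw [hu1] at hfu
    exact hc.ne hfu
  have e2 : f s2 = b := by
    refine le_antisymm ?_ hs2'
    by_contra! hc
    obtain ⟨u, hu, hfu⟩ := intermediate_value_Icc hs2.1 hfc.continuousOn
      (show b ∈ Icc (f s1) (f s2) from ⟨e1.trans_le hab, hc.le⟩)
    have := hmin ⟨⟨hu.1, hu.2.trans hs2.2⟩, hfu.ge⟩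
    have hu1 : u = s2 := le_antisymm hu.2 this
    rw [hu1] at hfu
    exact hc.ne' hfu
  have hpc0 : IsPathConnected (p.extend '' Icc 0 1) :=
    ((convex_Icc (0 : ℝ) 1).isPathConnected ⟨0, by simp⟩).image p.continuous_extend
  refine ⟨p.extend s1, p.extend s2, e1, e2, ?_,
    (hpc0.joinedIn _ ⟨0, by simp⟩ _ ⟨s1, hs1, rfl⟩).mono (by rintro _ ⟨s, -, rfl⟩; exact hpF s)⟩
  have hpc : IsPathConnected (p.extend '' Icc s1 s2) :=
    ((convex_Icc s1 s2).isPathConnected ⟨s1, le_rfl, hs2.1⟩).image p.continuous_extend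
  refine (hpc.joinedIn _ ⟨s1, ⟨le_rfl, hs2.1⟩, rfl⟩ _ ⟨s2, ⟨hs2.1, le_rfl⟩, rfl⟩).mono ?_
  rintro _ ⟨s, hs, rfl⟩
  refine ⟨hpF s, ?_, ?_⟩
  · rcases hs.1.eq_or_lt with h | h
    · rw [← h]; exact e1.ge
    · by_contra! hc
      exact h.not_ge (hmax ⟨⟨hs1.1.trans hs.1, hs.2.trans hs2.2⟩, hc.le⟩)
  · rcases hs.2.eq_or_lt with h | h
    · rw [h]; exact e2.le
    · by_contra! hc
      exact h.not_ge (hmin ⟨⟨hs.1, hs.2.trans hs2.2⟩, hc.le⟩)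

/-- The family of sets in which `A` and `B` are joined inside the region `R`. -/
def Conn (R A B : Set (ℝ × ℝ)) : Set (Set (ℝ × ℝ)) :=
  {F | ∃ x ∈ A, ∃ y ∈ B, JoinedIn (F ∩ R) x y}

/-- Horizontal crossings of a rectangle. -/
def HC (a b c d : ℝ) : Set (Set (ℝ × ℝ)) := Conn (rect a b c d) {p | p.1 = a} {p | p.1 = b}

/-- Vertical crossings of a rectangle. -/
def VC (a b c d : ℝ) : Set (Set (ℝ × ℝ)) := Conn (rect a b c d) {p | p.2 = c} {p | p.2 = d}

theorem conn_mono {R R' A A' B B' : Set (ℝ × ℝ)} (hR : R ⊆ R') (hA : A ⊆ A') (hB : B ⊆ B') :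
    Conn R A B ⊆ Conn R' A' B' := fun _ ⟨x, hx, y, hy, h⟩ =>
  ⟨x, hA hx, y, hB hy, h.mono (inter_subset_inter_right _ hR)⟩

theorem isUpperSet_conn (R A B : Set (ℝ × ℝ)) : IsUpperSet (Conn R A B) :=
  fun _ _ hFG ⟨x, hx, y, hy, h⟩ => ⟨x, hx, y, hy, h.mono (inter_subset_inter_left _ hFG)⟩

theorem conn_map {Φ : ℝ × ℝ → ℝ × ℝ} (hc : Continuous Φ) {R A B R' A' B' : Set (ℝ × ℝ)}
    (hR : MapsTo Φ R R') (hA : MapsTo Φ A A') (hB : MapsTo Φ B B') {F : Set (ℝ × ℝ)}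
    (h : Φ ⁻¹' F ∈ Conn R A B) : F ∈ Conn R' A' B' := by
  obtain ⟨x, hx, y, hy, hj⟩ := h
  refine ⟨Φ x, hA hx, Φ y, hB hy, ?_⟩
  obtain ⟨p, hp⟩ := hj
  exact ⟨p.map hc, fun t => ⟨(hp t).1, hR (hp t).2⟩⟩

theorem mem_HC_iff_conn {a b c d : ℝ} (hab : a ≤ b) (F : Set (ℝ × ℝ)) :
    F ∈ HC a b c d ↔ ∃ x y, x.1 ≤ a ∧ b ≤ y.1 ∧ JoinedIn (F ∩ {p | c ≤ p.2 ∧ p.2 ≤ d}) x y := by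
  constructor
  · rintro ⟨x, hx, y, hy, h⟩
    exact ⟨x, y, hx.le, hy.ge, h.mono fun p hp => ⟨hp.1, hp.2.2⟩⟩
  · rintro ⟨x, y, hx, hy, h⟩
    obtain ⟨x', y', hx', hy', h', -⟩ := joinedIn_exists_level h continuous_fst hab hx hy
    exact ⟨x', hx', y', hy', h'.mono fun p hp => ⟨hp.1.1, hp.2, hp.1.2⟩⟩

theorem mem_VC_iff_conn {a b c d : ℝ} (hcd : c ≤ d) (F : Set (ℝ × ℝ)) :
    F ∈ VC a b c d ↔ ∃ x y, x.2 ≤ c ∧ d ≤ y.2 ∧ JoinedIn (F ∩ {p | a ≤ p.1 ∧ p.1 ≤ b}) x y := by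
  constructor
  · rintro ⟨x, hx, y, hy, h⟩
    exact ⟨x, y, hx.le, hy.ge, h.mono fun p hp => ⟨hp.1, hp.2.1⟩⟩
  · rintro ⟨x, y, hx, hy, h⟩
    obtain ⟨x', y', hx', hy', h', -⟩ := joinedIn_exists_level h continuous_snd hcd hx hy
    exact ⟨x', hx', y', hy', h'.mono fun p hp => ⟨hp.1.1, hp.1.2, hp.2⟩⟩

/-- An abstract random planar set with positive association, lattice symmetries, square crossings
and approximately independent annuli. -/
structure RSWModel (s₀ T : ℕ) (c₀ : ℝ) where
  /-- the law of the random set -/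
  pr : Set (Set (ℝ × ℝ)) → ℝ
  nonneg : ∀ A, 0 ≤ pr A
  le_one : ∀ A, pr A ≤ 1
  mono : ∀ A B, A ⊆ B → pr A ≤ pr B
  union : ∀ A B, pr (A ∪ B) ≤ pr A + pr B
  fkg : ∀ A B, IsUpperSet A → IsUpperSet B → pr A * pr B ≤ pr (A ∩ B)
  trans : ∀ (m n : ℤ) A, pr {F | (fun p : ℝ × ℝ => (p.1 + m, p.2 + n)) ⁻¹' F ∈ A} = pr A
  refl : ∀ A, pr {F | (fun p : ℝ × ℝ => (-p.1, p.2)) ⁻¹' F ∈ A} = pr A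
  swap : ∀ A, pr {F | (Prod.swap : ℝ × ℝ → ℝ × ℝ) ⁻¹' F ∈ A} = pr A
  square : ∀ m : ℕ, 1 ≤ m → 1 / 2 ≤ pr (HC 0 m 0 m)
  indep : ∀ (J r : ℕ) (A : ℕ → Set (Set (ℝ × ℝ))), s₀ ≤ r → 4 ^ J * r ≤ T →
    (∀ j < J, ∀ F G : Set (ℝ × ℝ),
      F ∩ {p | (4 ^ j * r : ℝ) ≤ ‖p‖ ∧ ‖p‖ ≤ 2 * (4 ^ j * r)} =
        G ∩ {p | (4 ^ j * r : ℝ) ≤ ‖p‖ ∧ ‖p‖ ≤ 2 * (4 ^ j * r)} → F ∈ A j → G ∈ A j) →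
    pr {F | ∀ j < J, F ∉ A j} ≤ ∏ j ∈ Finset.range J, (1 - pr (A j)) + 1 / 64
  init : c₀ ≤ pr (HC 0 (4 * s₀) 0 s₀)

namespace RSWModel
variable {s₀ T : ℕ} {c₀ : ℝ} (M : RSWModel s₀ T c₀)

/-- Maps of the plane preserving the law. -/
def Sym (Φ : ℝ × ℝ → ℝ × ℝ) : Prop := Continuous Φ ∧ ∀ A, M.pr {F | Φ ⁻¹' F ∈ A} = M.pr A

theorem sym_comp {Φ Ψ : ℝ × ℝ → ℝ × ℝ} (h1 : M.Sym Φ) (h2 : M.Sym Ψ) : M.Sym (Φ ∘ Ψ) :=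
  ⟨h1.1.comp h2.1, fun A => by
    have := h1.2 {F | Ψ ⁻¹' F ∈ A}
    rw [h2.2] at this
    exact this⟩

theorem sym_trans (m n : ℤ) : M.Sym fun p => (p.1 + m, p.2 + n) := ⟨by fun_prop, M.trans m n⟩
theorem sym_refl : M.Sym fun p => (-p.1, p.2) := ⟨by fun_prop, M.refl⟩
theorem sym_swap : M.Sym Prod.swap := ⟨by fun_prop, M.swap⟩
theorem sym_refl' : M.Sym fun p => (p.1, -p.2) := M.sym_comp (M.sym_comp M.sym_swap M.sym_refl) M.sym_swap

theorem conn_le {Φ : ℝ × ℝ → ℝ × ℝ} (hΦ : M.Sym Φ) {R A B R' A' B' : Set (ℝ × ℝ)}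
    (hR : MapsTo Φ R R') (hA : MapsTo Φ A A') (hB : MapsTo Φ B B') :
    M.pr (Conn R A B) ≤ M.pr (Conn R' A' B') := by
  rw [← hΦ.2 (Conn R A B)]
  exact M.mono _ _ fun F hF => conn_map hΦ.1 hR hA hB hF

theorem HC_le_trans {L h a b c d : ℝ} (m n : ℤ) (ha : a = m) (hb : b = m + L) (hc : c = n)
    (hd : d = n + h) : M.pr (HC 0 L 0 h) ≤ M.pr (HC a b c d) := by
  refine M.conn_le (M.sym_trans m n) ?_ ?_ ?_
  · rintro p ⟨⟨h1, h2⟩, h3, h4⟩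
    refine ⟨⟨?_, ?_⟩, ?_, ?_⟩ <;> simp <;> linarith
  · intro p hp; simp at hp ⊢; linarith
  · intro p hp; simp at hp ⊢; linarith

theorem HC_le_VC_trans {L h a b c d : ℝ} (m n : ℤ) (ha : a = m) (hb : b = m + h) (hc : c = n)
    (hd : d = n + L) : M.pr (HC 0 L 0 h) ≤ M.pr (VC a b c d) := by
  refine M.conn_le (M.sym_comp (M.sym_trans m n) M.sym_swap) ?_ ?_ ?_
  · rintro p ⟨⟨h1, h2⟩, h3, h4⟩
    refine ⟨⟨?_, ?_⟩, ?_, ?_⟩ <;> simp <;> linarith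
  · intro p hp; simp at hp ⊢; linarith
  · intro p hp; simp at hp ⊢; linarith

theorem HC_mono {L L' h h' : ℝ} (hL : 0 ≤ L') (hLL : L' ≤ L) (hh : h ≤ h') :
    M.pr (HC 0 L 0 h) ≤ M.pr (HC 0 L' 0 h') := by
  refine M.mono _ _ fun F hF => ?_
  rw [mem_HC_iff_conn (hL.trans hLL)] at hF
  obtain ⟨x, y, hx, hy, h⟩ := hF
  exact (mem_HC_iff_conn hL F).2 ⟨x, y, hx, hLL.trans hy,
    h.mono fun p hp => ⟨hp.1, hp.2.1, hp.2.2.trans hh⟩⟩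

/-- Gluing two overlapping horizontal crossings with a vertical one. -/
theorem chain {L h : ℕ} (hh : 1 ≤ h) (hhL : h ≤ L) :
    M.pr (HC 0 L 0 h) ^ 2 / 2 ≤ M.pr (HC 0 (2 * L - h) 0 h) := by
  have hhL' : (h : ℝ) ≤ L := by exact_mod_cast hhL
  have h0 : (0 : ℝ) ≤ h := by positivity
  have i2 : M.pr (HC 0 L 0 h) ≤ M.pr (HC (L - h) (2 * L - h) 0 h) :=
    M.HC_le_trans (L - h) 0 (by push_cast; ring) (by push_cast; ring) (by simp) (by simp)
  have i3 : 1 / 2 ≤ M.pr (VC (L - h) L 0 h) := (M.square h hh).trans <|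
    M.HC_le_VC_trans (L - h) 0 (by push_cast; ring) (by push_cast; ring) (by simp) (by simp)
  have f1 := M.fkg (HC 0 L 0 h) (HC (L - h) (2 * L - h) 0 h) (isUpperSet_conn ..)
    (isUpperSet_conn ..)
  have f2 := M.fkg (HC 0 L 0 h ∩ HC (L - h) (2 * L - h) 0 h) (VC (L - h) L 0 h)
    ((isUpperSet_conn ..).inter (isUpperSet_conn ..)) (isUpperSet_conn ..)
  have g0 := M.nonneg (HC 0 L 0 h)
  calc M.pr (HC 0 L 0 h) ^ 2 / 2 ≤ M.pr (HC 0 L 0 h ∩ HC (L - h) (2 * L - h) 0 h) * M.pr (VC (L - h) L 0 h) := by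
        have := mul_le_mul ((mul_le_mul_of_nonneg_left i2 g0).trans f1) i3 (by norm_num)
          (M.nonneg _)
        nlinarith
    _ ≤ _ := f2
    _ ≤ _ := M.mono _ _ ?_
  rintro F ⟨⟨⟨x1, hx1, y1, hy1, j1⟩, x2, hx2, y2, hy2, j2⟩, x3, hx3, y3, hy3, j3⟩
  simp only [mem_ofPred_eq] at *
  rw [mem_HC_iff_conn (by linarith)]
  have a1 : JoinedIn (F ∩ {p | 0 ≤ p.2 ∧ p.2 ≤ (h : ℝ)}) x1 x3 :=
    joinedIn_of_cross j1 j3 (fun p hp => ⟨hp.1, hp.2.2⟩) (fun p hp => ⟨hp.1, hp.2.2⟩)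
      (fun z hz => by have := hz.2.1; constructor <;> linarith [this.1, this.2])
      (fun z hz => by have := hz.2.2; constructor <;> linarith [this.1, this.2])
  have a2 : JoinedIn (F ∩ {p | 0 ≤ p.2 ∧ p.2 ≤ (h : ℝ)}) x2 x3 :=
    joinedIn_of_cross j2 j3 (fun p hp => ⟨hp.1, hp.2.2⟩) (fun p hp => ⟨hp.1, hp.2.2⟩)
      (fun z hz => by have := hz.2.1; constructor <;> linarith [this.1, this.2])
      (fun z hz => by have := hz.2.2; constructor <;> linarith [this.1, this.2])
  exact ⟨x1, y2, by linarith, by linarith,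
    (a1.trans a2.symm).trans (j2.mono fun p hp => ⟨hp.1, hp.2.2⟩)⟩

/-- Iterating `chain`: a crossing of a rectangle longer than a square yields crossings of
rectangles of any aspect ratio. -/
theorem chain_iterate {L h : ℕ} (hh : 1 ≤ h) (hhL : h ≤ L) {c : ℝ} (hc : 0 ≤ c)
    (h1 : c ≤ M.pr (HC 0 L 0 h)) (k : ℕ) :
    2 * (c / 2) ^ 2 ^ k ≤ M.pr (HC 0 ((h : ℝ) + 2 ^ k * (L - h)) 0 h) := by
  induction k with
  | zero => simpa [show 2 * (c / 2) = c by ring] using h1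
  | succ k ih =>
    have := M.chain (L := h + 2 ^ k * (L - h)) hh (Nat.le_add_right _ _)
    push_cast [Nat.cast_sub hhL] at this
    rw [show (h : ℝ) + 2 ^ (k + 1) * (L - h) = 2 * (h + 2 ^ k * (L - h)) - h by ring]
    refine le_trans ?_ this
    rw [pow_succ, pow_mul]
    have h0 : 0 ≤ (c / 2) ^ 2 ^ k := by positivity
    nlinarith

end RSWModel

theorem joinedIn_convex {K F : Set (ℝ × ℝ)} (hK : Convex ℝ K) (hKF : K ⊆ F) {x y : ℝ × ℝ}
    (hx : x ∈ K) (hy : y ∈ K) : JoinedIn F x y :=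
  ((hK.isPathConnected ⟨x, hx⟩).joinedIn x hx y hy).mono hKF

theorem joinedIn_of_inter {F S T : Set (ℝ × ℝ)} {A B C D : ℝ × ℝ}
    (hS : JoinedIn S A B) (hT : JoinedIn T C D) (hSF : S ⊆ F) (hTF : T ⊆ F)
    (h : ∀ S' T', S' ⊆ S → T' ⊆ T → JoinedIn S' A B → JoinedIn T' C D → (S' ∩ T').Nonempty) :
    JoinedIn F A C := by
  obtain ⟨p, hp⟩ := hS
  obtain ⟨q, hq⟩ := hT
  have hpS : range p ⊆ S := by rintro _ ⟨t, rfl⟩; exact hp t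
  have hqT : range q ⊆ T := by rintro _ ⟨t, rfl⟩; exact hq t
  obtain ⟨z, ⟨s, hs⟩, ⟨t, ht⟩⟩ := h _ _ hpS hqT ⟨p, fun t => mem_range_self t⟩
    ⟨q, fun t => mem_range_self t⟩
  have : PathConnectedSpace unitInterval := isPathConnected_iff_pathConnectedSpace.1
    ((convex_Icc (0 : ℝ) 1).isPathConnected ⟨0, by simp⟩)
  have hp1 : JoinedIn F A z :=
    ((isPathConnected_range p.continuous).joinedIn _ ⟨0, p.source⟩ _ ⟨s, hs⟩).mono (hpS.trans hSF)
  have hq1 : JoinedIn F z C :=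
    ((isPathConnected_range q.continuous).joinedIn _ ⟨t, ht⟩ _ ⟨0, q.source⟩).mono (hqT.trans hTF)
  exact hp1.trans hq1

/-- In a half-plane, a path whose endpoints on the boundary line enclose the landing point of a
second path coming from far away meets this second path. -/
theorem bracket_joined {F S T : Set (ℝ × ℝ)} {A B C D : ℝ × ℝ} {M : ℝ}
    (hS : JoinedIn S A B) (hT : JoinedIn T C D) (hSF : S ⊆ F) (hTF : T ⊆ F)
    (hS0 : ∀ z ∈ S, z.1 ≤ 0) (hT0 : ∀ z ∈ T, z.1 ≤ 0) (hA : A.1 = 0) (hB : B.1 = 0) (hD : D.1 = 0)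
    (hAD : A.2 ≤ D.2) (hDB : D.2 ≤ B.2) (hC : ∀ z ∈ S, C.1 ≤ z.1)
    (hM : ∀ z ∈ T, -M ≤ z.2 ∧ z.2 ≤ M) (hMS : ∀ z ∈ S, -M ≤ z.2 ∧ z.2 ≤ M) :
    JoinedIn F A C := by
  refine joinedIn_of_inter hS hT hSF hTF fun S' T' hS' hT' jS jT => ?_
  have hAS := jS.source_mem
  have hBS := jS.target_mem
  have hDT := jT.target_mem
  have hC0 : C.1 ≤ 0 := hT0 _ (hT' jT.source_mem)
  have mA := hMS _ (hS' hAS)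
  have mB := hMS _ (hS' hBS)
  have mD := hM _ (hT' hDT)
  set ES : Set (ℝ × ℝ) := {p | 0 ≤ p.1 ∧ p.1 ≤ 1 ∧ (p.2 = A.2 ∨ p.2 = B.2)} ∪
    {p | p.1 = 1 ∧ -M ≤ p.2 ∧ p.2 ≤ M ∧ (p.2 ≤ A.2 ∨ B.2 ≤ p.2)} with hES
  set ET : Set (ℝ × ℝ) := {p | 0 ≤ p.1 ∧ p.1 ≤ 2 ∧ p.2 = D.2} with hET
  have j1 : JoinedIn (S' ∪ ES) (1, -M) A := by
    refine (joinedIn_convex (convex_rect 1 1 (-M) A.2) (y := (1, A.2)) ?_ ?_ ?_).trans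
      (joinedIn_convex (convex_rect 0 1 A.2 A.2) ?_ ?_ ?_)
    · rintro p ⟨⟨h1, h2⟩, h3, h4⟩
      exact Or.inr (Or.inr ⟨le_antisymm h2 h1, h3, h4.trans mA.2, Or.inl h4⟩)
    · exact ⟨⟨le_rfl, le_rfl⟩, le_rfl, mA.1⟩
    · exact ⟨⟨le_rfl, le_rfl⟩, mA.1, le_rfl⟩
    · rintro p ⟨⟨h1, h2⟩, h3, h4⟩
      exact Or.inr (Or.inl ⟨h1, h2, Or.inl (le_antisymm h4 h3)⟩)
    · exact ⟨⟨zero_le_one, le_rfl⟩, le_rfl, le_rfl⟩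
    · exact ⟨⟨hA.ge, hA.le.trans zero_le_one⟩, le_rfl, le_rfl⟩
  have j2 : JoinedIn (S' ∪ ES) B (1, M) := by
    refine (joinedIn_convex (convex_rect 0 1 B.2 B.2) (y := (1, B.2)) ?_ ?_ ?_).trans
      (joinedIn_convex (convex_rect 1 1 B.2 M) ?_ ?_ ?_)
    · rintro p ⟨⟨h1, h2⟩, h3, h4⟩
      exact Or.inr (Or.inl ⟨h1, h2, Or.inr (le_antisymm h4 h3)⟩)
    · exact ⟨⟨hB.ge, hB.le.trans zero_le_one⟩, le_rfl, le_rfl⟩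
    · exact ⟨⟨zero_le_one, le_rfl⟩, le_rfl, le_rfl⟩
    · rintro p ⟨⟨h1, h2⟩, h3, h4⟩
      exact Or.inr (Or.inr ⟨le_antisymm h2 h1, mB.1.trans h3, h4, Or.inr h3⟩)
    · exact ⟨⟨le_rfl, le_rfl⟩, le_rfl, mB.2⟩
    · exact ⟨⟨le_rfl, le_rfl⟩, mB.2, le_rfl⟩
  have j3 : JoinedIn (T' ∪ ET) C (2, D.2) := by
    refine (jT.mono subset_union_left).trans (joinedIn_convex (convex_rect 0 2 D.2 D.2) ?_ ?_ ?_)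
    · rintro p ⟨⟨h1, h2⟩, h3, h4⟩
      exact Or.inr ⟨h1, h2, le_antisymm h4 h3⟩
    · exact ⟨⟨hD.ge, by rw [hD]; norm_num⟩, le_rfl, le_rfl⟩
    · exact ⟨⟨zero_le_two, le_rfl⟩, le_rfl, le_rfl⟩
  have hD' : D.2 = A.2 → D = A := fun h => Prod.ext (hD.trans hA.symm) h
  have hD'' : D.2 = B.2 → D = B := fun h => Prod.ext (hD.trans hB.symm) h
  obtain ⟨z, hz1, hz2⟩ := inter_nonempty_of_joinedIn j3
    ((j1.trans (jS.mono subset_union_left)).trans j2) (by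
      rintro z (hz | ⟨h1, h2, -⟩ | ⟨h1, -⟩)
      · exact ⟨hC z (hS' hz), (hS0 z (hS' hz)).trans zero_le_two⟩
      · exact ⟨by linarith, by simp; linarith⟩
      · exact ⟨by linarith, by simp; linarith⟩) (by
      rintro z (hz | ⟨h1, h2, h3⟩)
      · exact hM z (hT' hz)
      · rw [h3]; exact mD)
  rcases hz1 with hz1 | ⟨h1, -, h2⟩ <;> rcases hz2 with hz2 | ⟨h3, h4, h5⟩ | ⟨h3, h4, h5, h6⟩
  · exact ⟨z, hz2, hz1⟩
  · have h0 : z.1 = 0 := le_antisymm (hT0 z (hT' hz1)) h3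
    rcases h5 with h5 | h5
    · rw [show z = A from Prod.ext (h0.trans hA.symm) h5] at hz1
      exact ⟨A, hAS, hz1⟩
    · rw [show z = B from Prod.ext (h0.trans hB.symm) h5] at hz1
      exact ⟨B, hBS, hz1⟩
  · have := hT0 z (hT' hz1); linarith
  · have h0 : z.1 = 0 := le_antisymm (hS0 z (hS' hz2)) h1
    rw [show z = D from Prod.ext (h0.trans hD.symm) h2] at hz2
    exact ⟨D, hz2, hDT⟩
  · rcases h5 with h5 | h5
    · exact ⟨D, hD' (h2.symm.trans h5) ▸ hAS, hDT⟩
    · exact ⟨D, hD'' (h2.symm.trans h5) ▸ hBS, hDT⟩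
  · rcases h6 with h6 | h6
    · exact ⟨D, hD' (le_antisymm (h2.symm.trans_le h6) hAD) ▸ hAS, hDT⟩
    · exact ⟨D, hD'' (le_antisymm hDB (h6.trans_eq h2)) ▸ hBS, hDT⟩

/-- A path in the left half-plane traversing a square annulus is joined to an arc made of three
crossings of rectangles. -/
theorem arc_joined {F R G : Set (ℝ × ℝ)} {r e : ℝ} (hr : 0 < r) (he : 0 ≤ e)
    {xl yl xt yt xb yb u v : ℝ × ℝ}
    (hl : JoinedIn (F ∩ rect (-2 * r) (-r) (-2 * r) (2 * r)) xl yl)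
    (hxl : xl.2 = -2 * r) (hyl : yl.2 = 2 * r)
    (ht : JoinedIn (F ∩ rect (-2 * r) e r (2 * r)) xt yt) (hxt : xt.1 = -2 * r) (hyt : yt.1 = e)
    (hb : JoinedIn (F ∩ rect (-2 * r) e (-2 * r) (-r)) xb yb) (hxb : xb.1 = -2 * r)
    (hyb : yb.1 = e) (hG : F ∩ rect (-2 * r) e (-2 * r) (2 * r) ⊆ G) (hFG : F ∩ R ⊆ G)
    (hR : ∀ z ∈ R, z.1 ≤ 0) (hu : ‖u‖ ≤ r) (hv : 2 * r ≤ ‖v‖) (huv : JoinedIn (F ∩ R) u v) :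
    JoinedIn G xt u := by
  have gl : F ∩ rect (-2 * r) (-r) (-2 * r) (2 * r) ⊆ G := fun p hp => hG ⟨hp.1,
    ⟨hp.2.1.1, hp.2.1.2.trans (by linarith)⟩, hp.2.2⟩
  have gt : F ∩ rect (-2 * r) e r (2 * r) ⊆ G := fun p hp => hG ⟨hp.1,
    hp.2.1, le_trans (by linarith) hp.2.2.1, hp.2.2.2⟩
  have gb : F ∩ rect (-2 * r) e (-2 * r) (-r) ⊆ G := fun p hp => hG ⟨hp.1,
    hp.2.1, hp.2.2.1, hp.2.2.2.trans (by linarith)⟩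
  have jtl : JoinedIn G xt xl := joinedIn_of_cross ht hl gt gl
    (fun z hz => ⟨hxt.trans_le hz.2.1.1, by rw [hyt]; linarith [hz.2.1.2]⟩)
    (fun z hz => ⟨by rw [hxl]; linarith [hz.2.2.1], by rw [hyl]; exact hz.2.2.2⟩)
  have jbl : JoinedIn G xb xl := joinedIn_of_cross hb hl gb gl
    (fun z hz => ⟨hxb.trans_le hz.2.1.1, by rw [hyb]; linarith [hz.2.1.2]⟩)
    (fun z hz => ⟨by rw [hxl]; linarith [hz.2.2.1], by rw [hyl]; linarith [hz.2.2.2]⟩)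
  obtain ⟨u', v', hu', hv', huv', juu'⟩ := joinedIn_exists_level huv continuous_norm
    (show r ≤ 2 * r by linarith) hu hv
  have hnorm : ∀ p : ℝ × ℝ, ‖p‖ ≤ 2 * r → (-2 * r ≤ p.1 ∧ p.1 ≤ 2 * r) ∧
      (-2 * r ≤ p.2 ∧ p.2 ≤ 2 * r) := fun p hp => by
    rw [Prod.norm_def, max_le_iff, Real.norm_eq_abs, Real.norm_eq_abs, abs_le, abs_le] at hp
    exact ⟨⟨by linarith [hp.1.1], hp.1.2⟩, by linarith [hp.2.1], hp.2.2⟩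
  have hnu : (-r ≤ u'.1 ∧ u'.1 ≤ r) ∧ (-r ≤ u'.2 ∧ u'.2 ≤ r) := by
    have := hu'.le
    rw [Prod.norm_def, max_le_iff, Real.norm_eq_abs, Real.norm_eq_abs, abs_le, abs_le] at this
    exact this
  have jG : JoinedIn G u u' := juu'.mono hFG
  have hv0 := hR v' huv'.target_mem.1.2
  have hcase : v'.1 = -2 * r ∨ v'.2 = 2 * r ∨ v'.2 = -2 * r := by
    rw [Prod.norm_def, Real.norm_eq_abs, Real.norm_eq_abs] at hv'
    rcases max_choice |v'.1| |v'.2| with h | h <;> rw [h] at hv'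
    · rw [abs_of_nonpos hv0] at hv'; left; linarith
    · rcases abs_cases v'.2 with h' | h'
      · right; left; linarith
      · right; right; linarith
  have hsub : ∀ K : Set (ℝ × ℝ), (F ∩ R ∩ {p | r ≤ ‖p‖ ∧ ‖p‖ ≤ 2 * r}) ∩ K ⊆ G :=
    fun K p hp => hFG hp.1.1
  rcases hcase with h | h | h
  · obtain ⟨x, y, hx, hy, jxy, jx⟩ := joinedIn_exists_level huv' (φ := fun p => -p.1)
      (by fun_prop) (show r ≤ 2 * r by linarith) (by linarith [hnu.1.1]) (by linarith)
    have := joinedIn_of_cross jxy.symm hl (hsub _) gl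
      (fun z hz => ⟨by linarith [hz.2.1.1], by linarith [hz.2.1.2]⟩)
      (fun z hz => by
        have := hnorm z hz.1.2.2
        exact ⟨hxl.trans_le this.2.1, this.2.2.trans_eq hyl.symm⟩)
    exact jtl.trans ((jG.trans ((jx.mono fun p hp => hFG hp.1).trans
      ((jxy.mono (hsub _)).trans this))).symm)
  · obtain ⟨x, y, hx, hy, jxy, jx⟩ := joinedIn_exists_level huv' (φ := fun p => p.2)
      (by fun_prop) (show r ≤ 2 * r by linarith) (by linarith [hnu.2.2]) (by linarith)
    have := joinedIn_of_cross ht jxy gt (hsub _)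
      (fun z hz => by
        have := hnorm z hz.1.2.2
        exact ⟨hxt.trans_le this.1.1, by rw [hyt]; linarith [hR z hz.1.1.2]⟩)
      (fun z hz => ⟨by linarith [hz.2.2.1], by linarith [hz.2.2.2]⟩)
    exact this.trans (jG.trans (jx.mono fun p hp => hFG hp.1)).symm
  · obtain ⟨x, y, hx, hy, jxy, jx⟩ := joinedIn_exists_level huv' (φ := fun p => -p.2)
      (by fun_prop) (show r ≤ 2 * r by linarith) (by linarith [hnu.2.1]) (by linarith)
    have := joinedIn_of_cross hb jxy.symm gb (hsub _)
      (fun z hz => by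
        have := hnorm z hz.1.2.2
        exact ⟨hxb.trans_le this.1.1, by rw [hyb]; linarith [hR z hz.1.1.2]⟩)
      (fun z hz => ⟨by linarith [hz.2.2.1], by linarith [hz.2.2.2]⟩)
    exact jtl.trans (jbl.symm.trans (this.trans ((jxy.symm.mono (hsub _)).trans
      (jG.trans (jx.mono fun p hp => hFG hp.1)).symm)))

/-- Crossings of the square `[-2 t,0] × [n-t,n+t]` from the left side to the part of the right side
at heights between `n+a` and `n+b`. -/
def Hev (t n a b : ℝ) : Set (Set (ℝ × ℝ)) :=
  Conn (rect (-2 * t) 0 (n - t) (n + t)) {p | p.1 = -2 * t}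
    {p | p.1 = 0 ∧ n + a ≤ p.2 ∧ p.2 ≤ n + b}

/-- Existence of a bracket in the square `[-2 t,0] × [n-t,n+t]`. -/
def Bev (t n a : ℝ) : Set (Set (ℝ × ℝ)) :=
  (Hev t n a t ∩ Hev t n (-t) (-a)) ∩ VC (-2 * t) 0 (n - t) (n + t)

theorem isUpperSet_Bev (t n a : ℝ) : IsUpperSet (Bev t n a) :=
  ((isUpperSet_conn ..).inter (isUpperSet_conn ..)).inter (isUpperSet_conn ..)

theorem Bev_joined {t n a : ℝ} {F : Set (ℝ × ℝ)} (hF : F ∈ Bev t n a) :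
    ∃ l u w w' v v' : ℝ × ℝ, l.1 = 0 ∧ u.1 = 0 ∧ w.1 = -2 * t ∧ w'.1 = -2 * t ∧ v.2 = n - t ∧
      v'.2 = n + t ∧
      (n - t ≤ l.2 ∧ l.2 ≤ n - a) ∧ (n + a ≤ u.2 ∧ u.2 ≤ n + t) ∧
      JoinedIn (F ∩ rect (-2 * t) 0 (n - t) (n + t)) w u ∧
      JoinedIn (F ∩ rect (-2 * t) 0 (n - t) (n + t)) w' l ∧
      JoinedIn (F ∩ rect (-2 * t) 0 (n - t) (n + t)) v v' ∧
      JoinedIn (F ∩ rect (-2 * t) 0 (n - t) (n + t)) l u ∧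
      JoinedIn (F ∩ rect (-2 * t) 0 (n - t) (n + t)) u v := by
  obtain ⟨⟨⟨w, hw, u, hu, j1⟩, w', hw', l, hl, j2⟩, v, hv, v', hv', j3⟩ := hF
  simp only [mem_ofPred_eq] at hw hu hw' hl hv hv'
  have c1 := joinedIn_of_cross j1 j3 Subset.rfl Subset.rfl
    (fun z hz => ⟨hw.trans_le hz.2.1.1, hz.2.1.2.trans_eq hu.1.symm⟩)
    (fun z hz => ⟨hv.trans_le hz.2.2.1, hz.2.2.2.trans_eq hv'.symm⟩)
  have c2 := joinedIn_of_cross j2 j3 Subset.rfl Subset.rfl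
    (fun z hz => ⟨hw'.trans_le hz.2.1.1, hz.2.1.2.trans_eq hl.1.symm⟩)
    (fun z hz => ⟨hv.trans_le hz.2.2.1, hz.2.2.2.trans_eq hv'.symm⟩)
  exact ⟨l, u, w, w', v, v', hl.1, hu.1, hw, hw', hv, hv',
    ⟨by linarith [hl.2.1], by linarith [hl.2.2]⟩,
    ⟨hu.2.1, hu.2.2⟩, j1, j2, j3, (j2.symm.trans c2).trans (c1.symm.trans j1),
    j1.symm.trans c1⟩

namespace RSWModel
variable {s₀ T : ℕ} {c₀ : ℝ} (M : RSWModel s₀ T c₀)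

theorem le_inter {A B : Set (Set (ℝ × ℝ))} (hA : IsUpperSet A) (hB : IsUpperSet B) {a b : ℝ}
    (_ha0 : 0 ≤ a) (hb0 : 0 ≤ b) (ha : a ≤ M.pr A) (hb : b ≤ M.pr B) : a * b ≤ M.pr (A ∩ B) :=
  (mul_le_mul ha hb hb0 (M.nonneg A)).trans (M.fkg A B hA hB)

theorem isUpperSet_preimage {A : Set (Set (ℝ × ℝ))} (hA : IsUpperSet A) (Φ : ℝ × ℝ → ℝ × ℝ) :
    IsUpperSet {F | Φ ⁻¹' F ∈ A} := fun _ _ h hF => hA (preimage_mono h) hF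

theorem Hev_trans (t a b : ℝ) (n : ℤ) : M.pr (Hev t 0 a b) ≤ M.pr (Hev t n a b) := by
  refine M.conn_le (M.sym_trans 0 n) ?_ ?_ ?_
  · rintro p ⟨⟨h1, h2⟩, h3, h4⟩
    refine ⟨⟨?_, ?_⟩, ?_, ?_⟩ <;> simp <;> linarith
  · intro p hp; simp at hp ⊢; linarith
  · rintro p ⟨h1, h2, h3⟩
    refine ⟨?_, ?_, ?_⟩ <;> simp <;> linarith

theorem Hev_refl (t a b : ℝ) : M.pr (Hev t 0 a b) ≤ M.pr (Hev t 0 (-b) (-a)) := by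
  refine M.conn_le M.sym_refl' ?_ ?_ ?_
  · rintro p ⟨⟨h1, h2⟩, h3, h4⟩
    refine ⟨⟨?_, ?_⟩, ?_, ?_⟩ <;> simp <;> linarith
  · intro p hp; simpa using hp
  · rintro p ⟨h1, h2, h3⟩
    refine ⟨?_, ?_, ?_⟩ <;> simp <;> linarith

theorem Hev_union (t a b c : ℝ) :
    M.pr (Hev t 0 a c) ≤ M.pr (Hev t 0 a b) + M.pr (Hev t 0 b c) := by
  refine (M.mono _ _ ?_).trans (M.union _ _)
  rintro F ⟨x, hx, y, ⟨h1, h2, h3⟩, hj⟩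
  rcases le_total y.2 (0 + b) with h | h
  · exact Or.inl ⟨x, hx, y, ⟨h1, h2, h⟩, hj⟩
  · exact Or.inr ⟨x, hx, y, ⟨h1, h, h3⟩, hj⟩

theorem quarter_le {t : ℕ} (ht : 1 ≤ t) : 1 / 4 ≤ M.pr (Hev t 0 0 t) := by
  have h1 : M.pr (HC 0 (2 * t : ℕ) 0 (2 * t : ℕ)) ≤ M.pr (HC (-2 * t) 0 (0 - t) (0 + t)) :=
    M.HC_le_trans (-(2 * t : ℕ)) (-t) (by push_cast; ring) (by push_cast; ring)
      (by push_cast; ring) (by push_cast; ring)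
  have h2 : M.pr (HC (-2 * t) 0 (0 - t) (0 + t)) ≤ M.pr (Hev t 0 (-t) t) := by
    refine M.mono _ _ ?_
    rintro F ⟨x, hx, y, hy, hj⟩
    have := hj.target_mem.2.2
    exact ⟨x, hx, y, ⟨hy, by linarith [this.1], by linarith [this.2]⟩, hj⟩
  have h3 := M.Hev_union t (-t) 0 t
  have h4 := M.Hev_refl t (-t) 0
  rw [neg_neg, neg_zero] at h4
  have h5 := M.square (2 * t) (by omega)
  linarith

/-- The balanced height at scale `t`. -/
noncomputable def bal (t : ℕ) : ℕ := Nat.findGreatest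
  (fun a : ℕ => M.pr (Hev t 0 0 a) ≤ M.pr (Hev t 0 a t) + 1 / 16) (t / 2)

theorem bal_le (t : ℕ) : 2 * M.bal t ≤ t := by
  have : M.bal t ≤ t / 2 := Nat.findGreatest_le _
  omega

theorem three_le {t : ℕ} (ht : 1 ≤ t) : 3 / 32 ≤ M.pr (Hev t 0 (M.bal t) t) := by
  have h0 : M.pr (Hev t 0 0 (0 : ℕ)) ≤ M.pr (Hev t 0 (0 : ℕ) t) + 1 / 16 := by
    have : M.pr (Hev t 0 0 (0 : ℕ)) ≤ M.pr (Hev t 0 (0 : ℕ) t) := by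
      refine M.mono _ _ (conn_mono Subset.rfl Subset.rfl ?_)
      rintro p ⟨h1, h2, h3⟩
      have : (0 : ℝ) ≤ t := by positivity
      simp only [Nat.cast_zero] at h3 ⊢
      exact ⟨h1, h2, by linarith⟩
    exact this.trans (le_add_of_nonneg_right (by norm_num))
  have h1 : M.pr (Hev t 0 0 (M.bal t)) ≤ M.pr (Hev t 0 (M.bal t) t) + 1 / 16 :=
    Nat.findGreatest_spec (P := fun a : ℕ => M.pr (Hev t 0 0 a) ≤ M.pr (Hev t 0 a t) + 1 / 16)
      (Nat.zero_le _) h0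
  have h2 := M.Hev_union t 0 (M.bal t) t
  have h3 := M.quarter_le ht
  linarith

theorem lt_of_bal_lt {t a : ℕ} (h : M.bal t < a) (ha : 2 * a ≤ t) :
    M.pr (Hev t 0 a t) + 1 / 16 < M.pr (Hev t 0 0 a) := by
  have := Nat.findGreatest_is_greatest
    (P := fun a : ℕ => M.pr (Hev t 0 0 a) ≤ M.pr (Hev t 0 a t) + 1 / 16) h (by omega)
  exact not_le.1 this

theorem Bev_ge {t : ℕ} (ht : 1 ≤ t) (n : ℤ) :
    3 / 32 * (3 / 32) * (1 / 2) ≤ M.pr (Bev t n (M.bal t)) := by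
  have h1 := (M.three_le ht).trans (M.Hev_trans t (M.bal t) t n)
  have h2 := ((M.three_le ht).trans (M.Hev_refl t (M.bal t) t)).trans (M.Hev_trans t _ _ n)
  have h3 : 1 / 2 ≤ M.pr (VC (-2 * t) 0 (n - t) (n + t)) :=
    (M.square (2 * t) (by omega)).trans
      (M.HC_le_VC_trans (-(2 * t : ℕ)) (n - t) (by push_cast; ring) (by push_cast; ring)
        (by push_cast; ring) (by push_cast; ring))
  exact M.le_inter ((isUpperSet_conn ..).inter (isUpperSet_conn ..)) (isUpperSet_conn ..)
    (by norm_num) (by norm_num) (M.le_inter (isUpperSet_conn ..) (isUpperSet_conn ..)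
    (by norm_num) (by norm_num) h1 h2) h3

/-- Three interleaved brackets form a long vertical crossing. -/
theorem long_of_bal_eq {t : ℕ} (ht : 1 ≤ t) (h : 2 * M.bal t = t) :
    (3 / 32 * (3 / 32) * (1 / 2)) * (3 / 32 * (3 / 32) * (1 / 2)) * (3 / 32 * (3 / 32) * (1 / 2))
      ≤ M.pr (HC 0 (3 * t) 0 (2 * t)) := by
  have b0 := M.Bev_ge ht 0
  have b1 := M.Bev_ge ht t
  have b2 := M.Bev_ge ht (-t)
  have u : ∀ n : ℤ, IsUpperSet (Bev t n (M.bal t)) := fun n => isUpperSet_Bev ..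
  have key := M.le_inter ((u 0).inter (u t)) (u (-t)) (by norm_num) (by norm_num)
    (M.le_inter (u 0) (u t) (by norm_num) (by norm_num) b0 b1) b2
  refine key.trans ?_
  have hα : (M.bal t : ℝ) = t / 2 := by
    rw [eq_div_iff (by norm_num)]; exact_mod_cast (by omega : M.bal t * 2 = t)
  have ht0 : (1 : ℝ) ≤ t := by exact_mod_cast ht
  refine le_trans (M.mono _ (VC (-2 * t) 0 (-(3 * (M.bal t))) (3 * M.bal t)) ?_) ?_
  · rintro F ⟨⟨h0, h1⟩, h2⟩
    obtain ⟨l, u, w, w', v, v', el, eu, ew, ew', -, -, ⟨hl1, hl2⟩, ⟨hu1, hu2⟩, j1, j2, -, j3, -⟩ :=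
      Bev_joined h0
    obtain ⟨l1, u1, w1, w1', -, -, el1, eu1, ew1, ew1', -, -, ⟨hl11, hl12⟩, ⟨hu11, hu12⟩, j11, j12,
      -, j13, -⟩ := Bev_joined h1
    obtain ⟨l2, u2, w2, w2', -, -, el2, eu2, ew2, ew2', -, -, ⟨hl21, hl22⟩, ⟨hu21, hu22⟩, j21, j22,
      -, j23, -⟩ := Bev_joined h2
    push_cast at *
    rw [hα] at *
    rw [mem_VC_iff_conn (by linarith)]
    have m : ∀ a b : ℝ, F ∩ rect (-2 * t) 0 a b ⊆ F ∩ {p | -2 * (t : ℝ) ≤ p.1 ∧ p.1 ≤ 0} :=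
      fun a b p hp => ⟨hp.1, hp.2.1⟩
    have k1 := bracket_joined (M := 2 * t) j3 j12 (m _ _) (m _ _) (fun z hz => hz.2.1.2)
      (fun z hz => hz.2.1.2) el eu el1 (by linarith) (by linarith)
      (fun z hz => ew1'.trans_le hz.2.1.1)
      (fun z hz => ⟨by linarith [hz.2.2.1], by linarith [hz.2.2.2]⟩)
      (fun z hz => ⟨by linarith [hz.2.2.1], by linarith [hz.2.2.2]⟩)
    have k2 := bracket_joined (M := 2 * t) j3 j21 (m _ _) (m _ _) (fun z hz => hz.2.1.2)
      (fun z hz => hz.2.1.2) el eu eu2 (by linarith) (by linarith)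
      (fun z hz => ew2.trans_le hz.2.1.1)
      (fun z hz => ⟨by linarith [hz.2.2.1], by linarith [hz.2.2.2]⟩)
      (fun z hz => ⟨by linarith [hz.2.2.1], by linarith [hz.2.2.2]⟩)
    refine ⟨l2, u1, by linarith, by linarith, ?_⟩
    exact ((j23.mono (m _ _)).trans ((j21.symm.mono (m _ _)).trans k2.symm)).trans
      (k1.trans ((j12.mono (m _ _)).trans (j13.mono (m _ _))))
  · refine M.conn_le (M.sym_comp (M.sym_trans (3 * M.bal t) (2 * t)) M.sym_swap) ?_ ?_ ?_
    · rintro p ⟨⟨h1, h2⟩, h3, h4⟩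
      refine ⟨⟨?_, ?_⟩, ?_, ?_⟩ <;> simp <;> linarith
    · intro p hp; simp at hp ⊢; linarith
    · intro p hp; simp at hp ⊢; linarith

/-- A bracket at scale `t'` together with a crossing at scale `t` landing inside it. -/
theorem bracket_landing {t t' α α' : ℝ} {F : Set (ℝ × ℝ)} (ht' : t' ≤ t) (h0 : 0 < t') (hα : 0 ≤ α')
    (hαt : α' ≤ t')
    (hle : α ≤ 2 * α') (h1 : F ∈ Bev t' 0 α') (h2 : F ∈ Hev t (-α') 0 α) :
    ∃ z v v' w u : ℝ × ℝ, z.1 = -2 * t ∧ v.2 = -t' ∧ v'.2 = t' ∧ w.1 = -2 * t' ∧ u.1 = 0 ∧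
      JoinedIn (F ∩ rect (-2 * t') 0 (-t') t') v v' ∧
      JoinedIn (F ∩ rect (-2 * t') 0 (-t') t') w u ∧
      JoinedIn (F ∩ {p | -α' - t ≤ p.2 ∧ p.2 ≤ t}) z v ∧
      JoinedIn (F ∩ {p | -α' - t ≤ p.2 ∧ p.2 ≤ t}) z u := by
  obtain ⟨l, u, w, w', v, v', el, eu, ew, ew', ev, ev', ⟨hl1, hl2⟩, ⟨hu1, hu2⟩, j1, j2, j3, j4, j5⟩ :=
    Bev_joined h1
  obtain ⟨z, hz, y, ⟨hy0, hy1, hy2⟩, hj⟩ := h2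
  simp only [zero_sub, zero_add] at *
  simp only [mem_ofPred_eq] at hz
  have m : F ∩ rect (-2 * t') 0 (-t') t' ⊆ F ∩ {p | -α' - t ≤ p.2 ∧ p.2 ≤ t} :=
    fun p hp => ⟨hp.1, by linarith [hp.2.2.1], by linarith [hp.2.2.2]⟩
  have m' : F ∩ rect (-2 * t) 0 (-α' - t) (-α' + t) ⊆ F ∩ {p | -α' - t ≤ p.2 ∧ p.2 ≤ t} :=
    fun p hp => ⟨hp.1, by linarith [hp.2.2.1], by linarith [hp.2.2.2]⟩
  have k := bracket_joined (M := 2 * t) j4 hj m m' (fun z hz => hz.2.1.2)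
      (fun z hz => hz.2.1.2) el eu hy0 (by linarith) (by linarith)
      (fun p hp => by linarith [hp.2.1.1])
      (fun z hz => ⟨by linarith [hz.2.2.1], by linarith [hz.2.2.2]⟩)
      (fun z hz => ⟨by linarith [hz.2.2.1], by linarith [hz.2.2.2]⟩)
  have ku := k.symm.trans (j4.mono m)
  exact ⟨z, v, v', w, u, hz, ev, ev', ew, eu, j3, j1, ku.trans (j5.mono m), ku⟩

theorem long_of_bal_lt {t t' : ℕ} (ht' : 1 ≤ t') (hbal : 2 * (M.bal t + 1) ≤ t) (hlt : t' ≤ t)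
    (hle : M.bal t + 1 ≤ 2 * M.bal t') :
    (3 / 32 * (3 / 32) * (1 / 2) * (1 / 16)) * (3 / 32 * (3 / 32) * (1 / 2) * (1 / 16))
      ≤ M.pr (HC 0 (4 * t - 2 * t') 0 (2 * t + M.bal t')) := by
  set E := Bev t' (0 : ℤ) (M.bal t') ∩ Hev t (-M.bal t' : ℤ) 0 (M.bal t + 1 : ℕ) with hE
  have hEu : IsUpperSet E := (isUpperSet_Bev ..).inter (isUpperSet_conn ..)
  have h1 : 1 / 16 ≤ M.pr (Hev t (-M.bal t' : ℤ) 0 (M.bal t + 1 : ℕ)) := by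
    refine le_trans ?_ (M.Hev_trans t 0 _ (-M.bal t'))
    have := M.lt_of_bal_lt (Nat.lt_succ_self (M.bal t)) hbal
    linarith [M.nonneg (Hev t 0 (M.bal t + 1 : ℕ) t)]
  have h2 : 3 / 32 * (3 / 32) * (1 / 2) * (1 / 16) ≤ M.pr E := M.le_inter (isUpperSet_Bev ..)
    (isUpperSet_conn ..) (by norm_num) (by norm_num) (M.Bev_ge ht' 0) h1
  have hΦ := M.sym_comp (M.sym_trans (-2 * t') 0) M.sym_refl
  set Φ := (fun p : ℝ × ℝ => (p.1 + ((-2 * t' : ℤ) : ℝ), p.2 + ((0 : ℤ) : ℝ))) ∘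
    (fun p : ℝ × ℝ => (-p.1, p.2)) with hΦd
  have hΦx : ∀ p, (Φ p).1 = -2 * t' - p.1 := fun p => by simp [hΦd]; ring
  have hΦy : ∀ p, (Φ p).2 = p.2 := fun p => by simp [hΦd]
  have key := M.le_inter hEu (isUpperSet_preimage hEu Φ) (by norm_num) (by norm_num) h2
    (h2.trans_eq (hΦ.2 E).symm)
  refine key.trans (le_trans (M.mono _ (HC (-2 * t) (2 * t - 2 * t') (-M.bal t' - t) t) ?_) ?_)
  · have r1 : (t' : ℝ) ≤ t := by exact_mod_cast hlt
    have r2 : (0 : ℝ) < t' := by exact_mod_cast ht'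
    have r3 : (M.bal t' : ℝ) ≤ t' := by
      have := M.bal_le t'
      exact_mod_cast (by omega : M.bal t' ≤ t')
    have r4 : (((M.bal t + 1 : ℕ) : ℝ)) ≤ 2 * M.bal t' := by exact_mod_cast hle
    rintro F ⟨⟨e1, e2⟩, e3, e4⟩
    push_cast at e1 e2 e3 e4 r4
    obtain ⟨z, v, v', w, u, hz, hv, hv', hw, hu, j1, j2, j3, j4⟩ :=
      bracket_landing r1 r2 (by positivity) r3 r4 e1 e2
    obtain ⟨z1, v1, v1', w1, u1, hz1, hv1, hv1', hw1, hu1, j11, j12, j13, j14⟩ :=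
      bracket_landing r1 r2 (by positivity) r3 r4 e3 e4
    have map : ∀ {S S' : Set (ℝ × ℝ)} {x y}, JoinedIn (Φ ⁻¹' F ∩ S) x y → MapsTo Φ S S' →
        JoinedIn (F ∩ S') (Φ x) (Φ y) := by
      rintro S S' x y ⟨p, hp⟩ hS
      exact ⟨p.map hΦ.1, fun t => ⟨(hp t).1, hS (hp t).2⟩⟩
    have mQ : MapsTo Φ (rect (-2 * t') 0 (-t') t') (rect (-2 * t') 0 (-t') t') := by
      rintro p ⟨⟨h1, h2⟩, h3, h4⟩
      refine ⟨⟨?_, ?_⟩, ?_, ?_⟩ <;> simp only [hΦx, hΦy] <;> linarith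
    have mS : MapsTo Φ {p | -(M.bal t' : ℝ) - t ≤ p.2 ∧ p.2 ≤ t}
        {p | -(M.bal t' : ℝ) - t ≤ p.2 ∧ p.2 ≤ t} := by
      rintro p ⟨h1, h2⟩
      simp only [mem_ofPred_eq, hΦy]; exact ⟨h1, h2⟩
    have m : F ∩ rect (-2 * t') 0 (-t') t' ⊆ F ∩ {p | -(M.bal t' : ℝ) - t ≤ p.2 ∧ p.2 ≤ t} :=
      fun p hp => ⟨hp.1, by linarith [hp.2.2.1, (Nat.cast_nonneg (M.bal t') : (0:ℝ) ≤ _)],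
        by linarith [hp.2.2.2]⟩
    have k := joinedIn_of_cross j2 (map j11 mQ) m m
      (fun p hp => ⟨hw.trans_le hp.2.1.1, hp.2.1.2.trans_eq hu.symm⟩)
      (fun p hp => ⟨by rw [hΦy, hv1]; exact hp.2.2.1, by rw [hΦy, hv1']; exact hp.2.2.2⟩)
    rw [mem_HC_iff_conn (by linarith)]
    refine ⟨z, Φ z1, hz.le, ?_, ?_⟩
    · rw [hΦx]; linarith
    · exact (j4.trans (j2.symm.mono m)).trans (k.trans (map j13 mS).symm)
  · refine M.conn_le (M.sym_trans (2 * t) (M.bal t' + t)) ?_ ?_ ?_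
    · rintro p ⟨⟨h1, h2⟩, h3, h4⟩
      refine ⟨⟨?_, ?_⟩, ?_, ?_⟩ <;> simp <;> linarith
    · intro p hp; simp at hp ⊢; linarith
    · intro p hp; simp at hp ⊢; linarith

end RSWModel

namespace RSWModel
variable {s₀ T : ℕ} {c₀ : ℝ} (M : RSWModel s₀ T c₀)

/-- A universal lower bound for the probability of hard crossings at good scales. -/
noncomputable def hardConst : ℝ :=
  2 * ((3 / 32 * (3 / 32) * (1 / 2) * (1 / 16)) * (3 / 32 * (3 / 32) * (1 / 2) * (1 / 16)) / 2) ^ 2 ^ 6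

theorem hardConst_pos : 0 < hardConst := by unfold hardConst; positivity

theorem exists_hard {t t' : ℕ} (ht' : 1 ≤ t') (hev : Even t) (h34 : 4 * t' ≤ 3 * t)
    (h : 2 * M.bal t = t ∨ M.bal t + 1 ≤ 2 * M.bal t') :
    ∃ h : ℕ, 2 * t ≤ h ∧ h ≤ 3 * t ∧ hardConst ≤ M.pr (HC 0 (4 * h) 0 h) := by
  have ht1 : 1 ≤ t := by omega
  by_cases hA : 2 * M.bal t = t
  · refine ⟨2 * t, le_rfl, by omega, ?_⟩
    have h1 := M.long_of_bal_eq ht1 hA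
    have h2 := M.chain_iterate (L := 3 * t) (h := 2 * t) (by omega) (by omega)
      (c := (3 / 32 * (3 / 32) * (1 / 2) * (1 / 16)) * (3 / 32 * (3 / 32) * (1 / 2) * (1 / 16)))
      (by norm_num) (by push_cast; refine le_trans (by norm_num) h1) 6
    refine h2.trans (M.HC_mono (by positivity) ?_ le_rfl)
    push_cast
    have : (1 : ℝ) ≤ t := by exact_mod_cast ht1
    nlinarith
  · have h2 : M.bal t + 1 ≤ 2 * M.bal t' := by tauto
    have hb := M.bal_le t
    have hb' := M.bal_le t'
    obtain ⟨m, rfl⟩ := hev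
    have h1 := M.long_of_bal_lt ht' (by omega) (by omega) h2
    refine ⟨2 * (m + m) + M.bal t', by omega, by omega, ?_⟩
    have h3 := M.chain_iterate (L := 4 * (m + m) - 2 * t') (h := 2 * (m + m) + M.bal t') (by omega)
      (by omega)
      (c := (3 / 32 * (3 / 32) * (1 / 2) * (1 / 16)) * (3 / 32 * (3 / 32) * (1 / 2) * (1 / 16)))
      (by norm_num) (by
        rw [Nat.cast_sub (by omega)]
        push_cast at h1 ⊢
        exact h1) 6
    refine h3.trans (M.HC_mono (by positivity) ?_ le_rfl)
    rw [Nat.cast_sub (by omega)]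
    push_cast
    have e1 : (4 : ℝ) * t' ≤ 3 * (m + m) := by exact_mod_cast h34
    have e2 : (2 : ℝ) * M.bal t' ≤ t' := by exact_mod_cast hb'
    nlinarith

/-- The three crossings forming the left half of an annulus, extended to the right up to `e`. -/
def Arc (r e : ℝ) : Set (Set (ℝ × ℝ)) :=
  VC (-2 * r) (-r) (-2 * r) (2 * r) ∩ (HC (-2 * r) e r (2 * r) ∩ HC (-2 * r) e (-2 * r) (-r))

theorem isUpperSet_Arc (r e : ℝ) : IsUpperSet (Arc r e) :=
  (isUpperSet_conn ..).inter ((isUpperSet_conn ..).inter (isUpperSet_conn ..))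

theorem Arc_ge {r : ℕ} {c : ℝ} (hc : 0 ≤ c) (h : c ≤ M.pr (HC 0 (4 * r) 0 r)) :
    c * (c * c) ≤ M.pr (Arc r (2 * r)) := by
  refine M.le_inter (isUpperSet_conn ..) ((isUpperSet_conn ..).inter (isUpperSet_conn ..)) hc
    (by positivity) (h.trans ?_) (M.le_inter (isUpperSet_conn ..) (isUpperSet_conn ..) hc hc
    (h.trans ?_) (h.trans ?_))
  · exact M.HC_le_VC_trans (-2 * r) (-2 * r) (by push_cast; ring) (by push_cast; ring)
      (by push_cast; ring) (by push_cast; ring)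
  · exact M.HC_le_trans (-2 * r) r (by push_cast; ring) (by push_cast; ring)
      (by push_cast; ring) (by push_cast; ring)
  · exact M.HC_le_trans (-2 * r) (-2 * r) (by push_cast; ring) (by push_cast; ring)
      (by push_cast; ring) (by push_cast; ring)

theorem Arc_mono {r e : ℝ} (he : -2 * r ≤ e) (hr : 0 ≤ r) (h : 0 ≤ e) : Arc r e ⊆ Arc r 0 := by
  rintro F ⟨h1, h2, h3⟩
  refine ⟨h1, ?_, ?_⟩
  · rw [mem_HC_iff_conn he] at h2
    rw [mem_HC_iff_conn (by linarith)]
    obtain ⟨x, y, hx, hy, j⟩ := h2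
    exact ⟨x, y, hx, h.trans hy, j⟩
  · rw [mem_HC_iff_conn he] at h3
    rw [mem_HC_iff_conn (by linarith)]
    obtain ⟨x, y, hx, hy, j⟩ := h3
    exact ⟨x, y, hx, h.trans hy, j⟩

theorem Hev_zero_ge {t ℓ : ℕ} (hb : M.bal t < ℓ) (ht : 4 * ℓ ≤ t) :
    1 / 16 ≤ M.pr (Hev t 0 0 ℓ) := by
  have := M.lt_of_bal_lt hb (by omega)
  linarith [M.nonneg (Hev t 0 ℓ t)]

/-- A crossing ending inside the half annulus is joined to its top crossing. -/
theorem Hev_Arc {t r e a b : ℝ} {F : Set (ℝ × ℝ)} (hr : 0 < r) (he : 0 ≤ e) (hrt : 2 * r ≤ t)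
    (ha : 0 ≤ a) (hb : b ≤ r)
    (h : F ∈ Hev t 0 a b) (hA : F ∈ Arc r e) :
    ∃ w xl yl xt yt : ℝ × ℝ, w.1 = -2 * t ∧ xl.2 = -2 * r ∧ yl.2 = 2 * r ∧ xt.1 = -2 * r ∧ yt.1 = e ∧
      JoinedIn (F ∩ rect (-2 * r) (-r) (-2 * r) (2 * r)) xl yl ∧
      JoinedIn (F ∩ rect (-2 * r) e r (2 * r)) xt yt ∧
      JoinedIn (F ∩ (rect (-2 * t) 0 (-t) t ∪ rect (-2 * r) e (-2 * r) (2 * r))) w xt := by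
  obtain ⟨⟨xl, hxl, yl, hyl, jl⟩, ⟨xt, hxt, yt, hyt, jt⟩, xb, hxb, yb, hyb, jb⟩ := hA
  obtain ⟨w, hw, u, ⟨hu0, hu1, hu2⟩, j⟩ := h
  simp only [mem_ofPred_eq, zero_sub, zero_add] at *
  refine ⟨w, xl, yl, xt, yt, hw, hxl, hyl, hxt, hyt, jl, jt, ?_⟩
  have hG : F ∩ rect (-2 * t) 0 (-t) t ⊆
      F ∩ (rect (-2 * t) 0 (-t) t ∪ rect (-2 * r) e (-2 * r) (2 * r)) :=
    inter_subset_inter_right _ subset_union_left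
  have hu : ‖u‖ ≤ r := by
    rw [Prod.norm_def, hu0, norm_zero, Real.norm_of_nonneg (ha.trans hu1)]
    exact max_le hr.le (hu2.trans hb)
  have hw' : 2 * r ≤ ‖w‖ := by
    refine le_trans ?_ (norm_fst_le w)
    rw [hw, Real.norm_eq_abs, abs_of_nonpos (by linarith)]
    linarith
  have := arc_joined hr he jl hxl hyl jt hxt hyt jb hxb hyb
    (inter_subset_inter_right _ subset_union_right) hG (fun z hz => hz.1.2) hu hw' j.symm
  exact (j.mono hG).trans this.symm

/-- If the balanced height at scale `t` is less than `ℓ`, crossings at scale `ℓ` produce crossings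
at scale `t`. -/
theorem hard_of_bal_lt {t ℓ : ℕ} {c : ℝ} (hb : M.bal t < ℓ) (ht : 4 * ℓ ≤ t) (hc : 0 ≤ c)
    (h : c ≤ M.pr (HC 0 (4 * ℓ) 0 ℓ)) :
    2 * ((1 / 16 * (c * (c * c))) * (1 / 16 * (c * (c * c))) / 2) ^ 2 ^ 2
      ≤ M.pr (HC 0 (4 * (2 * t : ℕ)) 0 (2 * t : ℕ)) := by
  have hℓ : 1 ≤ ℓ := by omega
  set E := Hev t 0 0 ℓ ∩ Arc ℓ (2 * ℓ) with hE
  have hEu : IsUpperSet E := (isUpperSet_conn ..).inter (isUpperSet_Arc ..)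
  have h2 := M.le_inter (isUpperSet_conn ..) (isUpperSet_Arc ..) (by norm_num) (by positivity)
    (M.Hev_zero_ge hb ht) (M.Arc_ge hc h)
  have key := M.le_inter hEu (isUpperSet_preimage hEu _) (by positivity) (by positivity) h2
    (h2.trans_eq (M.sym_refl.2 E).symm)
  have r0 : (1 : ℝ) ≤ ℓ := by exact_mod_cast hℓ
  have r1 : (4 : ℝ) * ℓ ≤ t := by exact_mod_cast ht
  have g : 1 / 16 * (c * (c * c)) * (1 / 16 * (c * (c * c))) ≤
      M.pr (HC 0 (4 * t : ℕ) 0 (2 * t : ℕ)) := by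
    refine key.trans (le_trans (M.mono _ (HC (-2 * t) (2 * t) (-t) t) ?_) ?_)
    · rintro F ⟨⟨e1, e2⟩, e3, e4⟩
      obtain ⟨w, xl, yl, xt, yt, hw, hxl, hyl, hxt, hyt, jl, jt, j⟩ :=
        Hev_Arc (by linarith) (by linarith) (by linarith) le_rfl le_rfl e1 e2
      obtain ⟨w', xl', yl', xt', yt', hw', hxl', hyl', hxt', hyt', jl', jt', j'⟩ :=
        Hev_Arc (by linarith) (by linarith) (by linarith) le_rfl le_rfl e3 e4
      have map : ∀ {S S' : Set (ℝ × ℝ)} {x y},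
          JoinedIn ((fun p : ℝ × ℝ => (-p.1, p.2)) ⁻¹' F ∩ S) x y →
          MapsTo (fun p : ℝ × ℝ => (-p.1, p.2)) S S' →
          JoinedIn (F ∩ S') (-x.1, x.2) (-y.1, y.2) := by
        rintro S S' x y ⟨p, hp⟩ hS
        exact ⟨p.map M.sym_refl.1, fun t => ⟨(hp t).1, hS (hp t).2⟩⟩
      have k1 := map j' (S' := {p | -(t : ℝ) ≤ p.2 ∧ p.2 ≤ t}) (by
        rintro p (⟨-, h1, h2⟩ | ⟨-, h1, h2⟩)
        · exact ⟨h1, h2⟩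
        · constructor <;> simp only <;> linarith)
      have k2 := map jt' (S' := rect (-2 * ℓ) (2 * ℓ) ℓ (2 * ℓ)) (by
        rintro p ⟨⟨h3, h4⟩, h1, h2⟩
        refine ⟨⟨?_, ?_⟩, ?_, ?_⟩ <;> simp only <;> linarith)
      have m : ∀ {a b c d : ℝ}, -2 * ℓ ≤ c → d ≤ 2 * ℓ →
          F ∩ rect a b c d ⊆ F ∩ {p | -(t : ℝ) ≤ p.2 ∧ p.2 ≤ t} :=
        fun hc hd p hp => ⟨hp.1, by linarith [hp.2.2.1], by linarith [hp.2.2.2]⟩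
      have a1 := joinedIn_of_cross jt jl (m (by linarith) le_rfl) (m le_rfl le_rfl)
        (fun z hz => ⟨hxt.trans_le hz.2.1.1, by rw [hyt]; linarith [hz.2.1.2]⟩)
        (fun z hz => ⟨by rw [hxl]; linarith [hz.2.2.1], by rw [hyl]; exact hz.2.2.2⟩)
      have a2 := joinedIn_of_cross k2.symm jl (m (by linarith) le_rfl) (m le_rfl le_rfl)
        (fun z hz => ⟨by simp only [hyt']; linarith [hz.2.1.1],
          by simp only [hxt']; linarith [hz.2.1.2]⟩)
        (fun z hz => ⟨by rw [hxl]; linarith [hz.2.2.1], by rw [hyl]; exact hz.2.2.2⟩)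
      rw [mem_HC_iff_conn (by linarith)]
      refine ⟨w, (-w'.1, w'.2), hw.le, by simp only [hw']; linarith, ?_⟩
      have j1 : JoinedIn (F ∩ {p | -(t : ℝ) ≤ p.2 ∧ p.2 ≤ t}) w xt := j.mono (by
        rintro p ⟨hF, ⟨-, h1, h2⟩ | ⟨-, h1, h2⟩⟩
        · exact ⟨hF, h1, h2⟩
        · exact ⟨hF, by linarith, by linarith⟩)
      exact j1.trans ((a1.trans a2.symm).trans ((k2.symm.mono (m (by linarith) le_rfl)).trans
        k1.symm))
    · refine M.conn_le (M.sym_trans (2 * t) t) ?_ ?_ ?_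
      · rintro p ⟨⟨h1, h2⟩, h3, h4⟩
        refine ⟨⟨?_, ?_⟩, ?_, ?_⟩ <;> simp <;> linarith
      · intro p hp; simp at hp ⊢; linarith
      · intro p hp; simp at hp ⊢; linarith
  have h3 := M.chain_iterate (L := 4 * t) (h := 2 * t) (by omega) (by omega) (by positivity) g 2
  refine h3.trans (M.HC_mono (by positivity) ?_ le_rfl)
  push_cast
  linarith

/-- Many scales with half annuli force a large balanced height. -/
theorem exists_le_bal {ℓ J : ℕ} {c : ℝ} (hℓ : 1 ≤ ℓ) (hs : s₀ ≤ 8 * ℓ) (hT : 4 ^ J * (8 * ℓ) ≤ T)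
    (hc : 0 ≤ c) (hc1 : (1 - c * (c * c)) ^ J ≤ 1 / 64)
    (h : ∀ j ≤ J, M.bal (4 ^ j * (4 * ℓ)) < ℓ → c ≤ M.pr (HC 0 (4 * (4 ^ j * (8 * ℓ) : ℕ)) 0
      (4 ^ j * (8 * ℓ) : ℕ))) :
    ∃ j ≤ J, ℓ ≤ M.bal (4 ^ j * (4 * ℓ)) := by
  by_contra hcon
  push Not at hcon
  have hpow : 1 ≤ 4 ^ J := Nat.one_le_pow _ _ (by norm_num)
  have hJ := M.lt_of_bal_lt (hcon J le_rfl) (by nlinarith)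
  have hA : ∀ j < J, c * (c * c) ≤ M.pr (Arc (4 ^ j * (8 * ℓ) : ℕ) 0) := fun j hj =>
    (M.Arc_ge hc (h j hj.le (hcon j hj.le))).trans (M.mono _ _ (Arc_mono
      (by push_cast; nlinarith [pow_pos (show (0:ℝ) < 4 by norm_num) j]) (by positivity) (by positivity)))
  have hind := M.indep J (8 * ℓ) (fun j => Arc (4 ^ j * (8 * ℓ) : ℕ) 0) hs hT ?_
  · have hprod : ∏ j ∈ Finset.range J, (1 - M.pr (Arc (4 ^ j * (8 * ℓ) : ℕ) 0)) ≤ 1 / 64 := by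
      refine le_trans ?_ hc1
      rw [← Finset.card_range J, ← Finset.prod_const, Finset.card_range]
      exact Finset.prod_le_prod (fun j _ => by linarith [M.le_one (Arc (4 ^ j * (8 * ℓ) : ℕ) 0)])
        (fun j hj => by linarith [hA j (Finset.mem_range.1 hj)])
    have hsub : Hev (4 ^ J * (4 * ℓ) : ℕ) 0 0 ℓ ⊆ Hev (4 ^ J * (4 * ℓ) : ℕ) 0 ℓ (4 ^ J * (4 * ℓ) : ℕ) ∪
        {F | ∀ j < J, F ∉ Arc (4 ^ j * (8 * ℓ) : ℕ) 0} := by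
      intro F hF
      by_cases hF' : ∀ j < J, F ∉ Arc (4 ^ j * (8 * ℓ) : ℕ) 0
      · exact Or.inr hF'
      push Not at hF'
      obtain ⟨j, hj, hFA⟩ := hF'
      left
      have n0 : 4 ^ (j + 1) ≤ 4 ^ J := Nat.pow_le_pow_right (by norm_num) hj
      rw [pow_succ] at n0
      have n1 : 2 * (4 ^ j * (8 * ℓ)) ≤ 4 ^ J * (4 * ℓ) := by nlinarith
      have n2 : ℓ ≤ 4 ^ j * (8 * ℓ) := by nlinarith [Nat.one_le_pow j 4 (by norm_num)]
      have r1 : (2 : ℝ) * (4 ^ j * (8 * ℓ) : ℕ) ≤ (4 ^ J * (4 * ℓ) : ℕ) := by exact_mod_cast n1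
      have r2 : (ℓ : ℝ) ≤ (4 ^ j * (8 * ℓ) : ℕ) := by exact_mod_cast n2
      have r3 : (1 : ℝ) ≤ ℓ := by exact_mod_cast hℓ
      generalize ((4 ^ J * (4 * ℓ) : ℕ) : ℝ) = t at *
      generalize ((4 ^ j * (8 * ℓ) : ℕ) : ℝ) = r at *
      obtain ⟨w, xl, yl, xt, yt, hw, hxl, hyl, hxt, hyt, jl, jt, j⟩ :=
        Hev_Arc (by linarith) le_rfl r1 le_rfl r2 hF hFA
      have m : ∀ {a b c d : ℝ}, -t ≤ c → d ≤ t → -2 * t ≤ a → b ≤ 0 →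
          F ∩ rect a b c d ⊆ F ∩ rect (-2 * t) 0 (0 - t) (0 + t) :=
        fun hc hd ha hb p hp => ⟨hp.1, ⟨by linarith [hp.2.1.1], by linarith [hp.2.1.2]⟩,
          by linarith [hp.2.2.1], by linarith [hp.2.2.2]⟩
      have hy := jt.target_mem.2.2
      refine ⟨w, hw, yt, ⟨hyt, by linarith [hy.1], by linarith [hy.2]⟩, (j.mono ?_).trans
        (jt.mono (m (by linarith) (by linarith) (by linarith) le_rfl))⟩
      rw [inter_union_distrib_left]
      exact union_subset (m le_rfl le_rfl le_rfl le_rfl)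
        (m (by linarith) (by linarith) (by linarith) le_rfl)
    have := (M.mono _ _ hsub).trans (M.union _ _)
    linarith
  · intro j hj F G hFG hF
    have hr : (4 ^ j * (8 * ℓ : ℕ) : ℝ) = ((4 ^ j * (8 * ℓ) : ℕ) : ℝ) := by push_cast; ring
    rw [hr] at hFG
    have r3 : (0 : ℝ) < (4 ^ j * (8 * ℓ) : ℕ) := by positivity
    generalize ((4 ^ j * (8 * ℓ) : ℕ) : ℝ) = r at *
    have step : ∀ R A B, R ⊆ {p : ℝ × ℝ | r ≤ ‖p‖ ∧ ‖p‖ ≤ 2 * r} → F ∈ Conn R A B →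
        G ∈ Conn R A B := by
      rintro R A B hR ⟨x, hx, y, hy, j⟩
      exact ⟨x, hx, y, hy, j.mono fun p hp => ⟨(hFG.subset ⟨hp.1, hR hp.2⟩).1, hp.2⟩⟩
    have nb : ∀ p : ℝ × ℝ, |p.1| ≤ 2 * r → |p.2| ≤ 2 * r → (r ≤ |p.1| ∨ r ≤ |p.2|) →
        r ≤ ‖p‖ ∧ ‖p‖ ≤ 2 * r := fun p h1 h2 h3 => by
      rw [Prod.norm_def, Real.norm_eq_abs, Real.norm_eq_abs]
      exact ⟨le_max_iff.2 h3, max_le h1 h2⟩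
    refine ⟨step _ _ _ ?_ hF.1, step _ _ _ ?_ hF.2.1, step _ _ _ ?_ hF.2.2⟩ <;>
      rintro p ⟨⟨h1, h2⟩, h3, h4⟩ <;> refine nb p (abs_le.2 ⟨by linarith, by linarith⟩)
        (abs_le.2 ⟨by linarith, by linarith⟩) ?_
    · left; rw [abs_of_nonpos (by linarith)]; linarith
    · right; rw [abs_of_nonneg (by linarith)]; linarith
    · right; rw [abs_of_nonpos (by linarith)]; linarith

/-- Starting from a scale with a large balanced height, a good scale is met soon. -/
theorem exists_good_after {t₀ ℓ m : ℕ} (hℓ : 1 ≤ ℓ) (h2 : 2 ∣ t₀) (h4 : 4 ∣ t₀)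
    (hb : ℓ ≤ M.bal t₀) (hm : t₀ < 2 ^ m * (2 * ℓ)) :
    ∃ h : ℕ, t₀ ≤ h ∧ h ≤ 3 * (2 ^ m * t₀) ∧ hardConst ≤ M.pr (HC 0 (4 * h) 0 h) := by
  by_contra! hcon
  obtain ⟨u, rfl⟩ := h4
  have ht0 : 1 ≤ 4 * u := by have := M.bal_le (4 * u); omega
  have key : ∀ i ≤ m, 2 ^ i * (2 ^ i * ℓ) ≤ M.bal (2 ^ i * (4 * u)) := by
    intro i
    induction i with
    | zero => intro _; simpa using hb
    | succ i ih =>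
      intro hi
      have hp : 1 ≤ 2 ^ i := Nat.one_le_pow _ _ (by norm_num)
      have hmi : 2 ^ (i + 1) ≤ 2 ^ m := Nat.pow_le_pow_right (by norm_num) hi
      rw [pow_succ] at hmi
      have hle : 2 ^ i * 2 * u ≤ 2 ^ m * u := Nat.mul_le_mul_right _ hmi
      have hpu : 1 * u ≤ 2 ^ i * u := Nat.mul_le_mul_right _ hp
      have e1 : 2 ^ i * (4 * u) = 4 * (2 ^ i * u) := by ring
      have e2 : 2 ^ (i + 1) * (4 * u) = 8 * (2 ^ i * u) := by ring
      have e3 : 2 ^ m * (4 * u) = 4 * (2 ^ m * u) := by ring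
      have e4 : 2 ^ (i + 1) * (2 ^ (i + 1) * ℓ) = 4 * (2 ^ i * (2 ^ i * ℓ)) := by ring
      have e5 : 2 ^ i * 2 * u = 2 * (2 ^ i * u) := by ring
      have ih' := ih (by omega)
      rw [e1] at ih'
      rw [e2, e4]
      rw [e3] at hcon
      generalize 2 ^ i * u = v at *
      have s1 : 2 * M.bal (4 * v) ≤ M.bal (6 * v) := by
        by_contra hlt
        obtain ⟨h, g1, g2, g3⟩ := M.exists_hard (t := 6 * v) (t' := 4 * v) (by omega)
          ⟨3 * v, by ring⟩ (by omega) (Or.inr (by omega))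
        exact absurd g3 (not_le.2 (hcon h (by omega) (by omega)))
      have s2 : 2 * M.bal (6 * v) ≤ M.bal (8 * v) := by
        by_contra hlt
        obtain ⟨h, g1, g2, g3⟩ := M.exists_hard (t := 8 * v) (t' := 6 * v) (by omega)
          ⟨4 * v, by ring⟩ (by omega) (Or.inr (by omega))
        exact absurd g3 (not_le.2 (hcon h (by omega) (by omega)))
      omega
  have h1 := key m le_rfl
  have h2 := M.bal_le (2 ^ m * (4 * u))
  have h3 : 1 ≤ 2 ^ m := Nat.one_le_pow _ _ (by norm_num)
  have h5 : 2 ^ m * (4 * u) < 2 ^ m * (2 ^ m * (2 * ℓ)) := Nat.mul_lt_mul_of_pos_left hm (by omega)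
  have h6 : 2 ^ m * (2 ^ m * (2 * ℓ)) = 2 * (2 ^ m * (2 ^ m * ℓ)) := by ring
  omega

end RSWModel

/-- **Russo–Seymour–Welsh theorem**: rectangle crossings have probability bounded below
uniformly in the scale and the model. -/
theorem rsw {c₀ : ℝ} (hc₀ : 0 < c₀) : ∃ c : ℝ, 0 < c ∧ ∃ C : ℕ, ∀ (s₀ T : ℕ), 1 ≤ s₀ →
    ∀ M : RSWModel s₀ T c₀, ∀ s : ℕ, s₀ ≤ s → C * s ≤ T → c ≤ M.pr (HC 0 (4 * s) 0 s) := by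
  set c1 := min (min RSWModel.hardConst c₀) 1 with hc1
  have c1pos : 0 < c1 := lt_min (lt_min RSWModel.hardConst_pos hc₀) one_pos
  have c1one : c1 ≤ 1 := min_le_right _ _
  set c2 := 2 * ((1 / 16 * (c1 * (c1 * c1))) * (1 / 16 * (c1 * (c1 * c1))) / 2) ^ 2 ^ 2 with hc2
  have c2pos : 0 < c2 := by positivity
  have c2one : c2 ≤ 1 := by
    have h1 : c1 * (c1 * c1) ≤ 1 := by
      have := mul_le_one₀ c1one c1pos.le c1one
      exact mul_le_one₀ c1one (by positivity) this
    have h2 : (1 / 16 * (c1 * (c1 * c1))) * (1 / 16 * (c1 * (c1 * c1))) / 2 ≤ 1 / 2 := by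
      have h0 : 0 ≤ c1 * (c1 * c1) := by positivity
      nlinarith
    have := pow_le_pow_left₀ (by positivity) h2 (2 ^ 2)
    rw [hc2]
    refine (mul_le_mul_of_nonneg_left this (by norm_num)).trans (by norm_num)
  obtain ⟨J, hJ⟩ := exists_pow_lt_of_lt_one (show (0 : ℝ) < 1 / 64 by norm_num)
    (show 1 - c2 * (c2 * c2) < 1 by have : 0 < c2 * (c2 * c2) := by positivity
                                    linarith)
  set D := 3 * (2 ^ (2 * J + 2) * (4 ^ J * 4)) with hD
  set k := 2 * D with hk
  refine ⟨2 * (c1 / 2) ^ 2 ^ k, by positivity, 4 ^ J * 8, fun s₀ T hs₀ M s hs hT => ?_⟩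
  let P : ℕ → Prop := fun ℓ => s₀ ≤ ℓ ∧ c1 ≤ M.pr (HC 0 (4 * ℓ) 0 ℓ)
  have hP0 : P s₀ := ⟨le_rfl, ((min_le_left _ _).trans (min_le_right _ _)).trans M.init⟩
  set ℓ := Nat.findGreatest P s with hℓ
  have hPℓ : P ℓ := Nat.findGreatest_spec hs hP0
  have hℓs : ℓ ≤ s := Nat.findGreatest_le _
  have hℓ1 : 1 ≤ ℓ := hs₀.trans hPℓ.1
  have hnext : ∃ h, ℓ < h ∧ h ≤ D * ℓ ∧ P h := by
    obtain ⟨j, hj, hb⟩ := M.exists_le_bal (J := J) (c := c2) hℓ1 (by linarith [hPℓ.1])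
      (by calc 4 ^ J * (8 * ℓ) = 4 ^ J * 8 * ℓ := by ring
            _ ≤ 4 ^ J * 8 * s := Nat.mul_le_mul_left _ hℓs
            _ ≤ T := hT) c2pos.le hJ.le (by
        intro j hj hb
        have := M.hard_of_bal_lt hb (by nlinarith [Nat.one_le_pow j 4 (by norm_num)]) c1pos.le hPℓ.2
        rw [show 2 * (4 ^ j * (4 * ℓ)) = 4 ^ j * (8 * ℓ) by ring] at this
        exact this)
    have hj4 : 4 ^ j ≤ 4 ^ J := Nat.pow_le_pow_right (by norm_num) hj
    have hj1 : 1 ≤ 4 ^ j := Nat.one_le_pow _ _ (by norm_num)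
    have h44 : 4 ^ j * (4 * ℓ) ≤ 4 ^ J * (4 * ℓ) := Nat.mul_le_mul_right _ hj4
    obtain ⟨h, g1, g2, g3⟩ := M.exists_good_after (m := 2 * J + 2) (t₀ := 4 ^ j * (4 * ℓ)) hℓ1
      ⟨4 ^ j * (2 * ℓ), by ring⟩ ⟨4 ^ j * ℓ, by ring⟩ hb (by
        refine h44.trans_lt ?_
        rw [pow_add, pow_mul]
        have : 1 ≤ 4 ^ J := Nat.one_le_pow _ _ (by norm_num)
        norm_num
        nlinarith)
    have hlt : ℓ < h := by nlinarith
    refine ⟨h, hlt, g2.trans ?_, hPℓ.1.trans hlt.le,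
      ((min_le_left _ _).trans (min_le_left _ _)).trans g3⟩
    rw [hD]
    calc 3 * (2 ^ (2 * J + 2) * (4 ^ j * (4 * ℓ))) ≤ 3 * (2 ^ (2 * J + 2) * (4 ^ J * (4 * ℓ))) := by
          gcongr
      _ = _ := by ring
  obtain ⟨h, h1, h2, h3⟩ := hnext
  have hsh : s < h := by
    by_contra hle
    exact absurd h1 (not_lt.2 (Nat.le_findGreatest (not_lt.1 hle) h3))
  have hch := M.chain_iterate (L := 4 * ℓ) (h := ℓ) hℓ1 (by omega) c1pos.le
    (by push_cast; exact hPℓ.2) k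
  refine hch.trans (M.HC_mono (by positivity) ?_ (by exact_mod_cast hℓs))
  have hkD : (k : ℝ) ≤ 2 ^ k := by exact_mod_cast Nat.lt_two_pow_self.le
  have hsD : (s : ℝ) ≤ D * ℓ := by exact_mod_cast hsh.le.trans h2
  have hk2 : (k : ℝ) = 2 * D := by rw [hk]; push_cast; ring
  have hℓ0 : (0 : ℝ) ≤ ℓ := by positivity
  push_cast
  nlinarith [mul_le_mul_of_nonneg_right hkD hℓ0]

section Product
set_option linter.unusedSectionVars false
variable {ι κ α β : Type*} [Fintype ι] [Fintype κ] [Fintype α] [Fintype β]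

/-- The expectation of `F` under the product of copies of the weight `w`. -/
noncomputable def Ex (w : α → ℝ) (F : (ι → α) → ℝ) : ℝ := ∑ ω, (∏ i, w (ω i)) * F ω

/-- Probability weights. -/
structure IsWeight (w : α → ℝ) : Prop where
  nonneg : ∀ s, 0 ≤ w s
  sum_eq : ∑ s, w s = 1

variable {w : α → ℝ}

theorem Ex_add (F G : (ι → α) → ℝ) : Ex w (fun ω => F ω + G ω) = Ex w F + Ex w G := by
  simp [Ex, mul_add, Finset.sum_add_distrib]

theorem Ex_sub (F G : (ι → α) → ℝ) : Ex w (fun ω => F ω - G ω) = Ex w F - Ex w G := by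
  simp [Ex, mul_sub, Finset.sum_sub_distrib]

theorem Ex_const_mul (c : ℝ) (F : (ι → α) → ℝ) : Ex w (fun ω => c * F ω) = c * Ex w F := by
  simp [Ex, Finset.mul_sum, mul_left_comm]

theorem Ex_sum {τ : Type*} (s : Finset τ) (F : τ → (ι → α) → ℝ) :
    Ex w (fun ω => ∑ t ∈ s, F t ω) = ∑ t ∈ s, Ex w (F t) := by
  simp only [Ex, Finset.mul_sum]
  exact Finset.sum_comm

theorem Ex_const (hw : IsWeight w) (c : ℝ) : Ex w (fun _ : ι → α => c) = c := by
  have : ∑ ω : ι → α, ∏ i, w (ω i) = 1 := by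
    rw [← Fintype.prod_sum]
    simp [hw.sum_eq]
  rw [Ex, ← Finset.sum_mul, this, one_mul]

theorem Ex_mono (hw : IsWeight w) {F G : (ι → α) → ℝ} (h : ∀ ω, F ω ≤ G ω) : Ex w F ≤ Ex w G :=
  Finset.sum_le_sum fun ω _ => mul_le_mul_of_nonneg_left (h ω) (Finset.prod_nonneg fun _ _ => hw.nonneg _)

theorem Ex_nonneg (hw : IsWeight w) {F : (ι → α) → ℝ} (h : ∀ ω, 0 ≤ F ω) : 0 ≤ Ex w F :=
  (Ex_const hw 0).symm.trans_le (Ex_mono hw h)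

theorem Ex_le_of_le (hw : IsWeight w) {F : (ι → α) → ℝ} {c : ℝ} (h : ∀ ω, F ω ≤ c) : Ex w F ≤ c :=
  (Ex_mono hw h).trans_eq (Ex_const hw c)

/-- Cauchy–Schwarz. -/
theorem Ex_mul_sq_le (hw : IsWeight w) (F G : (ι → α) → ℝ) :
    Ex w (fun ω => F ω * G ω) ^ 2 ≤ Ex w (fun ω => F ω ^ 2) * Ex w (fun ω => G ω ^ 2) := by
  have := Finset.sum_mul_sq_le_sq_mul_sq Finset.univ
    (fun ω : ι → α => √(∏ i, w (ω i)) * F ω) (fun ω => √(∏ i, w (ω i)) * G ω)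
  have h : ∀ ω : ι → α, √(∏ i, w (ω i)) * √(∏ i, w (ω i)) = ∏ i, w (ω i) := fun ω =>
    Real.mul_self_sqrt (Finset.prod_nonneg fun _ _ => hw.nonneg _)
  simp only [mul_pow, sq (√ _), h] at this
  simp only [Ex]
  refine le_trans (le_of_eq ?_) this
  congr 1
  refine Finset.sum_congr rfl fun ω _ => ?_
  linear_combination (-(F ω * G ω)) * h ω

/-- The expectation over the `i`-th coordinate. -/
noncomputable def avg (w : α → ℝ) (i : ι) (F : (ι → α) → ℝ) (ω : ι → α) : ℝ :=
  ∑ s, w s * F (Function.update ω i s)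

/-- `F` does not depend on the `i`-th coordinate. -/
def Free (i : ι) (F : (ι → α) → ℝ) : Prop := ∀ ω s, F (Function.update ω i s) = F ω

theorem Ex_avg (hw : IsWeight w) (i : ι) (F : (ι → α) → ℝ) : Ex w (avg w i F) = Ex w F := by
  have h : ∀ (ω : ι → α) s, (∏ j, w (ω j)) * w s =
      (∏ j, w (Function.update ω i s j)) * w (ω i) := fun ω s => by
    have h1 := Finset.mul_prod_erase Finset.univ (fun j => w (ω j)) (Finset.mem_univ i)
    have h2 := Finset.mul_prod_erase Finset.univ (fun j => w (Function.update ω i s j))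
      (Finset.mem_univ i)
    have h3 : ∏ j ∈ Finset.univ.erase i, w (Function.update ω i s j) =
        ∏ j ∈ Finset.univ.erase i, w (ω j) := Finset.prod_congr rfl fun j hj => by
      rw [Function.update_of_ne (Finset.ne_of_mem_erase hj)]
    simp only [Function.update_self, h3] at h2
    rw [← h1, ← h2]
    ring
  calc Ex w (avg w i F) = ∑ x : (ι → α) × α, (∏ j, w (x.1 j)) * w x.2 * F (Function.update x.1 i x.2) := by
        rw [Fintype.sum_prod_type]
        simp only [Ex, avg, Finset.mul_sum, mul_assoc]
    _ = ∑ x : (ι → α) × α, (∏ j, w (x.1 j)) * w x.2 * F x.1 := by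
        refine Finset.sum_nbij' (fun x => (Function.update x.1 i x.2, x.1 i))
          (fun x => (Function.update x.1 i x.2, x.1 i)) (fun _ _ => Finset.mem_univ _)
          (fun _ _ => Finset.mem_univ _)
          (fun x _ => Prod.ext (by simp only [Function.update_idem, Function.update_eq_self])
            (by simp only [Function.update_self]))
          (fun x _ => Prod.ext (by simp only [Function.update_idem, Function.update_eq_self])
            (by simp only [Function.update_self])) ?_
        rintro ⟨ω, s⟩ -
        exact congrArg (· * F (Function.update ω i s)) (h ω s)
    _ = Ex w F := by
        rw [Fintype.sum_prod_type]
        refine Finset.sum_congr rfl fun ω _ => ?_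
        simp only [← Finset.sum_mul, ← Finset.mul_sum, hw.sum_eq, mul_one]

theorem avg_mul_of_free {i : ι} {F : (ι → α) → ℝ} (hF : Free i F) (G : (ι → α) → ℝ) (ω : ι → α) :
    avg w i (fun ω => F ω * G ω) ω = F ω * avg w i G ω := by
  simp only [avg, hF ω, Finset.mul_sum, mul_left_comm]

theorem free_avg (i : ι) (F : (ι → α) → ℝ) : Free i (avg w i F) := fun ω s => by
  simp [avg]

theorem Free.avg_eq (hw : IsWeight w) {i : ι} {F : (ι → α) → ℝ} (hF : Free i F) (ω : ι → α) :
    avg w i F ω = F ω := by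
  simp only [avg, hF ω, ← Finset.sum_mul, hw.sum_eq, one_mul]

theorem Free.avg {i j : ι} {F : (ι → α) → ℝ} (hF : Free j F) : Free j (avg w i F) := fun ω s => by
  by_cases hij : i = j
  · subst hij; simp [VoronoiTest.avg]
  · refine Finset.sum_congr rfl fun t _ => ?_
    rw [Function.update_comm (Ne.symm hij), hF]

theorem avg_comm (i j : ι) (F : (ι → α) → ℝ) (ω : ι → α) :
    avg w i (avg w j F) ω = avg w j (avg w i F) ω := by
  by_cases hij : i = j
  · rw [hij]
  · simp only [avg, Finset.mul_sum]
    rw [Finset.sum_comm]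
    refine Finset.sum_congr rfl fun s _ => Finset.sum_congr rfl fun t _ => ?_
    rw [Function.update_comm hij]; ring

theorem Ex_mul_eq_zero (hw : IsWeight w) {i : ι} {F G : (ι → α) → ℝ} (hF : Free i F)
    (hG : ∀ ω, avg w i G ω = 0) : Ex w (fun ω => F ω * G ω) = 0 := by
  rw [← Ex_avg hw i, ← Ex_const (ι := ι) hw 0]
  congr 1
  funext ω
  rw [avg_mul_of_free hF, hG, mul_zero]

theorem Free.mul {i : ι} {F G : (ι → α) → ℝ} (hF : Free i F) (hG : Free i G) :
    Free i (fun ω => F ω * G ω) := fun ω s => by simp only [hF ω s, hG ω s]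

/-- Averaging over a list of coordinates. -/
noncomputable def avgL (w : α → ℝ) (l : List ι) (F : (ι → α) → ℝ) : (ι → α) → ℝ :=
  l.foldr (avg w) F

theorem Ex_avgL (hw : IsWeight w) (l : List ι) (F : (ι → α) → ℝ) : Ex w (avgL w l F) = Ex w F := by
  induction l with
  | nil => rfl
  | cons i l ih => exact (Ex_avg hw i _).trans ih

theorem Free.avgL {j : ι} {F : (ι → α) → ℝ} (hF : Free j F) (l : List ι) : Free j (avgL w l F) := by
  induction l with
  | nil => exact hF
  | cons i l ih => exact Free.avg ih

theorem free_avgL {j : ι} {l : List ι} (hj : j ∈ l) (F : (ι → α) → ℝ) : Free j (avgL w l F) := by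
  induction l with
  | nil => simp at hj
  | cons i l ih =>
    rcases List.mem_cons.1 hj with rfl | h
    · exact free_avg _ _
    · exact Free.avg (ih h)

theorem avgL_mul_of_free {l : List ι} {F : (ι → α) → ℝ} (hF : ∀ i ∈ l, Free i F)
    (G : (ι → α) → ℝ) : avgL w l (fun ω => F ω * G ω) = fun ω => F ω * avgL w l G ω := by
  induction l with
  | nil => rfl
  | cons i l ih =>
    have := ih fun j hj => hF j (List.mem_cons_of_mem _ hj)
    funext ω
    change avg w i (avgL w l _) ω = _
    rw [this, avg_mul_of_free (hF i List.mem_cons_self)]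
    rfl

theorem eq_of_free {F : (ι → α) → ℝ} {s : Finset ι} (hF : ∀ i ∈ s, Free i F) {ω ω' : ι → α}
    (h : ∀ i ∉ s, ω i = ω' i) : F ω = F ω' := by
  induction s using Finset.induction_on generalizing ω with
  | empty => rw [show ω = ω' from funext fun i => h i (Finset.notMem_empty _)]
  | insert j s hj ih =>
    rw [← hF j (Finset.mem_insert_self _ _) ω (ω' j)]
    refine ih (fun i hi => hF i (Finset.mem_insert_of_mem hi)) fun i hi => ?_
    by_cases hij : i = j
    · subst hij; simp
    · rw [Function.update_of_ne hij]
      exact h i (by simp [hij, hi])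

theorem free_of_dependsOn {F : (ι → α) → ℝ} {s : Set ι} (hF : DependsOn F s) {i : ι} (hi : i ∉ s) :
    Free i F := fun ω t => hF fun j hj => Function.update_of_ne (fun h => hi (by rwa [← h])) _ _

theorem eq_Ex_of_free (hw : IsWeight w) {F : (ι → α) → ℝ} (hF : ∀ i, Free i F) (ω : ι → α) :
    F ω = Ex w F := by
  rw [← Ex_const (ι := ι) hw (F ω)]
  congr 1
  funext ω'
  exact eq_of_free (s := Finset.univ) (fun i _ => hF i) (by simp)

theorem Ex_mul_of_dependsOn (hw : IsWeight w) {F G : (ι → α) → ℝ} {s t : Set ι}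
    (hF : DependsOn F s) (hG : DependsOn G t) (hst : Disjoint s t) :
    Ex w (fun ω => F ω * G ω) = Ex w F * Ex w G := by
  set l := (Finset.univ.filter (· ∈ t)).toList
  have hl : ∀ i, i ∈ l ↔ i ∈ t := by simp [l]
  have hc : ∀ ω, avgL w l G ω = Ex w G := fun ω => by
    rw [← Ex_avgL hw l G]
    refine eq_Ex_of_free hw (fun i => ?_) ω
    by_cases hi : i ∈ t
    · exact free_avgL ((hl i).2 hi) G
    · exact (free_of_dependsOn hG hi).avgL l
  rw [← Ex_avgL hw l, avgL_mul_of_free fun i hi => free_of_dependsOn hF fun his =>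
    disjoint_left.1 hst his ((hl i).1 hi)]
  simp only [hc, mul_comm _ (Ex w G), Ex_const_mul]

theorem Ex_prod_of_dependsOn (hw : IsWeight w) {τ : Type*} (T : Finset τ) {F : τ → (ι → α) → ℝ}
    {s : τ → Set ι} (hF : ∀ j ∈ T, DependsOn (F j) (s j))
    (hs : ∀ j ∈ T, ∀ k ∈ T, j ≠ k → Disjoint (s j) (s k)) :
    Ex w (fun ω => ∏ j ∈ T, F j ω) = ∏ j ∈ T, Ex w (F j) := by
  induction T using Finset.induction_on with
  | empty => simpa using Ex_const hw 1
  | insert a T ha ih =>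
    simp only [Finset.prod_insert ha]
    rw [← ih (fun j hj => hF j (Finset.mem_insert_of_mem hj)) (fun j hj k hk =>
      hs j (Finset.mem_insert_of_mem hj) k (Finset.mem_insert_of_mem hk))]
    refine Ex_mul_of_dependsOn hw (hF a (Finset.mem_insert_self _ _)) (t := ⋃ j ∈ T, s j) ?_ ?_
    · intro ω ω' h
      exact Finset.prod_congr rfl fun j hj => hF j (Finset.mem_insert_of_mem hj) fun i hi =>
        h i (mem_biUnion hj hi)
    · rw [disjoint_iUnion₂_right]
      exact fun j hj => hs a (Finset.mem_insert_self _ _) j (Finset.mem_insert_of_mem hj)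
        (fun h => ha (h ▸ hj))

theorem Ex_equiv (e : κ ≃ ι) (F : (κ → α) → ℝ) : Ex w (fun ω : ι → α => F (ω ∘ e)) = Ex w F := by
  refine Fintype.sum_equiv (e.arrowCongr (Equiv.refl α)).symm _ _ fun ω => ?_
  have : (e.arrowCongr (Equiv.refl α)).symm ω = ω ∘ e := by ext; simp [Equiv.arrowCongr]
  rw [this]
  congr 1
  exact (e.prod_comp fun i => w (ω i)).symm

theorem Ex_comp (hw : IsWeight w) {e : κ → ι} (he : Function.Injective e) (F : (κ → α) → ℝ) :
    Ex w (fun ω : ι → α => F (ω ∘ e)) = Ex w F := by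
  let e' : κ ⊕ {i // i ∉ range e} ≃ ι :=
    ((Equiv.ofInjective e he).sumCongr (Equiv.refl _)).trans (Equiv.Set.sumCompl (range e))
  have h : ∀ ω : ι → α, ω ∘ e = (ω ∘ e') ∘ Sum.inl := fun ω => by
    funext k
    change ω (e k) = ω ((Equiv.Set.sumCompl (range e)) (Sum.inl ⟨e k, mem_range_self k⟩))
    rw [Equiv.Set.sumCompl_apply_inl]
  simp only [h]
  rw [Ex_equiv e' (fun ω => F (ω ∘ Sum.inl)), Ex]
  refine Eq.trans (Finset.sum_congr (by ext; simp) fun _ _ => rfl)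
    ((Fintype.sum_equiv (Equiv.sumArrowEquivProdArrow κ {i // i ∉ range e} α)
      (fun ω => (∏ i, w (ω i)) * F (ω ∘ Sum.inl))
      (fun x : (κ → α) × ({i // i ∉ range e} → α) => (∏ i, w (x.1 i)) * (∏ i, w (x.2 i)) * F x.1)
      (fun ω => by rw [Fintype.prod_sum_type]; rfl)).trans ?_)
  rw [Fintype.sum_prod_type, Ex]
  refine Finset.sum_congr rfl fun ω _ => ?_
  have := Ex_const (ι := {i // i ∉ range e}) hw 1
  simp only [Ex, mul_one] at this
  dsimp only
  rw [← Finset.sum_mul, ← Finset.mul_sum]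
  rw [show ∑ x : {i // i ∉ range e} → α, ∏ i, w (x i) = 1 by convert this, mul_one]

/-- Fubini for pairs of independent families. -/
theorem Ex_pair {v : β → ℝ} (F : (ι → α × β) → ℝ) :
    Ex (fun s : α × β => w s.1 * v s.2) F = Ex w fun a => Ex v fun c => F fun i => (a i, c i) := by
  rw [Ex, Fintype.sum_equiv (Equiv.arrowProdEquivProdArrow ι (fun _ => α) (fun _ => β)) _
    (fun x : (ι → α) × (ι → β) => (∏ i, w (x.1 i)) * ((∏ i, v (x.2 i)) * F fun i => (x.1 i, x.2 i)))
    (fun ω => by rw [Finset.prod_mul_distrib, mul_assoc]; rfl), Fintype.sum_prod_type]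
  simp only [Ex, Finset.mul_sum]

theorem IsWeight.pair {v : β → ℝ} (hw : IsWeight w) (hv : IsWeight v) :
    IsWeight (fun s : α × β => w s.1 * v s.2) where
  nonneg s := mul_nonneg (hw.nonneg _) (hv.nonneg _)
  sum_eq := by
    rw [Fintype.sum_prod_type]
    simp only [← Finset.mul_sum, hv.sum_eq, mul_one, hw.sum_eq]

/-- The probability of an event. -/
noncomputable def Pro (w : α → ℝ) (A : Set (ι → α)) : ℝ := Ex w (A.indicator 1)

end Product

section Hoeffding
set_option linter.unusedSectionVars false
variable {ι α : Type*} [Fintype ι] [Fintype α] {w : α → ℝ}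

theorem dependsOn_of_free {F : (ι → α) → ℝ} {s : Set ι} (hF : ∀ i ∉ s, Free i F) : DependsOn F s :=
  fun _ _ h => eq_of_free (s := Finset.univ.filter (· ∉ s)) (fun i hi => hF i (by simpa using hi))
    fun i hi => h i (by simpa using hi)

theorem avg_sub (i : ι) (F G : (ι → α) → ℝ) (ω : ι → α) :
    avg w i (fun ω => F ω - G ω) ω = avg w i F ω - avg w i G ω := by
  simp [avg, mul_sub, Finset.sum_sub_distrib]

theorem avg_sum {τ : Type*} (i : ι) (s : Finset τ) (F : τ → (ι → α) → ℝ) (ω : ι → α) :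
    avg w i (fun ω => ∑ t ∈ s, F t ω) ω = ∑ t ∈ s, avg w i (F t) ω := by
  simp only [avg, Finset.mul_sum]
  exact Finset.sum_comm

theorem Free.sub {i : ι} {F G : (ι → α) → ℝ} (hF : Free i F) (hG : Free i G) :
    Free i (fun ω => F ω - G ω) := fun ω s => by simp only [hF ω s, hG ω s]

/-- A family of functions behaving like the Hoeffding components: `g T` depends only on the
coordinates in `T` and averages to zero in each of them. -/
structure IsComponents (w : α → ℝ) (g : Finset ι → (ι → α) → ℝ) : Prop where
  free : ∀ T, ∀ i ∉ T, Free i (g T)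
  avg_eq : ∀ T, ∀ i ∈ T, ∀ ω, avg w i (g T) ω = 0

theorem exists_components (hw : IsWeight w) (f : (ι → α) → ℝ) :
    ∃ g : Finset ι → (ι → α) → ℝ, IsComponents w g ∧ ∀ ω, f ω = ∑ T, g T ω := by
  have key : ∀ s : Finset ι, ∃ g : Finset ι → (ι → α) → ℝ,
      (∀ T, ∀ i ∈ s, i ∉ T → Free i (g T)) ∧ (∀ T, ∀ i ∈ s, i ∈ T → ∀ ω, avg w i (g T) ω = 0) ∧
      ∀ ω, f ω = ∑ T ∈ s.powerset, g T ω := by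
    intro s
    induction s using Finset.induction_on with
    | empty => exact ⟨fun _ => f, by simp, by simp, by simp⟩
    | insert j s hj ih =>
      obtain ⟨g, h1, h2, h3⟩ := ih
      refine ⟨fun T => if j ∈ T then fun ω => g (T.erase j) ω - avg w j (g (T.erase j)) ω
        else avg w j (g T), fun T i hi hiT => ?_, fun T i hi hiT ω => ?_, fun ω => ?_⟩
      · rcases Finset.mem_insert.1 hi with rfl | his
        · simp only [hiT, if_false]
          exact free_avg _ _
        · dsimp only
          split_ifs with hjT
          · have := h1 (T.erase j) i his (fun h => hiT (Finset.mem_of_mem_erase h))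
            exact this.sub this.avg
          · exact (h1 T i his hiT).avg
      · rcases Finset.mem_insert.1 hi with rfl | his
        · simp only [hiT, if_true]
          rw [avg_sub, (free_avg i _).avg_eq hw, sub_self]
        · have h0 : ∀ T', i ∈ T' → ∀ ω, avg w i (avg w j (g T')) ω = 0 := fun T' hT' ω => by
            rw [avg_comm]
            change ∑ s, w s * avg w i (g T') _ = 0
            simp [h2 T' i his hT']
          dsimp only
          split_ifs with hjT
          · have hiT' : i ∈ T.erase j := Finset.mem_erase.2 ⟨fun h => hj (h ▸ his), hiT⟩
            rw [avg_sub, h0 _ hiT', h2 _ i his hiT', sub_zero]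
          · exact h0 T hiT ω
      · rw [h3, Finset.sum_powerset_insert hj, ← Finset.sum_add_distrib]
        refine Finset.sum_congr rfl fun T hT => ?_
        have hjT : j ∉ T := fun h => hj (Finset.mem_powerset.1 hT h)
        simp [hjT]
  obtain ⟨g, h1, h2, h3⟩ := key Finset.univ
  exact ⟨g, ⟨fun T i hi => h1 T i (Finset.mem_univ _) hi, fun T i hi => h2 T i (Finset.mem_univ _) hi⟩,
    fun ω => by rw [h3]; rfl⟩

namespace IsComponents
variable {g : Finset ι → (ι → α) → ℝ}

theorem ex_mul_eq_zero (hw : IsWeight w) (hg : IsComponents w g) {φ : (ι → α) → ℝ} {T T' : Finset ι}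
    {i : ι} (hi : i ∈ T') (hiT : i ∉ T) (hφ : Free i φ) :
    Ex w (fun ω => φ ω * (g T ω * g T' ω)) = 0 := by
  simp only [← mul_assoc]
  exact Ex_mul_eq_zero hw (hφ.mul (hg.free T i hiT)) (hg.avg_eq T' i hi)

theorem ex_mul_sum (φ : (ι → α) → ℝ) (X Y : Finset (Finset ι)) :
    Ex w (fun ω => φ ω * ((∑ T ∈ X, g T ω) * ∑ T ∈ Y, g T ω)) =
      ∑ T ∈ X, ∑ T' ∈ Y, Ex w (fun ω => φ ω * (g T ω * g T' ω)) := by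
  simp only [Finset.sum_mul, Finset.mul_sum, Ex_sum]
  exact Finset.sum_comm

theorem ex_mul_sum_sq (hw : IsWeight w) (hg : IsComponents w g) (φ : (ι → α) → ℝ) (X : Finset (Finset ι))
    (h : ∀ T ∈ X, ∀ T' ∈ X, T ≠ T' → ∃ i, Free i φ ∧ (i ∈ T ∧ i ∉ T' ∨ i ∈ T' ∧ i ∉ T)) :
    Ex w (fun ω => φ ω * (∑ T ∈ X, g T ω) ^ 2) = ∑ T ∈ X, Ex w (fun ω => φ ω * g T ω ^ 2) := by
  simp only [sq, ex_mul_sum]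
  refine Finset.sum_congr rfl fun T hT => ?_
  rw [Finset.sum_eq_single T]
  · intro T' hT' hne
    obtain ⟨i, hi, ⟨h1, h2⟩ | ⟨h1, h2⟩⟩ := h T hT T' hT' hne.symm
    · simp only [mul_comm (g T _)]
      exact hg.ex_mul_eq_zero hw h1 h2 hi
    · exact hg.ex_mul_eq_zero hw h1 h2 hi
  · exact fun h => absurd hT h

theorem ex_sum_sq (hw : IsWeight w) (hg : IsComponents w g) (X : Finset (Finset ι)) :
    Ex w (fun ω => (∑ T ∈ X, g T ω) ^ 2) = ∑ T ∈ X, Ex w (fun ω => g T ω ^ 2) := by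
  have := hg.ex_mul_sum_sq hw (fun _ => 1) X fun T _ T' _ hne => by
    by_contra! hc
    refine hne (Finset.ext fun i => ?_)
    have := hc i (fun _ _ => rfl)
    tauto
  simpa using this

theorem ex_eq_zero (hw : IsWeight w) (hg : IsComponents w g) {T : Finset ι} (hT : T.Nonempty) :
    Ex w (g T) = 0 := by
  obtain ⟨i, hi⟩ := hT
  rw [← Ex_avg hw i, ← Ex_const (ι := ι) hw 0]
  exact congrArg _ (funext (hg.avg_eq T i hi))

variable {f : (ι → α) → ℝ}

theorem sub_ex (hw : IsWeight w) (hg : IsComponents w g) (hf : ∀ ω, f ω = ∑ T, g T ω) (ω : ι → α) :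
    f ω - Ex w f = ∑ T ∈ Finset.univ.erase ∅, g T ω := by
  have h0 : ∀ ω, g ∅ ω = Ex w (g ∅) := eq_Ex_of_free hw fun i => hg.free ∅ i (Finset.notMem_empty _)
  have : Ex w f = Ex w (g ∅) := by
    rw [show f = fun ω => ∑ T, g T ω from funext hf, Ex_sum,
      Finset.sum_eq_single ∅ (fun T _ hT => hg.ex_eq_zero hw (Finset.nonempty_iff_ne_empty.2 hT))
        (by simp)]
  rw [hf, this, ← h0 ω, ← Finset.add_sum_erase _ _ (Finset.mem_univ ∅)]
  ring

theorem sub_avg (hw : IsWeight w) (hg : IsComponents w g) (hf : ∀ ω, f ω = ∑ T, g T ω) (i : ι)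
    (ω : ι → α) : f ω - VoronoiTest.avg w i f ω = ∑ T ∈ Finset.univ.filter (i ∈ ·), g T ω := by
  rw [show f = fun ω => ∑ T, g T ω from funext hf, avg_sum, Finset.sum_filter,
    ← Finset.sum_sub_distrib]
  refine Finset.sum_congr rfl fun T _ => ?_
  split_ifs with h
  · rw [hg.avg_eq T i h, sub_zero]
  · rw [(hg.free T i h).avg_eq hw, sub_self]

theorem variance_eq (hw : IsWeight w) (hg : IsComponents w g) (hf : ∀ ω, f ω = ∑ T, g T ω) :
    Ex w (fun ω => (f ω - Ex w f) ^ 2) = ∑ T ∈ Finset.univ.erase ∅, Ex w (fun ω => g T ω ^ 2) := by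
  simp only [hg.sub_ex hw hf]
  exact hg.ex_sum_sq hw _

theorem energy_eq (hw : IsWeight w) (hg : IsComponents w g) (hf : ∀ ω, f ω = ∑ T, g T ω) :
    ∑ i, Ex w (fun ω => (f ω - VoronoiTest.avg w i f ω) ^ 2) =
      ∑ T, (T.card : ℝ) * Ex w (fun ω => g T ω ^ 2) := by
  simp only [hg.sub_avg hw hf, hg.ex_sum_sq hw]
  simp only [Finset.sum_filter]
  rw [Finset.sum_comm]
  refine Finset.sum_congr rfl fun T _ => ?_
  rw [← Finset.sum_filter, Finset.sum_const, nsmul_eq_mul]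
  simp

end IsComponents

theorem ex_sq_nonneg (hw : IsWeight w) (F : (ι → α) → ℝ) : 0 ≤ Ex w (fun ω => F ω ^ 2) :=
  Ex_nonneg hw fun _ => sq_nonneg _

theorem efron_stein (hw : IsWeight w) (f : (ι → α) → ℝ) :
    Ex w (fun ω => (f ω - Ex w f) ^ 2) ≤ ∑ i, Ex w (fun ω => (f ω - avg w i f ω) ^ 2) := by
  obtain ⟨g, hg, hf⟩ := exists_components hw f
  rw [hg.variance_eq hw hf, hg.energy_eq hw hf]
  refine (Finset.sum_le_sum fun T hT => ?_).trans (Finset.sum_le_sum_of_subset_of_nonneg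
    (Finset.erase_subset ∅ Finset.univ) fun T _ _ => mul_nonneg T.card.cast_nonneg (ex_sq_nonneg hw _))
  refine le_mul_of_one_le_left (ex_sq_nonneg hw _) ?_
  have : T.Nonempty := Finset.nonempty_iff_ne_empty.2 (Finset.ne_of_mem_erase hT)
  exact_mod_cast this.card_pos

theorem Pro_eq_sum (A : Set (ι → α)) : Pro w A = Ex w (fun ω => if ω ∈ A then 1 else 0) := by
  unfold Pro
  congr 1

set_option maxHeartbeats 1000000 in
/-- The Schramm–Steif inequality for a stopping set. -/
theorem schramm_steif (hw : IsWeight w) {g : Finset ι → (ι → α) → ℝ} (hg : IsComponents w g)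
    {k : ℕ} (hk : 1 ≤ k) {X : Finset (Finset ι)} (hX : ∀ T ∈ X, T.card = k)
    {H : (ι → α) → ℝ} {S : (ι → α) → Finset ι}
    (hS : ∀ ω ω', (∀ i ∈ S ω, ω i = ω' i) → S ω' = S ω ∧ H ω' = H ω) :
    Ex w (fun ω => H ω * ∑ T ∈ X, g T ω) ^ 2 ≤ Ex w (fun ω => H ω ^ 2) *
      ∑ T ∈ X, Ex w (fun ω => g T ω ^ 2) * Pro w {ω | ¬ Disjoint T (S ω)} := by
  set φ : Finset ι → (ι → α) → ℝ := fun A ω => if S ω = A then 1 else 0 with hφ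
  have hcongr : ∀ A : Finset ι, ∀ i ∉ A, ∀ ω s, S (Function.update ω i s) = A →
      S ω = A ∧ H ω = H (Function.update ω i s) := by
    intro A i hi ω s h
    have := hS (Function.update ω i s) ω fun j hj => by
      rw [h] at hj
      exact Function.update_of_ne (by rintro rfl; exact hi hj) _ _
    exact ⟨this.1.trans h, this.2⟩
  have hcongr' : ∀ A : Finset ι, ∀ i ∉ A, ∀ ω s, S ω = A →
      S (Function.update ω i s) = A ∧ H (Function.update ω i s) = H ω := by
    intro A i hi ω s h
    have := hcongr A i hi (Function.update ω i s) (ω i)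
    simp only [Function.update_idem, Function.update_eq_self] at this
    exact this h
  have hfree : ∀ A : Finset ι, ∀ i ∉ A, Free i (φ A) := fun A i hi ω s => by
    simp only [hφ]
    by_cases h : S ω = A
    · rw [if_pos h, if_pos (hcongr' A i hi ω s h).1]
    · rw [if_neg h, if_neg fun h' => h (hcongr A i hi ω s h').1]
  have hfreeH : ∀ A : Finset ι, ∀ i ∉ A, Free i (fun ω => φ A ω * H ω) := fun A i hi ω s => by
    change φ A _ * _ = _
    rw [hfree A i hi ω s]
    by_cases h : S ω = A
    · rw [(hcongr' A i hi ω s h).2]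
    · simp [hφ, h]
  have hpart : ∀ F : (ι → α) → ℝ, Ex w F = ∑ A, Ex w (fun ω => φ A ω * F ω) := fun F => by
    rw [← Ex_sum]
    simp [hφ]
  set G : (ι → α) → ℝ := fun ω => ∑ T ∈ X.filter (· ⊆ S ω), g T ω with hG
  have h1 : Ex w (fun ω => H ω * ∑ T ∈ X, g T ω) = Ex w (fun ω => H ω * G ω) := by
    rw [hpart, hpart (fun ω => H ω * G ω)]
    refine Finset.sum_congr rfl fun A _ => ?_
    have e1 : ∀ ω, φ A ω * (H ω * G ω) = ∑ T ∈ X.filter (· ⊆ A), (φ A ω * H ω) * g T ω := fun ω => by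
      rw [← Finset.mul_sum, ← mul_assoc]
      by_cases h : S ω = A
      · simp only [hG, h]
      · simp [hφ, h]
    simp only [e1, ← mul_assoc, Finset.mul_sum, Ex_sum]
    symm
    refine Finset.sum_subset (Finset.filter_subset _ _) fun T hT hT' => ?_
    have : ¬ T ⊆ A := fun h => hT' (Finset.mem_filter.2 ⟨hT, h⟩)
    obtain ⟨i, hi, hiA⟩ := Finset.not_subset.1 this
    exact Ex_mul_eq_zero hw (hfreeH A i hiA) (hg.avg_eq T i hi)
  have h2 : Ex w (fun ω => G ω ^ 2) ≤
      ∑ T ∈ X, Ex w (fun ω => g T ω ^ 2) * Pro w {ω | ¬ Disjoint T (S ω)} := by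
    have hA : ∀ A : Finset ι, Ex w (fun ω => φ A ω * G ω ^ 2) +
        ∑ T ∈ X, Ex w (fun ω => g T ω ^ 2) * Ex w (fun ω => φ A ω * if Disjoint T (S ω) then 1 else 0)
        ≤ Ex w (fun ω => φ A ω * (∑ T ∈ X, g T ω) ^ 2) := by
      intro A
      set X1 := X.filter (· ⊆ A)
      set X2 := X.filter (Disjoint · A)
      have e1 : Ex w (fun ω => φ A ω * G ω ^ 2) = Ex w (fun ω => φ A ω * (∑ T ∈ X1, g T ω) ^ 2) := by
        congr 1; funext ω
        by_cases h : S ω = A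
        · simp only [hG, h, X1]
        · simp [hφ, h]
      have hne : ∀ T ∈ X, ∀ T' ∈ X, T ≠ T' → ∃ i ∈ T', i ∉ T := fun T hT T' hT' hne => by
        by_contra! hc
        exact hne (Finset.eq_of_subset_of_card_le hc (by rw [hX T hT, hX T' hT'])).symm
      have e2 : Ex w (fun ω => φ A ω * (∑ T ∈ X2, g T ω) ^ 2) = ∑ T ∈ X, Ex w (fun ω => g T ω ^ 2) *
          Ex w (fun ω => φ A ω * if Disjoint T (S ω) then 1 else 0) := by
        rw [hg.ex_mul_sum_sq hw, Finset.sum_filter]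
        · refine Finset.sum_congr rfl fun T hT => ?_
          split_ifs with h
          · rw [show (fun ω => φ A ω * if Disjoint T (S ω) then (1 : ℝ) else 0) = φ A from ?_]
            · rw [Ex_mul_of_dependsOn hw (s := (A : Set ι)) (t := (T : Set ι))
                (dependsOn_of_free fun i hi => hfree A i (by simpa using hi))
                (dependsOn_of_free fun i hi => by
                  have := hg.free T i (by simpa using hi)
                  simpa only [sq] using this.mul this) (by exact_mod_cast h.symm), mul_comm]
            · funext ω
              by_cases h' : S ω = A
              · simp [h', h]
              · simp [hφ, h']
          · rw [show (fun ω => φ A ω * if Disjoint T (S ω) then (1 : ℝ) else 0) = fun _ => 0 from ?_,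
              Ex_const hw, mul_zero]
            funext ω
            by_cases h' : S ω = A
            · simp [h', h]
            · simp [hφ, h']
        · intro T hT T' hT' h
          obtain ⟨i, h1, h2⟩ := hne T (Finset.mem_filter.1 hT).1 T' (Finset.mem_filter.1 hT').1 h
          exact ⟨i, hfree A i (Finset.disjoint_left.1 (Finset.mem_filter.1 hT').2 h1), Or.inr ⟨h1, h2⟩⟩
      set X3 := X.filter fun T => ¬ T ⊆ A ∧ ¬ Disjoint T A
      have hsplit : ∀ ω, ∑ T ∈ X, g T ω =
          ∑ T ∈ X1, g T ω + ∑ T ∈ X2, g T ω + ∑ T ∈ X3, g T ω := fun ω => by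
        simp only [X1, X2, X3, Finset.sum_filter, ← Finset.sum_add_distrib]
        refine Finset.sum_congr rfl fun T hT => ?_
        by_cases a : T ⊆ A
        · by_cases b : Disjoint T A
          · have : T = ∅ := Finset.disjoint_self_iff_empty T |>.1 (b.mono_right a)
            have h0 := hX T hT
            rw [this, Finset.card_empty] at h0
            omega
          · simp [a, b]
        · by_cases b : Disjoint T A <;> simp [a, b]
      have z12 : Ex w (fun ω => φ A ω * ((∑ T ∈ X1, g T ω) * ∑ T ∈ X2, g T ω)) = 0 := by
        rw [IsComponents.ex_mul_sum]
        refine Finset.sum_eq_zero fun T hT => Finset.sum_eq_zero fun T' hT' => ?_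
        have a := (Finset.mem_filter.1 hT).2
        have b := (Finset.mem_filter.1 hT').2
        have : T'.Nonempty := Finset.card_pos.1 (by rw [hX T' (Finset.mem_filter.1 hT').1]; omega)
        obtain ⟨i, hi⟩ := this
        have hiA := Finset.disjoint_left.1 b hi
        exact hg.ex_mul_eq_zero hw hi (fun h => hiA (a h)) (hfree A i hiA)
      have z13 : Ex w (fun ω => φ A ω * ((∑ T ∈ X1, g T ω) * ∑ T ∈ X3, g T ω)) = 0 := by
        rw [IsComponents.ex_mul_sum]
        refine Finset.sum_eq_zero fun T hT => Finset.sum_eq_zero fun T' hT' => ?_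
        have a := (Finset.mem_filter.1 hT).2
        obtain ⟨i, hi, hiA⟩ := Finset.not_subset.1 (Finset.mem_filter.1 hT').2.1
        exact hg.ex_mul_eq_zero hw hi (fun h => hiA (a h)) (hfree A i hiA)
      have z32 : Ex w (fun ω => φ A ω * ((∑ T ∈ X3, g T ω) * ∑ T ∈ X2, g T ω)) = 0 := by
        rw [IsComponents.ex_mul_sum]
        refine Finset.sum_eq_zero fun T hT => Finset.sum_eq_zero fun T' hT' => ?_
        have a := (Finset.mem_filter.1 hT)
        have b := (Finset.mem_filter.1 hT')
        obtain ⟨i, hi, hiT⟩ := hne T a.1 T' b.1 fun h => a.2.2 (h ▸ b.2)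
        exact hg.ex_mul_eq_zero hw hi hiT (hfree A i (Finset.disjoint_left.1 b.2 hi))
      have e3 : Ex w (fun ω => φ A ω * (∑ T ∈ X, g T ω) ^ 2) =
          Ex w (fun ω => φ A ω * (∑ T ∈ X1, g T ω) ^ 2) + Ex w (fun ω => φ A ω * (∑ T ∈ X2, g T ω) ^ 2) +
          Ex w (fun ω => φ A ω * (∑ T ∈ X3, g T ω) ^ 2) +
          2 * Ex w (fun ω => φ A ω * ((∑ T ∈ X1, g T ω) * ∑ T ∈ X2, g T ω)) +
          2 * Ex w (fun ω => φ A ω * ((∑ T ∈ X1, g T ω) * ∑ T ∈ X3, g T ω)) +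
          2 * Ex w (fun ω => φ A ω * ((∑ T ∈ X3, g T ω) * ∑ T ∈ X2, g T ω)) := by
        simp only [hsplit, ← Ex_const_mul, ← Ex_add]
        congr 1; funext ω; ring
      have e4 : 0 ≤ Ex w (fun ω => φ A ω * (∑ T ∈ X3, g T ω) ^ 2) :=
        Ex_nonneg hw fun ω => mul_nonneg (by simp only [hφ]; split_ifs <;> norm_num) (sq_nonneg _)
      rw [e1, ← e2, e3, z12, z13, z32]
      linarith
    have := Finset.sum_le_sum fun A (_ : A ∈ Finset.univ) => hA A
    rw [Finset.sum_add_distrib, ← hpart, ← hpart, hg.ex_sum_sq hw, Finset.sum_comm] at this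
    simp only [← Finset.mul_sum, ← hpart] at this
    have hP : ∀ T, Pro w {ω | ¬ Disjoint T (S ω)} = 1 - Ex w (fun ω => if Disjoint T (S ω) then 1 else 0) :=
      fun T => by
        have e := Ex_sub (w := w) (fun _ => 1) (fun ω => if Disjoint T (S ω) then 1 else 0)
        rw [Ex_const hw] at e
        rw [Pro_eq_sum, ← e]
        congr 1; funext ω
        by_cases h : Disjoint T (S ω) <;> simp [h]
    simp only [hP, mul_sub, mul_one, Finset.sum_sub_distrib]
    linarith
  rw [h1]
  exact (Ex_mul_sq_le hw _ _).trans (mul_le_mul_of_nonneg_left h2 (ex_sq_nonneg hw _))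

end Hoeffding

section Pro
set_option linter.unusedSectionVars false
variable {ι κ α β : Type*} [Fintype ι] [Fintype κ] [Fintype α] [Fintype β] {w : α → ℝ}

theorem Pro_mono (hw : IsWeight w) {A B : Set (ι → α)} (h : A ⊆ B) : Pro w A ≤ Pro w B :=
  Ex_mono hw fun ω => indicator_le_indicator_of_subset h (fun _ => zero_le_one) ω

theorem Pro_nonneg (hw : IsWeight w) (A : Set (ι → α)) : 0 ≤ Pro w A :=
  Ex_nonneg hw fun _ => indicator_nonneg (fun _ _ => zero_le_one) _

theorem Pro_le_one (hw : IsWeight w) (A : Set (ι → α)) : Pro w A ≤ 1 :=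
  Ex_le_of_le hw fun _ => indicator_le_self' (f := 1) (fun _ _ => zero_le_one) _

theorem Pro_univ (hw : IsWeight w) : Pro w (univ : Set (ι → α)) = 1 := by
  rw [Pro, indicator_univ]
  exact Ex_const hw 1

theorem Pro_union_le (hw : IsWeight w) (A B : Set (ι → α)) : Pro w (A ∪ B) ≤ Pro w A + Pro w B := by
  rw [Pro, Pro, Pro, ← Ex_add]
  refine Ex_mono hw fun ω => ?_
  by_cases hA : ω ∈ A <;> by_cases hB : ω ∈ B <;> simp [hA, hB]

theorem Pro_compl (hw : IsWeight w) (A : Set (ι → α)) : Pro w Aᶜ = 1 - Pro w A := by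
  have e := Ex_sub (w := w) (fun _ => 1) (A.indicator 1)
  rw [Ex_const hw] at e
  rw [Pro, Pro, ← e]
  congr 1; funext ω
  by_cases h : ω ∈ A <;> simp [h]

theorem Pro_biUnion_le (hw : IsWeight w) {τ : Type*} (s : Finset τ) (A : τ → Set (ι → α)) :
    Pro w (⋃ t ∈ s, A t) ≤ ∑ t ∈ s, Pro w (A t) := by
  induction s using Finset.induction_on with
  | empty => simp [Pro, Ex]
  | insert a s ha ih =>
    rw [Finset.sum_insert ha, Finset.set_biUnion_insert]
    exact (Pro_union_le hw _ _).trans (by gcongr)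

/-- Markov's inequality. -/
theorem mul_Pro_le (hw : IsWeight w) {F : (ι → α) → ℝ} (hF : ∀ ω, 0 ≤ F ω) {A : Set (ι → α)} {c : ℝ}
    (h : ∀ ω ∈ A, c ≤ F ω) : c * Pro w A ≤ Ex w F := by
  rw [Pro, ← Ex_const_mul]
  refine Ex_mono hw fun ω => ?_
  by_cases hA : ω ∈ A
  · simpa [hA] using h ω hA
  · simpa [hA] using hF ω

theorem chebyshev_sum (hw : IsWeight w) {f g : α → ℝ} (h : ∀ s t, 0 ≤ (f s - f t) * (g s - g t)) :
    (∑ s, w s * f s) * (∑ s, w s * g s) ≤ ∑ s, w s * (f s * g s) := by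
  have h0 : 0 ≤ ∑ s, ∑ t, w s * w t * ((f s - f t) * (g s - g t)) :=
    Finset.sum_nonneg fun s _ => Finset.sum_nonneg fun t _ =>
      mul_nonneg (mul_nonneg (hw.nonneg s) (hw.nonneg t)) (h s t)
  have e : ∑ s, ∑ t, w s * w t * ((f s - f t) * (g s - g t)) =
      2 * ((∑ t, w t) * (∑ s, w s * (f s * g s)) - (∑ s, w s * f s) * ∑ t, w t * g t) := by
    have e1 : ∀ s t, w s * w t * ((f s - f t) * (g s - g t)) =
      (w s * (f s * g s)) * w t + w s * (w t * (f t * g t)) - (w s * f s) * (w t * g t) -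
        (w s * g s) * (w t * f t) := fun s t => by ring
    simp only [e1, Finset.sum_sub_distrib, Finset.sum_add_distrib, ← Finset.mul_sum, ← Finset.sum_mul]
    ring
  rw [e, hw.sum_eq] at h0
  linarith

/-- Monotone functions for the order induced by `r` on each coordinate. -/
def MonoFor (r : α → ℤ) (F : (ι → α) → ℝ) : Prop := ∀ ω ω', (∀ i, r (ω i) ≤ r (ω' i)) → F ω ≤ F ω'

theorem MonoFor.avg (hw : IsWeight w) {r : α → ℤ} {F : (ι → α) → ℝ} (hF : MonoFor r F) (i : ι) :
    MonoFor r (avg w i F) := fun ω ω' h => Finset.sum_le_sum fun s _ => by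
  refine mul_le_mul_of_nonneg_left (hF _ _ fun j => ?_) (hw.nonneg s)
  by_cases hj : j = i
  · subst hj; simp
  · simpa [Function.update_of_ne hj] using h j

theorem avg_mono (hw : IsWeight w) (i : ι) {F G : (ι → α) → ℝ} (h : ∀ ω, F ω ≤ G ω) (ω : ι → α) :
    avg w i F ω ≤ avg w i G ω :=
  Finset.sum_le_sum fun s _ => mul_le_mul_of_nonneg_left (h _) (hw.nonneg s)

/-- Harris' inequality. -/
theorem harris (hw : IsWeight w) {r : α → ℤ} {F G : (ι → α) → ℝ} (hF : MonoFor r F)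
    (hG : MonoFor r G) : Ex w F * Ex w G ≤ Ex w (fun ω => F ω * G ω) := by
  have key : ∀ l : List ι, MonoFor r (avgL w l F) ∧ MonoFor r (avgL w l G) ∧
      ∀ ω, avgL w l F ω * avgL w l G ω ≤ avgL w l (fun ω => F ω * G ω) ω := by
    intro l
    induction l with
    | nil => exact ⟨hF, hG, fun _ => le_rfl⟩
    | cons i l ih =>
      obtain ⟨h1, h2, h3⟩ := ih
      refine ⟨h1.avg hw i, h2.avg hw i, fun ω => ?_⟩
      refine le_trans ?_ (avg_mono hw i h3 ω)
      refine chebyshev_sum hw fun s t => ?_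
      have hle : ∀ s t, r s ≤ r t → ∀ j, r (Function.update ω i s j) ≤ r (Function.update ω i t j) :=
        fun s t hst j => by
          by_cases hj : j = i
          · subst hj; simpa using hst
          · simp [Function.update_of_ne hj]
      rcases le_total (r s) (r t) with h | h
      · exact mul_nonneg_of_nonpos_of_nonpos (sub_nonpos.2 (h1 _ _ (hle _ _ h)))
          (sub_nonpos.2 (h2 _ _ (hle _ _ h)))
      · exact mul_nonneg (sub_nonneg.2 (h1 _ _ (hle _ _ h))) (sub_nonneg.2 (h2 _ _ (hle _ _ h)))
  have hc : ∀ F : (ι → α) → ℝ, ∀ ω, avgL w Finset.univ.toList F ω = Ex w F := fun F ω => by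
    rw [← Ex_avgL hw Finset.univ.toList F]
    exact eq_Ex_of_free hw (fun i => free_avgL (by simp) F) ω
  have := (key Finset.univ.toList).2.2
  simp only [hc] at this
  by_cases hne : Nonempty (ι → α)
  · exact this hne.some
  · have : IsEmpty (ι → α) := not_nonempty_iff.1 hne
    simp [Ex]

theorem harris_Pro (hw : IsWeight w) {r : α → ℤ} {A B : Set (ι → α)}
    (hA : ∀ ω ω', (∀ i, r (ω i) ≤ r (ω' i)) → ω ∈ A → ω' ∈ A)
    (hB : ∀ ω ω', (∀ i, r (ω i) ≤ r (ω' i)) → ω ∈ B → ω' ∈ B) :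
    Pro w A * Pro w B ≤ Pro w (A ∩ B) := by
  have hm : ∀ A : Set (ι → α), (∀ ω ω', (∀ i, r (ω i) ≤ r (ω' i)) → ω ∈ A → ω' ∈ A) →
      MonoFor r (A.indicator (1 : (ι → α) → ℝ)) := fun A hA ω ω' h => by
    by_cases hω : ω ∈ A
    · simp [hω, hA ω ω' h hω]
    · rw [indicator_of_notMem hω]
      exact indicator_nonneg (fun _ _ => zero_le_one) _
  refine (harris hw (hm A hA) (hm B hB)).trans_eq ?_
  rw [Pro]
  congr 1; funext ω
  by_cases h1 : ω ∈ A <;> by_cases h2 : ω ∈ B <;> simp [h1, h2]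

/-- The Bernoulli weight. -/
def bw (p : ℝ) (b : Bool) : ℝ := if b then p else 1 - p

theorem isWeight_bw {p : ℝ} (h0 : 0 ≤ p) (h1 : p ≤ 1) : IsWeight (bw p) where
  nonneg s := by cases s <;> simp [bw, h0, h1]
  sum_eq := by simp [bw]

theorem avg_bw (p : ℝ) (i : ι) (f : (ι → Bool) → ℝ) (a : ι → Bool) :
    avg (bw p) i f a = p * f (Function.update a i true) + (1 - p) * f (Function.update a i false) := by
  simp [avg, bw]

theorem energy_le {p : ℝ} (h0 : 0 ≤ p) (h1 : p ≤ 1) (f : (ι → Bool) → ℝ) (i : ι) :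
    Ex (bw p) (fun a => (f a - avg (bw p) i f a) ^ 2) ≤
      Ex (bw p) (fun a => (f a - f (Function.update a i false)) ^ 2) := by
  have hw := isWeight_bw h0 h1
  rw [← Ex_avg hw i, ← Ex_avg hw i (fun a => (f a - f (Function.update a i false)) ^ 2)]
  refine Ex_mono hw fun a => ?_
  simp only [avg_bw, Function.update_idem]
  nlinarith [mul_nonneg (mul_nonneg h0 h0)
    (sq_nonneg (f (Function.update a i true) - f (Function.update a i false)))]

theorem abs_exp_sub_exp_le (x y : ℝ) :
    |Real.exp x - Real.exp y| ≤ |x - y| * Real.exp (x + |x - y|) := by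
  rcases le_total y x with h | h
  · have h1 := Real.add_one_le_exp (y - x)
    have h2 : Real.exp y = Real.exp x * Real.exp (y - x) := by rw [← Real.exp_add]; ring_nf
    have h3 : Real.exp x ≤ Real.exp (x + |x - y|) := Real.exp_le_exp.2 (by linarith [abs_nonneg (x - y)])
    rw [abs_of_nonneg (sub_nonneg.2 (Real.exp_le_exp.2 h)), abs_of_nonneg (sub_nonneg.2 h)] at *
    nlinarith [Real.exp_pos x]
  · have h1 := Real.add_one_le_exp (x - y)
    have h2 : Real.exp x = Real.exp y * Real.exp (x - y) := by rw [← Real.exp_add]; ring_nf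
    rw [abs_sub_comm, abs_sub_comm x y, abs_of_nonneg (sub_nonneg.2 (Real.exp_le_exp.2 h)),
      abs_of_nonneg (sub_nonneg.2 h), show x + (y - x) = y by ring]
    nlinarith [Real.exp_pos y]

/-- The exponential moment bound behind the tail estimate. -/
theorem exp_moment_le {p : ℝ} (h0 : 0 ≤ p) (h1 : p ≤ 1) {g : (ι → Bool) → ℝ} (hg : ∀ a, |g a| ≤ 1)
    (hEg : Ex (bw p) g = 0) {J : ι → (ι → Bool) → ℝ} (hJ0 : ∀ i a, 0 ≤ J i a)
    (hgJ : ∀ i a, |g a - g (Function.update a i false)| ≤ J i a) (hJ1 : ∀ a, ∑ i, J i a ^ 2 ≤ 1)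
    {Bad : Set (ι → Bool)} {v Λ : ℝ} (hv : ∀ a ∉ Bad, ∑ i, J i a ^ 2 ≤ v) (hΛ : 0 < Λ)
    (hv0 : 0 ≤ v) (hvΛ : 16 * v * Λ ^ 2 ≤ 1) (hBad : Pro (bw p) Bad ≤ Real.exp (-(4 * Λ))) :
    Ex (bw p) (fun a => Real.exp (Λ * g a)) ≤ 2 := by
  have hw := isWeight_bw h0 h1
  set Φ : ℝ → ℝ := fun l => Ex (bw p) (fun a => Real.exp (l * g a)) with hΦ
  have hΦ1 : ∀ l, 1 ≤ Φ l := fun l => by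
    have : Ex (bw p) (fun a => 1 + l * g a) ≤ Φ l := Ex_mono hw fun a => by
      linarith [Real.add_one_le_exp (l * g a)]
    rw [Ex_add, Ex_const hw, Ex_const_mul, hEg] at this
    linarith
  set K := 3 / 4 * v + Real.exp (-(2 * Λ)) / 4 with hK
  have hK0 : 0 ≤ K := by positivity
  have hΛ2 : Λ ^ 2 * Real.exp (-(2 * Λ)) ≤ 1 / 7 := by
    have a1 : Λ ≤ Real.exp (Λ - 1) := by linarith [Real.add_one_le_exp (Λ - 1)]
    have a2 : Λ * Real.exp (-Λ) ≤ Real.exp (-1) := by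
      calc Λ * Real.exp (-Λ) ≤ Real.exp (Λ - 1) * Real.exp (-Λ) := by gcongr
        _ = Real.exp (-1) := by rw [← Real.exp_add]; ring_nf
    have a3 : Real.exp (-1) ≤ 0.37 := by
      have := Real.exp_one_gt_d9
      rw [Real.exp_neg, inv_le_comm₀ (Real.exp_pos 1) (by norm_num)]
      norm_num at this ⊢
      linarith
    have a4 : Real.exp (-(2 * Λ)) = Real.exp (-Λ) ^ 2 := by rw [← Real.exp_nat_mul]; ring_nf
    have a5 : 0 ≤ Λ * Real.exp (-Λ) := by positivity
    rw [a4, ← mul_pow]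
    have : Λ * Real.exp (-Λ) ≤ 0.37 := a2.trans a3
    nlinarith
  have hKΛ : K * Λ ^ 2 ≤ 1 / 12 := by
    have : K * Λ ^ 2 = 3 / 64 * (16 * v * Λ ^ 2) + Λ ^ 2 * Real.exp (-(2 * Λ)) / 4 := by rw [hK]; ring
    rw [this]; linarith
  have step : ∀ l, 0 ≤ l → l ≤ Λ → Φ l ≤ Φ (l / 2) ^ 2 * Real.exp (2 * K * l ^ 2) := by
    intro l hl0 hl
    set G : (ι → Bool) → ℝ := fun a => Real.exp (l / 2 * g a) with hG
    have hGG : ∀ a, G a ^ 2 = Real.exp (l * g a) := fun a => by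
      rw [hG, ← Real.exp_nat_mul]; congr 1; push_cast; ring
    have e1 : Ex (bw p) (fun a => (G a - Ex (bw p) G) ^ 2) = Φ l - Φ (l / 2) ^ 2 := by
      have : ∀ a, (G a - Ex (bw p) G) ^ 2 =
          Real.exp (l * g a) - 2 * Ex (bw p) G * G a + Ex (bw p) G ^ 2 := fun a => by
        rw [← hGG]; ring
      simp only [this]
      rw [Ex_add, Ex_sub, Ex_const_mul, Ex_const hw]
      simp only [hΦ, hG]
      ring
    have e2 : ∀ a, ∑ i, (G a - G (Function.update a i false)) ^ 2 ≤
        3 / 4 * l ^ 2 * v * Real.exp (l * g a) + l ^ 2 / 4 * Real.exp (2 * Λ) * Bad.indicator 1 a := by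
      intro a
      have b1 : ∀ i, (G a - G (Function.update a i false)) ^ 2 ≤
          l ^ 2 / 4 * J i a ^ 2 * Real.exp (l * g a + l * J i a) := fun i => by
        have c0 := abs_exp_sub_exp_le (l / 2 * g a) (l / 2 * g (Function.update a i false))
        have c1 : |l / 2 * g a - l / 2 * g (Function.update a i false)| ≤ l / 2 * J i a := by
          rw [← mul_sub, abs_mul, abs_of_nonneg (by linarith : 0 ≤ l / 2)]
          exact mul_le_mul_of_nonneg_left (hgJ i a) (by linarith)
        have c2 : |G a - G (Function.update a i false)| ≤
            l / 2 * J i a * Real.exp (l / 2 * g a + l / 2 * J i a) := by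
          refine c0.trans (mul_le_mul c1 (Real.exp_le_exp.2 (by linarith)) (Real.exp_pos _).le ?_)
          exact mul_nonneg (by linarith) (hJ0 i a)
        calc (G a - G (Function.update a i false)) ^ 2
            = |G a - G (Function.update a i false)| ^ 2 := (sq_abs _).symm
          _ ≤ (l / 2 * J i a * Real.exp (l / 2 * g a + l / 2 * J i a)) ^ 2 := by gcongr
          _ = _ := by
            rw [mul_pow, ← Real.exp_nat_mul]
            congr 1
            · ring
            · congr 1; push_cast; ring
      by_cases ha : a ∈ Bad
      · rw [indicator_of_mem ha]
        have : ∀ i, (G a - G (Function.update a i false)) ^ 2 ≤ l ^ 2 / 4 * Real.exp (2 * Λ) * J i a ^ 2 :=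
          fun i => by
            refine (b1 i).trans ?_
            have hJi : J i a ≤ 1 := by
              have := (Finset.single_le_sum (fun j _ => sq_nonneg (J j a)) (Finset.mem_univ i)).trans (hJ1 a)
              have h0 := hJ0 i a
              nlinarith
            have : Real.exp (l * g a + l * J i a) ≤ Real.exp (2 * Λ) := Real.exp_le_exp.2 (by
              have := (abs_le.1 (hg a)).2
              nlinarith)
            calc _ ≤ l ^ 2 / 4 * J i a ^ 2 * Real.exp (2 * Λ) := by gcongr
              _ = _ := by ring
        refine (Finset.sum_le_sum fun i _ => this i).trans ?_
        rw [← Finset.mul_sum]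
        have h3 : 0 ≤ 3 / 4 * l ^ 2 * v * Real.exp (l * g a) := by positivity
        have h4 := mul_le_mul_of_nonneg_left (hJ1 a) (by positivity : 0 ≤ l ^ 2 / 4 * Real.exp (2 * Λ))
        simp only [Pi.one_apply]
        linarith
      · rw [indicator_of_notMem ha, mul_zero, add_zero]
        have : ∀ i, (G a - G (Function.update a i false)) ^ 2 ≤ l ^ 2 / 4 * Real.exp (l * g a) * 3 * J i a ^ 2 :=
          fun i => by
            refine (b1 i).trans ?_
            have hJi : l * J i a ≤ 1 := by
              have h1 := (Finset.single_le_sum (fun j _ => sq_nonneg (J j a)) (Finset.mem_univ i)).trans (hv a ha)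
              have h0 := hJ0 i a
              have h2 : (l * J i a) ^ 2 ≤ 1 := by
                calc (l * J i a) ^ 2 = l ^ 2 * J i a ^ 2 := by ring
                  _ ≤ Λ ^ 2 * v := by gcongr
                  _ ≤ 1 := by nlinarith [mul_nonneg hv0 (sq_nonneg Λ)]
              have h3 : 0 ≤ l * J i a := mul_nonneg hl0 h0
              nlinarith
            have : Real.exp (l * g a + l * J i a) ≤ Real.exp (l * g a) * 3 := by
              rw [Real.exp_add]
              have := Real.exp_le_exp.2 hJi
              have := Real.exp_one_lt_d9
              gcongr; linarith
            calc _ ≤ l ^ 2 / 4 * J i a ^ 2 * (Real.exp (l * g a) * 3) := by gcongr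
              _ = _ := by ring
        refine (Finset.sum_le_sum fun i _ => this i).trans ?_
        rw [← Finset.mul_sum]
        have h4 := mul_le_mul_of_nonneg_left (hv a ha) (by positivity : 0 ≤ l ^ 2 / 4 * Real.exp (l * g a) * 3)
        linarith
    have e3 : Φ l - Φ (l / 2) ^ 2 ≤ l ^ 2 * K * Φ l := by
      rw [← e1]
      refine (efron_stein hw G).trans ((Finset.sum_le_sum fun i _ => energy_le h0 h1 G i).trans ?_)
      rw [← Ex_sum (w := bw p) Finset.univ (fun i a => (G a - G (Function.update a i false)) ^ 2)]
      refine (Ex_mono hw e2).trans ?_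
      rw [Ex_add, Ex_const_mul, Ex_const_mul]
      have b1 : Real.exp (2 * Λ) * Pro (bw p) Bad ≤ Real.exp (-(2 * Λ)) := by
        calc _ ≤ Real.exp (2 * Λ) * Real.exp (-(4 * Λ)) := by gcongr
          _ = _ := by rw [← Real.exp_add]; ring_nf
      have b2 : Real.exp (-(2 * Λ)) ≤ Real.exp (-(2 * Λ)) * Φ l :=
        le_mul_of_one_le_right (Real.exp_pos _).le (hΦ1 l)
      have b3 : l ^ 2 / 4 * (Real.exp (2 * Λ) * Pro (bw p) Bad) ≤ l ^ 2 / 4 * (Real.exp (-(2 * Λ)) * Φ l) :=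
        mul_le_mul_of_nonneg_left (b1.trans b2) (by positivity)
      simp only [Pro] at b3
      calc _ = 3 / 4 * l ^ 2 * v * Φ l + l ^ 2 / 4 * (Real.exp (2 * Λ) * Ex (bw p) (Bad.indicator 1)) := by
            simp only [hΦ]; ring
        _ ≤ 3 / 4 * l ^ 2 * v * Φ l + l ^ 2 / 4 * (Real.exp (-(2 * Λ)) * Φ l) := by gcongr
        _ = _ := by rw [hK]; ring
    have hx : K * l ^ 2 ≤ 1 / 12 := (mul_le_mul_of_nonneg_left (by gcongr) hK0).trans hKΛ
    have hx0 : 0 ≤ K * l ^ 2 := by positivity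
    have e4 : 1 ≤ (1 - K * l ^ 2) * Real.exp (2 * K * l ^ 2) := by
      have := Real.add_one_le_exp (2 * K * l ^ 2)
      nlinarith
    have e5 : (1 - K * l ^ 2) * Φ l ≤ Φ (l / 2) ^ 2 := by linarith
    calc Φ l = 1 * Φ l := (one_mul _).symm
      _ ≤ ((1 - K * l ^ 2) * Real.exp (2 * K * l ^ 2)) * Φ l := by
        have := hΦ1 l
        gcongr
      _ = ((1 - K * l ^ 2) * Φ l) * Real.exp (2 * K * l ^ 2) := by ring
      _ ≤ _ := by gcongr
  have iter : ∀ j : ℕ, ∀ l, 0 ≤ l → l ≤ Λ →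
      Φ l ≤ Φ (l / 2 ^ j) ^ 2 ^ j * Real.exp (4 * K * l ^ 2 * (1 - (1 / 2) ^ j)) := by
    intro j
    induction j with
    | zero => intro l _ _; simp
    | succ j ih =>
      intro l hl0 hl
      have h2 := ih (l / 2) (by linarith) (by linarith)
      have hpos : 0 ≤ Φ (l / 2) := by linarith [hΦ1 (l / 2)]
      calc Φ l ≤ Φ (l / 2) ^ 2 * Real.exp (2 * K * l ^ 2) := step l hl0 hl
        _ ≤ (Φ (l / 2 / 2 ^ j) ^ 2 ^ j * Real.exp (4 * K * (l / 2) ^ 2 * (1 - (1 / 2) ^ j))) ^ 2 *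
            Real.exp (2 * K * l ^ 2) := by gcongr
        _ = _ := by
          rw [mul_pow, ← pow_mul, ← pow_succ, ← Real.exp_nat_mul, mul_assoc, ← Real.exp_add]
          congr 2
          · rw [div_div, ← pow_succ']
          · push_cast; ring_nf
  obtain ⟨j, hj⟩ : ∃ j : ℕ, Λ + 4 * Λ ^ 2 ≤ 2 ^ j := by
    obtain ⟨j, hj⟩ := pow_unbounded_of_one_lt (Λ + 4 * Λ ^ 2) (one_lt_two)
    exact ⟨j, hj.le⟩
  have hj1 : Λ / 2 ^ j ≤ 1 := by
    rw [div_le_one (by positivity)]; nlinarith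
  have hj0 : 0 ≤ Λ / 2 ^ j := by positivity
  have hsmall : Φ (Λ / 2 ^ j) ≤ Real.exp ((Λ / 2 ^ j) ^ 2) := by
    set m := Λ / 2 ^ j
    have : Φ m ≤ Ex (bw p) (fun a => (1 + m ^ 2) + m * g a) := Ex_mono hw fun a => by
      have hmg : |m * g a| ≤ 1 := by
        rw [abs_mul, abs_of_nonneg hj0]
        exact mul_le_one₀ hj1 (abs_nonneg _) (hg a)
      have h1 := (abs_le.1 (Real.abs_exp_sub_one_sub_id_le hmg)).2
      have h2 : (m * g a) ^ 2 ≤ m ^ 2 := by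
        rw [mul_pow, ← sq_abs (g a)]
        have := hg a
        have h3 := abs_nonneg (g a)
        exact mul_le_of_le_one_right (sq_nonneg _) (by nlinarith)
      linarith
    rw [Ex_add, Ex_const hw, Ex_const_mul, hEg, mul_zero, add_zero] at this
    linarith [Real.add_one_le_exp (m ^ 2)]
  have hfin := iter j Λ hΛ.le le_rfl
  have h3 : Φ (Λ / 2 ^ j) ^ 2 ^ j ≤ Real.exp (1 / 4) := by
    have := hΦ1 (Λ / 2 ^ j)
    calc Φ (Λ / 2 ^ j) ^ 2 ^ j ≤ Real.exp ((Λ / 2 ^ j) ^ 2) ^ 2 ^ j := by gcongr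
      _ = Real.exp (Λ ^ 2 / 2 ^ j) := by
        rw [← Real.exp_nat_mul]; congr 1; push_cast; field_simp
      _ ≤ _ := Real.exp_le_exp.2 (by
        rw [div_le_iff₀ (by positivity)]; linarith)
  have h4 : Real.exp (4 * K * Λ ^ 2 * (1 - (1 / 2) ^ j)) ≤ Real.exp (1 / 3) := Real.exp_le_exp.2 (by
    have : (0 : ℝ) ≤ (1 / 2) ^ j := by positivity
    nlinarith [mul_nonneg hK0 (sq_nonneg Λ)])
  have h5 : Real.exp (1 / 4) * Real.exp (1 / 3) ≤ 2 := by
    rw [← Real.exp_add]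
    calc Real.exp (1 / 4 + 1 / 3) ≤ Real.exp (Real.log 2) := Real.exp_le_exp.2 (by
          have := Real.log_two_gt_d9; norm_num at this ⊢; linarith)
      _ = 2 := Real.exp_log (by norm_num)
  exact (hfin.trans (mul_le_mul h3 h4 (Real.exp_pos _).le (Real.exp_pos _).le)).trans h5

theorem tail_of_influence {p : ℝ} (h0 : 0 ≤ p) (h1 : p ≤ 1) {f : (ι → Bool) → ℝ} (hf0 : ∀ a, 0 ≤ f a)
    (hf1 : ∀ a, f a ≤ 1) {J : ι → (ι → Bool) → ℝ} (hJ0 : ∀ i a, 0 ≤ J i a)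
    (hfJ : ∀ i a, |f a - f (Function.update a i false)| ≤ J i a) (hJ1 : ∀ a, ∑ i, J i a ^ 2 ≤ 1)
    {Bad : Set (ι → Bool)} {v Λ : ℝ} (hv : ∀ a ∉ Bad, ∑ i, J i a ^ 2 ≤ v) (hΛ : 0 < Λ)
    (hv0 : 0 ≤ v) (hvΛ : 16 * v * Λ ^ 2 ≤ 1) (hBad : Pro (bw p) Bad ≤ Real.exp (-(4 * Λ))) (t : ℝ) :
    Pro (bw p) {a | t ≤ |f a - Ex (bw p) f|} ≤ 4 * Real.exp (-(t * Λ)) := by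
  have hw := isWeight_bw h0 h1
  have hE0 : 0 ≤ Ex (bw p) f := Ex_nonneg hw hf0
  have hE1 : Ex (bw p) f ≤ 1 := Ex_le_of_le hw hf1
  have key : ∀ g : (ι → Bool) → ℝ, (∀ a, |g a| ≤ 1) → Ex (bw p) g = 0 →
      (∀ i a, |g a - g (Function.update a i false)| ≤ J i a) →
      Pro (bw p) {a | t ≤ g a} ≤ 2 * Real.exp (-(t * Λ)) := fun g hg1 hg2 hg3 => by
    have hm := exp_moment_le h0 h1 hg1 hg2 hJ0 hg3 hJ1 hv hΛ hv0 hvΛ hBad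
    have := mul_Pro_le hw (fun a => (Real.exp_pos (Λ * g a)).le) (A := {a | t ≤ g a})
      (c := Real.exp (Λ * t)) fun a ha => Real.exp_le_exp.2 (mul_le_mul_of_nonneg_left ha hΛ.le)
    calc Pro (bw p) {a | t ≤ g a}
        = Real.exp (-(t * Λ)) * (Real.exp (Λ * t) * Pro (bw p) {a | t ≤ g a}) := by
          rw [← mul_assoc, ← Real.exp_add]; ring_nf; simp
      _ ≤ Real.exp (-(t * Λ)) * 2 := by gcongr; exact this.trans hm
      _ = _ := by ring
  have hsub : Ex (bw p) (fun a => f a - Ex (bw p) f) = 0 := by rw [Ex_sub, Ex_const hw, sub_self]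
  have hsub' : Ex (bw p) (fun a => Ex (bw p) f - f a) = 0 := by rw [Ex_sub, Ex_const hw, sub_self]
  have b : ∀ a, |f a - Ex (bw p) f| ≤ 1 := fun a => by
    rw [abs_le]; constructor <;> linarith [hf0 a, hf1 a]
  have k1 := key (fun a => f a - Ex (bw p) f) b hsub (fun i a => by
    rw [sub_sub_sub_cancel_right]; exact hfJ i a)
  have k2 := key (fun a => Ex (bw p) f - f a) (fun a => by rw [abs_sub_comm]; exact b a) hsub'
    (fun i a => by rw [sub_sub_sub_cancel_left, abs_sub_comm]; exact hfJ i a)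
  calc _ ≤ Pro (bw p) ({a | t ≤ f a - Ex (bw p) f} ∪ {a | t ≤ Ex (bw p) f - f a}) :=
        Pro_mono hw fun a (ha : t ≤ |_|) => by
          rcases le_abs.1 ha with h | h
          · exact Or.inl h
          · exact Or.inr (show t ≤ _ by linarith)
    _ ≤ _ := Pro_union_le hw _ _
    _ ≤ _ := by linarith

end Pro

section Stopping
set_option linter.unusedSectionVars false
variable {ι α β τ : Type*} [Fintype ι] [Fintype α] [Fintype β] {w : α → ℝ}

/-- `S` is a stopping set which determines `H`. -/
def IsStopping (S : (ι → α) → Finset ι) (H : (ι → α) → ℝ) : Prop :=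
  ∀ ω ω', (∀ i ∈ S ω, ω i = ω' i) → S ω' = S ω ∧ H ω' = H ω

theorem isStopping_univ (H : (ι → α) → ℝ) : IsStopping (fun _ => Finset.univ) H := fun ω ω' h => by
  rw [show ω = ω' from funext fun i => h i (Finset.mem_univ i)]
  exact ⟨rfl, rfl⟩

/-- The sign of a colour. -/
def sgn (b : Bool) : ℝ := if b then 1 else -1

theorem sum_sq_le_of_isStopping {H : (ι → Bool) → ℝ} (h0 : ∀ c, 0 ≤ H c) (h1 : ∀ c, H c ≤ 1)
    {Q : Finset τ} (hQ : Q.Nonempty) {S : τ → (ι → Bool) → Finset ι} (hS : ∀ ρ ∈ Q, IsStopping (S ρ) H)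
    {δ : ℝ} (hδ0 : 0 ≤ δ) (hδ : ∀ i, ∑ ρ ∈ Q, Pro (bw (1 / 2)) {c | i ∈ S ρ c} ≤ δ * Q.card) :
    ∑ i, Ex (bw (1 / 2)) (fun c => H c * sgn (c i)) ^ 2 ≤ δ := by
  have hw : IsWeight (bw (1 / 2)) := isWeight_bw (by norm_num) (by norm_num)
  set J : ι → ℝ := fun i => Ex (bw (1 / 2)) (fun c => H c * sgn (c i)) with hJ
  set A := ∑ i, J i ^ 2 with hA
  set g : Finset ι → (ι → Bool) → ℝ := fun T c => ∑ i, if T = {i} then J i * sgn (c i) else 0 with hgdef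
  have hgi : ∀ i c, g {i} c = J i * sgn (c i) := fun i c => by
    simp [hgdef, Finset.singleton_inj]
  have hgo : ∀ T, (∀ i, T ≠ {i}) → ∀ c, g T c = 0 := fun T hT c => by
    simp [hgdef, hT]
  have hg : IsComponents (bw (1 / 2)) g := by
    refine ⟨fun T j hj c s => ?_, fun T j hj c => ?_⟩
    · by_cases hT : ∃ i, T = {i}
      · obtain ⟨i, rfl⟩ := hT
        rw [hgi, hgi, Function.update_of_ne (by rintro rfl; simp at hj)]
      · push Not at hT
        rw [hgo T hT, hgo T hT]
    · rw [avg_bw]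
      by_cases hT : ∃ i, T = {i}
      · obtain ⟨i, rfl⟩ := hT
        obtain rfl := Finset.mem_singleton.1 hj
        simp only [hgi, Function.update_self, sgn]
        norm_num
      · push Not at hT
        rw [hgo T hT, hgo T hT]
        simp
  set X : Finset (Finset ι) := Finset.univ.image fun i => {i}
  have hXsum : ∀ F : Finset ι → ℝ, ∑ T ∈ X, F T = ∑ i, F {i} := fun F =>
    Finset.sum_image (fun i _ j _ h => Finset.singleton_injective h)
  have hEg : ∀ i, Ex (bw (1 / 2)) (fun c => g {i} c ^ 2) = J i ^ 2 := fun i => by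
    have : ∀ c : ι → Bool, g {i} c ^ 2 = J i ^ 2 := fun c => by
      rw [hgi, mul_pow]
      cases c i <;> simp [sgn]
    simp only [this, Ex_const hw]
  have hHg : Ex (bw (1 / 2)) (fun c => H c * ∑ T ∈ X, g T c) = A := by
    simp only [hXsum, hgi, Finset.mul_sum, Ex_sum, hA]
    refine Finset.sum_congr rfl fun i _ => ?_
    rw [sq, ← Ex_const_mul]
    congr 1; funext c; ring
  have hH2 : Ex (bw (1 / 2)) (fun c => H c ^ 2) ≤ 1 := Ex_le_of_le hw fun c => by
    have := h0 c; have := h1 c; nlinarith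
  have key : ∀ ρ ∈ Q, A ^ 2 ≤ ∑ i, J i ^ 2 * Pro (bw (1 / 2)) {c | i ∈ S ρ c} := fun ρ hρ => by
    have := schramm_steif hw hg le_rfl (X := X) (fun T hT => by
      obtain ⟨i, -, rfl⟩ := Finset.mem_image.1 hT
      simp) (hS ρ hρ)
    rw [hHg, hXsum] at this
    simp only [hEg] at this
    simp only [Finset.disjoint_singleton_left, not_not] at this
    refine this.trans (mul_le_of_le_one_left ?_ hH2)
    exact Finset.sum_nonneg fun i _ => mul_nonneg (sq_nonneg _) (Pro_nonneg hw _)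
  have hsum := Finset.sum_le_sum key
  rw [Finset.sum_const, nsmul_eq_mul, Finset.sum_comm] at hsum
  simp only [← Finset.mul_sum] at hsum
  have hA0 : 0 ≤ A := Finset.sum_nonneg fun i _ => sq_nonneg _
  have h2 : ∑ i, J i ^ 2 * ∑ ρ ∈ Q, Pro (bw (1 / 2)) {c | i ∈ S ρ c} ≤ A * (δ * Q.card) := by
    rw [hA, Finset.sum_mul]
    exact Finset.sum_le_sum fun i _ => mul_le_mul_of_nonneg_left (hδ i) (sq_nonneg _)
  have hQ0 : (0 : ℝ) < Q.card := by exact_mod_cast hQ.card_pos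
  rcases hA0.eq_or_lt with h | h
  · rwa [← h]
  · have : A * (A * Q.card) ≤ A * (δ * Q.card) := by nlinarith
    exact le_of_mul_le_mul_right (le_of_mul_le_mul_left this h) hQ0

theorem sum_sq_le_one {H : (ι → Bool) → ℝ} (h0 : ∀ c, 0 ≤ H c) (h1 : ∀ c, H c ≤ 1) :
    ∑ i, Ex (bw (1 / 2)) (fun c => H c * sgn (c i)) ^ 2 ≤ 1 :=
  sum_sq_le_of_isStopping h0 h1 (Finset.singleton_nonempty ()) (S := fun _ _ => Finset.univ)
    (fun _ _ => isStopping_univ H) zero_le_one fun i => by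
      have := Pro_univ (ι := ι) (isWeight_bw (p := 1 / 2) (by norm_num) (by norm_num))
      simpa using this.le

theorem variance_le_of_isStopping {v : β → ℝ} (hw : IsWeight w) (hv : IsWeight v)
    {f : (ι → α) → ℝ} {H : (ι → α × β) → ℝ} (h0 : ∀ c, 0 ≤ H c) (h1 : ∀ c, H c ≤ 1)
    (hf : ∀ a, f a = Ex v fun c => H fun i => (a i, c i))
    {Q : Finset τ} (hQ : Q.Nonempty) {S : τ → (ι → α × β) → Finset ι} (hS : ∀ ρ ∈ Q, IsStopping (S ρ) H)
    {δ : ℝ} (hδ0 : 0 ≤ δ)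
    (hδ : ∀ i, ∑ ρ ∈ Q, Pro (fun s : α × β => w s.1 * v s.2) {c | i ∈ S ρ c} ≤ δ * Q.card)
    (hE : ∑ i, Ex w (fun a => (f a - avg w i f a) ^ 2) ≤ 1) {K : ℕ} (hK : 1 ≤ K) :
    Ex w (fun a => (f a - Ex w f) ^ 2) ≤ 1 / K + K ^ 2 * δ := by
  have hwv := hw.pair hv
  obtain ⟨g, hg, hfg⟩ := exists_components hw f
  set g' : Finset ι → (ι → α × β) → ℝ := fun T ω => g T fun i => (ω i).1 with hg'
  have hup : ∀ (ω : ι → α × β) i s, (fun j => (Function.update ω i s j).1) =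
      Function.update (fun j => (ω j).1) i s.1 := fun ω i s => by
    funext j
    by_cases hj : j = i
    · subst hj; simp
    · simp [Function.update_of_ne hj]
  have hgc : IsComponents (fun s : α × β => w s.1 * v s.2) g' := by
    refine ⟨fun T i hi ω s => ?_, fun T i hi ω => ?_⟩
    · change g T (fun j => (Function.update ω i s j).1) = g T _
      rw [hup]
      exact hg.free T i hi _ _
    · have := hg.avg_eq T i hi (fun j => (ω j).1)
      simp only [avg] at this ⊢
      rw [Fintype.sum_prod_type, ← this]
      refine Finset.sum_congr rfl fun x _ => ?_
      have e : ∀ y, g' T (Function.update ω i (x, y)) = g T (Function.update (fun j => (ω j).1) i x) := fun y => by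
        change g T (fun j => (Function.update ω i (x, y) j).1) = _
        rw [hup]
      simp only [e, ← Finset.sum_mul, ← Finset.mul_sum, hv.sum_eq, mul_one]
  have hlift : ∀ F : (ι → α) → ℝ, Ex (fun s : α × β => w s.1 * v s.2) (fun ω => F fun i => (ω i).1) = Ex w F :=
    fun F => by
      rw [Ex_pair]
      simp only [Ex_const hv]
  set q : Finset ι → ℝ := fun T => Ex w (fun a => g T a ^ 2) with hq
  have hq0 : ∀ T, 0 ≤ q T := fun T => ex_sq_nonneg hw _
  set W : ℕ → ℝ := fun k => ∑ T ∈ Finset.univ.filter (·.card = k), q T with hW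
  have hW0 : ∀ k, 0 ≤ W k := fun k => Finset.sum_nonneg fun T _ => hq0 T
  have hQ0 : (0 : ℝ) < Q.card := by exact_mod_cast hQ.card_pos
  have hWk : ∀ k, 1 ≤ k → W k ≤ k * δ := by
    intro k hk
    set X := Finset.univ.filter fun T : Finset ι => T.card = k
    have hHg : Ex (fun s : α × β => w s.1 * v s.2) (fun ω => H ω * ∑ T ∈ X, g' T ω) = W k := by
      rw [Ex_pair]
      have : ∀ a : ι → α, (Ex v fun c => H (fun i => (a i, c i)) * ∑ T ∈ X, g' T fun i => (a i, c i)) =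
          1 * ((∑ T ∈ Finset.univ, g T a) * ∑ T ∈ X, g T a) := fun a => by
        simp only [hg', mul_comm (H _)]
        rw [Ex_const_mul, ← hf, hfg]
        ring
      simp only [this]
      rw [IsComponents.ex_mul_sum (g := g) (fun _ => (1 : ℝ)), Finset.sum_comm]
      refine Finset.sum_congr rfl fun T hT => ?_
      rw [Finset.sum_eq_single T]
      · simp only [one_mul, ← sq, hq]
      · intro T' _ hne
        by_cases hc : ∃ i, i ∈ T ∧ i ∉ T'
        · obtain ⟨i, hi, hi'⟩ := hc
          exact hg.ex_mul_eq_zero hw hi hi' fun _ _ => rfl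
        · have : ∃ i, i ∈ T' ∧ i ∉ T := by
            by_contra! h2
            push Not at hc
            exact hne (Finset.ext fun i => ⟨h2 i, hc i⟩)
          obtain ⟨i, hi, hi'⟩ := this
          simp only [mul_comm (g T' _)]
          exact hg.ex_mul_eq_zero hw hi hi' fun _ _ => rfl
      · simp
    have hH2 : Ex (fun s : α × β => w s.1 * v s.2) (fun c => H c ^ 2) ≤ 1 := Ex_le_of_le hwv fun c => by
      have := h0 c; have := h1 c; nlinarith
    have key : ∀ ρ ∈ Q, W k ^ 2 ≤ ∑ T ∈ X, q T *
        ∑ i ∈ T, Pro (fun s : α × β => w s.1 * v s.2) {c | i ∈ S ρ c} := fun ρ hρ => by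
      have := schramm_steif hwv hgc hk (X := X) (fun T hT => (Finset.mem_filter.1 hT).2) (hS ρ hρ)
      rw [hHg] at this
      refine this.trans ((mul_le_of_le_one_left ?_ hH2).trans (Finset.sum_le_sum fun T _ => ?_))
      · exact Finset.sum_nonneg fun T _ => mul_nonneg (ex_sq_nonneg hwv _) (Pro_nonneg hwv _)
      · have e : Ex (fun s : α × β => w s.1 * v s.2) (fun ω => g' T ω ^ 2) = q T :=
          hlift fun a => g T a ^ 2
        rw [e]
        refine mul_le_mul_of_nonneg_left ((Pro_mono hwv fun c hc => ?_).trans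
          (Pro_biUnion_le hwv T fun i => {c | i ∈ S ρ c})) (hq0 T)
        obtain ⟨i, hi, hi'⟩ := Finset.not_disjoint_iff.1 hc
        exact mem_biUnion hi hi'
    have hsum := Finset.sum_le_sum key
    rw [Finset.sum_const, nsmul_eq_mul, Finset.sum_comm] at hsum
    simp only [← Finset.mul_sum] at hsum
    have h2 : ∑ T ∈ X, q T * ∑ ρ ∈ Q, ∑ i ∈ T, Pro (fun s : α × β => w s.1 * v s.2) {c | i ∈ S ρ c} ≤
        W k * (k * (δ * Q.card)) := by
      rw [hW, Finset.sum_mul]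
      refine Finset.sum_le_sum fun T hT => mul_le_mul_of_nonneg_left ?_ (hq0 T)
      rw [Finset.sum_comm]
      refine (Finset.sum_le_sum fun i _ => hδ i).trans_eq ?_
      rw [Finset.sum_const, nsmul_eq_mul, (Finset.mem_filter.1 hT).2]
    rcases (hW0 k).eq_or_lt with h | h
    · rw [← h]; positivity
    · have : W k * (W k * Q.card) ≤ W k * (k * δ * Q.card) := by nlinarith
      exact le_of_mul_le_mul_right (le_of_mul_le_mul_left this h) hQ0
  have hK0 : (0 : ℝ) < K := by exact_mod_cast hK
  rw [hg.energy_eq hw hfg] at hE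
  rw [hg.variance_eq hw hfg]
  have hsmall : ∑ T ∈ (Finset.univ.erase ∅).filter (fun T : Finset ι => T.card ≤ K), q T ≤ K ^ 2 * δ := by
    calc _ = ∑ k ∈ Finset.Icc 1 K, ∑ T ∈ ((Finset.univ.erase ∅).filter
            (fun T : Finset ι => T.card ≤ K)).filter (·.card = k), q T := by
          symm
          refine Finset.sum_fiberwise_of_maps_to (fun T hT => ?_) _
          simp only [Finset.mem_filter, Finset.mem_erase] at hT
          exact Finset.mem_Icc.2 ⟨Finset.card_pos.2 (Finset.nonempty_iff_ne_empty.2 hT.1.1), hT.2⟩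
      _ ≤ ∑ k ∈ Finset.Icc 1 K, (K : ℝ) * δ := by
          refine Finset.sum_le_sum fun k hk => ?_
          have hk := Finset.mem_Icc.1 hk
          refine (Finset.sum_le_sum_of_subset_of_nonneg (fun T hT => ?_) fun T _ _ => hq0 T).trans
            ((hWk k hk.1).trans ?_)
          · simp only [Finset.mem_filter] at hT ⊢
            exact ⟨Finset.mem_univ _, hT.2⟩
          · have : (k : ℝ) ≤ K := by exact_mod_cast hk.2
            gcongr
      _ = _ := by rw [Finset.sum_const, Nat.card_Icc, nsmul_eq_mul, Nat.add_sub_cancel]; ring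
  have hlarge : ∑ T ∈ (Finset.univ.erase ∅).filter (fun T : Finset ι => ¬ T.card ≤ K), q T ≤ 1 / K := by
    rw [le_div_iff₀ hK0, Finset.sum_mul]
    refine le_trans (le_trans (Finset.sum_le_sum fun T hT => ?_)
      (Finset.sum_le_sum_of_subset_of_nonneg (Finset.subset_univ _) fun T _ _ =>
        mul_nonneg (Nat.cast_nonneg T.card) (hq0 T))) hE
    have : (K : ℝ) ≤ T.card := by
      have := (Finset.mem_filter.1 hT).2
      exact_mod_cast (not_le.1 this).le
    rw [mul_comm]
    exact mul_le_mul_of_nonneg_right this (hq0 T)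
  have := Finset.sum_filter_add_sum_filter_not (Finset.univ.erase ∅) (fun T : Finset ι => T.card ≤ K) q
  linarith

end Stopping

theorem sqDist_le_of_norm {p x : ℝ × ℝ} {r : ℝ} (h : ‖p - x‖ ≤ r) : sqDist p x ≤ 2 * r ^ 2 := by
  rw [Prod.norm_def, max_le_iff, Real.norm_eq_abs, Real.norm_eq_abs] at h
  have h1 := sq_le_sq' (by linarith [neg_abs_le (p - x).1]) ((le_abs_self _).trans h.1)
  have h2 := sq_le_sq' (by linarith [neg_abs_le (p - x).2]) ((le_abs_self _).trans h.2)
  simp only [Prod.fst_sub, Prod.snd_sub] at h1 h2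
  unfold sqDist
  linarith

theorem norm_sq_le_sqDist (p x : ℝ × ℝ) : ‖p - x‖ ^ 2 ≤ sqDist p x := by
  unfold sqDist
  rw [Prod.norm_def, Real.norm_eq_abs, Real.norm_eq_abs]
  rcases max_choice |(p - x).1| |(p - x).2| with h | h <;> rw [h, sq_abs]
  · simp only [Prod.fst_sub]; nlinarith [sq_nonneg (p.2 - x.2)]
  · simp only [Prod.snd_sub]; nlinarith [sq_nonneg (p.1 - x.1)]

theorem continuous_sqDist_left (x : ℝ × ℝ) : Continuous fun p => sqDist p x := by
  unfold sqDist; fun_prop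

/-- The points strictly closer to `R` than to `B`. -/
def SR (R B : Set (ℝ × ℝ)) : Set (ℝ × ℝ) := {p | ∃ x ∈ R, ∀ y ∈ B, sqDist p x < sqDist p y}

theorem SR_mono {R R' B B' : Set (ℝ × ℝ)} (hR : R ⊆ R') (hB : B' ⊆ B) : SR R B ⊆ SR R' B' :=
  fun _ ⟨x, hx, h⟩ => ⟨x, hR hx, fun y hy => h y (hB hy)⟩

theorem SR_local_imp {R R' B B' : Set (ℝ × ℝ)} {p : ℝ × ℝ} {r : ℝ}
    (hR : ∀ x, sqDist p x ≤ r → (x ∈ R ↔ x ∈ R')) (hB : ∀ x, sqDist p x ≤ r → (x ∈ B ↔ x ∈ B'))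
    (hne : ∃ a ∈ R ∪ B, sqDist p a ≤ r) (hp : p ∈ SR R B) : p ∈ SR R' B' := by
  obtain ⟨x, hx, h⟩ := hp
  by_cases hxr : sqDist p x ≤ r
  · refine ⟨x, (hR x hxr).1 hx, fun y hy => ?_⟩
    by_cases hyr : sqDist p y ≤ r
    · exact h y ((hB y hyr).2 hy)
    · exact hxr.trans_lt (not_le.1 hyr)
  · obtain ⟨a, ha | ha, har⟩ := hne
    · refine ⟨a, (hR a har).1 ha, fun y hy => ?_⟩
      by_cases hyr : sqDist p y ≤ r
      · exact absurd ((h y ((hB y hyr).2 hy)).le.trans hyr) hxr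
      · exact har.trans_lt (not_le.1 hyr)
    · exact absurd ((h a ha).le.trans har) hxr

theorem SR_local {R R' B B' : Set (ℝ × ℝ)} {p : ℝ × ℝ} {r : ℝ}
    (hR : ∀ x, sqDist p x ≤ r → (x ∈ R ↔ x ∈ R')) (hB : ∀ x, sqDist p x ≤ r → (x ∈ B ↔ x ∈ B'))
    (hne : ∃ a ∈ R ∪ B, sqDist p a ≤ r) : p ∈ SR R B ↔ p ∈ SR R' B' := by
  refine ⟨SR_local_imp hR hB hne, SR_local_imp (fun x h => (hR x h).symm) (fun x h => (hB x h).symm) ?_⟩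
  obtain ⟨a, ha | ha, har⟩ := hne
  · exact ⟨a, Or.inl ((hR a har).1 ha), har⟩
  · exact ⟨a, Or.inr ((hB a har).1 ha), har⟩

theorem isOpen_SR {R B : Set (ℝ × ℝ)} (hB : ∀ C : ℝ, (B ∩ {y | ‖y‖ ≤ C}).Finite) : IsOpen (SR R B) := by
  rw [isOpen_iff_mem_nhds]
  rintro p ⟨x, hx, h⟩
  set C := ‖p‖ + 1 + 2 * (‖p‖ + 1 + ‖x‖) + 1
  have hV : Metric.ball p 1 ∩ ⋂ y ∈ B ∩ {y | ‖y‖ ≤ C}, {p' | sqDist p' x < sqDist p' y} ∈ nhds p := by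
    refine Filter.inter_mem (Metric.ball_mem_nhds _ one_pos) ((Filter.biInter_mem (hB C)).2 fun y hy => ?_)
    exact (isOpen_lt (continuous_sqDist_left x) (continuous_sqDist_left y)).mem_nhds (h y hy.1)
  filter_upwards [hV] with p' hp'
  refine ⟨x, hx, fun y hy => ?_⟩
  by_cases hyC : ‖y‖ ≤ C
  · exact mem_iInter₂.1 hp'.2 y ⟨hy, hyC⟩
  · have h1 : ‖p'‖ ≤ ‖p‖ + 1 := by
      have : ‖p' - p‖ < 1 := by simpa [dist_eq_norm] using hp'.1
      linarith [norm_le_norm_add_norm_sub' p' p]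
    have h2 : ‖p' - x‖ ≤ ‖p‖ + 1 + ‖x‖ := (norm_sub_le _ _).trans (by linarith)
    have h3 : 2 * (‖p‖ + 1 + ‖x‖) < ‖p' - y‖ := by
      have := norm_le_norm_add_norm_sub p' y
      have := not_le.1 hyC
      linarith
    have := sqDist_le_of_norm h2
    have := norm_sq_le_sqDist p' y
    nlinarith [norm_nonneg p, norm_nonneg x]

section Fields
set_option linter.unusedSectionVars false
variable {ι κ : Type*}

/-- The strictly red region of a field of (activity, colour) pairs. -/
def RS (x : ι → ℝ × ℝ) (ω : ι → Bool × Bool) : Set (ℝ × ℝ) :=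
  SR (x '' {i | ω i = (true, true)}) (x '' {i | ω i = (true, false)})

theorem isOpen_RS [Finite ι] (x : ι → ℝ × ℝ) (ω : ι → Bool × Bool) : IsOpen (RS x ω) :=
  isOpen_SR fun _ => ((toFinite _).image x).inter_of_left _

theorem RS_local {x : ι → ℝ × ℝ} {x' : κ → ℝ × ℝ} {ω : ι → Bool × Bool} {ω' : κ → Bool × Bool}
    {p : ℝ × ℝ} {r : ℝ}
    (h : ∀ i, sqDist p (x i) ≤ r → (ω i).1 = true → ∃ j, x' j = x i ∧ ω' j = ω i)
    (h' : ∀ j, sqDist p (x' j) ≤ r → (ω' j).1 = true → ∃ i, x i = x' j ∧ ω i = ω' j)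
    (hne : ∃ i, (ω i).1 = true ∧ sqDist p (x i) ≤ r) : p ∈ RS x ω ↔ p ∈ RS x' ω' := by
  have key : ∀ s : Bool, ∀ y, sqDist p y ≤ r →
      (y ∈ x '' {i | ω i = (true, s)} ↔ y ∈ (x') '' {j | ω' j = (true, s)}) := by
    intro s y hy
    constructor
    · rintro ⟨i, hi, rfl⟩
      have hi : ω i = _ := hi
      obtain ⟨j, hj, hj'⟩ := h i hy (by rw [hi])
      exact ⟨j, hj'.trans hi, hj⟩
    · rintro ⟨i, hi, rfl⟩
      have hi : ω' i = _ := hi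
      obtain ⟨j, hj, hj'⟩ := h' i hy (by rw [hi])
      exact ⟨j, hj'.trans hi, hj⟩
  refine SR_local (key true) (key false) ?_
  obtain ⟨i, hi, hir⟩ := hne
  rcases hs : (ω i).2 with _ | _
  · exact ⟨x i, Or.inr ⟨i, Prod.ext hi hs, rfl⟩, hir⟩
  · exact ⟨x i, Or.inl ⟨i, Prod.ext hi hs, rfl⟩, hir⟩

/-- The set `V` joins a point with `h ≤ h₀` to a point with `h ≥ h₁`. -/
def Joins (V : Set (ℝ × ℝ)) (h : ℝ × ℝ → ℝ) (h₀ h₁ : ℝ) : Prop :=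
  ∃ p r, h p ≤ h₀ ∧ h₁ ≤ h r ∧ JoinedIn V p r

theorem Joins.mono {V V' : Set (ℝ × ℝ)} {h : ℝ × ℝ → ℝ} {h₀ h₁ : ℝ} (H : Joins V h h₀ h₁) (hV : V ⊆ V') :
    Joins V' h h₀ h₁ := by
  obtain ⟨p, r, hp, hr, hj⟩ := H
  exact ⟨p, r, hp, hr, hj.mono hV⟩

/-- The box of side `κ` containing a point. -/
noncomputable def box (κ : ℝ) (p : ℝ × ℝ) : ℤ × ℤ := (⌊p.1 / κ⌋, ⌊p.2 / κ⌋)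

theorem floor_near {κ a b : ℝ} (hκ : 0 < κ) {m : ℕ} (h : |a - b| ≤ m * κ) : |⌊a / κ⌋ - ⌊b / κ⌋| ≤ m := by
  have h2 : |a / κ - b / κ| ≤ m := by
    rw [← sub_div, abs_div, abs_of_pos hκ, div_le_iff₀ hκ]; exact h
  rw [abs_le] at h2 ⊢
  have a1 := Int.floor_le (a / κ); have a2 := Int.lt_floor_add_one (a / κ)
  have b1 := Int.floor_le (b / κ); have b2 := Int.lt_floor_add_one (b / κ)
  constructor
  · have : ((⌊b / κ⌋ - ⌊a / κ⌋ : ℤ) : ℝ) < m + 1 := by push_cast; linarith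
    have : ⌊b / κ⌋ - ⌊a / κ⌋ < (m : ℤ) + 1 := by exact_mod_cast this
    omega
  · have : ((⌊a / κ⌋ - ⌊b / κ⌋ : ℤ) : ℝ) < m + 1 := by push_cast; linarith
    have : ⌊a / κ⌋ - ⌊b / κ⌋ < (m : ℤ) + 1 := by exact_mod_cast this
    omega

theorem near_of_floor {κ a b : ℝ} (hκ : 0 < κ) {m : ℕ} (h : |⌊a / κ⌋ - ⌊b / κ⌋| ≤ m) :
    |a - b| ≤ (m + 1) * κ := by
  have a1 := Int.floor_le (a / κ); have a2 := Int.lt_floor_add_one (a / κ)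
  have b1 := Int.floor_le (b / κ); have b2 := Int.lt_floor_add_one (b / κ)
  have h' : |(⌊a / κ⌋ : ℝ) - ⌊b / κ⌋| ≤ m := by exact_mod_cast h
  rw [abs_le] at h'
  have : |a / κ - b / κ| ≤ m + 1 := by rw [abs_le]; constructor <;> linarith [h'.1, h'.2]
  rwa [← sub_div, abs_div, abs_of_pos hκ, div_le_iff₀ hκ] at this

theorem norm_le_of_box_eq {κ : ℝ} (hκ : 0 < κ) {p x : ℝ × ℝ} (h : box κ p = box κ x) : ‖p - x‖ ≤ κ := by
  obtain ⟨h1, h2⟩ := Prod.ext_iff.1 h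
  simp only [box] at h1 h2
  have e1 := near_of_floor (a := p.1) (b := x.1) hκ (m := 0) (by simp [h1])
  have e2 := near_of_floor (a := p.2) (b := x.2) hκ (m := 0) (by simp [h2])
  simp only [Nat.cast_zero, zero_add, one_mul] at e1 e2
  exact max_le e1 e2

/-- Two boxes are near each other. -/
def Near (b b' : ℤ × ℤ) : Prop := |b.1 - b'.1| ≤ 2 ∧ |b.2 - b'.2| ≤ 2

theorem near_of_sqDist {κ : ℝ} (hκ : 0 < κ) {p x : ℝ × ℝ} (h : sqDist p x ≤ 2 * κ ^ 2) :
    Near (box κ x) (box κ p) := by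
  have h1 := (norm_sq_le_sqDist p x).trans h
  have h2 : ‖p - x‖ ≤ 2 * κ := by nlinarith [norm_nonneg (p - x)]
  rw [Prod.norm_def, max_le_iff] at h2
  exact ⟨floor_near hκ (m := 2) (by rw [abs_sub_comm]; exact_mod_cast h2.1),
    floor_near hκ (m := 2) (by rw [abs_sub_comm]; exact_mod_cast h2.2)⟩

theorem norm_le_of_near {κ : ℝ} (hκ : 0 < κ) {p x : ℝ × ℝ} (h : Near (box κ x) (box κ p)) :
    ‖x - p‖ ≤ 3 * κ := by
  have e1 := near_of_floor (a := x.1) (b := p.1) hκ (m := 2) h.1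
  have e2 := near_of_floor (a := x.2) (b := p.2) hκ (m := 2) h.2
  norm_num at e1 e2
  exact max_le e1 e2

/-- The part of `K` joined to the level set `D` in the red region. -/
def Clu (x : ι → ℝ × ℝ) (K D : Set (ℝ × ℝ)) (ω : ι → Bool × Bool) : Set (ℝ × ℝ) :=
  {p | ∃ d ∈ D, JoinedIn (RS x ω ∩ K) d p}

/-- The explored region. -/
def Expl (x : ι → ℝ × ℝ) (K D : Set (ℝ × ℝ)) (ω : ι → Bool × Bool) : Set (ℝ × ℝ) :=
  closure (Clu x K D ω) ∪ D

/-- Every point of `M` lies in a box with an active site. -/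
def Mesh (x : ι → ℝ × ℝ) (κ : ℝ) (M : Set (ℝ × ℝ)) (a : ι → Bool) : Prop :=
  ∀ p ∈ M, ∃ i, a i = true ∧ box κ (x i) = box κ p

/-- The revealed sites. -/
noncomputable def Rev [Fintype ι] (x : ι → ℝ × ℝ) (κ : ℝ) (K D : Set (ℝ × ℝ)) (ω : ι → Bool × Bool) :
    Finset ι :=
  if Mesh x κ (Expl x K D ω) (fun i => (ω i).1) then
    Finset.univ.filter fun i => ∃ p ∈ Expl x K D ω, Near (box κ (x i)) (box κ p)
  else Finset.univ

theorem clu_subset_expl (x : ι → ℝ × ℝ) (K D : Set (ℝ × ℝ)) (ω : ι → Bool × Bool) :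
    Clu x K D ω ⊆ Expl x K D ω := subset_closure.trans subset_union_left

theorem clu_path {x : ι → ℝ × ℝ} {K D : Set (ℝ × ℝ)} {ω : ι → Bool × Bool} {d : ℝ × ℝ} (hd : d ∈ D)
    {p : ℝ × ℝ} (γ : Path d p) (hγ : ∀ t, γ t ∈ RS x ω ∩ K) (t : unitInterval) : γ t ∈ Clu x K D ω := by
  refine ⟨d, hd, ?_⟩
  have := JoinedIn.ofLine (F := RS x ω ∩ K) (f := fun s : ℝ => γ.extend (s * t))
    (x := d) (y := γ t) (by fun_prop) (by simp) (by simp) (by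
      rintro _ ⟨s, -, rfl⟩
      exact hγ _)
  exact this

theorem mem_RS_iff_of_agree {x : ι → ℝ × ℝ} {κ : ℝ} (hκ : 0 < κ) {M : Set (ℝ × ℝ)} {ω ω' : ι → Bool × Bool}
    (hm : Mesh x κ M fun i => (ω i).1)
    (h : ∀ i, (∃ p ∈ M, Near (box κ (x i)) (box κ p)) → ω i = ω' i) {p : ℝ × ℝ} (hp : p ∈ M) :
    p ∈ RS x ω ↔ p ∈ RS x ω' := by
  refine RS_local (r := 2 * κ ^ 2)
    (fun i hi _ => ⟨i, rfl, (h i ⟨p, hp, near_of_sqDist hκ hi⟩).symm⟩)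
    (fun i hi _ => ⟨i, rfl, h i ⟨p, hp, near_of_sqDist hκ hi⟩⟩) ?_
  obtain ⟨i, hi, hb⟩ := hm p hp
  exact ⟨i, hi, sqDist_le_of_norm (norm_le_of_box_eq hκ hb.symm)⟩

theorem clu_eq_of_agree [Finite ι] {x : ι → ℝ × ℝ} {K D : Set (ℝ × ℝ)} {ω ω' : ι → Bool × Bool}
    (hU : ∀ p ∈ Expl x K D ω, p ∈ RS x ω ↔ p ∈ RS x ω') : Clu x K D ω' = Clu x K D ω := by
  apply Subset.antisymm
  · rintro p ⟨d, hd, γ, hγ⟩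
    have hγ' : ∀ s : ℝ, γ.extend s ∈ RS x ω' ∩ K := fun s => hγ _
    have hsub : Icc (0 : ℝ) 1 ⊆ {s | γ.extend s ∈ Clu x K D ω} := by
      have near : ∀ s : ℝ, γ.extend s ∈ Expl x K D ω → ∃ ε > 0, ∀ s', |s' - s| < ε →
          JoinedIn (RS x ω ∩ K) (γ.extend s') (γ.extend s) := by
        intro s hs
        have hsU : γ.extend s ∈ RS x ω := (hU _ hs).2 (hγ' s).1
        have : γ.extend ⁻¹' RS x ω ∈ nhds s :=
          γ.continuous_extend.continuousAt.preimage_mem_nhds ((isOpen_RS x ω).mem_nhds hsU)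
        obtain ⟨ε, hε, hb⟩ := Metric.mem_nhds_iff.1 this
        refine ⟨ε, hε, fun s' hs' => ?_⟩
        refine JoinedIn.ofLine (f := fun u : ℝ => γ.extend (s' + u * (s - s'))) (by fun_prop) (by simp)
          (by simp) ?_
        rintro _ ⟨u, hu, rfl⟩
        refine ⟨hb ?_, (hγ' _).2⟩
        rw [Metric.mem_ball, Real.dist_eq, show s' + u * (s - s') - s = (1 - u) * (s' - s) by ring,
          abs_mul, abs_of_nonneg (by linarith [hu.2])]
        nlinarith [abs_nonneg (s' - s), hu.1, hu.2]
      refine IsClosed.Icc_subset_of_forall_mem_nhdsWithin ?_ ?_ ?_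
      · refine isClosed_of_closure_subset fun s hs => ?_
        have hsI : s ∈ Icc (0 : ℝ) 1 :=
          closure_minimal inter_subset_right isClosed_Icc hs
        refine ⟨?_, hsI⟩
        have hcl : γ.extend s ∈ closure (Clu x K D ω) :=
          map_mem_closure γ.continuous_extend hs fun s' hs' => hs'.1
        obtain ⟨ε, hε, hj⟩ := near s (Or.inl hcl)
        obtain ⟨s', hs', hd'⟩ := Metric.mem_closure_iff.1 hs ε hε
        obtain ⟨d', hd'', hj'⟩ := hs'.1
        exact ⟨d', hd'', hj'.trans (hj s' (by rwa [dist_comm, Real.dist_eq] at hd'))⟩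
      · have : γ.extend 0 ∈ Expl x K D ω := Or.inr (by simpa using hd)
        obtain ⟨ε, hε, hj⟩ := near 0 this
        have h0 := hj 0 (by simpa using hε)
        rw [mem_ofPred_eq]
        exact ⟨γ.extend 0, by simpa using hd, h0⟩
      · rintro s ⟨hs, -⟩
        obtain ⟨ε, hε, hj⟩ := near s (clu_subset_expl _ _ _ _ hs)
        obtain ⟨d', hd', hj'⟩ := hs
        refine mem_nhdsWithin_of_mem_nhds (Metric.mem_nhds_iff.2 ⟨ε, hε, fun s' hs' => ?_⟩)
        exact ⟨d', hd', hj'.trans (hj s' (by rwa [Metric.mem_ball, Real.dist_eq] at hs')).symm⟩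
    have := hsub ⟨zero_le_one, le_rfl⟩
    simpa using this
  · rintro p ⟨d, hd, γ, hγ⟩
    refine ⟨d, hd, γ, fun t => ⟨(hU _ (clu_subset_expl _ _ _ _ (clu_path hd γ hγ t))).1 (hγ t).1, (hγ t).2⟩⟩

theorem joins_of_agree {x : ι → ℝ × ℝ} {K : Set (ℝ × ℝ)} {h : ℝ × ℝ → ℝ} (hh : Continuous h)
    {h₀ h₁ ρ : ℝ} (hρ₀ : h₀ ≤ ρ) (hρ₁ : ρ ≤ h₁) {ω ω' : ι → Bool × Bool}
    (hU : ∀ p ∈ Clu x K (K ∩ {p | h p = ρ}) ω, p ∈ RS x ω → p ∈ RS x ω')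
    (H : Joins (RS x ω ∩ K) h h₀ h₁) : Joins (RS x ω' ∩ K) h h₀ h₁ := by
  obtain ⟨p, r, hp, hr, γ, hγ⟩ := H
  have hc : Continuous fun t => h (γ t) := hh.comp γ.continuous
  obtain ⟨t₀, ht₀⟩ := mem_range_of_exists_le_of_exists_ge hc (c := ρ) ⟨0, by simpa using hp.trans hρ₀⟩
    ⟨1, by simpa using hρ₁.trans hr⟩
  refine ⟨p, r, hp, hr, γ, fun t => ⟨hU _ ⟨γ t₀, ⟨(hγ _).2, ht₀⟩, ?_⟩ (hγ t).1, (hγ t).2⟩⟩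
  refine JoinedIn.ofLine (f := fun u : ℝ => γ.extend (t₀ + u * (t - t₀))) (by fun_prop) (by simp)
    (by simp) ?_
  rintro _ ⟨u, hu, rfl⟩
  exact hγ _

/-- The indicator of a crossing by the red region. -/
noncomputable def crossInd (x : ι → ℝ × ℝ) (K : Set (ℝ × ℝ)) (h : ℝ × ℝ → ℝ) (h₀ h₁ : ℝ)
    (ω : ι → Bool × Bool) : ℝ := if Joins (RS x ω ∩ K) h h₀ h₁ then 1 else 0

theorem isStopping_rev [Fintype ι] (x : ι → ℝ × ℝ) {κ : ℝ} (hκ : 0 < κ) (K : Set (ℝ × ℝ))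
    {h : ℝ × ℝ → ℝ} (hh : Continuous h) {h₀ h₁ ρ : ℝ} (hρ₀ : h₀ ≤ ρ) (hρ₁ : ρ ≤ h₁) :
    IsStopping (Rev x κ K (K ∩ {p | h p = ρ})) (crossInd x K h h₀ h₁) := by
  intro ω ω' hag
  set D := K ∩ {p | h p = ρ}
  by_cases hm : Mesh x κ (Expl x K D ω) (fun i => (ω i).1)
  · have hag' : ∀ i, (∃ p ∈ Expl x K D ω, Near (box κ (x i)) (box κ p)) → ω i = ω' i := fun i hi => by
      refine hag i ?_
      rw [Rev, if_pos hm]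
      simpa using hi
    have hU : ∀ p ∈ Expl x K D ω, p ∈ RS x ω ↔ p ∈ RS x ω' := fun p hp =>
      mem_RS_iff_of_agree hκ hm hag' hp
    have hC := clu_eq_of_agree hU
    have hE : Expl x K D ω' = Expl x K D ω := by rw [Expl, hC, Expl]
    have hm' : Mesh x κ (Expl x K D ω') (fun i => (ω' i).1) := by
      rw [hE]
      intro p hp
      obtain ⟨i, hi, hb⟩ := hm p hp
      refine ⟨i, ?_, hb⟩
      change (ω' i).1 = true
      rw [← hag' i ⟨p, hp, by simp [Near, hb]⟩]
      exact hi
    refine ⟨by rw [Rev, Rev, if_pos hm, if_pos hm', hE], ?_⟩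
    have : Joins (RS x ω' ∩ K) h h₀ h₁ ↔ Joins (RS x ω ∩ K) h h₀ h₁ := by
      constructor
      · refine joins_of_agree hh hρ₀ hρ₁ fun p hp h => ?_
        rw [hC] at hp
        exact (hU p (clu_subset_expl _ _ _ _ hp)).2 h
      · refine joins_of_agree hh hρ₀ hρ₁ fun p hp h => ?_
        exact (hU p (clu_subset_expl _ _ _ _ hp)).1 h
    simp only [crossInd, this]
  · have : ω = ω' := funext fun i => hag i (by rw [Rev, if_neg hm]; exact Finset.mem_univ i)
    subst this
    exact ⟨rfl, rfl⟩

end Fields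

section Arms
set_option linter.unusedSectionVars false
variable {ι : Type*}

/-- The position of a lattice site. -/
noncomputable def pos (q : ℕ) (z : ℤ × ℤ) : ℝ × ℝ := ((z.1 : ℝ) / q, (z.2 : ℝ) / q)

/-- The point of the plane given by an integer vector. -/
def ipt (y : ℤ × ℤ) : ℝ × ℝ := ((y.1 : ℝ), (y.2 : ℝ))

/-- The site with position shifted by `y`. -/
def shift (q : ℕ) (y z : ℤ × ℤ) : ℤ × ℤ := (z.1 + q * y.1, z.2 + q * y.2)

theorem pos_shift {q : ℕ} (hq : 0 < q) (y z : ℤ × ℤ) : pos q (shift q y z) = pos q z + ipt y := by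
  have : (q : ℝ) ≠ 0 := by positivity
  ext <;> simp [pos, shift, ipt] <;> field_simp

theorem shift_injective (q : ℕ) (y : ℤ × ℤ) : Function.Injective (shift q y) := fun z z' h => by
  simp only [shift, Prod.mk.injEq, add_left_inj] at h
  exact Prod.ext h.1 h.2

theorem finite_pos_le {q : ℕ} (hq : 0 < q) (C : ℝ) : {z : ℤ × ℤ | ‖pos q z‖ ≤ C}.Finite := by
  have hq' : (0 : ℝ) < q := by exact_mod_cast hq
  set m : ℤ := ⌈C * q⌉
  refine (Set.finite_Icc (-m, -m) (m, m)).subset fun z hz => ?_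
  have hz : ‖pos q z‖ ≤ C := hz
  rw [Prod.norm_def, max_le_iff, Real.norm_eq_abs, Real.norm_eq_abs, pos, abs_div, abs_div,
    abs_of_pos hq', div_le_iff₀ hq', div_le_iff₀ hq', abs_le, abs_le] at hz
  have hm : C * q ≤ m := Int.le_ceil _
  have a1 : ((-m : ℤ) : ℝ) ≤ z.1 := by push_cast; linarith [hz.1.1]
  have a2 : (z.1 : ℝ) ≤ m := by linarith [hz.1.2]
  have a3 : ((-m : ℤ) : ℝ) ≤ z.2 := by push_cast; linarith [hz.2.1]
  have a4 : (z.2 : ℝ) ≤ m := by linarith [hz.2.2]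
  exact ⟨⟨by exact_mod_cast a1, by exact_mod_cast a3⟩, ⟨by exact_mod_cast a2, by exact_mod_cast a4⟩⟩

/-- The sites which may influence the annulus of scale `s`. -/
noncomputable def Win (q s : ℕ) : Finset (ℤ × ℤ) :=
  if hq : 0 < q then
    (finite_pos_le hq (5 / 2 * s)).toFinset.filter fun z => 7 / 10 * (s : ℝ) < ‖pos q z‖
  else ∅

theorem mem_Win {q s : ℕ} (hq : 0 < q) {z : ℤ × ℤ} :
    z ∈ Win q s ↔ 7 / 10 * (s : ℝ) < ‖pos q z‖ ∧ ‖pos q z‖ ≤ 5 / 2 * s := by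
  rw [Win, dif_pos hq, Finset.mem_filter, Finite.mem_toFinset, and_comm]
  rfl

/-- The annulus of scale `s`. -/
def Ann (s : ℝ) : Set (ℝ × ℝ) := {p | s ≤ ‖p‖ ∧ ‖p‖ ≤ 2 * s}

/-- Positions of the sites in a finite set. -/
noncomputable def wpos (q : ℕ) (W : Finset (ℤ × ℤ)) (z : W) : ℝ × ℝ := pos q z.1

/-- The red crossing of the annulus of scale `s`. -/
def WX (q s : ℕ) (ω : Win q s → Bool × Bool) : Prop :=
  Joins (RS (wpos q (Win q s)) ω ∩ Ann s) (fun p => ‖p‖) s (2 * s)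

theorem sqDist_sub (p x y : ℝ × ℝ) : sqDist (p - y) (x - y) = sqDist p x := by
  simp [sqDist]

theorem mem_RS_sub {x : ι → ℝ × ℝ} {ω : ι → Bool × Bool} {p y : ℝ × ℝ} :
    p - y ∈ RS (fun i => x i - y) ω ↔ p ∈ RS x ω := by
  simp only [RS, SR, mem_ofPred_eq, exists_mem_image, forall_mem_image, sqDist_sub]

theorem mem_window {q : ℕ} (hq : 0 < q) {W : Finset (ℤ × ℤ)} {s : ℕ} {y : ℤ × ℤ}
    (hW : ∀ z ∈ Win q s, shift q y z ∈ W) {κ : ℝ} (hκ : 0 < κ) (hs : 5 * κ ≤ s)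
    {ω : W → Bool × Bool} {p : ℝ × ℝ} (hp : p ∈ RS (wpos q W) ω)
    (hm : ∃ i, (ω i).1 = true ∧ box κ (wpos q W i) = box κ p)
    (hA : p - ipt y ∈ Ann s) :
    p - ipt y ∈ RS (wpos q (Win q s)) (fun z => ω ⟨shift q y z.1, hW z.1 z.2⟩) := by
  have hp' : p - ipt y ∈ RS (fun i => wpos q W i - ipt y) ω := mem_RS_sub.2 hp
  refine (RS_local (r := 2 * κ ^ 2) (fun i hi ha => ?_) (fun j hj ha => ?_) ?_).1 hp'
  · have h1 := (norm_sq_le_sqDist _ _).trans hi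
    have h2 : ‖p - ipt y - (wpos q W i - ipt y)‖ ≤ 71 / 50 * κ :=
      abs_le_of_sq_le_sq' (by nlinarith) (by positivity) |>.2
    have hz : shift q y (i.1.1 - q * y.1, i.1.2 - q * y.2) = i.1 := by simp [shift]
    have hpz : pos q (i.1.1 - q * y.1, i.1.2 - q * y.2) = wpos q W i - ipt y := by
      rw [eq_sub_iff_add_eq, ← pos_shift hq, hz]; rfl
    have hzW : ((i.1.1 - q * y.1, i.1.2 - q * y.2) : ℤ × ℤ) ∈ Win q s := by
      rw [mem_Win hq, hpz]
      have h3 := norm_le_norm_add_norm_sub (p - ipt y) (wpos q W i - ipt y)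
      have h4 := norm_le_norm_add_norm_sub (wpos q W i - ipt y) (p - ipt y)
      rw [norm_sub_rev _ (p - ipt y)] at h4
      have h5 := hA.1; have h6 := hA.2
      constructor <;> linarith
    refine ⟨⟨_, hzW⟩, hpz, ?_⟩
    congr 1
    exact Subtype.ext hz
  · refine ⟨⟨shift q y j.1, hW j.1 j.2⟩, ?_, rfl⟩
    simp only [wpos, pos_shift hq, add_sub_cancel_right]
  · obtain ⟨i, hi, hb⟩ := hm
    refine ⟨i, hi, ?_⟩
    rw [sqDist_sub]
    exact sqDist_le_of_norm (norm_le_of_box_eq hκ hb.symm)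

theorem window_of_path {q : ℕ} (hq : 0 < q) {W : Finset (ℤ × ℤ)} {s : ℕ} {y : ℤ × ℤ}
    (hW : ∀ z ∈ Win q s, shift q y z ∈ W) {κ : ℝ} (hκ : 0 < κ) (hs : 5 * κ ≤ s)
    {ω : W → Bool × Bool} {K : Set (ℝ × ℝ)} (hm : Mesh (wpos q W) κ K fun i => (ω i).1)
    {p p' : ℝ × ℝ} (hj : JoinedIn (RS (wpos q W) ω ∩ K) p p') (hp : ‖p - ipt y‖ ≤ s)
    (hp' : 2 * s ≤ ‖p' - ipt y‖) :
    WX q s (fun z => ω ⟨shift q y z.1, hW z.1 z.2⟩) := by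
  have hs0 : (0 : ℝ) ≤ s := Nat.cast_nonneg s
  obtain ⟨u, u', hu, hu', hj', -⟩ := joinedIn_exists_level hj (φ := fun p => ‖p - ipt y‖) (by fun_prop)
    (a := s) (b := 2 * s) (by linarith) hp hp'
  obtain ⟨γ, hγ⟩ := hj'
  refine ⟨u - ipt y, u' - ipt y, hu.le, hu'.ge, (γ.map (continuous_id.sub continuous_const)), fun t => ?_⟩
  have ht := hγ t
  have hA : γ t - ipt y ∈ Ann s := ht.2
  exact ⟨mem_window hq hW hκ hs ht.1.1 (hm _ ht.1.2) hA, hA⟩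

theorem expl_subset {x : ι → ℝ × ℝ} {K D : Set (ℝ × ℝ)} (hK : IsClosed K) (hD : D ⊆ K)
    (ω : ι → Bool × Bool) : Expl x K D ω ⊆ K := by
  refine union_subset (closure_minimal ?_ hK) hD
  rintro p ⟨d, hd, hj⟩
  exact hj.target_mem.2

theorem exists_of_mem_rev [Fintype ι] {x : ι → ℝ × ℝ} {κ : ℝ} {K D : Set (ℝ × ℝ)}
    (hK : IsClosed K) (hD : D ⊆ K) {ω : ι → Bool × Bool} (hm : Mesh x κ K fun i => (ω i).1) {i : ι}
    (hi : i ∈ Rev x κ K D ω) : ∃ p ∈ Expl x K D ω, Near (box κ (x i)) (box κ p) := by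
  have hm' : Mesh x κ (Expl x K D ω) fun i => (ω i).1 := fun p hp => hm p (expl_subset hK hD ω hp)
  rw [Rev, if_pos hm'] at hi
  simpa using hi

theorem arm {q : ℕ} (hq : 0 < q) {W : Finset (ℤ × ℤ)} {κ : ℝ} (hκ : 0 < κ) {K : Set (ℝ × ℝ)}
    (hK : IsClosed K) {h : ℝ × ℝ → ℝ} (hh : LipschitzWith 1 h) {R ρ : ℝ} {ω : W → Bool × Bool}
    (hm : Mesh (wpos q W) κ K fun i => (ω i).1) {i : W}
    (hi : i ∈ Rev (wpos q W) κ K (K ∩ {p | h p = ρ}) ω) (hfar : R < |h (wpos q W i) - ρ|)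
    {y : ℤ × ℤ} (hy : ‖wpos q W i - ipt y‖ ≤ 1) {s : ℕ} (hs : 5 * κ ≤ s) (hs1 : 4 * κ + 1 ≤ s)
    (hsR : 2 * s + 1 ≤ R) (hW : ∀ z ∈ Win q s, shift q y z ∈ W) :
    WX q s (fun z => ω ⟨shift q y z.1, hW z.1 z.2⟩) := by
  have hlip : ∀ p p', |h p - h p'| ≤ ‖p - p'‖ := fun p p' => by
    have := hh.dist_le_mul p p'
    rwa [Real.dist_eq, dist_eq_norm, NNReal.coe_one, one_mul] at this
  obtain ⟨p, hp, hn⟩ := exists_of_mem_rev hK inter_subset_left hm hi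
  have hnp := norm_le_of_near hκ hn
  obtain ⟨p', d, hd, hj, hpp⟩ : ∃ p' d, d ∈ K ∩ {p | h p = ρ} ∧
      JoinedIn (RS (wpos q W) ω ∩ K) d p' ∧ ‖wpos q W i - p'‖ ≤ 4 * κ := by
    rcases hp with hp | hp
    · obtain ⟨p', ⟨d, hd, hj⟩, hpp⟩ := Metric.mem_closure_iff.1 hp κ hκ
      refine ⟨p', d, hd, hj, ?_⟩
      rw [dist_eq_norm] at hpp
      linarith [norm_sub_le_norm_sub_add_norm_sub (wpos q W i) p p']
    · have : R < 3 * κ := by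
        have := hlip (wpos q W i) p
        rw [show h p = ρ from hp.2] at this
        linarith
      linarith
  refine window_of_path hq hW hκ hs hm hj.symm ?_ ?_
  · have := norm_sub_le_norm_sub_add_norm_sub p' (wpos q W i) (ipt y)
    rw [norm_sub_rev p' (wpos q W i)] at this
    linarith
  · have h1 := hlip (wpos q W i) d
    rw [show h d = ρ from hd.2] at h1
    have := norm_sub_le_norm_sub_add_norm_sub (wpos q W i) (ipt y) d
    rw [norm_sub_rev (ipt y) d] at this
    linarith

end Arms

section Indep
set_option linter.unusedSectionVars false
variable {ι α τ : Type*} [Fintype ι] [Fintype α] {w : α → ℝ}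

theorem Pro_comp (hw : IsWeight w) {κ : Type*} [Fintype κ] {e : κ → ι} (he : Function.Injective e)
    (A : Set (κ → α)) : Pro w {ω : ι → α | ω ∘ e ∈ A} = Pro w A :=
  Ex_comp hw he (A.indicator 1)

theorem Pro_prod_of_disjoint (hw : IsWeight w) {κ : τ → Type*} [∀ j, Fintype (κ j)] {e : ∀ j, κ j → ι}
    (he : ∀ j, Function.Injective (e j)) (hd : ∀ j k, j ≠ k → Disjoint (range (e j)) (range (e k)))
    (A : ∀ j, Set (κ j → α)) (T : Finset τ) :
    Pro w {ω : ι → α | ∀ j ∈ T, ω ∘ e j ∈ A j} = ∏ j ∈ T, Pro w (A j) := by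
  have h1 : ∀ j, Pro w (A j) = Ex w (fun ω : ι → α => (A j).indicator (1 : (κ j → α) → ℝ) (ω ∘ e j)) := fun j =>
    (Ex_comp hw (he j) _).symm
  simp only [h1]
  rw [← Ex_prod_of_dependsOn hw T (s := fun j => range (e j)) (fun j _ ω ω' h => ?_)
    fun j _ k _ hjk => hd j k hjk]
  · rw [Pro_eq_sum]
    congr 1; funext ω
    simp only [indicator_apply, Pi.one_apply, mem_ofPred_eq]
    rw [Finset.prod_ite_zero]
    simp
  · have : ω ∘ e j = ω' ∘ e j := funext fun k => h _ (mem_range_self k)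
    simp only [this]

theorem Pro_many_le (hw : IsWeight w) {J : ℕ} {κ : Fin J → Type*} [∀ j, Fintype (κ j)] {e : ∀ j, κ j → ι}
    (he : ∀ j, Function.Injective (e j)) (hd : ∀ j k, j ≠ k → Disjoint (range (e j)) (range (e k)))
    (A : ∀ j, Set (κ j → α)) {B : ℝ} (hB : 0 ≤ B) (hA : ∀ j, Pro w (A j) ≤ Real.exp (-B)) :
    Pro w {ω : ι → α | (J : ℝ) / 2 ≤ (Finset.univ.filter fun j => ω ∘ e j ∈ A j).card} ≤
      2 ^ J * Real.exp (-(B * J / 2)) := by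
  set Q := (Finset.univ : Finset (Finset (Fin J))).filter fun T => (J : ℝ) / 2 ≤ T.card
  have hsub : {ω : ι → α | (J : ℝ) / 2 ≤ (Finset.univ.filter fun j => ω ∘ e j ∈ A j).card} ⊆
      ⋃ T ∈ Q, {ω : ι → α | ∀ j ∈ T, ω ∘ e j ∈ A j} := fun ω hω => by
    refine mem_biUnion (x := Finset.univ.filter fun j => ω ∘ e j ∈ A j) (by simpa [Q] using hω) ?_
    intro j hj
    simpa using hj
  refine (Pro_mono hw hsub).trans ((Pro_biUnion_le hw _ _).trans ?_)
  calc _ ≤ ∑ T ∈ Q, Real.exp (-(B * J / 2)) := by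
        refine Finset.sum_le_sum fun T hT => ?_
        rw [Pro_prod_of_disjoint hw he hd]
        refine (Finset.prod_le_prod (fun j _ => Pro_nonneg hw _) fun j _ => hA j).trans ?_
        rw [Finset.prod_const, ← Real.exp_nat_mul, Real.exp_le_exp]
        have : (J : ℝ) / 2 ≤ T.card := (Finset.mem_filter.1 hT).2
        nlinarith
    _ ≤ _ := by
        rw [Finset.sum_const, nsmul_eq_mul]
        gcongr
        have : Q.card ≤ 2 ^ J := (Finset.card_filter_le _ _).trans (by simp)
        exact_mod_cast this

theorem Pro_forall (T : Finset ι) (hw : IsWeight w) (A : Set α) :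
    Pro w {ω : ι → α | ∀ i ∈ T, ω i ∈ A} = (∑ s, if s ∈ A then w s else 0) ^ T.card := by
  have h1 : ∀ i, Ex w (fun ω : ι → α => if ω i ∈ A then 1 else 0) = ∑ s, if s ∈ A then w s else 0 := fun i => by
    have := Ex_comp (w := w) hw (e := fun _ : Unit => i) (fun _ _ _ => rfl)
      (fun ω => if ω () ∈ A then 1 else 0)
    refine Eq.trans this ?_
    refine (Finset.sum_congr (by ext; simp) fun _ _ => rfl).trans
      (Fintype.sum_equiv (Equiv.funUnique Unit α) (fun ω => (∏ i, w (ω i)) * if ω () ∈ A then 1 else 0)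
        (fun s => if s ∈ A then w s else 0) fun ω => ?_)
    simp
  rw [Pro_eq_sum, ← Finset.prod_const, ← Finset.prod_congr rfl fun i _ => h1 i]
  refine Eq.trans ?_ (Ex_prod_of_dependsOn hw T (s := fun i => {i}) (fun j _ ω ω' h => by
    simp only [h j rfl]) fun j _ k _ hjk => by simpa using hjk)
  congr 1; funext ω
  rw [Finset.prod_ite_zero]
  simp

end Indep

section MeshProb

/-- The probability that a site is active. -/
noncomputable def act (q : ℕ) : ℝ := 1 / (q : ℝ) ^ 2

theorem act_nonneg (q : ℕ) : 0 ≤ act q := by unfold act; positivity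

theorem act_le_one {q : ℕ} (hq : 0 < q) : act q ≤ 1 := by
  have : (1 : ℝ) ≤ q := by exact_mod_cast hq
  rw [act, div_le_one (by positivity)]
  nlinarith

theorem Pro_empty_box_le {q : ℕ} (hq : 0 < q) {W : Finset (ℤ × ℤ)} {k : ℕ} (hk : 0 < k) (b : ℤ × ℤ)
    (hW : ∀ z, box k (pos q z) = b → z ∈ W) :
    Pro (bw (act q)) {a : W → Bool | ∀ i, box k (wpos q W i) = b → a i = false} ≤
      Real.exp (-(k : ℝ) ^ 2) := by
  have hw := isWeight_bw (act_nonneg q) (act_le_one hq)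
  have hq' : (0 : ℝ) < q := by exact_mod_cast hq
  have hk' : (0 : ℝ) < k := by exact_mod_cast hk
  have hfl : ∀ (c : ℤ) (u : Fin (k * q)), ⌊((c * (k * q) + (u : ℕ) : ℤ) : ℝ) / q / k⌋ = c := fun c u => by
    rw [Int.floor_eq_iff]
    have hu : ((u : ℕ) : ℝ) < k * q := by exact_mod_cast u.2
    push_cast
    have : (c * (k * q) + (u : ℕ) : ℝ) / q / k = c + (u : ℕ) / (k * q) := by field_simp
    rw [this]
    have h1 : ((u : ℕ) : ℝ) / (k * q) < 1 := by rw [div_lt_one (by positivity)]; exact hu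
    have h2 : 0 ≤ ((u : ℕ) : ℝ) / (k * q) := by positivity
    constructor <;> linarith
  set g : Fin (k * q) × Fin (k * q) → ℤ × ℤ := fun u =>
    (b.1 * (k * q) + (u.1 : ℕ), b.2 * (k * q) + (u.2 : ℕ)) with hg
  have hgb : ∀ u, box k (pos q (g u)) = b := fun u => Prod.ext (hfl b.1 u.1) (hfl b.2 u.2)
  have hgi : Function.Injective g := fun u v h => by
    simp only [hg, Prod.mk.injEq, add_right_inj, Nat.cast_inj] at h
    exact Prod.ext (Fin.ext h.1) (Fin.ext h.2)
  set T : Finset W := Finset.univ.image fun u => (⟨g u, hW _ (hgb u)⟩ : W)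
  have hT : T.card = (k * q) ^ 2 := by
    rw [Finset.card_image_of_injective _ fun u v h => hgi (Subtype.ext_iff.1 h), Finset.card_univ]
    simp [sq]
  calc _ ≤ Pro (bw (act q)) {a : W → Bool | ∀ i ∈ T, a i ∈ ({false} : Set Bool)} := by
        refine Pro_mono hw fun a ha i hi => ?_
        obtain ⟨u, -, rfl⟩ := Finset.mem_image.1 hi
        exact ha _ (hgb u)
    _ = (1 - act q) ^ (k * q) ^ 2 := by
        rw [Pro_forall T hw, hT]
        simp [bw]
    _ ≤ Real.exp (-act q) ^ (k * q) ^ 2 := by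
        gcongr
        · linarith [act_le_one hq]
        · exact Real.one_sub_le_exp_neg _
    _ = _ := by
        rw [← Real.exp_nat_mul, act]
        congr 1
        push_cast
        field_simp

theorem Pro_not_mesh_le {q : ℕ} (hq : 0 < q) {W : Finset (ℤ × ℤ)} {k : ℕ} (hk : 0 < k) {K : Set (ℝ × ℝ)}
    {X : ℕ} (hX : ∀ p ∈ K, ‖p‖ ≤ X) (hW : ∀ z, (∃ p ∈ K, ‖pos q z - p‖ ≤ k) → z ∈ W) :
    Pro (bw (act q)) {a : W → Bool | ¬ Mesh (wpos q W) k K a} ≤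
      (2 * X + 3) ^ 2 * Real.exp (-(k : ℝ) ^ 2) := by
  have hw := isWeight_bw (act_nonneg q) (act_le_one hq)
  have hk' : (1 : ℝ) ≤ k := by exact_mod_cast hk
  set Q : Finset (ℤ × ℤ) := (Finset.Icc (-(X + 1 : ℤ)) (X + 1) ×ˢ Finset.Icc (-(X + 1 : ℤ)) (X + 1)).filter
    fun b => ∃ p ∈ K, box k p = b with hQ
  have hfl : ∀ x : ℝ, |x| ≤ X → ⌊x / k⌋ ∈ Finset.Icc (-(X + 1 : ℤ)) (X + 1) := fun x hx => by
    have h1 : |x / k| ≤ X := by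
      rw [abs_div, Nat.abs_cast]
      exact (div_le_self (abs_nonneg _) hk').trans hx
    rw [abs_le] at h1
    rw [Finset.mem_Icc]
    constructor
    · rw [Int.le_floor]; push_cast; linarith
    · have := Int.floor_le (x / k)
      have : (⌊x / k⌋ : ℝ) ≤ ((X + 1 : ℤ) : ℝ) := by push_cast; linarith
      exact_mod_cast this
  have hQc : (Q.card : ℝ) ≤ (2 * X + 3) ^ 2 := by
    have : Q.card ≤ (2 * X + 3) ^ 2 := by
      refine (Finset.card_filter_le _ _).trans (le_of_eq ?_)
      rw [Finset.card_product, Int.card_Icc, sq]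
      congr 1 <;> omega
    exact_mod_cast this
  have hsub : {a : W → Bool | ¬ Mesh (wpos q W) k K a} ⊆
      ⋃ b ∈ Q, {a : W → Bool | ∀ i, box k (wpos q W i) = b → a i = false} := fun a ha => by
    simp only [Mesh, mem_ofPred_eq] at ha
    push Not at ha
    obtain ⟨p, hp, h⟩ := ha
    have hpX := hX p hp
    rw [Prod.norm_def, max_le_iff, Real.norm_eq_abs, Real.norm_eq_abs] at hpX
    refine mem_biUnion (x := box k p) ?_ fun i hi => ?_
    · exact Finset.mem_coe.2 (Finset.mem_filter.2
        ⟨Finset.mem_product.2 ⟨hfl _ hpX.1, hfl _ hpX.2⟩, p, hp, rfl⟩)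
    · by_contra hai
      exact h i (by simpa using hai) hi
  refine (Pro_mono hw hsub).trans ((Pro_biUnion_le hw _ _).trans ?_)
  calc _ ≤ ∑ b ∈ Q, Real.exp (-(k : ℝ) ^ 2) := by
        refine Finset.sum_le_sum fun b hb => Pro_empty_box_le hq hk b fun z hz => hW z ?_
        obtain ⟨p, hp, rfl⟩ := (Finset.mem_filter.1 hb).2
        exact ⟨p, hp, norm_le_of_box_eq (by linarith) hz⟩
    _ ≤ _ := by
        rw [Finset.sum_const, nsmul_eq_mul]
        gcongr

end MeshProb

section Influence
set_option linter.unusedSectionVars false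
variable {ι : Type*} [Fintype ι]

theorem RS_mono {x : ι → ℝ × ℝ} {ω ω' : ι → Bool × Bool} (h1 : ∀ i, ω i = (true, true) → ω' i = (true, true))
    (h2 : ∀ i, ω' i = (true, false) → ω i = (true, false)) : RS x ω ⊆ RS x ω' :=
  SR_mono (image_mono h1) (image_mono h2)

theorem crossInd_mono {x : ι → ℝ × ℝ} {K : Set (ℝ × ℝ)} {h : ℝ × ℝ → ℝ} {h₀ h₁ : ℝ}
    {ω ω' : ι → Bool × Bool} (h1 : ∀ i, ω i = (true, true) → ω' i = (true, true))
    (h2 : ∀ i, ω' i = (true, false) → ω i = (true, false)) :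
    crossInd x K h h₀ h₁ ω ≤ crossInd x K h h₀ h₁ ω' := by
  unfold crossInd
  split_ifs with a b
  · exact le_rfl
  · exact absurd (a.mono (inter_subset_inter_left _ (RS_mono h1 h2))) b
  · exact zero_le_one
  · exact le_rfl

theorem crossInd_nonneg (x : ι → ℝ × ℝ) (K : Set (ℝ × ℝ)) (h : ℝ × ℝ → ℝ) (h₀ h₁ : ℝ)
    (ω : ι → Bool × Bool) : 0 ≤ crossInd x K h h₀ h₁ ω := by
  unfold crossInd; split_ifs <;> norm_num

theorem crossInd_le_one (x : ι → ℝ × ℝ) (K : Set (ℝ × ℝ)) (h : ℝ × ℝ → ℝ) (h₀ h₁ : ℝ)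
    (ω : ι → Bool × Bool) : crossInd x K h h₀ h₁ ω ≤ 1 := by
  unfold crossInd; split_ifs <;> norm_num

theorem isWeight_half : IsWeight (bw (1 / 2)) := isWeight_bw (by norm_num) (by norm_num)

/-- The conditional probability of a red crossing given the activities. -/
noncomputable def qcp (x : ι → ℝ × ℝ) (K : Set (ℝ × ℝ)) (h : ℝ × ℝ → ℝ) (h₀ h₁ : ℝ) (a : ι → Bool) : ℝ :=
  Ex (bw (1 / 2)) fun c : ι → Bool => crossInd x K h h₀ h₁ fun i => (a i, c i)

/-- The conditional influence of a site given the activities. -/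
noncomputable def qinf (x : ι → ℝ × ℝ) (K : Set (ℝ × ℝ)) (h : ℝ × ℝ → ℝ) (h₀ h₁ : ℝ) (i : ι) (a : ι → Bool) : ℝ :=
  |Ex (bw (1 / 2)) fun c : ι → Bool => crossInd x K h h₀ h₁ (fun j => (a j, c j)) * sgn (c i)|

variable (x : ι → ℝ × ℝ) (K : Set (ℝ × ℝ)) (h : ℝ × ℝ → ℝ) (h₀ h₁ : ℝ)

theorem qcp_nonneg (a : ι → Bool) : 0 ≤ qcp x K h h₀ h₁ a :=
  Ex_nonneg isWeight_half fun _ => crossInd_nonneg ..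

theorem qcp_le_one (a : ι → Bool) : qcp x K h h₀ h₁ a ≤ 1 :=
  Ex_le_of_le isWeight_half fun _ => crossInd_le_one ..

theorem qinf_sq_sum_le (a : ι → Bool) : ∑ i, qinf x K h h₀ h₁ i a ^ 2 ≤ 1 := by
  simp only [qinf, sq_abs]
  exact sum_sq_le_one (fun _ => crossInd_nonneg ..) fun _ => crossInd_le_one ..

theorem abs_sub_le_qinf (i : ι) (a : ι → Bool) :
    |qcp x K h h₀ h₁ a - qcp x K h h₀ h₁ (Function.update a i false)| ≤ qinf x K h h₀ h₁ i a := by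
  have hw := isWeight_half
  set H : (ι → Bool) → ℝ := fun c => crossInd x K h h₀ h₁ fun j => (a j, c j)
  set H' : (ι → Bool) → ℝ := fun c => crossInd x K h h₀ h₁ fun j => (Function.update a i false j, c j)
  by_cases ha : a i = true
  · have e1 : ∀ c s, H' (Function.update c i s) ≤ H (Function.update c i true) := fun c s => by
      refine crossInd_mono (fun j hj => ?_) fun j hj => ?_ <;> by_cases hji : j = i
      · subst hji; simp at hj
      · simpa [Function.update_of_ne hji] using hj
      · subst hji; simp at hj
      · simpa [Function.update_of_ne hji] using hj
    have e0 : ∀ c s, H (Function.update c i false) ≤ H' (Function.update c i s) := fun c s => by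
      refine crossInd_mono (fun j hj => ?_) fun j hj => ?_ <;> by_cases hji : j = i
      · subst hji; simp at hj
      · simpa [Function.update_of_ne hji] using hj
      · subst hji; simp at hj
      · simpa [Function.update_of_ne hji] using hj
    have hav : Ex (bw (1 / 2)) (fun c => H c * sgn (c i)) =
        Ex (bw (1 / 2)) fun c => (H (Function.update c i true) - H (Function.update c i false)) / 2 := by
      rw [← Ex_avg hw i]
      congr 1; funext c
      rw [avg_bw]
      simp [sgn]
      ring
    have hdiff : qcp x K h h₀ h₁ a - qcp x K h h₀ h₁ (Function.update a i false) =
        Ex (bw (1 / 2)) fun c => (H (Function.update c i true) + H (Function.update c i false)) / 2 -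
          (H' (Function.update c i true) + H' (Function.update c i false)) / 2 := by
      rw [Ex_sub]
      congr 1
      · rw [qcp, ← Ex_avg hw i]
        congr 1; funext c
        rw [avg_bw]; ring
      · rw [qcp, ← Ex_avg hw i]
        congr 1; funext c
        rw [avg_bw]; ring
    rw [hdiff]
    refine le_trans ?_ (le_abs_self _)
    change _ ≤ Ex (bw (1 / 2)) (fun c => H c * sgn (c i))
    rw [hav, abs_le]
    constructor
    · have e := Ex_const_mul (ι := ι) (w := bw (1 / 2)) (-1)
        fun c => (H (Function.update c i true) - H (Function.update c i false)) / 2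
      rw [← neg_one_mul, ← e]
      refine Ex_mono hw fun c => ?_
      linarith [e1 c true, e1 c false, e0 c true, e0 c false]
    · refine Ex_mono hw fun c => ?_
      linarith [e1 c true, e1 c false, e0 c true, e0 c false]
  · have : Function.update a i false = a := by
      have ha' : a i = false := by simpa using ha
      rw [← ha', Function.update_eq_self]
    rw [this, sub_self, abs_zero]
    exact abs_nonneg _

theorem energy_qcp_le {p : ℝ} (hp0 : 0 ≤ p) (hp1 : p ≤ 1) :
    ∑ i, Ex (bw p) (fun a => (qcp x K h h₀ h₁ a - avg (bw p) i (qcp x K h h₀ h₁) a) ^ 2) ≤ 1 := by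
  refine (Finset.sum_le_sum fun i _ => energy_le hp0 hp1 _ i).trans ?_
  rw [← Ex_sum]
  refine Ex_le_of_le (isWeight_bw hp0 hp1) fun a => ?_
  refine (Finset.sum_le_sum fun i _ => ?_).trans (qinf_sq_sum_le x K h h₀ h₁ a)
  rw [← sq_abs]
  exact pow_le_pow_left₀ (abs_nonneg _) (abs_sub_le_qinf ..) 2

end Influence

section Region
set_option linter.unusedSectionVars false

/-- The scales of the windows used around a site. -/
def sc (k j : ℕ) : ℕ := 16 * k * 4 ^ j

/-- The data of a crossing problem in a region with a margin. -/
structure Region (q k J m X : ℕ) (W : Finset (ℤ × ℤ)) (K : Set (ℝ × ℝ)) (h : ℝ × ℝ → ℝ) (h₀ h₁ : ℝ) : Prop where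
  q_pos : 0 < q
  k_pos : 0 < k
  m_pos : 0 < m
  closed : IsClosed K
  bound : ∀ p ∈ K, ‖p‖ ≤ X
  lip : LipschitzWith 1 h
  levels : h₀ + m * (2 * sc k J + 1) ≤ h₁
  margin : ∀ z, (∃ p ∈ K, ‖pos q z - p‖ ≤ 3 * sc k J) → z ∈ W

variable {q k J m X : ℕ} {W : Finset (ℤ × ℤ)} {K : Set (ℝ × ℝ)} {h : ℝ × ℝ → ℝ} {h₀ h₁ : ℝ}

/-- A centre close to `K`. -/
def Centre (k : ℕ) (K : Set (ℝ × ℝ)) (y : ℤ × ℤ) : Prop := ∃ p ∈ K, ‖ipt y - p‖ ≤ 3 * k + 1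

theorem sc_le (k : ℕ) {i j : ℕ} (h : i < j) : 4 * sc k i ≤ sc k j := by
  unfold sc
  have : 4 ^ (i + 1) ≤ 4 ^ j := Nat.pow_le_pow_right (by norm_num) h
  rw [pow_succ] at this
  nlinarith

theorem le_sc (k j : ℕ) : 16 * k ≤ sc k j := by
  unfold sc
  exact Nat.le_mul_of_pos_right _ (by positivity)

theorem Region.window (H : Region q k J m X W K h h₀ h₁) {y : ℤ × ℤ} (hy : Centre k K y) (j : Fin J) :
    ∀ z ∈ Win q (sc k j), shift q y z ∈ W := fun z hz => by
  obtain ⟨p, hp, hyp⟩ := hy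
  refine H.margin _ ⟨p, hp, ?_⟩
  rw [pos_shift H.q_pos]
  have h1 := ((mem_Win H.q_pos).1 hz).2
  have h2 : (4 * sc k j : ℝ) ≤ sc k J := by exact_mod_cast sc_le k j.2
  have h3 : (16 * k : ℝ) ≤ sc k J := by exact_mod_cast le_sc k J
  have h4 : (1 : ℝ) ≤ k := by exact_mod_cast H.k_pos
  have := norm_add_le (pos q z) (ipt y - p)
  rw [← add_sub_assoc] at this
  linarith

/-- The embedding of a window into a region. -/
def Region.emb (H : Region q k J m X W K h h₀ h₁) {y : ℤ × ℤ} (hy : Centre k K y) (j : Fin J)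
    (z : Win q (sc k j)) : W := ⟨shift q y z.1, H.window hy j z.1 z.2⟩

theorem Region.emb_injective (H : Region q k J m X W K h h₀ h₁) {y : ℤ × ℤ} (hy : Centre k K y) (j : Fin J) :
    Function.Injective (H.emb hy j) := fun _ _ h =>
  Subtype.ext (shift_injective q y (Subtype.ext_iff.1 h))

theorem win_disjoint {q s s' : ℕ} (hq : 0 < q) (h : 4 * s ≤ s') {z : ℤ × ℤ} (hz : z ∈ Win q s) :
    z ∉ Win q s' := fun hz' => by
  have h1 := ((mem_Win hq).1 hz).2
  have h2 := ((mem_Win hq).1 hz').1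
  have : (4 * s : ℝ) ≤ s' := by exact_mod_cast h
  have : (0 : ℝ) ≤ s := Nat.cast_nonneg s
  linarith

theorem Region.emb_disjoint (H : Region q k J m X W K h h₀ h₁) {y : ℤ × ℤ} (hy : Centre k K y)
    (j j' : Fin J) (hj : j ≠ j') : Disjoint (range (H.emb hy j)) (range (H.emb hy j')) := by
  rw [Set.disjoint_left]
  rintro _ ⟨z, rfl⟩ ⟨z', hz'⟩
  have : z'.1 = z.1 := shift_injective q y (Subtype.ext_iff.1 hz')
  rcases lt_or_gt_of_ne hj with h | h
  · exact win_disjoint H.q_pos (sc_le k h) z.2 (this ▸ z'.2)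
  · exact win_disjoint H.q_pos (sc_le k h) z'.2 (this.symm ▸ z.2)

/-- The conditional probability of a window crossing. -/
noncomputable def fw (q s : ℕ) : (Win q s → Bool) → ℝ :=
  qcp (wpos q (Win q s)) (Ann s) (fun p => ‖p‖) s (2 * s)

theorem fw_eq (q s : ℕ) (a : Win q s → Bool) :
    fw q s a = Pro (bw (1 / 2)) {c | WX q s fun z => (a z, c z)} := by
  rw [Pro_eq_sum]
  rfl

theorem exists_centre {q : ℕ} (z : ℤ × ℤ) : ∃ y, ‖pos q z - ipt y‖ ≤ 1 := by
  refine ⟨(⌊(pos q z).1⌋, ⌊(pos q z).2⌋), max_le ?_ ?_⟩ <;>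
  · simp only [ipt, Prod.fst_sub, Prod.snd_sub, Real.norm_eq_abs]
    exact (abs_of_nonneg (Int.fract_nonneg _)).trans_le (Int.fract_lt_one _).le

theorem Region.sum_rev_le (H : Region q k J m X W K h h₀ h₁) {α : Type*} [Fintype α] {v : α → ℝ}
    (hv : IsWeight v) (φ : (W → α) → W → Bool × Bool) {β₁ β₂ : ℝ}
    (h1 : Pro v {c | ¬ Mesh (wpos q W) k K fun i => (φ c i).1} ≤ β₁) (hβ : 0 ≤ β₂)
    (h2 : ∀ y (hy : Centre k K y), Pro v {c | ∀ j : Fin J, WX q (sc k j) (φ c ∘ H.emb hy j)} ≤ β₂) (i : W) :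
    ∑ l ∈ Finset.range m, Pro v {c | i ∈ Rev (wpos q W) k K
      (K ∩ {p | h p = h₀ + l * (2 * sc k J + 1)}) (φ c)} ≤ 1 + m * (β₁ + β₂) := by
  have hk0 : (0 : ℝ) < k := by exact_mod_cast H.k_pos
  have hk1 : (1 : ℝ) ≤ k := by exact_mod_cast H.k_pos
  have hβ1 : 0 ≤ β₁ := (Pro_nonneg hv _).trans h1
  set r : ℕ → ℝ := fun l => h₀ + l * (2 * sc k J + 1)
  have key : ∀ l, ¬ |h (wpos q W i) - r l| ≤ sc k J →
      Pro v {c | i ∈ Rev (wpos q W) k K (K ∩ {p | h p = r l}) (φ c)} ≤ β₁ + β₂ := by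
    intro l hl
    by_cases hp : ∃ p ∈ K, ‖wpos q W i - p‖ ≤ 3 * k
    · obtain ⟨y, hy⟩ := exists_centre (q := q) i.1
      obtain ⟨p, hp, hip⟩ := hp
      have hyc : Centre k K y := ⟨p, hp, by
        have := norm_sub_le_norm_sub_add_norm_sub (ipt y) (pos q i.1) p
        rw [norm_sub_rev (ipt y) (pos q i.1)] at this
        have : ‖pos q i.1 - p‖ ≤ 3 * k := hip
        linarith⟩
      refine (Pro_mono hv ?_).trans ((Pro_union_le hv _ _).trans (add_le_add h1 (h2 y hyc)))
      intro c hc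
      by_cases hm : Mesh (wpos q W) k K fun i => (φ c i).1
      · refine Or.inr fun j => ?_
        have a1 : (16 * k : ℝ) ≤ sc k j := by exact_mod_cast le_sc k j
        have a2 : (4 * sc k j : ℝ) ≤ sc k J := by exact_mod_cast sc_le k j.2
        exact arm H.q_pos hk0 H.closed H.lip hm hc (not_le.1 hl) hy (by linarith) (by linarith)
          (by linarith) (H.window hyc j)
      · exact Or.inl hm
    · refine (Pro_mono hv fun c hc => ?_).trans (h1.trans (by linarith))
      intro hm
      obtain ⟨p, hp', hn⟩ := exists_of_mem_rev H.closed inter_subset_left hm hc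
      exact hp ⟨p, expl_subset H.closed inter_subset_left _ hp', norm_le_of_near hk0 hn⟩
  rw [← Finset.sum_filter_add_sum_filter_not _ fun l => |h (wpos q W i) - r l| ≤ sc k J]
  refine add_le_add ?_ ?_
  · have hc : ((Finset.range m).filter fun l => |h (wpos q W i) - r l| ≤ sc k J).card ≤ 1 := by
      rw [Finset.card_le_one]
      have : ∀ l l' : ℕ, |h (wpos q W i) - r l| ≤ sc k J → |h (wpos q W i) - r l'| ≤ sc k J → ¬ l < l' := by
        intro l l' hl hl' hlt
        have h3 : (l : ℝ) + 1 ≤ l' := by exact_mod_cast hlt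
        rw [abs_le] at hl hl'
        have h4 : (0 : ℝ) ≤ sc k J := Nat.cast_nonneg _
        simp only [r] at hl hl'
        nlinarith
      intro l hl l' hl'
      rw [Finset.mem_filter] at hl hl'
      exact le_antisymm (not_lt.1 (this l' l hl'.2 hl.2)) (not_lt.1 (this l l' hl.2 hl'.2))
    refine (Finset.sum_le_sum fun l _ => Pro_le_one hv _).trans ?_
    rw [Finset.sum_const, nsmul_eq_mul, mul_one]
    exact_mod_cast hc
  · refine (Finset.sum_le_sum fun l hl => key l (Finset.mem_filter.1 hl).2).trans ?_
    rw [Finset.sum_const, nsmul_eq_mul]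
    have : ((Finset.range m).filter fun l => ¬ |h (wpos q W i) - r l| ≤ sc k J).card ≤ m :=
      (Finset.card_filter_le _ _).trans (by simp)
    gcongr

theorem Region.isStopping (H : Region q k J m X W K h h₀ h₁) {l : ℕ} (hl : l ∈ Finset.range m) :
    IsStopping (Rev (wpos q W) k K (K ∩ {p | h p = h₀ + l * (2 * sc k J + 1)}))
      (crossInd (wpos q W) K h h₀ h₁) := by
  have h1 : (l : ℝ) ≤ m := by exact_mod_cast (Finset.mem_range.1 hl).le
  have h2 := H.levels
  have h3 : (0 : ℝ) ≤ 2 * sc k J + 1 := by positivity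
  refine isStopping_rev _ (by exact_mod_cast H.k_pos) K H.lip.continuous ?_ ?_
  · exact le_add_of_nonneg_right (by positivity)
  · nlinarith

end Region

section Tail
set_option linter.unusedSectionVars false
variable {q k J m X : ℕ} {W : Finset (ℤ × ℤ)} {K : Set (ℝ × ℝ)} {h : ℝ × ℝ → ℝ} {h₀ h₁ : ℝ}

theorem Region.mesh_le (H : Region q k J m X W K h h₀ h₁) :
    Pro (bw (act q)) {a | ¬ Mesh (wpos q W) k K a} ≤ (2 * X + 3) ^ 2 * Real.exp (-(k : ℝ) ^ 2) := by
  refine Pro_not_mesh_le H.q_pos H.k_pos H.bound fun z hz => ?_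
  obtain ⟨p, hp, hz⟩ := hz
  refine H.margin z ⟨p, hp, hz.trans ?_⟩
  have : (16 * k : ℝ) ≤ sc k J := by exact_mod_cast le_sc k J
  have : (0 : ℝ) ≤ k := Nat.cast_nonneg k
  linarith

/-- The integer points in a box. -/
noncomputable def centres (X k : ℕ) : Finset (ℤ × ℤ) :=
  Finset.Icc (-(X + 3 * k + 1 : ℤ)) (X + 3 * k + 1) ×ˢ Finset.Icc (-(X + 3 * k + 1 : ℤ)) (X + 3 * k + 1)

theorem card_centres (X k : ℕ) : ((centres X k).card : ℝ) = (2 * X + 6 * k + 3) ^ 2 := by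
  unfold centres
  rw [Finset.card_product, Int.card_Icc]
  have : (X + 3 * k + 1 + 1 - -(X + 3 * k + 1 : ℤ)).toNat = 2 * X + 6 * k + 3 := by omega
  rw [this]; push_cast; ring

theorem mem_centres (hb : ∀ p ∈ K, ‖p‖ ≤ X) {y : ℤ × ℤ} (hy : Centre k K y) : y ∈ centres X k := by
  obtain ⟨p, hp, h⟩ := hy
  have h1 : ‖ipt y‖ ≤ X + 3 * k + 1 := by
    have := norm_le_norm_add_norm_sub' (ipt y) p
    linarith [hb p hp]
  have h2 := (norm_fst_le _).trans h1
  have h3 := (norm_snd_le _).trans h1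
  simp only [ipt, Real.norm_eq_abs, abs_le] at h2 h3
  unfold centres
  rw [Finset.mem_product, Finset.mem_Icc, Finset.mem_Icc]
  refine ⟨⟨?_, ?_⟩, ?_, ?_⟩
  · exact_mod_cast h2.1
  · exact_mod_cast h2.2
  · exact_mod_cast h3.1
  · exact_mod_cast h3.2

theorem Region.qinf_sq_sum_le (H : Region q k J m X W K h h₀ h₁) {a : W → Bool} (hm : Mesh (wpos q W) k K a)
    {β : ℝ} (hβ : 0 ≤ β)
    (h2 : ∀ y (hy : Centre k K y), ∏ j : Fin J, fw q (sc k j) (a ∘ H.emb hy j) ≤ β) :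
    ∑ i, qinf (wpos q W) K h h₀ h₁ i a ^ 2 ≤ 1 / m + β := by
  have hm0 : (0 : ℝ) < m := by exact_mod_cast H.m_pos
  simp only [qinf, sq_abs]
  refine sum_sq_le_of_isStopping (fun _ => crossInd_nonneg ..) (fun _ => crossInd_le_one ..)
    (Q := Finset.range m) (Finset.nonempty_range_iff.2 H.m_pos.ne')
    (S := fun l c => Rev (wpos q W) k K (K ∩ {p | h p = h₀ + l * (2 * sc k J + 1)}) fun i => (a i, c i))
    (fun l hl c c' hc => ?_) (by positivity) fun i => ?_
  · exact H.isStopping hl _ _ fun i hi => Prod.ext rfl (hc i hi)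
  · have := H.sum_rev_le isWeight_half (fun c i => (a i, c i)) (β₁ := 0) (β₂ := β) ?_ hβ (fun y hy => ?_) i
    · refine this.trans_eq ?_
      rw [Finset.card_range]
      field_simp
      ring
    · have e : {c : W → Bool | ¬ Mesh (wpos q W) k K fun i => ((a i, c i) : Bool × Bool).1} = ∅ := by
        ext c; simpa using hm
      rw [e, Pro_eq_sum]
      simp [Ex]
    · refine le_trans (le_of_eq ?_) (h2 y hy)
      have := Pro_prod_of_disjoint isWeight_half (H.emb_injective hy) (H.emb_disjoint hy)
        (fun j => {c' | WX q (sc k j) fun z => (a (H.emb hy j z), c' z)}) Finset.univ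
      simp only [Finset.mem_univ, true_imp_iff] at this
      simp only [fw_eq]
      exact this

/-- The configurations around a centre with many crossings that are likely. -/
def badAt (H : Region q k J m X W K h h₀ h₁) (c : ℝ) (y : ℤ × ℤ) : Set (W → Bool) :=
  {a | ∃ hy : Centre k K y, (J : ℝ) / 2 ≤
    (Finset.univ.filter fun j : Fin J => a ∘ H.emb hy j ∈ {a' | 1 - c < fw q (sc k j) a'}).card}

theorem Region.prod_fw_le (H : Region q k J m X W K h h₀ h₁) {c : ℝ} (hc : 0 ≤ c) {a : W → Bool} {y : ℤ × ℤ}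
    (hy : Centre k K y) (ha : a ∉ badAt H c y) :
    ∏ j : Fin J, fw q (sc k j) (a ∘ H.emb hy j) ≤ Real.exp (-(c * J / 2)) := by
  set G := Finset.univ.filter fun j : Fin J => a ∘ H.emb hy j ∈ {a' | 1 - c < fw q (sc k j) a'}
  have hG : (G.card : ℝ) < J / 2 := by
    by_contra hh
    exact ha ⟨hy, not_lt.1 hh⟩
  have hcard : ((Gᶜ).card : ℝ) = J - G.card := by
    have := Finset.card_add_card_compl G
    rw [Fintype.card_fin] at this
    have : (G.card : ℝ) + (Gᶜ).card = J := by exact_mod_cast this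
    linarith
  rw [← Finset.prod_mul_prod_compl G]
  have p1 : ∏ j ∈ G, fw q (sc k j) (a ∘ H.emb hy j) ≤ 1 :=
    Finset.prod_le_one (fun j _ => qcp_nonneg ..) fun j _ => qcp_le_one ..
  have p2 : ∏ j ∈ Gᶜ, fw q (sc k j) (a ∘ H.emb hy j) ≤ Real.exp (-c) ^ (Gᶜ).card := by
    rw [← Finset.prod_const]
    refine Finset.prod_le_prod (fun j _ => qcp_nonneg ..) fun j hj => ?_
    have : ¬ 1 - c < fw q (sc k j) (a ∘ H.emb hy j) := by
      simpa [G] using Finset.mem_compl.1 hj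
    have := Real.add_one_le_exp (-c)
    linarith
  refine (mul_le_mul p1 p2 (Finset.prod_nonneg fun j _ => qcp_nonneg ..) zero_le_one).trans ?_
  rw [one_mul, ← Real.exp_nat_mul]
  refine Real.exp_le_exp.2 ?_
  rw [hcard]
  nlinarith

theorem Region.tail (H : Region q k J m X W K h h₀ h₁) {c B Λ : ℝ} (hc : 0 ≤ c) (hB : 0 ≤ B)
    (hf : ∀ j : Fin J, Pro (bw (act q)) {a | 1 - c < fw q (sc k j) a} ≤ Real.exp (-B)) (hΛ : 0 < Λ)
    (hv : 16 * (1 / m + Real.exp (-(c * J / 2))) * Λ ^ 2 ≤ 1)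
    (hbad : (2 * X + 3) ^ 2 * Real.exp (-(k : ℝ) ^ 2) +
      (2 * X + 6 * k + 3) ^ 2 * (2 ^ J * Real.exp (-(B * J / 2))) ≤ Real.exp (-(4 * Λ))) (t : ℝ) :
    Pro (bw (act q)) {a | t ≤ |qcp (wpos q W) K h h₀ h₁ a - Ex (bw (act q)) (qcp (wpos q W) K h h₀ h₁)|} ≤
      4 * Real.exp (-(t * Λ)) := by
  have hw := isWeight_bw (act_nonneg q) (act_le_one H.q_pos)
  refine tail_of_influence (act_nonneg q) (act_le_one H.q_pos) (fun a => qcp_nonneg ..) (fun a => qcp_le_one ..)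
    (J := qinf (wpos q W) K h h₀ h₁) (fun i a => abs_nonneg _) (abs_sub_le_qinf _ _ _ _ _)
    (VoronoiTest.qinf_sq_sum_le _ _ _ _ _)
    (Bad := {a | ¬ Mesh (wpos q W) k K a} ∪ ⋃ y ∈ centres X k, badAt H c y) (fun a ha => ?_) hΛ (by positivity) hv
    (le_trans ?_ hbad) t
  · rw [mem_union, not_or] at ha
    refine H.qinf_sq_sum_le (not_not.1 ha.1) (Real.exp_pos _).le fun y hy => H.prod_fw_le hc hy fun hh => ha.2 ?_
    exact mem_biUnion (mem_centres H.bound hy) hh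
  · refine (Pro_union_le hw _ _).trans (add_le_add H.mesh_le ((Pro_biUnion_le hw _ _).trans ?_))
    rw [← card_centres, ← nsmul_eq_mul]
    refine Finset.sum_le_card_nsmul _ _ _ fun y _ => ?_
    by_cases hy : Centre k K y
    · refine (Pro_mono hw ?_).trans (Pro_many_le hw (H.emb_injective hy) (H.emb_disjoint hy)
        (fun j => {a' | 1 - c < fw q (sc k j) a'}) hB hf)
      rintro a ⟨_, ha⟩
      exact ha
    · refine (Pro_mono hw (B := ∅) ?_).trans ?_
      · rintro a ⟨hy', _⟩
        exact hy hy'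
      · rw [Pro_eq_sum]; simp [Ex]; positivity

theorem Region.variance (H : Region q k J m X W K h h₀ h₁) {β : ℝ} (hβ : 0 ≤ β)
    (hx : ∀ j : Fin J, Pro (fun s : Bool × Bool => bw (act q) s.1 * bw (1 / 2) s.2) {ω | WX q (sc k j) ω} ≤ β)
    {D : ℕ} (hD : 1 ≤ D) :
    Ex (bw (act q)) (fun a => (qcp (wpos q W) K h h₀ h₁ a - Ex (bw (act q)) (qcp (wpos q W) K h h₀ h₁)) ^ 2) ≤
      1 / D + D ^ 2 * (1 / m + ((2 * X + 3) ^ 2 * Real.exp (-(k : ℝ) ^ 2) + β ^ J)) := by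
  have hm0 : (0 : ℝ) < m := by exact_mod_cast H.m_pos
  have hw := isWeight_bw (act_nonneg q) (act_le_one H.q_pos)
  have hwv := hw.pair isWeight_half
  refine variance_le_of_isStopping hw isWeight_half (H := crossInd (wpos q W) K h h₀ h₁)
    (fun _ => crossInd_nonneg ..) (fun _ => crossInd_le_one ..) (fun a => rfl)
    (Q := Finset.range m) (Finset.nonempty_range_iff.2 H.m_pos.ne') (fun l hl => H.isStopping hl)
    (by positivity) (fun i => ?_) (energy_qcp_le _ _ _ _ _ (act_nonneg q) (act_le_one H.q_pos)) hD
  refine (H.sum_rev_le hwv (fun c => c) (β₁ := (2 * X + 3) ^ 2 * Real.exp (-(k : ℝ) ^ 2)) (β₂ := β ^ J)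
    ?_ (by positivity) (fun y hy => ?_) i).trans_eq ?_
  · refine le_trans (le_of_eq ?_) H.mesh_le
    rw [Pro_eq_sum, Pro_eq_sum, Ex_pair]
    congr 1; funext a
    simp only [mem_ofPred_eq]
    by_cases hm : Mesh (wpos q W) k K a 
    · simp only [hm, not_true, if_false]
      exact Ex_const isWeight_half 0
    · simp only [hm, not_false_iff, if_true]
      exact Ex_const isWeight_half 1
  · have := Pro_prod_of_disjoint hwv (H.emb_injective hy) (H.emb_disjoint hy)
        (fun j => {ω | WX q (sc k j) ω}) Finset.univ
    simp only [Finset.mem_univ, true_imp_iff] at this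
    refine this.le.trans ?_
    refine (Finset.prod_le_prod (fun j _ => Pro_nonneg hwv _) fun j _ => hx j).trans_eq ?_
    simp
  · rw [Finset.card_range]
    field_simp

end Tail

theorem convex_sqDist_le (b x : ℝ × ℝ) : Convex ℝ {p | sqDist p b ≤ sqDist p x} := by
  intro p hp p' hp' α β hα hβ h
  simp only [mem_ofPred_eq, sqDist, Prod.fst_add, Prod.snd_add, Prod.smul_fst, Prod.smul_snd, smul_eq_mul] at *
  have e : α = 1 - β := by linarith
  subst e
  nlinarith [mul_le_mul_of_nonneg_left hp hα, mul_le_mul_of_nonneg_left hp' hβ]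

theorem isClosed_sqDist_le (b x : ℝ × ℝ) : IsClosed {p | sqDist p b ≤ sqDist p x} :=
  isClosed_le (continuous_sqDist_left b) (continuous_sqDist_left x)

theorem norm_le_of_sqDist_le {p x y : ℝ × ℝ} {C D : ℝ} (hp : ‖p‖ ≤ C) (hx : ‖x‖ ≤ D)
    (h : sqDist p y ≤ sqDist p x) : ‖y‖ ≤ 3 * C + 2 * D := by
  have h1 : ‖p - x‖ ≤ C + D := (norm_sub_le p x).trans (add_le_add hp hx)
  have h2 := sqDist_le_of_norm h1
  have h3 := (norm_sq_le_sqDist p y).trans (h.trans h2)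
  have h4 : ‖p - y‖ ≤ 2 * (C + D) := by
    have : 0 ≤ C + D := (norm_nonneg _).trans h1
    nlinarith [norm_nonneg (p - y)]
  have := norm_le_norm_add_norm_sub p y
  linarith

/-- The complement of the strict red region contains a vertical crossing of a rectangle unless the
strict red region contains a horizontal one. -/
theorem SR_duality {a b c d : ℝ} (hab : a < b) (hcd : c < d) {R B : Set (ℝ × ℝ)}
    (hB : ∀ C : ℝ, (B ∩ {y | ‖y‖ ≤ C}).Finite)
    (hno : ¬ ∃ x y, x.1 = a ∧ y.1 = b ∧ JoinedIn (SR R B ∩ rect a b c d) x y) :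
    ∃ x y, x.2 = c ∧ y.2 = d ∧ JoinedIn (rect a b c d \ SR R B) x y := by
  rcases R.eq_empty_or_nonempty with rfl | ⟨x₀, hx₀⟩
  · have e : SR ∅ B = ∅ := by
      ext p; simp [SR]
    refine rect_duality hab hcd (isOpen_SR hB) (fun _ : Unit => rect a b c d) (fun _ => convex_rect ..)
      (fun _ => (isCompact_rect ..).isClosed) ?_ hno
    rw [e, sdiff_empty, iUnion_const]
  · obtain ⟨C, hC⟩ := (isCompact_rect a b c d).isBounded.exists_norm_le
    set B' := B ∩ {y | ‖y‖ ≤ 3 * C + 2 * ‖x₀‖}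
    have hfin : Finite B' := (hB _).to_subtype
    refine rect_duality hab hcd (isOpen_SR hB)
      (fun y : B' => rect a b c d ∩ ⋂ x ∈ R, {p | sqDist p y ≤ sqDist p x})
      (fun y => (convex_rect ..).inter (convex_iInter₂ fun x _ => convex_sqDist_le _ _))
      (fun y => (isCompact_rect ..).isClosed.inter (isClosed_biInter fun x _ => isClosed_sqDist_le _ _)) ?_ hno
    ext p
    simp only [mem_sdiff, mem_iUnion, mem_inter_iff, mem_iInter, mem_ofPred_eq, SR, not_exists, not_and]
    constructor
    · rintro ⟨hp, h⟩
      have h' : ∀ x ∈ R, ∃ y ∈ B, sqDist p y ≤ sqDist p x := fun x hx => by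
        have := h x hx
        push Not at this
        exact this
      obtain ⟨y₀, hy₀, hy₀'⟩ := h' x₀ hx₀
      have hne : B'.Nonempty := ⟨y₀, hy₀, norm_le_of_sqDist_le (hC p hp) le_rfl hy₀'⟩
      obtain ⟨y, hy, hmin⟩ := Set.exists_min_image B' (sqDist p) (hB _) hne
      refine ⟨⟨y, hy⟩, hp, fun x hx => ?_⟩
      obtain ⟨z, hz, hzx⟩ := h' x hx
      by_cases hzB : z ∈ B'
      · exact (hmin z hzB).trans hzx
      · have h0 : ¬ sqDist p z ≤ sqDist p x₀ := fun hh => hzB ⟨hz, norm_le_of_sqDist_le (hC p hp) le_rfl hh⟩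
        exact ((hmin y₀ ⟨hy₀, norm_le_of_sqDist_le (hC p hp) le_rfl hy₀'⟩).trans hy₀').trans
          ((not_le.1 h0).le.trans hzx)
    · rintro ⟨y, hp, h⟩
      exact ⟨hp, fun x hx hh => absurd (hh y y.2.1) (not_lt.2 (h x hx))⟩

section Torus
variable {q N : ℕ}

/-- The sites of the discrete torus. -/
abbrev Tor (N : ℕ) := ZMod N × ZMod N

/-- The projection to the torus. -/
def tproj (N : ℕ) (z : ℤ × ℤ) : Tor N := (z.1, z.2)

theorem tproj_inj {z z' : ℤ × ℤ} (h1 : |z.1 - z'.1| < N) (h2 : |z.2 - z'.2| < N) (h : tproj N z = tproj N z') :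
    z = z' := by
  obtain ⟨e1, e2⟩ := Prod.ext_iff.1 h
  simp only [tproj] at e1 e2
  rw [← sub_eq_zero, ← Int.cast_sub, ZMod.intCast_zmod_eq_zero_iff_dvd] at e1 e2
  refine Prod.ext ?_ ?_
  · exact sub_eq_zero.1 (Int.eq_zero_of_abs_lt_dvd e1 h1)
  · exact sub_eq_zero.1 (Int.eq_zero_of_abs_lt_dvd e2 h2)

/-- The periodic strict red region. -/
def tred (q : ℕ) (ω : Tor N → Bool × Bool) : Set (ℝ × ℝ) := RS (pos q) (ω ∘ tproj N)

theorem locFin {q : ℕ} (hq : 0 < q) (S : Set (ℤ × ℤ)) (C : ℝ) : (pos q '' S ∩ {y | ‖y‖ ≤ C}).Finite := by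
  refine ((finite_pos_le hq C).image (pos q)).subset ?_
  rintro _ ⟨⟨z, -, rfl⟩, hz⟩
  exact ⟨z, hz, rfl⟩

/-- The isometries of the plane acting on the torus. -/
theorem tred_map {Φ : ℝ × ℝ → ℝ × ℝ} (hΦ : ∀ p x, sqDist (Φ p) (Φ x) = sqDist p x) {E : ℤ × ℤ → ℤ × ℤ}
    (hE : Function.Surjective E) (hΦE : ∀ z, Φ (pos q z) = pos q (E z)) {e : Tor N → Tor N}
    (he : ∀ z, tproj N (E z) = e (tproj N z)) (ω : Tor N → Bool × Bool) :
    Φ ⁻¹' tred q ω = tred q (ω ∘ e) := by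
  ext p
  simp only [tred, RS, SR, mem_preimage, mem_ofPred_eq, exists_mem_image, forall_mem_image]
  constructor
  · rintro ⟨z, hz, h⟩
    obtain ⟨z, rfl⟩ := hE z
    refine ⟨z, by simpa [← he] using hz, fun b hb => ?_⟩
    have := h (x := E b) (by simpa [← he] using hb)
    rwa [← hΦE, ← hΦE, hΦ, hΦ] at this
  · rintro ⟨z, hz, h⟩
    refine ⟨E z, by simpa [← he] using hz, fun b hb => ?_⟩
    obtain ⟨b, rfl⟩ := hE b
    have := h (x := b) (by simpa [← he] using hb)
    rwa [← hΦE, ← hΦE, hΦ, hΦ]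

/-- The law of an active coloured site. -/
noncomputable def sw (q : ℕ) (s : Bool × Bool) : ℝ := bw (act q) s.1 * bw (1 / 2) s.2

theorem isWeight_sw (hq : 0 < q) : IsWeight (sw q) :=
  (isWeight_bw (act_nonneg q) (act_le_one hq)).pair isWeight_half

/-- The law of the closed complement of the periodic red region. -/
noncomputable def tpr (q N : ℕ) [NeZero N] (A : Set (Set (ℝ × ℝ))) : ℝ :=
  Pro (sw q) {ω : Tor N → Bool × Bool | (tred q ω)ᶜ ∈ A}

theorem Pro_equiv {ι : Type*} [Fintype ι] {α : Type*} [Fintype α] {w : α → ℝ} (e : ι ≃ ι) (A : Set (ι → α)) :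
    Pro w {ω | ω ∘ e ∈ A} = Pro w A := by
  rw [Pro_eq_sum, Pro_eq_sum]
  exact Ex_equiv e fun ω => if ω ∈ A then 1 else 0

theorem tpr_map [NeZero N] {Φ : ℝ × ℝ → ℝ × ℝ} (hΦ : ∀ p x, sqDist (Φ p) (Φ x) = sqDist p x) {E : ℤ × ℤ → ℤ × ℤ}
    (hE : Function.Surjective E) (hΦE : ∀ z, Φ (pos q z) = pos q (E z)) (e : Tor N ≃ Tor N)
    (he : ∀ z, tproj N (E z) = e (tproj N z)) (A : Set (Set (ℝ × ℝ))) :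
    tpr q N {F | Φ ⁻¹' F ∈ A} = tpr q N A := by
  unfold tpr
  refine Eq.trans ?_ (Pro_equiv e _)
  congr 1; ext ω
  simp only [mem_ofPred_eq, preimage_compl, tred_map hΦ hE hΦE he]

theorem tpr_trans [NeZero N] (hq : 0 < q) (m n : ℤ) (A : Set (Set (ℝ × ℝ))) :
    tpr q N {F | (fun p : ℝ × ℝ => (p.1 + m, p.2 + n)) ⁻¹' F ∈ A} = tpr q N A := by
  have : (q : ℝ) ≠ 0 := by positivity
  refine tpr_map (E := fun z => (z.1 + q * m, z.2 + q * n)) (fun p x => by simp [sqDist])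
    (fun z => ⟨(z.1 - q * m, z.2 - q * n), by simp⟩) (fun z => ?_)
    ((Equiv.addRight ((q * m : ℤ) : ZMod N)).prodCongr (Equiv.addRight ((q * n : ℤ) : ZMod N)))
    (fun z => by simp [tproj]) A
  ext <;> simp [pos] <;> field_simp

theorem tpr_refl [NeZero N] (A : Set (Set (ℝ × ℝ))) :
    tpr q N {F | (fun p : ℝ × ℝ => (-p.1, p.2)) ⁻¹' F ∈ A} = tpr q N A :=
  tpr_map (E := fun z => (-z.1, z.2)) (fun p x => by simp [sqDist]; ring)
    (fun z => ⟨(-z.1, z.2), by simp⟩) (fun z => by ext <;> simp [pos, neg_div])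
    ((Equiv.neg (ZMod N)).prodCongr (Equiv.refl _)) (fun z => by simp [tproj]) A

theorem tpr_swap [NeZero N] (A : Set (Set (ℝ × ℝ))) :
    tpr q N {F | (Prod.swap : ℝ × ℝ → ℝ × ℝ) ⁻¹' F ∈ A} = tpr q N A :=
  tpr_map (E := Prod.swap) (fun p x => by simp [sqDist]; ring)
    Prod.swap_surjective (fun z => by ext <;> simp [pos])
    (Equiv.prodComm _ _) (fun z => by simp [tproj]) A

/-- The rank of a state in the blue order. -/
def rk : Bool × Bool → ℤ
  | (true, true) => -1
  | (true, false) => 1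
  | (false, _) => 0

theorem tred_anti {ω ω' : Tor N → Bool × Bool} (h : ∀ i, rk (ω i) ≤ rk (ω' i)) : tred q ω' ⊆ tred q ω := by
  refine SR_mono (image_mono fun i hi => ?_) (image_mono fun i hi => ?_)
  · have := h (tproj N i)
    simp only [Function.comp, mem_ofPred_eq] at hi ⊢
    rw [hi] at this
    revert this
    rcases ω (tproj N i) with ⟨_ | _, _ | _⟩ <;> simp [rk]
  · have := h (tproj N i)
    simp only [Function.comp, mem_ofPred_eq] at hi ⊢
    rw [hi] at this
    revert this
    rcases ω' (tproj N i) with ⟨_ | _, _ | _⟩ <;> simp [rk]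

theorem tpr_fkg [NeZero N] (hq : 0 < q) (A B : Set (Set (ℝ × ℝ))) (hA : IsUpperSet A) (hB : IsUpperSet B) :
    tpr q N A * tpr q N B ≤ tpr q N (A ∩ B) :=
  harris_Pro (ι := Tor N) (A := {ω | (tred q ω)ᶜ ∈ A}) (B := {ω | (tred q ω)ᶜ ∈ B}) (isWeight_sw hq) (r := rk) (fun _ _ h hω => hA (compl_subset_compl.2 (tred_anti h)) hω)
    fun _ _ h hω => hB (compl_subset_compl.2 (tred_anti h)) hω

/-- Colour exchange. -/
def cflip (s : Bool × Bool) : Bool × Bool := (s.1, !s.2)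

theorem Pro_cflip {ι : Type*} [Fintype ι] (A : Set (ι → Bool × Bool)) :
    Pro (sw q) {ω | (fun i => cflip (ω i)) ∈ A} = Pro (sw q) A := by
  have hinv : Function.Involutive fun (ω : ι → Bool × Bool) i => cflip (ω i) := fun ω => by
    funext i; simp [cflip]
  rw [Pro_eq_sum, Pro_eq_sum, Ex, Ex]
  refine Fintype.sum_equiv hinv.toPerm _ _ fun ω => ?_
  congr 1
  refine Finset.prod_congr rfl fun i _ => ?_
  simp only [Function.Involutive.coe_toPerm, cflip, sw]
  rcases ω i with ⟨_ | _, _ | _⟩ <;> norm_num [bw]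

theorem tred_cflip_subset (ω : Tor N → Bool × Bool) : tred q (fun i => cflip (ω i)) ⊆ (tred q ω)ᶜ := by
  rintro p ⟨x, ⟨z, hz, rfl⟩, h⟩ ⟨x', ⟨z', hz', rfl⟩, h'⟩
  have a1 := h (pos q z') ⟨z', by
    simp only [mem_ofPred_eq, Function.comp, cflip] at hz' ⊢
    rw [hz']; rfl, rfl⟩
  have a2 := h' (pos q z) ⟨z, by
    simp only [mem_ofPred_eq, Function.comp, cflip, Prod.mk.injEq] at hz ⊢
    exact Prod.ext hz.1 (by simpa using hz.2), rfl⟩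
  exact lt_asymm a1 a2

theorem tpr_square [NeZero N] (hq : 0 < q) (m : ℕ) (hm : 1 ≤ m) : 1 / 2 ≤ tpr q N (HC 0 m 0 m) := by
  have hw := isWeight_sw hq
  have hm0 : (0 : ℝ) < m := by exact_mod_cast hm
  have e1 : tpr q N (VC 0 m 0 m) ≤ tpr q N (HC 0 m 0 m) := by
    rw [← tpr_swap (VC 0 m 0 m)]
    refine Pro_mono hw fun ω hω => conn_map continuous_swap ?_ ?_ ?_ hω
    · exact fun p hp => ⟨hp.2, hp.1⟩
    · exact fun p hp => hp
    · exact fun p hp => hp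
  set X : Set (Tor N → Bool × Bool) := {ω | tred q ω ∈ HC 0 m 0 m}
  have e2 : Pro (sw q) X ≤ tpr q N (HC 0 m 0 m) := by
    rw [← Pro_cflip]
    refine Pro_mono hw fun ω hω => isUpperSet_conn _ _ _ (tred_cflip_subset ω) hω
  have e3 : 1 - Pro (sw q) X ≤ tpr q N (VC 0 m 0 m) := by
    rw [← Pro_compl hw]
    refine Pro_mono hw fun ω hω => ?_
    obtain ⟨x, y, hx, hy, h⟩ := SR_duality hm0 hm0 (R := pos q '' {i | (ω ∘ tproj N) i = (true, true)})
      (fun C => locFin hq {i | (ω ∘ tproj N) i = (true, false)} C)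
      (fun ⟨x, y, hx, hy, h⟩ => hω ⟨x, hx, y, hy, h⟩)
    refine ⟨x, hx, y, hy, h.mono ?_⟩
    rintro p ⟨h1, h2⟩
    exact ⟨h2, h1⟩
  linarith

end Torus

section Torus
variable {q N : ℕ}

theorem tred_window (hq : 0 < q) {s k : ℕ} (hk : 0 < k) (hs : 10 * k ≤ s) {ω : Tor N → Bool × Bool}
    (hm : Mesh (wpos q (Win q s)) k (Ann s) fun z => (ω (tproj N z.1)).1) {p : ℝ × ℝ} (hp : p ∈ Ann s) :
    p ∈ tred q ω ↔ p ∈ RS (wpos q (Win q s)) fun z => ω (tproj N z.1) := by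
  have hk0 : (0 : ℝ) < k := by exact_mod_cast hk
  have hs' : (10 * k : ℝ) ≤ s := by exact_mod_cast hs
  refine RS_local (r := 2 * (k : ℝ) ^ 2) (fun z hz _ => ?_) (fun z _ _ => ⟨z.1, rfl, rfl⟩) ?_
  · have h1 := (norm_sq_le_sqDist _ _).trans hz
    have h2 : ‖p - pos q z‖ ≤ 71 / 50 * k := abs_le_of_sq_le_sq' (by nlinarith) (by positivity) |>.2
    refine ⟨⟨z, (mem_Win hq).2 ?_⟩, rfl, rfl⟩
    have h3 := norm_le_norm_add_norm_sub p (pos q z)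
    have h4 := norm_le_norm_add_norm_sub (pos q z) p
    rw [norm_sub_rev (pos q z) p] at h4
    have h5 := hp.1; have h6 := hp.2
    constructor <;> linarith
  · obtain ⟨z, hz, hb⟩ := hm p hp
    exact ⟨z.1, hz, sqDist_le_of_norm (norm_le_of_box_eq hk0 hb.symm)⟩

theorem abs_le_of_pos (hq : 0 < q) {z : ℤ × ℤ} {C : ℝ} (hz : ‖pos q z‖ ≤ C) :
    |(z.1 : ℝ)| ≤ C * q ∧ |(z.2 : ℝ)| ≤ C * q := by
  have hq' : (0 : ℝ) < q := by exact_mod_cast hq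
  rwa [Prod.norm_def, max_le_iff, Real.norm_eq_abs, Real.norm_eq_abs, pos, abs_div, abs_div,
    abs_of_pos hq', div_le_iff₀ hq', div_le_iff₀ hq'] at hz

theorem tproj_win_inj (hq : 0 < q) {s s' L : ℕ} (h : 5 * s < L) (h' : 5 * s' < L) {z z' : ℤ × ℤ}
    (hz : z ∈ Win q s) (hz' : z' ∈ Win q s') (e : tproj (q * L) z = tproj (q * L) z') : z = z' := by
  have hq' : (0 : ℝ) < q := by exact_mod_cast hq
  have a := abs_le_of_pos hq ((mem_Win hq).1 hz).2
  have a' := abs_le_of_pos hq ((mem_Win hq).1 hz').2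
  have h1 : (5 * s : ℝ) < L := by exact_mod_cast h
  have h2 : (5 * s' : ℝ) < L := by exact_mod_cast h'
  rw [abs_le, abs_le] at a a'
  refine tproj_inj ?_ ?_ e <;> rw [abs_lt]
  · constructor
    · have : (-(q * L) : ℝ) < z.1 - z'.1 := by nlinarith [a.1.1, a'.1.2]
      exact_mod_cast this
    · have : (z.1 - z'.1 : ℝ) < q * L := by nlinarith [a.1.2, a'.1.1]
      exact_mod_cast this
  · constructor
    · have : (-(q * L) : ℝ) < z.2 - z'.2 := by nlinarith [a.2.1, a'.2.2]
      exact_mod_cast this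
    · have : (z.2 - z'.2 : ℝ) < q * L := by nlinarith [a.2.2, a'.2.1]
      exact_mod_cast this

/-- The smallest scale used for the torus. -/
def baseScale : ℕ := 3000000

theorem error_le {s : ℕ} (hs : baseScale ≤ s) :
    (2 * ((2 * s : ℕ) : ℝ) + 3) ^ 2 * Real.exp (-((s / 10 : ℕ) : ℝ) ^ 2) ≤ 1 / s := by
  unfold baseScale at hs
  obtain ⟨k, hk⟩ : ∃ k : ℕ, k = s / 10 := ⟨_, rfl⟩
  rw [← hk]
  have h1 : 300000 ≤ k := by omega
  have h2 : s ≤ 10 * k + 9 := by omega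
  have h1' : (300000 : ℝ) ≤ k := by exact_mod_cast h1
  have h2' : (s : ℝ) ≤ 11 * k := by
    have : (s : ℝ) ≤ 10 * k + 9 := by exact_mod_cast h2
    linarith
  have hs0 : (0 : ℝ) < s := by
    have : 0 < s := by omega
    exact_mod_cast this
  have h3 : ((k : ℝ) ^ 2) ^ 2 / 2 ≤ Real.exp ((k : ℝ) ^ 2) := by
    have := Real.pow_div_factorial_le_exp ((k : ℝ) ^ 2) (by positivity) 2
    simpa using this
  rw [Real.exp_neg, ← div_eq_mul_inv, div_le_div_iff₀ (Real.exp_pos _) hs0, one_mul]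
  refine le_trans ?_ h3
  push_cast
  have h4 : (2 * (2 * (s : ℝ)) + 3) ^ 2 ≤ (45 * k) ^ 2 := by
    apply pow_le_pow_left₀ (by positivity); linarith
  have h5 : (2 * (2 * (s : ℝ)) + 3) ^ 2 * s ≤ (45 * k) ^ 2 * (11 * k) :=
    mul_le_mul h4 h2' hs0.le (by positivity)
  refine h5.trans ?_
  have : (0 : ℝ) ≤ k ^ 3 * (k - 2 * 45 ^ 2 * 11) := mul_nonneg (by positivity) (by linarith)
  nlinarith

theorem Pro_sw_fst {ι : Type*} [Fintype ι] (A : Set (ι → Bool)) :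
    Pro (sw q) {ω | (fun i => (ω i).1) ∈ A} = Pro (bw (act q)) A := by
  rw [Pro_eq_sum, Pro_eq_sum]
  refine (Ex_pair (w := bw (act q)) (v := bw (1 / 2)) _).trans ?_
  congr 1; funext a
  exact Ex_const (ι := ι) isWeight_half (if a ∈ A then 1 else 0)

theorem mesh_win_le (hq : 0 < q) {s : ℕ} (hs : baseScale ≤ s) :
    Pro (sw q) {ω : Win q s → Bool × Bool | ¬ Mesh (wpos q (Win q s)) (s / 10 : ℕ) (Ann s) fun i => (ω i).1} ≤
      1 / s := by
  refine (Pro_sw_fst {a | ¬ Mesh (wpos q (Win q s)) (s / 10 : ℕ) (Ann s) a}).le.trans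
    (le_trans (Pro_not_mesh_le hq (X := 2 * s) ?_ ?_ ?_) (error_le hs))
  · unfold baseScale at hs; omega
  · intro p hp
    push_cast
    exact hp.2
  · rintro z ⟨p, hp, hz⟩
    rw [mem_Win hq]
    have h0 : 10 * (s / 10) ≤ s := Nat.mul_div_le s 10
    have h1 : (10 * (s / 10 : ℕ) : ℝ) ≤ s := by exact_mod_cast h0
    have h3 := norm_le_norm_add_norm_sub p (pos q z)
    have h4 := norm_le_norm_add_norm_sub (pos q z) p
    rw [norm_sub_rev p (pos q z)] at *
    have h5 := hp.1; have h6 := hp.2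
    have : (0 : ℝ) ≤ s := Nat.cast_nonneg s
    have : (0 : ℝ) < s := by
      have : 0 < s := by unfold baseScale at hs; omega
      exact_mod_cast this
    constructor <;> linarith

/-- The projection of a window to the torus. -/
def twin (q N s : ℕ) (z : Win q s) : Tor N := tproj N z.1

theorem twin_injective (hq : 0 < q) {s L : ℕ} (h : 5 * s < L) : Function.Injective (twin q (q * L) s) :=
  fun z w e => Subtype.ext (tproj_win_inj hq h h z.2 w.2 e)

/-- The windows whose closed complement of the red region lies in a family. -/
def winEv (q s : ℕ) (A : Set (Set (ℝ × ℝ))) : Set (Win q s → Bool × Bool) :=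
  {ω | (RS (wpos q (Win q s)) ω)ᶜ ∈ A}

/-- The windows without a fine mesh of active sites. -/
def winBad (q s : ℕ) : Set (Win q s → Bool × Bool) :=
  {ω | ¬ Mesh (wpos q (Win q s)) (s / 10 : ℕ) (Ann s) fun i => (ω i).1}

theorem mem_winEv (hq : 0 < q) {s : ℕ} (hs : baseScale ≤ s) {A : Set (Set (ℝ × ℝ))}
    (hA : ∀ F G : Set (ℝ × ℝ), F ∩ Ann s = G ∩ Ann s → F ∈ A → G ∈ A) {ω : Tor N → Bool × Bool}
    (hm : ω ∘ twin q N s ∉ winBad q s) : (tred q ω)ᶜ ∈ A ↔ ω ∘ twin q N s ∈ winEv q s A := by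
  have hk : 0 < s / 10 := by unfold baseScale at hs; omega
  have e : (tred q ω)ᶜ ∩ Ann s = (RS (wpos q (Win q s)) (ω ∘ twin q N s))ᶜ ∩ Ann s := by
    ext p
    simp only [mem_inter_iff, mem_compl_iff]
    refine and_congr_left fun hp => not_congr ?_
    exact tred_window hq hk (Nat.mul_div_le s 10) (not_not.1 hm) hp
  exact ⟨hA _ _ e, hA _ _ e.symm⟩

theorem tpr_le_winEv [NeZero (q * N)] (hq : 0 < q) {s : ℕ} (hs : baseScale ≤ s) (hN : 5 * s < N)
    {A : Set (Set (ℝ × ℝ))}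
    (hA : ∀ F G : Set (ℝ × ℝ), F ∩ Ann s = G ∩ Ann s → F ∈ A → G ∈ A) :
    tpr q (q * N) A ≤ Pro (sw q) (winEv q s A) + 1 / s ∧ Pro (sw q) (winEv q s A) ≤ tpr q (q * N) A + 1 / s := by
  have hw := isWeight_sw hq
  have e1 := Pro_comp hw (twin_injective hq hN) (winEv q s A)
  have e2 := Pro_comp hw (twin_injective hq hN) (winBad q s)
  have e3 := mesh_win_le hq hs
  rw [← e1]
  constructor
  · refine (Pro_mono hw (B := {ω | ω ∘ twin q (q * N) s ∈ winEv q s A} ∪ {ω | ω ∘ twin q (q * N) s ∈ winBad q s})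
      fun ω hω => ?_).trans ((Pro_union_le hw _ _).trans (add_le_add_right (e2.le.trans e3) _))
    by_cases hm : ω ∘ twin q (q * N) s ∈ winBad q s
    · exact Or.inr hm
    · exact Or.inl ((mem_winEv hq hs hA hm).1 hω)
  · refine (Pro_mono hw (B := {ω | (tred q ω)ᶜ ∈ A} ∪ {ω | ω ∘ twin q (q * N) s ∈ winBad q s})
      fun ω hω => ?_).trans ((Pro_union_le hw _ _).trans (add_le_add_right (e2.le.trans e3) _))
    by_cases hm : ω ∘ twin q (q * N) s ∈ winBad q s
    · exact Or.inr hm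
    · exact Or.inl ((mem_winEv hq hs hA hm).2 hω)

theorem prod_le_prod_add {τ : Type*} (S : Finset τ) {x y e : τ → ℝ} (hx : ∀ j ∈ S, 0 ≤ x j) (hx1 : ∀ j ∈ S, x j ≤ 1)
    (hy : ∀ j ∈ S, 0 ≤ y j) (hy1 : ∀ j ∈ S, y j ≤ 1) (he : ∀ j ∈ S, 0 ≤ e j) (h : ∀ j ∈ S, y j ≤ x j + e j) :
    ∏ j ∈ S, y j ≤ ∏ j ∈ S, x j + ∑ j ∈ S, e j := by
  induction S using Finset.induction_on with
  | empty => simp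
  | insert a S ha ih =>
    simp only [Finset.mem_insert, forall_eq_or_imp] at hx hx1 hy hy1 he h
    rw [Finset.prod_insert ha, Finset.prod_insert ha, Finset.sum_insert ha]
    have ih := ih hx.2 hx1.2 hy.2 hy1.2 he.2 h.2
    have p0 := Finset.prod_nonneg hy.2
    have p1 := Finset.prod_le_one hy.2 hy1.2
    have s0 := Finset.sum_nonneg he.2
    nlinarith [mul_le_mul_of_nonneg_right h.1 p0, mul_le_mul_of_nonneg_left ih hx.1,
      mul_le_mul_of_nonneg_left p1 he.1, mul_le_mul_of_nonneg_right hx1.1 s0]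

theorem sum_quarter_le (J : ℕ) : ∑ j ∈ Finset.range J, (1 / 4 : ℝ) ^ j ≤ 4 / 3 := by
  have : ∑ j ∈ Finset.range J, (1 / 4 : ℝ) ^ j = 4 / 3 * (1 - (1 / 4) ^ J) := by
    induction J with
    | zero => simp
    | succ J ih => rw [Finset.sum_range_succ, ih]; ring
  rw [this]
  have : (0 : ℝ) ≤ (1 / 4) ^ J := by positivity
  linarith

theorem tpr_indep [NeZero (q * N)] (hq : 0 < q) {T : ℕ} (hN : 5 * T < N) (J r : ℕ)
    (A : ℕ → Set (Set (ℝ × ℝ))) (hr : baseScale ≤ r) (hT : 4 ^ J * r ≤ T)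
    (hA : ∀ j < J, ∀ F G : Set (ℝ × ℝ),
      F ∩ {p | (4 ^ j * r : ℝ) ≤ ‖p‖ ∧ ‖p‖ ≤ 2 * (4 ^ j * r)} =
        G ∩ {p | (4 ^ j * r : ℝ) ≤ ‖p‖ ∧ ‖p‖ ≤ 2 * (4 ^ j * r)} → F ∈ A j → G ∈ A j) :
    tpr q (q * N) {F | ∀ j < J, F ∉ A j} ≤ ∏ j ∈ Finset.range J, (1 - tpr q (q * N) (A j)) + 1 / 64 := by
  have hw := isWeight_sw hq
  have hr0 : 0 < r := by unfold baseScale at hr; omega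
  have hr0' : (3000000 : ℝ) ≤ r := by unfold baseScale at hr; exact_mod_cast hr
  set s : ℕ → ℕ := fun j => 4 ^ j * r
  have hs : ∀ j, baseScale ≤ s j := fun j => hr.trans (Nat.le_mul_of_pos_left _ (by positivity))
  have hsT : ∀ j < J, 5 * s j < N := fun j hj => by
    have : s j ≤ 4 ^ J * r := Nat.mul_le_mul_right _ (Nat.pow_le_pow_right (by norm_num) hj.le)
    omega
  have hA' : ∀ j < J, ∀ F G : Set (ℝ × ℝ), F ∩ Ann (s j) = G ∩ Ann (s j) → F ∈ A j → G ∈ A j := by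
    intro j hj F G h
    refine hA j hj F G ?_
    simpa [Ann, s] using h
  have hinj : ∀ j : Fin J, Function.Injective (twin q (q * N) (s j)) := fun j => twin_injective hq (hsT j j.2)
  have hdis : ∀ j k : Fin J, j ≠ k → Disjoint (range (twin q (q * N) (s j))) (range (twin q (q * N) (s k))) := by
    intro j k hjk
    rw [Set.disjoint_left]
    rintro _ ⟨z, rfl⟩ ⟨z', hz'⟩
    have e : z'.1 = z.1 := tproj_win_inj hq (hsT k k.2) (hsT j j.2) z'.2 z.2 hz'
    have hmul : ∀ a b : Fin J, a < b → 4 * s a ≤ s b := fun a b hab => by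
      have : 4 ^ (a.1 + 1) ≤ 4 ^ b.1 := Nat.pow_le_pow_right (by norm_num) hab
      have := Nat.mul_le_mul_right r this
      simp only [s]
      rw [pow_succ] at this
      linarith
    rcases lt_or_gt_of_ne hjk with h | h
    · exact win_disjoint hq (hmul _ _ h) z.2 (e ▸ z'.2)
    · exact win_disjoint hq (hmul _ _ h) z'.2 (e ▸ z.2)
  have hp := Pro_prod_of_disjoint hw hinj hdis (fun j => (winEv q (s j) (A j))ᶜ) Finset.univ
  have hb : Pro (sw q) (⋃ j ∈ Finset.range J, {ω : Tor (q * N) → Bool × Bool | ω ∘ twin q (q * N) (s j) ∈ winBad q (s j)}) ≤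
      ∑ j ∈ Finset.range J, 1 / (s j : ℝ) := by
    refine (Pro_biUnion_le hw _ _).trans (Finset.sum_le_sum fun j hj => ?_)
    exact (Pro_comp hw (twin_injective hq (hsT j (Finset.mem_range.1 hj))) (winBad q (s j))).le.trans
      (mesh_win_le hq (hs j))
  have hle : tpr q (q * N) {F | ∀ j < J, F ∉ A j} ≤ ∏ j : Fin J, Pro (sw q) (winEv q (s j) (A j))ᶜ +
      ∑ j ∈ Finset.range J, 1 / (s j : ℝ) := by
    rw [← hp]
    refine (Pro_mono hw ?_).trans ((Pro_union_le hw _ _).trans (add_le_add_right hb _))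
    intro ω hω
    by_cases hm : ∃ j < J, ω ∘ twin q (q * N) (s j) ∈ winBad q (s j)
    · obtain ⟨j, hj, hm⟩ := hm
      exact Or.inr (mem_biUnion (Finset.mem_coe.2 (Finset.mem_range.2 hj)) hm)
    · push Not at hm
      exact Or.inl fun j _ hh => hω j j.2 ((mem_winEv hq (hs j) (hA' j j.2) (hm j j.2)).2 hh)
  have hsum : ∑ j ∈ Finset.range J, 1 / (s j : ℝ) ≤ 1 / 128 := by
    have : ∀ j, 1 / (s j : ℝ) = 1 / r * (1 / 4) ^ j := fun j => by
      simp only [s]; push_cast; rw [one_div_pow]; field_simp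
    simp only [this]
    rw [← Finset.mul_sum]
    have h1 := sum_quarter_le J
    have h2 : 1 / (r : ℝ) ≤ 1 / 3000000 := one_div_le_one_div_of_le (by norm_num) hr0'
    have h3 : 0 ≤ 1 / (r : ℝ) := by positivity
    nlinarith
  rw [Finset.prod_range] at *
  have hprod := prod_le_prod_add (Finset.univ : Finset (Fin J)) (x := fun j => 1 - tpr q (q * N) (A j))
    (y := fun j => Pro (sw q) (winEv q (s j) (A j))ᶜ) (e := fun j => 1 / (s j : ℝ))
    (fun j _ => sub_nonneg.2 (Pro_le_one hw _)) (fun j _ => sub_le_self _ (Pro_nonneg hw _))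
    (fun j _ => Pro_nonneg hw _) (fun j _ => Pro_le_one hw _) (fun j _ => by positivity) (fun j _ => by
      rw [Pro_compl hw]
      linarith [(tpr_le_winEv hq (hs j) (hsT j j.2) (hA' j j.2)).1])
  rw [Finset.sum_range] at *
  linarith

end Torus

section Torus
variable {q N : ℕ}

theorem exp_le_one_sub {x : ℝ} (h0 : 0 ≤ x) (h1 : x ≤ 1 / 2) : Real.exp (-(2 * x)) ≤ 1 - x := by
  have h := Real.add_one_le_exp (2 * x)
  rw [Real.exp_neg, inv_le_comm₀ (Real.exp_pos _) (by linarith)]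
  refine le_trans ?_ h
  rw [inv_le_iff_one_le_mul₀ (by linarith)]
  nlinarith

theorem Pro_sw_ne [NeZero N] (hq : 0 < q) (b : Bool) (T : Finset (Tor N)) :
    Pro (sw q) {ω : Tor N → Bool × Bool | ∀ i ∈ T, ω i ∈ ({(true, b)}ᶜ : Set (Bool × Bool))} = (1 - act q / 2) ^ T.card := by
  rw [Pro_forall T (isWeight_sw hq)]
  congr 1
  rw [Fintype.sum_prod_type]
  cases b <;> simp [sw, bw] <;> ring

/-- The sites in a square. -/
noncomputable def sqSites (N : ℕ) (a b : ℤ) : Finset (Tor N) := (Finset.Icc a b ×ˢ Finset.Icc a b).image (tproj N)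

theorem tpr_init [NeZero N] (hq : 0 < q) {s : ℕ} (hs : 2 ≤ s) (hN : q * s ≤ N) :
    Real.exp (-(441 * (s : ℝ) ^ 2)) / 2 ≤ tpr q N (HC 0 (4 * s) 0 s) := by
  have hw := isWeight_sw hq
  have hq0 : (0 : ℝ) < q := by exact_mod_cast hq
  have hq1 : (1 : ℝ) ≤ q := by exact_mod_cast hq
  have hs2 : (2 : ℝ) ≤ s := by exact_mod_cast hs
  have ha0 := act_nonneg q
  have ha1 := act_le_one hq
  have haq : act q * (q : ℝ) ^ 2 = 1 := by unfold act; field_simp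
  set T₁ := sqSites N (-(8 * (q * s : ℕ))) (12 * (q * s : ℕ))
  set T₂ := sqSites N 0 ((q * s : ℕ) - 1)
  set A : Set (Tor N → Bool × Bool) := {ω | ∀ i ∈ T₁, ω i ∈ ({(true, true)}ᶜ : Set (Bool × Bool))}
  set B : Set (Tor N → Bool × Bool) := {ω | ∀ i ∈ T₂, ω i ∈ ({(true, false)}ᶜ : Set (Bool × Bool))}
  have hA : Real.exp (-(441 * (s : ℝ) ^ 2)) ≤ Pro (sw q) A := by
    rw [Pro_sw_ne hq]
    have hc : T₁.card ≤ (20 * (q * s) + 1) ^ 2 := by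
      refine Finset.card_image_le.trans ?_
      rw [Finset.card_product, Int.card_Icc, sq]
      have : (12 * (q * s : ℕ) + 1 - -(8 * (q * s : ℕ)) : ℤ).toNat = 20 * (q * s) + 1 := by omega
      rw [this]
    have hc' : (T₁.card : ℝ) ≤ (21 * (q * s)) ^ 2 := by
      have : (T₁.card : ℝ) ≤ (20 * (q * s) + 1) ^ 2 := by exact_mod_cast hc
      refine this.trans (pow_le_pow_left₀ (by positivity) ?_ 2)
      nlinarith
    calc Real.exp (-(441 * (s : ℝ) ^ 2)) = Real.exp (-(act q * (21 * (q * s)) ^ 2)) := by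
          congr 2
          linear_combination (-441 * (s : ℝ) ^ 2) * haq
      _ ≤ Real.exp (-(act q * T₁.card)) := by gcongr
      _ = Real.exp (-(2 * (act q / 2))) ^ T₁.card := by rw [← Real.exp_nat_mul]; congr 1; ring
      _ ≤ _ := pow_le_pow_left₀ (Real.exp_pos _).le (exp_le_one_sub (by linarith) (by linarith)) _
  have hB : Pro (sw q) B ≤ 1 / 2 := by
    rw [Pro_sw_ne hq]
    have hc : T₂.card = (q * s) ^ 2 := by
      have hinj : Set.InjOn (tproj N)
          ↑((Finset.Icc (0 : ℤ) ((q * s : ℕ) - 1) ×ˢ Finset.Icc (0 : ℤ) ((q * s : ℕ) - 1))) := by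
        intro z hz z' hz' e
        simp only [Finset.coe_product, Finset.coe_Icc, mem_prod, mem_Icc] at hz hz'
        refine tproj_inj ?_ ?_ e <;> rw [abs_lt] <;> constructor <;> omega
      change (Finset.image _ _).card = _
      rw [Finset.card_image_of_injOn hinj, Finset.card_product, Int.card_Icc, sq]
      have : ((q * s : ℕ) - 1 + 1 - 0 : ℤ).toNat = q * s := by omega
      rw [this]
    rw [hc]
    calc (1 - act q / 2) ^ ((q * s) ^ 2) ≤ Real.exp (-(act q / 2)) ^ ((q * s) ^ 2) := by
          apply pow_le_pow_left₀ (by linarith)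
          linarith [Real.add_one_le_exp (-(act q / 2))]
      _ = Real.exp (-((s : ℝ) ^ 2 / 2)) := by
          rw [← Real.exp_nat_mul]; congr 1; push_cast
          linear_combination (-(s : ℝ) ^ 2 / 2) * haq
      _ ≤ Real.exp (-1) := by gcongr; nlinarith
      _ ≤ 1 / 2 := by
          rw [Real.exp_neg, one_div]
          exact inv_anti₀ (by norm_num) (by linarith [Real.add_one_le_exp (1 : ℝ)])
  have hAB := harris_Pro hw (r := rk) (A := A) (B := Bᶜ) (fun ω ω' h hω i hi => by
      have h1 := h i
      have h2 := hω i hi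
      simp only [mem_compl_iff, mem_singleton_iff] at h2 ⊢
      intro h3
      rw [h3] at h1
      revert h1 h2
      rcases ω i with ⟨_ | _, _ | _⟩ <;> simp [rk]) (fun ω ω' h hω => by
      simp only [B, mem_compl_iff, mem_ofPred_eq, mem_singleton_iff, not_forall, not_not] at hω ⊢
      obtain ⟨i, hi, h2⟩ := hω
      refine ⟨i, hi, ?_⟩
      have h1 := h i
      rw [h2] at h1
      revert h1
      rcases ω' i with ⟨_ | _, _ | _⟩ <;> simp [rk])
  rw [Pro_compl hw] at hAB
  have hfin : Real.exp (-(441 * (s : ℝ) ^ 2)) / 2 ≤ Pro (sw q) (A ∩ Bᶜ) := by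
    refine le_trans ?_ hAB
    have := Real.exp_pos (-(441 * (s : ℝ) ^ 2))
    nlinarith
  refine hfin.trans (Pro_mono hw ?_)
  rintro ω ⟨hωA, hωB⟩
  have hsub : rect 0 (4 * s) 0 s ⊆ (tred q ω)ᶜ := by
    rintro p ⟨⟨p1, p2⟩, p3, p4⟩ ⟨_, ⟨z, hz, rfl⟩, h⟩
    simp only [B, mem_compl_iff, mem_ofPred_eq, mem_singleton_iff, not_forall, not_not] at hωB
    obtain ⟨i, hi, hib⟩ := hωB
    obtain ⟨b, hb, rfl⟩ := Finset.mem_image.1 hi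
    have h1 := h (pos q b) ⟨b, hib, rfl⟩
    rw [Finset.mem_product, Finset.mem_Icc, Finset.mem_Icc] at hb
    have hbb : ∀ u : ℤ, 0 ≤ u ∧ u ≤ (q * s : ℕ) - 1 → 0 ≤ (u : ℝ) / q ∧ (u : ℝ) / q ≤ s := fun u hu => by
      have u1 : (0 : ℝ) ≤ u := by exact_mod_cast hu.1
      have u2 : (u : ℝ) ≤ ((q * s : ℕ) : ℤ) := by
        have : u ≤ (q * s : ℕ) := by omega
        exact_mod_cast this
      push_cast at u2
      refine ⟨by positivity, ?_⟩
      rw [div_le_iff₀ hq0]; linarith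
    obtain ⟨b1, b2⟩ := hbb _ hb.1
    obtain ⟨b3, b4⟩ := hbb _ hb.2
    have h2 : sqDist p (pos q b) ≤ 17 * (s : ℝ) ^ 2 := by
      simp only [sqDist, pos]
      nlinarith
    have hzT : tproj N z ∉ T₁ := fun hh => hωA _ hh hz
    have hz' : ¬ (-(8 * (q * s : ℕ) : ℤ) ≤ z.1 ∧ z.1 ≤ 12 * (q * s : ℕ) ∧ -(8 * (q * s : ℕ) : ℤ) ≤ z.2 ∧ z.2 ≤ 12 * (q * s : ℕ)) := by
      rintro ⟨z1, z2, z3, z4⟩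
      exact hzT (Finset.mem_image_of_mem _ (Finset.mem_product.2 ⟨Finset.mem_Icc.2 ⟨z1, z2⟩, Finset.mem_Icc.2 ⟨z3, z4⟩⟩))
    have hlo : ∀ u : ℤ, u < -(8 * (q * s : ℕ) : ℤ) → (u : ℝ) / q ≤ -(8 * s) := fun u hu => by
      have : (u : ℝ) ≤ (-(8 * (q * s : ℕ) : ℤ) : ℤ) := by exact_mod_cast hu.le
      push_cast at this
      rw [div_le_iff₀ hq0]; linarith
    have hhi : ∀ u : ℤ, 12 * (q * s : ℕ) < u → (12 * s : ℝ) ≤ (u : ℝ) / q := fun u hu => by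
      have : ((12 * (q * s : ℕ) : ℤ) : ℝ) ≤ u := by exact_mod_cast hu.le
      push_cast at this
      rw [le_div_iff₀ hq0]; linarith
    have h3 : 64 * (s : ℝ) ^ 2 ≤ sqDist p (pos q z) := by
      simp only [sqDist, pos]
      by_cases z1 : z.1 < -(8 * (q * s : ℕ) : ℤ)
      · nlinarith [hlo _ z1, sq_nonneg (p.2 - z.2 / q)]
      by_cases z2 : 12 * (q * s : ℕ) < z.1
      · nlinarith [hhi _ z2, sq_nonneg (p.2 - z.2 / q)]
      by_cases z3 : z.2 < -(8 * (q * s : ℕ) : ℤ)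
      · nlinarith [hlo _ z3, sq_nonneg (p.1 - z.1 / q)]
      by_cases z4 : 12 * (q * s : ℕ) < z.2
      · nlinarith [hhi _ z4, sq_nonneg (p.1 - z.1 / q)]
      exact absurd ⟨not_lt.1 z1, not_lt.1 z2, not_lt.1 z3, not_lt.1 z4⟩ hz'
    nlinarith
  have m1 : ((0, 0) : ℝ × ℝ) ∈ rect 0 (4 * s) 0 s := by
    refine ⟨⟨le_rfl, ?_⟩, le_rfl, ?_⟩ <;> positivity
  have m2 : ((4 * s, 0) : ℝ × ℝ) ∈ rect 0 (4 * s) 0 s := by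
    refine ⟨⟨?_, le_rfl⟩, le_rfl, ?_⟩ <;> positivity
  refine ⟨(0, 0), rfl, (4 * s, 0), rfl, ?_⟩
  refine (JoinedIn.of_segment_subset ((convex_rect _ _ _ _).segment_subset m1 m2)).mono fun p hp => ⟨hsub hp, hp⟩

/-- The random closed set on the torus is a model to which the box crossing theory applies. -/
noncomputable def torModel [NeZero (q * N)] (hq : 0 < q) {T : ℕ} (hT : 5 * T < N) (hs : baseScale ≤ N) :
    RSWModel baseScale T (Real.exp (-(441 * (baseScale : ℝ) ^ 2)) / 2) where
  pr := tpr q (q * N)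
  nonneg _ := Pro_nonneg (isWeight_sw hq) _
  le_one _ := Pro_le_one (isWeight_sw hq) _
  mono _ _ h := Pro_mono (isWeight_sw hq) fun _ hω => h hω
  union _ _ := Pro_union_le (isWeight_sw hq) _ _
  fkg := tpr_fkg hq
  trans := tpr_trans hq
  refl := tpr_refl
  swap := tpr_swap
  square m hm := tpr_square hq m hm
  indep J r A hr hJ hA := tpr_indep hq hT J r A hr hJ hA
  init := tpr_init hq (by unfold baseScale; norm_num) (Nat.mul_le_mul_left _ hs)

theorem torus_crossing : ∃ c, 0 < c ∧ ∀ q s : ℕ, 0 < q → baseScale ≤ s → ∃ N₀, ∀ N, N₀ ≤ N → ∀ _ : NeZero (q * N),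
    c ≤ tpr q (q * N) (HC 0 (4 * s) 0 s) := by
  obtain ⟨c, hc, C, h⟩ := rsw (c₀ := Real.exp (-(441 * (baseScale : ℝ) ^ 2)) / 2) (by positivity)
  refine ⟨c, hc, fun q s hq hs => ⟨5 * (C * s) + baseScale + 1, fun N hN _ => ?_⟩⟩
  exact h baseScale (C * s) (by unfold baseScale; norm_num) (torModel hq (by omega) (by omega)) s hs le_rfl

end Torus

section Circuit
variable {q N : ℕ}

theorem no_conn_right {s : ℝ} (hs : 0 ≤ s) {F : Set (ℝ × ℝ)} (hF : F ∈ VC s (2 * s) (-(2 * s)) (2 * s)) :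
    Fᶜ ∉ Conn (Ann s) {p | ‖p‖ ≤ s} {p | 2 * s ≤ p.1} := by
  rintro ⟨x, hx, y, hy, hj⟩
  obtain ⟨C, hC, D, hD, hj'⟩ := hF
  obtain ⟨x', y', hx', hy', hj2, -⟩ := joinedIn_exists_level hj continuous_fst (a := s) (b := 2 * s) (by linarith)
    ((le_abs_self _).trans ((norm_fst_le x).trans hx)) hy
  obtain ⟨z, hz, hz'⟩ := inter_nonempty_of_joinedIn hj2 hj' (fun z hz => by
      rw [hx', hy']; exact hz.2.1) fun z hz => by
    rw [show C.2 = -(2 * s) from hC, show D.2 = 2 * s from hD]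
    exact abs_le.1 ((norm_snd_le z).trans hz.1.2.2)
  exact hz.1.1 hz'.1

theorem no_conn_map {s : ℝ} (hs : 0 ≤ s) {Φ : ℝ × ℝ → ℝ × ℝ} (hc : Continuous Φ) (hΦ : ∀ p, ‖Φ p‖ = ‖p‖)
    (hi : ∀ p, Φ (Φ p) = p) {F : Set (ℝ × ℝ)} (hF : Φ ⁻¹' F ∈ VC s (2 * s) (-(2 * s)) (2 * s)) :
    Fᶜ ∉ Conn (Ann s) {p | ‖p‖ ≤ s} {p | 2 * s ≤ (Φ p).1} := fun h => by
  refine no_conn_right hs hF (conn_map hc (R := Ann s) (A := {p | ‖p‖ ≤ s}) (B := {p | 2 * s ≤ (Φ p).1}) ?_ ?_ ?_ ?_)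
  · intro p hp; simpa [Ann, hΦ] using hp
  · intro p hp; simpa [hΦ] using hp
  · exact fun p hp => hp
  · convert h using 1
    ext p; simp [hi]

/-- The reflection in the vertical axis. -/
def rfl₁ (p : ℝ × ℝ) : ℝ × ℝ := (-p.1, p.2)

theorem not_joins_of_circuit {s : ℝ} (hs : 0 ≤ s) {F : Set (ℝ × ℝ)}
    (h1 : F ∈ VC s (2 * s) (-(2 * s)) (2 * s)) (h2 : rfl₁ ⁻¹' F ∈ VC s (2 * s) (-(2 * s)) (2 * s))
    (h3 : Prod.swap ⁻¹' F ∈ VC s (2 * s) (-(2 * s)) (2 * s))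
    (h4 : rfl₁ ⁻¹' (Prod.swap ⁻¹' (rfl₁ ⁻¹' F)) ∈ VC s (2 * s) (-(2 * s)) (2 * s)) :
    ¬ Joins (Fᶜ ∩ Ann s) (fun p => ‖p‖) s (2 * s) := by
  rintro ⟨x, y, hx, hy, hj⟩
  have n1 := no_conn_right hs h1
  have n2 := no_conn_map hs (Φ := rfl₁) (by unfold rfl₁; fun_prop) (fun p => by simp [rfl₁, Prod.norm_def])
    (fun p => by simp [rfl₁]) h2
  have n3 := no_conn_map hs (Φ := Prod.swap) (by fun_prop) (fun p => by simp [Prod.norm_def, max_comm])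
    (fun p => by simp) h3
  have n4 := no_conn_map hs (Φ := fun p => rfl₁ (Prod.swap (rfl₁ p))) (by unfold rfl₁; fun_prop)
    (fun p => by simp [rfl₁, Prod.norm_def, max_comm]) (fun p => by simp [rfl₁]) h4
  change 2 * s ≤ ‖y‖ at hy
  rw [Prod.norm_def, le_max_iff, Real.norm_eq_abs, Real.norm_eq_abs, le_abs, le_abs] at hy
  rcases hy with (h | h) | h | h
  · exact n1 ⟨x, hx, y, h, hj⟩
  · exact n2 ⟨x, hx, y, h, hj⟩
  · exact n3 ⟨x, hx, y, h, hj⟩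
  · exact n4 ⟨x, hx, y, h, hj⟩

theorem tpr_circuit [NeZero (q * N)] (hq : 0 < q) (s : ℕ) {c : ℝ} (hc : 0 ≤ c) (h : c ≤ tpr q (q * N) (HC 0 (4 * s) 0 s)) :
    c ^ 4 ≤ tpr q (q * N) {F | ¬ Joins (Fᶜ ∩ Ann s) (fun p => ‖p‖) s (2 * s)} := by
  have hw := isWeight_sw hq
  set V := VC (s : ℝ) (2 * s) (-(2 * s)) (2 * s)
  have hV : IsUpperSet V := isUpperSet_conn _ _ _
  have e1 : c ≤ tpr q (q * N) V := by
    refine h.trans ?_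
    rw [← tpr_swap V, ← tpr_trans (N := q * N) hq (2 * s : ℤ) (-s) {F | Prod.swap ⁻¹' F ∈ V}]
    refine Pro_mono hw fun ω hω => conn_map (Φ := fun p => (p.2 + s, p.1 - 2 * s)) (by fun_prop)
      (R := rect 0 (4 * s) 0 s) (A := {p | p.1 = 0}) (B := {p | p.1 = 4 * s}) ?_ ?_ ?_ ?_
    · rintro p ⟨⟨h1, h2⟩, h3, h4⟩
      refine ⟨⟨?_, ?_⟩, ?_, ?_⟩ <;> simp <;> linarith
    · intro p hp; simp at hp ⊢; linarith
    · intro p hp; simp at hp ⊢; linarith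
    · have : (fun p : ℝ × ℝ => (p.2 + (s : ℝ), p.1 - 2 * s)) ⁻¹' (Prod.swap ⁻¹'
          ((fun p : ℝ × ℝ => (p.1 + ((2 * s : ℤ) : ℝ), p.2 + ((-s : ℤ) : ℝ))) ⁻¹' (tred q ω)ᶜ)) = (tred q ω)ᶜ := by
        ext p; simp
      rw [this]; exact hω
  have pre : ∀ {A : Set (Set (ℝ × ℝ))}, IsUpperSet A → ∀ Φ : ℝ × ℝ → ℝ × ℝ, IsUpperSet {F | Φ ⁻¹' F ∈ A} :=
    fun hA Φ F G hFG hF => hA (preimage_mono hFG) hF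
  have e2 : c ≤ tpr q (q * N) {F | rfl₁ ⁻¹' F ∈ V} := e1.trans_eq (tpr_refl V).symm
  have e3 : c ≤ tpr q (q * N) {F | Prod.swap ⁻¹' F ∈ V} := e1.trans_eq (tpr_swap V).symm
  have e4 : c ≤ tpr q (q * N) {F | rfl₁ ⁻¹' (Prod.swap ⁻¹' (rfl₁ ⁻¹' F)) ∈ V} := by
    refine e1.trans_eq ?_
    rw [← tpr_refl V, ← tpr_swap, ← tpr_refl]
    rfl
  have f1 := tpr_fkg (N := q * N) hq V {F | rfl₁ ⁻¹' F ∈ V} hV (pre hV _)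
  have f2 := tpr_fkg (N := q * N) hq _ {F | Prod.swap ⁻¹' F ∈ V} (hV.inter (pre hV rfl₁)) (pre hV _)
  have f3 := tpr_fkg (N := q * N) hq _ {F | rfl₁ ⁻¹' (Prod.swap ⁻¹' (rfl₁ ⁻¹' F)) ∈ V}
    ((hV.inter (pre hV rfl₁)).inter (pre hV Prod.swap)) (pre (pre (pre hV rfl₁) Prod.swap) rfl₁)
  have g1 : c * c ≤ _ := (mul_le_mul e1 e2 hc (hc.trans e1)).trans f1
  have g2 : c * c * c ≤ _ := (mul_le_mul g1 e3 hc ((by positivity : (0 : ℝ) ≤ c * c).trans g1)).trans f2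
  have g3 : c * c * c * c ≤ _ := (mul_le_mul g2 e4 hc ((by positivity : (0 : ℝ) ≤ c * c * c).trans g2)).trans f3
  calc c ^ 4 = c * c * c * c := by ring
    _ ≤ _ := g3
    _ ≤ _ := Pro_mono hw fun ω ⟨⟨⟨h1, h2⟩, h3⟩, h4⟩ => not_joins_of_circuit (Nat.cast_nonneg s) h1 h2 h3 h4

theorem annulus_crossing_le : ∃ c : ℝ, 0 < c ∧ ∃ s₁ : ℕ, ∀ q s : ℕ, 0 < q → s₁ ≤ s →
    Pro (sw q) {ω | WX q s ω} ≤ 1 - c := by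
  obtain ⟨c, hc, h⟩ := torus_crossing
  obtain ⟨s₁, hs₁⟩ := exists_nat_gt (2 / c ^ 4)
  refine ⟨c ^ 4 / 2, by positivity, max s₁ baseScale, fun q s hq hs => ?_⟩
  have hs' : baseScale ≤ s := (le_max_right _ _).trans hs
  have hs0 : 0 < s := lt_of_lt_of_le (by unfold baseScale; norm_num) hs'
  obtain ⟨N₀, hN⟩ := h q s hq hs'
  set N := max N₀ (5 * s + 1)
  have : NeZero (q * N) := ⟨by positivity⟩
  have h1 := tpr_circuit hq s hc.le (hN N (le_max_left _ _) this)
  have h2 := (tpr_le_winEv hq hs' (show 5 * s < N from lt_of_lt_of_le (by omega) (le_max_right _ _))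
    (A := {F | ¬ Joins (Fᶜ ∩ Ann s) (fun p => ‖p‖) s (2 * s)}) (fun F G hFG hF hG => hF (by
      rw [show Fᶜ ∩ Ann (s : ℝ) = Gᶜ ∩ Ann s by
        ext p
        have := Set.ext_iff.1 hFG p
        simp only [mem_inter_iff, mem_compl_iff] at this ⊢
        tauto]
      exact hG))).1
  have h3 : winEv q s {F | ¬ Joins (Fᶜ ∩ Ann s) (fun p => ‖p‖) s (2 * s)} = {ω | WX q s ω}ᶜ := by
    ext ω
    simp [winEv, WX]
  rw [h3, Pro_compl (isWeight_sw hq)] at h2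
  have h4 : (1 : ℝ) / s ≤ c ^ 4 / 2 := by
    have : (2 / c ^ 4 : ℝ) < s := hs₁.trans_le (by exact_mod_cast (le_max_left _ _).trans hs)
    rw [div_lt_iff₀ (by positivity)] at this
    rw [div_le_iff₀ (by exact_mod_cast hs0)]
    linarith
  linarith

end Circuit

section Scales

/-- With high probability, the conditional probability of an annulus crossing is bounded away from one. -/
def Good (c : ℝ) (i : ℕ) (B : ℝ) : Prop :=
  ∀ q, 0 < q → Pro (bw (act q)) {a | 1 - c < fw q (2 ^ i) a} ≤ Real.exp (-B)

theorem Good.mono {c : ℝ} {i : ℕ} {B B' : ℝ} (h : Good c i B) (hB : B' ≤ B) : Good c i B' :=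
  fun q hq => (h q hq).trans (Real.exp_le_exp.2 (neg_le_neg hB))

theorem sc_two_pow (a j : ℕ) : sc (2 ^ a) j = 2 ^ (a + 4 + 2 * j) := by
  unfold sc
  rw [pow_add, pow_add, pow_mul]; norm_num; ring

theorem region_win {q k J m s : ℕ} (hq : 0 < q) (hk : 0 < k) (hm : 0 < m) (h1 : 10 * sc k J < s)
    (h2 : m * (2 * sc k J + 1) ≤ s) : Region q k J m (2 * s) (Win q s) (Ann s) (fun p => ‖p‖) s (2 * s) where
  q_pos := hq
  k_pos := hk
  m_pos := hm
  closed := (isClosed_le continuous_const continuous_norm).inter (isClosed_le continuous_norm continuous_const)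
  bound p hp := by push_cast; exact hp.2
  lip := lipschitzWith_one_norm
  levels := by
    have : (m * (2 * sc k J + 1) : ℝ) ≤ s := by exact_mod_cast h2
    linarith
  margin z := by
    rintro ⟨p, hp, hz⟩
    have h1' : (10 * sc k J : ℝ) < s := by exact_mod_cast h1
    have := abs_le.1 (abs_norm_sub_norm_le (pos q z) p)
    rw [mem_Win hq]
    constructor <;> linarith [hp.1, hp.2]

theorem Ex_fw {q : ℕ} (s : ℕ) : Ex (bw (act q)) (fw q s) = Pro (sw q) {ω | WX q s ω} := by
  rw [Pro_eq_sum]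
  exact (Ex_pair (w := bw (act q)) (v := bw (1 / 2)) (fun ω : Win q s → Bool × Bool => if WX q s ω then (1 : ℝ) else 0)).symm

theorem good_base {c : ℝ} (hc : 0 < c) {s₁ : ℕ}
    (h : ∀ q s : ℕ, 0 < q → s₁ ≤ s → Pro (sw q) {ω | WX q s ω} ≤ 1 - 2 * c) (B : ℝ) :
    ∃ i₀, ∀ i, i₀ ≤ i → Good c i B := by
  set β := 1 - 2 * c with hβdef
  have hβ0 : 0 ≤ β := (Pro_nonneg (isWeight_sw one_pos) _).trans (h 1 s₁ one_pos le_rfl)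
  have hβ1 : β < 1 := by linarith
  set ε := c ^ 2 * Real.exp (-B) with hε
  have hε0 : 0 < ε := by positivity
  obtain ⟨D, hD⟩ := exists_nat_gt (4 / ε)
  have hD0 : (0 : ℝ) < D := lt_trans (by positivity) hD
  have hD1 : 1 ≤ D := by exact_mod_cast (by exact_mod_cast hD0 : 0 < D)
  obtain ⟨J, hJ⟩ := exists_pow_lt_of_lt_one (show 0 < ε / 4 / D ^ 2 by positivity) hβ1
  obtain ⟨m, hm⟩ := exists_nat_gt (D ^ 2 / (ε / 4))
  have hm0 : (0 : ℝ) < m := lt_trans (by positivity) hm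
  obtain ⟨M₁, hM₁⟩ := exists_nat_gt (2904 * D ^ 2 / ε)
  set M := m * (32 * 4 ^ J + 1) + 160 * 4 ^ J + 1 + s₁ + M₁
  refine ⟨2 * M, fun i hi q hq => ?_⟩
  set k := 2 ^ (i / 2) with hk
  have hkM : M ≤ k := (Nat.lt_two_pow_self).le.trans (Nat.pow_le_pow_right (by norm_num) (by omega))
  have hk1 : 1 ≤ k := Nat.one_le_two_pow
  have hkk : k * k ≤ 2 ^ i := by
    rw [hk, ← pow_add]; exact Nat.pow_le_pow_right (by norm_num) (by omega)
  have hkk' : 2 ^ i ≤ 2 * (k * k) := by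
    rw [hk, ← pow_add, ← pow_succ']; exact Nat.pow_le_pow_right (by norm_num) (by omega)
  have hMk : M * k ≤ 2 ^ i := (Nat.mul_le_mul_right _ hkM).trans hkk
  have hsc : sc k J = 16 * 4 ^ J * k := by unfold sc; ring
  have hp4 : 1 ≤ 4 ^ J := Nat.one_le_pow _ _ (by norm_num)
  have H := region_win (J := J) (m := m) (s := 2 ^ i) hq hk1 (by exact_mod_cast hm0) (by
      have := Nat.mul_le_mul_right k (by omega : 160 * 4 ^ J + 1 ≤ M)
      rw [hsc]; nlinarith) (by
      have := Nat.mul_le_mul_right k (by omega : m * (32 * 4 ^ J + 1) ≤ M)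
      calc m * (2 * sc k J + 1) ≤ m * (2 * sc k J + k) := by gcongr
        _ = m * (32 * 4 ^ J + 1) * k := by rw [hsc]; ring
        _ ≤ _ := this.trans hMk)
  have hsck : ∀ j, k ≤ sc k j := fun j => by
    have := le_sc k j; omega
  have hv := H.variance hβ0 (fun j => h q _ hq ((by omega : s₁ ≤ M).trans (hkM.trans (hsck j)))) hD1
  have hw := isWeight_bw (act_nonneg q) (act_le_one hq)
  have e1 : (1 : ℝ) / D ≤ ε / 4 := by
    rw [div_lt_iff₀ hε0] at hD
    rw [div_le_iff₀ hD0]; linarith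
  have e2 : (D : ℝ) ^ 2 * (1 / m) ≤ ε / 4 := by
    rw [div_lt_iff₀ (by positivity)] at hm
    rw [mul_one_div, div_le_iff₀ hm0]; linarith
  have e3 : (D : ℝ) ^ 2 * β ^ J ≤ ε / 4 := by
    rw [lt_div_iff₀ (by positivity)] at hJ
    linarith
  have hkr : (1 : ℝ) ≤ k := by exact_mod_cast hk1
  have e4 : (D : ℝ) ^ 2 * ((2 * (2 * 2 ^ i : ℕ) + 3) ^ 2 * Real.exp (-(k : ℝ) ^ 2)) ≤ ε / 4 := by
    have a1 : (2 * (2 * 2 ^ i : ℕ) + 3 : ℝ) ≤ 11 * k ^ 2 := by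
      have : ((2 ^ i : ℕ) : ℝ) ≤ 2 * (k * k) := by exact_mod_cast hkk'
      push_cast at this ⊢
      nlinarith
    have a2 := Real.pow_div_factorial_le_exp ((k : ℝ) ^ 2) (by positivity) 3
    have a3 : (M₁ : ℝ) ≤ k := by exact_mod_cast (by omega : M₁ ≤ M).trans hkM
    have a4 : 2904 * D ^ 2 / ε < k := hM₁.trans_le a3
    rw [div_lt_iff₀ hε0] at a4
    calc _ ≤ (D : ℝ) ^ 2 * ((11 * k ^ 2) ^ 2 * Real.exp (-(k : ℝ) ^ 2)) := by gcongr
      _ ≤ (D : ℝ) ^ 2 * ((11 * k ^ 2) ^ 2 * (((k : ℝ) ^ 2) ^ 3 / 6)⁻¹) := by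
          rw [Real.exp_neg]; gcongr
          simpa [Nat.factorial] using a2
      _ = 726 * D ^ 2 / k ^ 2 := by field_simp; ring
      _ ≤ ε / 4 := by
          rw [div_le_iff₀ (by positivity)]
          nlinarith
  have hvar : Ex (bw (act q)) (fun a => (fw q (2 ^ i) a - Ex (bw (act q)) (fw q (2 ^ i))) ^ 2) ≤ ε := by
    refine le_trans (le_of_eq ?_) (hv.trans (by linarith [mul_add ((D : ℝ) ^ 2) (1 / m) ((2 * (2 * 2 ^ i : ℕ) + 3) ^ 2 * Real.exp (-(k : ℝ) ^ 2) + β ^ J), mul_add ((D : ℝ) ^ 2) ((2 * (2 * 2 ^ i : ℕ) + 3) ^ 2 * Real.exp (-(k : ℝ) ^ 2)) (β ^ J)]))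
    rfl
  have hE : Ex (bw (act q)) (fw q (2 ^ i)) ≤ 1 - 2 * c := by
    rw [Ex_fw]
    exact h q _ hq ((by omega : s₁ ≤ M).trans (hkM.trans ((Nat.le_mul_of_pos_left k hk1).trans hkk)))
  have hmk := mul_Pro_le hw (F := fun a => (fw q (2 ^ i) a - Ex (bw (act q)) (fw q (2 ^ i))) ^ 2) (fun a => sq_nonneg _)
    (A := {a | 1 - c < fw q (2 ^ i) a}) (c := c ^ 2) (fun a ha => by
      have : c ≤ fw q (2 ^ i) a - Ex (bw (act q)) (fw q (2 ^ i)) := by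
        have : 1 - c < fw q (2 ^ i) a := ha
        linarith
      exact pow_le_pow_left₀ hc.le this 2)
  have : c ^ 2 * Pro (bw (act q)) {a | 1 - c < fw q (2 ^ i) a} ≤ c ^ 2 * Real.exp (-B) := hmk.trans hvar
  exact le_of_mul_le_mul_left this (by positivity)

theorem region_tail (X₀ : ℕ) {c : ℝ} (hc : 0 < c) (hc1 : c ≤ 1) : ∃ i₁ : ℕ, ∀ i, i₁ ≤ i → ∀ B : ℝ, 400 ≤ B →
    ∀ {q X : ℕ} {W : Finset (ℤ × ℤ)} {K : Set (ℝ × ℝ)} {h : ℝ × ℝ → ℝ} {h₀ h₁ : ℝ},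
    Region q (2 ^ (i - 8 * (i / 32))) (i / 32) (2 ^ (5 * (i / 32))) X W K h h₀ h₁ → X ≤ X₀ * 2 ^ i →
    (∀ i', 3 * i ≤ 4 * i' → i' < i → Good c i' B) → ∀ Λ : ℝ, 0 < Λ → 6 * Λ ≤ Real.exp (c * (i / 32 : ℕ) / 4) →
    32 * Λ ≤ B * (i / 32 : ℕ) → ∀ t, Pro (bw (act q))
      {a | t ≤ |qcp (wpos q W) K h h₀ h₁ a - Ex (bw (act q)) (qcp (wpos q W) K h h₀ h₁)|} ≤ 4 * Real.exp (-(t * Λ)) := by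
  obtain ⟨J₁, hJ₁⟩ := exists_nat_gt (2 * (2 * X₀ + 9 : ℝ) ^ 2)
  refine ⟨32 * (J₁ + 1), fun i hi B hB q X W K h h₀ h₁ H hX hg Λ hΛ hΛ1 hΛ2 t => ?_⟩
  set J := i / 32 with hJ
  have hJ1 : J₁ + 1 ≤ J := by omega
  have hi63 : i ≤ 63 * J := by omega
  have hJr : (1 : ℝ) ≤ J := by exact_mod_cast (by omega : 1 ≤ J)
  set k := 2 ^ (i - 8 * J) with hk
  have l2 := Real.log_two_gt_d9
  have l2' := Real.log_two_lt_d9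
  have two_exp : ∀ n : ℕ, (2 : ℝ) ^ n ≤ Real.exp n := fun n => by
    rw [← Real.exp_one_pow]
    exact pow_le_pow_left₀ (by norm_num) (by linarith [Real.add_one_le_exp (1 : ℝ)]) _
  have exp_two : ∀ n : ℕ, Real.exp (n / 2 : ℝ) ≤ (2 : ℝ) ^ n := fun n => by
    rw [← Real.exp_log (show (0 : ℝ) < 2 by norm_num), ← Real.exp_nat_mul, Real.exp_le_exp, Real.exp_log (by norm_num)]
    have : (0 : ℝ) ≤ n := Nat.cast_nonneg n
    nlinarith
  have hs : ((2 : ℝ) ^ i) ≤ Real.exp (63 * J) := (two_exp i).trans (Real.exp_le_exp.2 (by exact_mod_cast hi63))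
  have hX' : (X : ℝ) ≤ X₀ * 2 ^ i := by exact_mod_cast hX
  have hs1 : (1 : ℝ) ≤ 2 ^ i := one_le_pow₀ (by norm_num)
  have hks : (k : ℝ) ≤ 2 ^ i := by
    have : k ≤ 2 ^ i := Nat.pow_le_pow_right (by norm_num) (by omega)
    exact_mod_cast this
  have hJe : 2 * (2 * X₀ + 9 : ℝ) ^ 2 ≤ Real.exp J := by
    refine hJ₁.le.trans (le_trans ?_ ((by linarith : (J : ℝ) ≤ J + 1).trans (Real.add_one_le_exp _)))
    exact_mod_cast (by omega : J₁ ≤ J)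
  have hC : ((2 * X₀ + 9) * 2 ^ i : ℝ) ^ 2 ≤ Real.exp (127 * J) / 2 := by
    calc ((2 * X₀ + 9) * 2 ^ i : ℝ) ^ 2 = (2 * X₀ + 9 : ℝ) ^ 2 * (2 ^ i) ^ 2 := by ring
      _ ≤ (Real.exp J / 2) * (Real.exp (63 * J)) ^ 2 := by gcongr; linarith
      _ = Real.exp (127 * J) / 2 := by
        rw [div_mul_eq_mul_div, ← Real.exp_nat_mul, ← Real.exp_add]; congr 2; push_cast; ring
  refine H.tail hc.le (by linarith) (B := B) (fun j => ?_) hΛ ?_ ?_ t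
  · rw [sc_two_pow]
    exact hg _ (by omega) (by have := j.2; omega) q H.q_pos
  · have a1 : (1 : ℝ) / (2 ^ (5 * J) : ℕ) ≤ Real.exp (-(c * J / 2)) := by
      rw [Real.exp_neg, one_div]
      refine inv_anti₀ (Real.exp_pos _) ?_
      push_cast
      refine le_trans ?_ (exp_two _)
      rw [Real.exp_le_exp]; push_cast; nlinarith
    have a2 : (6 * Λ) ^ 2 ≤ Real.exp (c * J / 2) := by
      refine (pow_le_pow_left₀ (by linarith) hΛ1 2).trans_eq ?_
      rw [← Real.exp_nat_mul]; congr 1; push_cast; ring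
    calc 16 * (1 / (2 ^ (5 * J) : ℕ) + Real.exp (-(c * J / 2))) * Λ ^ 2
        ≤ 16 * (Real.exp (-(c * J / 2)) + Real.exp (-(c * J / 2))) * (Real.exp (c * J / 2) / 36) := by
          gcongr; nlinarith
      _ = 32 / 36 * (Real.exp (-(c * J / 2)) * Real.exp (c * J / 2)) := by ring
      _ ≤ 1 := by rw [← Real.exp_add]; norm_num
  · have b1 : (2 * X + 3 : ℝ) ^ 2 ≤ Real.exp (127 * J) / 2 := by
      refine le_trans (pow_le_pow_left₀ (by positivity) ?_ 2) hC
      nlinarith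
    have b2 : (2 * X + 6 * k + 3 : ℝ) ^ 2 ≤ Real.exp (127 * J) / 2 := by
      refine le_trans (pow_le_pow_left₀ (by positivity) ?_ 2) hC
      nlinarith
    have c1 : Real.exp (127 * J) * Real.exp (-(k : ℝ) ^ 2) ≤ Real.exp (-(4 * Λ)) := by
      rw [← Real.exp_add, Real.exp_le_exp]
      have d1 : (2 : ℝ) ^ J * 128 ≤ (k : ℝ) ^ 2 := by
        have : 2 ^ J * 2 ^ 7 ≤ k ^ 2 := by
          rw [hk, ← pow_add, ← pow_mul]
          exact Nat.pow_le_pow_right (by norm_num) (by omega)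
        exact_mod_cast this
      have d2 : (J : ℝ) ≤ 2 ^ J := by exact_mod_cast Nat.lt_two_pow_self.le
      have d3 : Real.exp (c * J / 4) ≤ 2 ^ J := by
        refine le_trans ?_ (exp_two J)
        rw [Real.exp_le_exp]; nlinarith
      linarith
    have c2 : Real.exp (127 * J) * (2 ^ J * Real.exp (-(B * J / 2))) ≤ Real.exp (-(4 * Λ)) := by
      calc _ ≤ Real.exp (127 * J) * (Real.exp J * Real.exp (-(B * J / 2))) := by gcongr; exact two_exp J
        _ ≤ _ := by
          rw [← Real.exp_add, ← Real.exp_add, Real.exp_le_exp]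
          nlinarith
    calc _ ≤ Real.exp (127 * J) / 2 * Real.exp (-(k : ℝ) ^ 2) +
          Real.exp (127 * J) / 2 * (2 ^ J * Real.exp (-(B * J / 2))) := by gcongr
      _ ≤ _ := by linarith

end Scales

section Iteration

theorem good_step {c : ℝ} (hc : 0 < c) (hc1 : c ≤ 1) {s₁ : ℕ}
    (h : ∀ q s : ℕ, 0 < q → s₁ ≤ s → Pro (sw q) {ω | WX q s ω} ≤ 1 - 2 * c) :
    ∃ i₁ : ℕ, ∀ i, i₁ ≤ i → ∀ B : ℝ, 400 ≤ B → (∀ i', 3 * i ≤ 4 * i' → i' < i → Good c i' B) →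
    ∀ Λ : ℝ, 0 < Λ → 6 * Λ ≤ Real.exp (c * (i / 32 : ℕ) / 4) → 32 * Λ ≤ B * (i / 32 : ℕ) →
    Good c i (c * Λ - Real.log 4) := by
  obtain ⟨i₁, hi₁⟩ := region_tail 2 hc hc1
  refine ⟨i₁ + 192 + s₁, fun i hi B hB hg Λ hΛ hΛ1 hΛ2 q hq => ?_⟩
  set J := i / 32 with hJ
  have hpow : ∀ {a b : ℕ}, a ≤ b → 2 ^ a ≤ 2 ^ b := fun hab => Nat.pow_le_pow_right (by norm_num) hab
  have hsc : sc (2 ^ (i - 8 * J)) J = 2 ^ (i - 6 * J + 4) := by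
    rw [sc_two_pow]; congr 1; omega
  have H := region_win (k := 2 ^ (i - 8 * J)) (J := J) (m := 2 ^ (5 * J)) (s := 2 ^ i) hq (by positivity) (by positivity)
    (by
      rw [hsc]
      have h1 : 0 < 2 ^ (i - 6 * J + 4) := by positivity
      calc 10 * 2 ^ (i - 6 * J + 4) < 2 ^ 4 * 2 ^ (i - 6 * J + 4) := by omega
        _ = 2 ^ (4 + (i - 6 * J + 4)) := by rw [pow_add _ 4 (i - 6 * J + 4)]
        _ ≤ 2 ^ i := hpow (by omega))
    (by
      rw [hsc]
      have h1 : 0 < 2 ^ (i - 6 * J + 4) := by positivity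
      calc 2 ^ (5 * J) * (2 * 2 ^ (i - 6 * J + 4) + 1) ≤ 2 ^ (5 * J) * (2 ^ 2 * 2 ^ (i - 6 * J + 4)) := by
            gcongr; omega
        _ = 2 ^ (5 * J + (2 + (i - 6 * J + 4))) := by rw [pow_add _ (5 * J) (2 + (i - 6 * J + 4)), pow_add _ 2 (i - 6 * J + 4)]
        _ ≤ 2 ^ i := hpow (by omega))
  have hE : Ex (bw (act q)) (fw q (2 ^ i)) ≤ 1 - 2 * c := by
    rw [Ex_fw]
    exact h q _ hq ((by omega : s₁ ≤ i).trans Nat.lt_two_pow_self.le)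
  have ht := hi₁ i (by omega) B hB H le_rfl hg Λ hΛ hΛ1 hΛ2 c
  refine (Pro_mono (isWeight_bw (act_nonneg q) (act_le_one hq)) fun a ha => ?_).trans (ht.trans_eq ?_)
  · have h1 : 1 - c < fw q (2 ^ i) a := ha
    have h2 : c ≤ fw q (2 ^ i) a - Ex (bw (act q)) (fw q (2 ^ i)) := by linarith
    exact h2.trans (le_abs_self _)
  · rw [neg_sub, Real.exp_sub, Real.exp_log (by norm_num), Real.exp_neg]
    rfl

theorem log_sq_le {u : ℝ} (hu : 1 ≤ u) : Real.log u ^ 2 ≤ 4 * u := by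
  have h1 : Real.log (√u) ≤ √u := (Real.log_le_sub_one_of_pos (by positivity)).trans (by linarith)
  rw [Real.log_sqrt (by linarith)] at h1
  have h2 := Real.log_nonneg hu
  have h3 := Real.sq_sqrt (by linarith : 0 ≤ u)
  nlinarith

/-- The exponent of the iterated bound. -/
noncomputable def alph : ℝ := 1 / (2 * Real.log (4 / 3))

theorem log_four_thirds : 1 / 4 ≤ Real.log (4 / 3) := by
  have := Real.one_sub_inv_le_log_of_pos (show (0 : ℝ) < 4 / 3 by norm_num)
  norm_num at this ⊢; linarith

theorem alph_pos : 0 < alph := by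
  have := log_four_thirds
  unfold alph; positivity

theorem alph_le : alph ≤ 2 := by
  have := log_four_thirds
  unfold alph
  rw [div_le_iff₀ (by positivity)]; linarith

theorem alph_mul : 2 * alph * Real.log (4 / 3) = 1 := by
  have := log_four_thirds
  unfold alph
  field_simp

set_option maxHeartbeats 1000000 in
theorem good_closed {c : ℝ} (hc : 0 < c) (hc1 : c ≤ 1) {s₁ : ℕ}
    (h : ∀ q s : ℕ, 0 < q → s₁ ≤ s → Pro (sw q) {ω | WX q s ω} ≤ 1 - 2 * c) {B : ℝ} (hB : 400 ≤ B) :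
    ∃ i₀ : ℕ, 1 ≤ i₀ ∧ ∀ i : ℕ, i₀ ≤ i → Good c i (B * Real.exp (alph * Real.log (i / i₀) ^ 2)) := by
  obtain ⟨i₁, hstep⟩ := good_step hc hc1 h
  obtain ⟨ib, hbase⟩ := good_base hc h (2 * B)
  obtain ⟨n₁, hn₁⟩ := exists_nat_gt (4096 / c)
  obtain ⟨n₂, hn₂⟩ := exists_nat_gt (6144 * B / c ^ 2)
  set i₀ := i₁ + ib + n₁ + n₂ + 32 with hi₀
  have hi₀r : (0 : ℝ) < i₀ := by exact_mod_cast (by omega : 0 < i₀)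
  have hl := log_four_thirds
  have ha := alph_pos
  refine ⟨i₀, by omega, fun i => ?_⟩
  induction i using Nat.strong_induction_on with
  | _ i ih =>
  intro hi
  have hir : (i₀ : ℝ) ≤ i := by exact_mod_cast hi
  have hu : 1 ≤ (i / i₀ : ℝ) := (one_le_div hi₀r).2 hir
  set L := Real.log (i / i₀) with hL
  have hL0 : 0 ≤ L := Real.log_nonneg hu
  rcases lt_or_ge L (Real.log (4 / 3)) with hlt | hge
  · refine (hbase i (by omega)).mono ?_
    have h1 : alph * L ^ 2 ≤ Real.log (4 / 3) := by
      have : alph * L ^ 2 ≤ alph * Real.log (4 / 3) ^ 2 := by gcongr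
      nlinarith [alph_mul]
    have h2 := Real.exp_le_exp.2 h1
    rw [Real.exp_log (by norm_num)] at h2
    nlinarith
  · set b := B * Real.exp (alph * L ^ 2) with hb
    set B' := B * Real.exp (alph * (L - Real.log (4 / 3)) ^ 2) with hB'
    have hbB : B ≤ b := le_mul_of_one_le_right (by linarith) (Real.one_le_exp (by positivity))
    have hBB' : B ≤ B' := le_mul_of_one_le_right (by linarith) (Real.one_le_exp (by positivity))
    have hi43 : (4 / 3 : ℝ) ≤ i / i₀ := by
      rwa [hL, Real.log_le_log_iff (by norm_num) (by linarith)] at hge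
    have hg : ∀ i', 3 * i ≤ 4 * i' → i' < i → Good c i' B' := fun i' h3 hlt => by
      have h3r : (3 * i : ℝ) ≤ 4 * i' := by exact_mod_cast h3
      rw [div_le_div_iff₀ (by norm_num) hi₀r] at hi43
      have hi' : (i₀ : ℝ) ≤ i' := by linarith
      refine (ih i' hlt (by exact_mod_cast hi')).mono ?_
      have : L - Real.log (4 / 3) ≤ Real.log (i' / i₀) := by
        rw [hL, ← Real.log_div (by positivity) (by norm_num)]
        refine Real.log_le_log (by positivity) ?_
        rw [div_div, div_le_div_iff₀ (by positivity) hi₀r]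
        nlinarith
      have h0 : 0 ≤ L - Real.log (4 / 3) := by linarith
      exact mul_le_mul_of_nonneg_left (Real.exp_le_exp.2 (mul_le_mul_of_nonneg_left
        (pow_le_pow_left₀ h0 this 2) ha.le)) (by linarith)
    have hlog4 : Real.log 4 ≤ b := by
      have := Real.log_le_sub_one_of_pos (show (0 : ℝ) < 4 by norm_num)
      linarith
    have hb0 : 0 < b := by linarith
    have hlog0 : 0 ≤ Real.log 4 := Real.log_nonneg (by norm_num)
    set Λ := (b + Real.log 4) / c with hΛ
    have hΛb : Λ ≤ 2 * b / c := by rw [hΛ]; gcongr; linarith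
    have hJi : (i : ℝ) / 64 ≤ (i / 32 : ℕ) := by
      rw [div_le_iff₀ (by norm_num)]
      exact_mod_cast (by omega : i ≤ i / 32 * 64)
    have hi0c : 4096 / c ≤ i₀ := hn₁.le.trans (by exact_mod_cast (by omega : n₁ ≤ i₀))
    have hi0c' : 6144 * B / c ^ 2 ≤ i₀ := hn₂.le.trans (by exact_mod_cast (by omega : n₂ ≤ i₀))
    rw [div_le_iff₀ (by positivity)] at hi0c hi0c'
    have hbB' : b * (i₀ / i) ≤ B' := by
      have e : (i₀ / i : ℝ) = Real.exp (-L) := by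
        rw [Real.exp_neg, hL, Real.exp_log (by linarith), inv_div]
      rw [e, hb, hB', mul_assoc, ← Real.exp_add]
      gcongr
      nlinarith [alph_mul, sq_nonneg (Real.log (4 / 3))]
    refine (hstep i (by omega) B' (hB.trans hBB') hg Λ (by positivity) ?_ ?_).mono ?_
    · calc 6 * Λ ≤ 12 * B / c * Real.exp (alph * L ^ 2) := by
            refine (mul_le_mul_of_nonneg_left hΛb (by norm_num)).trans_eq ?_
            rw [hb]; ring
        _ ≤ Real.exp (c * i₀ / 512) * Real.exp (c * i / 512) := by
            gcongr
            · refine le_trans ?_ ((by linarith : c * i₀ / 512 ≤ c * i₀ / 512 + 1).trans (Real.add_one_le_exp _))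
              rw [div_le_iff₀ hc]
              nlinarith
            · have h1 := log_sq_le hu
              have h2 : (i / i₀ : ℝ) * 4096 ≤ c * i := by
                rw [div_mul_eq_mul_div, div_le_iff₀ hi₀r]
                have : (0 : ℝ) ≤ i := by linarith
                nlinarith
              have h3 := alph_le
              have h4 : alph * L ^ 2 ≤ 2 * (4 * (i / i₀)) := by gcongr
              linarith
        _ ≤ Real.exp (c * (i / 32 : ℕ) / 4) := by
            rw [← Real.exp_add, Real.exp_le_exp]
            nlinarith
    · calc 32 * Λ ≤ 64 * b / c := (mul_le_mul_of_nonneg_left hΛb (by norm_num)).trans_eq (by ring)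
        _ ≤ b * (i₀ / 64) := by
            rw [div_le_iff₀ hc]
            nlinarith
        _ = b * (i₀ / i) * (i / 64) := by
            have : (i : ℝ) ≠ 0 := (hi₀r.trans_le hir).ne'
            field_simp
        _ ≤ B' * (i / 32 : ℕ) := by gcongr
    · rw [hΛ, mul_div_cancel₀ _ hc.ne']; linarith

end Iteration

section Rectangle

/-- The sites whose lattice cell lies in the rectangle `[-2 a, 2 a] × [-2 b, 2 b]`. -/
noncomputable def RW (q : ℕ) (a b : ℝ) : Finset (ℤ × ℤ) :=
  Finset.Icc ⌈-(2 * a) * q⌉ (⌊2 * a * q⌋ - 1) ×ˢ Finset.Icc ⌈-(2 * b) * q⌉ (⌊2 * b * q⌋ - 1)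

theorem mem_RW {q : ℕ} {a b : ℝ} {z : ℤ × ℤ} : z ∈ RW q a b ↔
    (-(2 * a) * q ≤ z.1 ∧ (z.1 + 1 : ℝ) ≤ 2 * a * q) ∧ -(2 * b) * q ≤ z.2 ∧ (z.2 + 1 : ℝ) ≤ 2 * b * q := by
  have h : ∀ (u : ℤ) (y : ℝ), u ≤ ⌊y⌋ - 1 ↔ (u + 1 : ℝ) ≤ y := fun u y => by
    rw [le_sub_iff_add_le, Int.le_floor]; push_cast; rfl
  rw [RW, Finset.mem_product, Finset.mem_Icc, Finset.mem_Icc, Int.ceil_le, Int.ceil_le, h, h]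

theorem card_RW_le {q : ℕ} {a b : ℝ} (ha : 0 ≤ a) (hb : 0 ≤ b) : ((RW q a b).card : ℝ) ≤ 16 * a * b * q ^ 2 := by
  have h : ∀ y : ℝ, 0 ≤ y → ((⌊2 * y * q⌋ - 1 + 1 - ⌈-(2 * y) * q⌉).toNat : ℝ) ≤ 4 * y * q := fun y hy => by
    have h1 := Int.floor_le (2 * y * q)
    have h2 := Int.le_ceil (-(2 * y) * q)
    rw [← Int.cast_natCast, Int.toNat_eq_max]
    push_cast
    refine max_le ?_ (by positivity)
    linarith
  rw [RW, Finset.card_product, Int.card_Icc, Int.card_Icc]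
  push_cast
  refine (mul_le_mul (h a ha) (h b hb) (Nat.cast_nonneg _) (by positivity)).trans_eq (by ring)

theorem region_rect {q i X₀ : ℕ} (hq : 0 < q) (hi : 192 ≤ i) {a b : ℝ} (ha : 2 * 2 ^ i ≤ a) (hb : 2 * 2 ^ i ≤ b)
    (ha' : a ≤ X₀ * 2 ^ i) (hb' : b ≤ X₀ * 2 ^ i) :
    Region q (2 ^ (i - 8 * (i / 32))) (i / 32) (2 ^ (5 * (i / 32))) (X₀ * 2 ^ i) (RW q a b) (rect (-a) a (-b) b)
      Prod.fst (-a) a := by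
  set J := i / 32 with hJ
  have hpow : ∀ {a b : ℕ}, a ≤ b → 2 ^ a ≤ 2 ^ b := fun hab => Nat.pow_le_pow_right (by norm_num) hab
  have hsc : sc (2 ^ (i - 8 * J)) J = 2 ^ (i - 6 * J + 4) := by
    rw [sc_two_pow]; congr 1; omega
  have hq1 : (1 : ℝ) ≤ q := by exact_mod_cast hq
  have hq0 : (0 : ℝ) < q := by linarith
  have h1 : 0 < 2 ^ (i - 6 * J + 4) := by positivity
  have h3 : 3 * 2 ^ (i - 6 * J + 4) + 1 ≤ 2 ^ i := by
    calc 3 * 2 ^ (i - 6 * J + 4) + 1 ≤ 2 ^ 2 * 2 ^ (i - 6 * J + 4) := by omega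
      _ = 2 ^ (2 + (i - 6 * J + 4)) := by rw [pow_add _ 2 (i - 6 * J + 4)]
      _ ≤ 2 ^ i := hpow (by omega)
  have h3r : (3 * sc (2 ^ (i - 8 * J)) J + 1 : ℝ) ≤ 2 ^ i := by rw [hsc]; exact_mod_cast h3
  have hs : (0 : ℝ) < 2 ^ i := by positivity
  refine ⟨hq, by positivity, by positivity, (isCompact_rect _ _ _ _).isClosed, ?_, LipschitzWith.prod_fst, ?_, ?_⟩
  · rintro p ⟨⟨p1, p2⟩, p3, p4⟩
    push_cast
    rw [Prod.norm_def]
    exact max_le ((abs_le.2 ⟨p1, p2⟩).trans ha') ((abs_le.2 ⟨p3, p4⟩).trans hb')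
  · have : 2 ^ (5 * J) * (2 * sc (2 ^ (i - 8 * J)) J + 1) ≤ 2 ^ i := by
      rw [hsc]
      calc 2 ^ (5 * J) * (2 * 2 ^ (i - 6 * J + 4) + 1) ≤ 2 ^ (5 * J) * (2 ^ 2 * 2 ^ (i - 6 * J + 4)) := by
            gcongr; omega
        _ = 2 ^ (5 * J + (2 + (i - 6 * J + 4))) := by rw [pow_add _ (5 * J) (2 + (i - 6 * J + 4)), pow_add _ 2 (i - 6 * J + 4)]
        _ ≤ 2 ^ i := hpow (by omega)
    have : ((2 ^ (5 * J) : ℕ) * (2 * sc (2 ^ (i - 8 * J)) J + 1) : ℝ) ≤ 2 ^ i := by exact_mod_cast this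
    linarith
  · rintro z ⟨p, ⟨⟨p1, p2⟩, p3, p4⟩, hz⟩
    have z1 := (norm_fst_le _).trans hz
    have z2 := (norm_snd_le _).trans hz
    simp only [pos, Real.norm_eq_abs, abs_le, Prod.fst_sub, Prod.snd_sub] at z1 z2
    have key : ∀ (u : ℤ) (v a : ℝ), 2 * 2 ^ i ≤ a → -a ≤ v → v ≤ a → -(3 * sc (2 ^ (i - 8 * J)) J : ℝ) ≤ u / q - v →
        u / q - v ≤ (3 * sc (2 ^ (i - 8 * J)) J : ℝ) → -(2 * a) * q ≤ u ∧ (u + 1 : ℝ) ≤ 2 * a * q := by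
      intro u v a ha v1 v2 u1 u2
      constructor
      · rw [← le_div_iff₀ hq0]; linarith
      · have : (u : ℝ) / q ≤ 2 * a - 1 := by linarith
        rw [div_le_iff₀ hq0] at this
        nlinarith
    exact mem_RW.2 ⟨key _ _ _ ha p1 p2 z1.1 z1.2, key _ _ _ hb p3 p4 z2.1 z2.2⟩

end Rectangle

section Numerics

theorem iterated_le {lam x : ℝ} (hl : 0 < lam) {k : ℕ} (hk : 1 ≤ k) (hx : 2 ^ (k - 1) * lam ≤ x) :
    (1 / lam) ^ (k - 1) * x ^ k ≤ x * Real.exp (3 / 2 * Real.log (x / lam) ^ 2) := by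
  have hu : (2 : ℝ) ^ (k - 1) ≤ x / lam := by rwa [le_div_iff₀ hl]
  have hx0 : 0 ≤ x := le_trans (by positivity) hx
  have h1 : (1 : ℝ) ≤ 2 ^ (k - 1) := one_le_pow₀ (by norm_num)
  have e : (1 / lam) ^ (k - 1) * x ^ k = x * (x / lam) ^ (k - 1) := by
    obtain ⟨j, rfl⟩ := Nat.exists_eq_add_of_le' hk
    rw [Nat.add_sub_cancel, div_pow, pow_succ]; ring
  rw [e]
  refine mul_le_mul_of_nonneg_left ?_ hx0
  have hu0 : 0 < x / lam := by linarith
  have hv := Real.log_nonneg (h1.trans hu)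
  have hlog : (k - 1 : ℕ) * Real.log 2 ≤ Real.log (x / lam) := by
    rw [← Real.log_pow]; exact Real.log_le_log (by positivity) hu
  calc (x / lam) ^ (k - 1) = Real.exp ((k - 1 : ℕ) * Real.log (x / lam)) := by
        rw [Real.exp_nat_mul, Real.exp_log hu0]
    _ ≤ _ := by
      rw [Real.exp_le_exp]
      have := Real.log_two_gt_d9
      have : ((k - 1 : ℕ) : ℝ) ≤ 3 / 2 * Real.log (x / lam) := by
        have : (0 : ℝ) ≤ (k - 1 : ℕ) := Nat.cast_nonneg _
        nlinarith
      nlinarith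

theorem alph_ge : 3 / 2 ≤ alph := by
  have h1 := Real.log_le_sub_one_of_pos (show (0 : ℝ) < 4 / 3 by norm_num)
  have := log_four_thirds
  unfold alph
  rw [le_div_iff₀ (by positivity)]; linarith

theorem numerics {c : ℝ} (hc : 0 < c) {i₀ : ℝ} (hi₀ : 1 ≤ i₀) : ∃ l₀ : ℝ, 1 ≤ l₀ ∧ ∀ lam, l₀ ≤ lam → ∀ x, lam ≤ x →
    ∀ G, 0 ≤ G → G ≤ x * Real.exp (3 / 2 * Real.log (x / lam) ^ 2) →
    6 * (40 * G * (1 + x)) ≤ Real.exp (c * (x / 512)) ∧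
    32 * (40 * G * (1 + x)) ≤ 400 * Real.exp (alph * Real.log (3 * x / (8 * i₀)) ^ 2) * (x / 128) := by
  set μ₀ := 1 + Real.log (2200 * i₀) with hμ₀
  have hlog0 : 0 ≤ Real.log (2200 * i₀) := Real.log_nonneg (by linarith)
  refine ⟨max 1 (max (512 * 16 / c) (max (6 * 480 * 1024 ^ 3 / c ^ 3) (8 * i₀ / 3 * Real.exp μ₀))), le_max_left _ _,
    fun lam hlam x hx G hG0 hG => ?_⟩
  simp only [max_le_iff] at hlam
  obtain ⟨l1, l2, l3, l4⟩ := hlam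
  have hl0 : 0 < lam := by linarith
  have hx1 : 1 ≤ x := l1.trans hx
  have hu : 1 ≤ x / lam := (one_le_div hl0).2 hx
  set u := x / lam with hu'
  have hxu : x = lam * u := by rw [hu']; field_simp
  set v := Real.log u with hv
  have hv0 : 0 ≤ v := Real.log_nonneg hu
  have hev : Real.exp v = u := Real.exp_log (by linarith)
  have hv2 : v ^ 2 ≤ 4 * u := log_sq_le hu
  have hGx : G * (1 + x) ≤ 2 * x ^ 2 * Real.exp (3 / 2 * v ^ 2) := by
    calc G * (1 + x) ≤ (x * Real.exp (3 / 2 * v ^ 2)) * (2 * x) := by gcongr; linarith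
      _ = _ := by ring
  rw [div_le_iff₀ (by positivity)] at l2 l3
  constructor
  · calc 6 * (40 * G * (1 + x)) ≤ 480 * lam ^ 2 * (u ^ 2 * Real.exp (3 / 2 * v ^ 2)) := by
          rw [hxu] at hGx ⊢; nlinarith
      _ ≤ Real.exp (c * lam / 1024) * Real.exp (8 * u) := by
          gcongr
          · have := Real.pow_div_factorial_le_exp (c * lam / 1024) (by positivity) 3
            refine le_trans ?_ this
            rw [show ((Nat.factorial 3 : ℕ) : ℝ) = 6 by norm_num [Nat.factorial], le_div_iff₀ (by norm_num), div_pow,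
              le_div_iff₀ (by positivity)]
            have := mul_le_mul_of_nonneg_left l3 (sq_nonneg lam)
            nlinarith
          · have : u ^ 2 = Real.exp (2 * v) := by rw [← hev, ← Real.exp_nat_mul]; norm_num
            rw [this, ← Real.exp_add, Real.exp_le_exp]
            have : v ≤ u := by rw [← hev]; linarith [Real.add_one_le_exp v]
            linarith
      _ ≤ _ := by
          rw [← Real.exp_add, Real.exp_le_exp, hxu]
          nlinarith
  · have hM : Real.exp μ₀ ≤ 3 * lam / (8 * i₀) := by
      rw [le_div_iff₀ (by positivity)]; linarith
    set μ := Real.log (3 * lam / (8 * i₀)) with hμ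
    have hμμ : μ₀ ≤ μ := by rw [hμ, Real.le_log_iff_exp_le (by positivity)]; exact hM
    have heμ : Real.exp μ = 3 * lam / (8 * i₀) := Real.exp_log (by positivity)
    have hsum : Real.log (3 * x / (8 * i₀)) = v + μ := by
      rw [hv, hμ, ← Real.log_mul (by positivity) (by positivity)]
      congr 1; rw [hu']; field_simp
    have hkey : 820 * x ≤ Real.exp (v + 3 / 2 * μ ^ 2) := by
      calc 820 * x ≤ u * (2200 * i₀ * Real.exp μ) := by
            rw [heμ, hxu]
            have : 2200 * i₀ * (3 * lam / (8 * i₀)) = 825 * lam := by field_simp; norm_num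
            rw [this]
            nlinarith
        _ = Real.exp (v + (Real.log (2200 * i₀) + μ)) := by
            have e := Real.exp_log (show 0 < 2200 * i₀ by positivity)
            rw [Real.exp_add, Real.exp_add, hev, e]
        _ ≤ _ := by
            rw [Real.exp_le_exp]
            nlinarith
    have hexp : Real.exp (3 / 2 * v ^ 2) * (820 * x) ≤ Real.exp (alph * (v + μ) ^ 2) := by
      calc _ ≤ Real.exp (3 / 2 * v ^ 2) * Real.exp (v + 3 / 2 * μ ^ 2) := by gcongr
        _ ≤ _ := by
          rw [← Real.exp_add, Real.exp_le_exp]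
          have := alph_ge
          have h1 : 3 / 2 * (v + μ) ^ 2 ≤ alph * (v + μ) ^ 2 := by gcongr
          nlinarith
    rw [hsum]
    nlinarith

end Numerics

set_option maxHeartbeats 1000000 in
/-- Concentration of the conditional crossing probability of a large rectangle in the lattice model. -/
theorem lattice_tail {θ : ℝ} (hθ : 0 < θ) (hθ1 : θ < 1) : ∃ γ : ℝ, 0 < γ ∧ ∃ N : ℕ, 3 ≤ N ∧ ∀ k : ℕ, 1 ≤ k → ∀ n : ℕ,
    N ^ 2 ^ (k - 1) ≤ n → 40 * (γ ^ (k - 1) * Real.log n ^ k) * (1 + Real.log n) ≤ n ∧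
    ∀ a b : ℝ, √n * √θ / 4 ≤ a → √n * √θ / 4 ≤ b → a ≤ √n / (4 * √θ) → b ≤ √n / (4 * √θ) →
      ∀ q : ℕ, 0 < q → ∀ t, Pro (bw (act q))
        {σ | t ≤ |qcp (wpos q (RW q a b)) (rect (-a) a (-b) b) Prod.fst (-a) a σ -
          Ex (bw (act q)) (qcp (wpos q (RW q a b)) (rect (-a) a (-b) b) Prod.fst (-a) a)|} ≤
        4 * Real.exp (-(t * (40 * (γ ^ (k - 1) * Real.log n ^ k) * (1 + Real.log n)))) := by
  obtain ⟨c₀, hc₀, s₁, hs₁⟩ := annulus_crossing_le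
  set c := min (c₀ / 2) 1 with hcdef
  have hc : 0 < c := by positivity
  have hc1 : c ≤ 1 := min_le_right _ _
  have hann : ∀ q s : ℕ, 0 < q → s₁ ≤ s → Pro (sw q) {ω | WX q s ω} ≤ 1 - 2 * c := fun q s hq hs => by
    have := min_le_left (c₀ / 2) 1
    linarith [hs₁ q s hq hs]
  obtain ⟨i₀, hi₀, hgood⟩ := good_closed hc hc1 hann le_rfl
  have hi₀r : (1 : ℝ) ≤ i₀ := by exact_mod_cast hi₀
  obtain ⟨i₁, hi₁⟩ := region_tail ⌈4 / θ⌉₊ hc hc1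
  obtain ⟨l₀, hl₀, hnum⟩ := numerics hc hi₀r
  have hτ : 0 < √θ := Real.sqrt_pos.2 hθ
  have hτ1 : √θ < 1 := by rw [Real.sqrt_lt' one_pos]; simpa using hθ1
  have hττ : √θ * √θ = θ := Real.mul_self_sqrt hθ.le
  set D := -Real.log (√θ / 8) with hD
  have hD0 : 0 ≤ D := by
    rw [hD, neg_nonneg]; exact Real.log_nonpos (by positivity) (by linarith)
  set L := max l₀ (max (2 * 192) (max (2 * i₁) (max (8 * i₀ / 3) (10 * (1 + D))))) with hL
  set N := ⌈Real.exp L⌉₊ with hN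
  have hNe : Real.exp L ≤ N := Nat.le_ceil _
  have hN0 : (0 : ℝ) < N := (Real.exp_pos _).trans_le hNe
  set lam := Real.log N with hlam
  have hLl : L ≤ lam := by rw [hlam, Real.le_log_iff_exp_le hN0]; exact hNe
  have hlL := hLl
  rw [hL] at hlL
  simp only [max_le_iff] at hlL
  obtain ⟨m1, m2, m3, m4, m5⟩ := hlL
  have hlam0 : 0 < lam := by linarith
  refine ⟨1 / lam, by positivity, N, ?_, fun k hk n hn => ?_⟩
  · have : (3 : ℝ) ≤ N := by
      have := Real.add_one_le_exp L
      have : (2 * 192 : ℝ) ≤ L := (le_max_left _ _).trans (le_max_right _ _)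
      linarith
    exact_mod_cast this
  set x := Real.log n with hx
  have hNn : (N : ℝ) ^ 2 ^ (k - 1) ≤ n := by exact_mod_cast hn
  have hn0 : (0 : ℝ) < n := (by positivity : (0 : ℝ) < N ^ 2 ^ (k - 1)).trans_le hNn
  have hx1 : 2 ^ (k - 1) * lam ≤ x := by
    have := Real.log_le_log (by positivity) hNn
    rw [Real.log_pow] at this
    push_cast at this
    exact this
  have hlx : lam ≤ x := by
    refine le_trans ?_ hx1
    have : (1 : ℝ) ≤ 2 ^ (k - 1) := one_le_pow₀ (by norm_num)
    nlinarith
  have hx0 : 0 < x := hlam0.trans_le hlx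
  set G := (1 / lam) ^ (k - 1) * x ^ k with hG
  have hG0 : 0 < G := by positivity
  obtain ⟨n1, n2⟩ := hnum lam m1 x hlx G hG0.le (iterated_le hlam0 hk hx1)
  have hΛ0 : 0 < 40 * G * (1 + x) := by positivity
  have hexpx : Real.exp x = n := Real.exp_log hn0
  refine ⟨?_, fun a b ha hb ha' hb' q hq t => ?_⟩
  · have : Real.exp (c * (x / 512)) ≤ Real.exp x := Real.exp_le_exp.2 (by nlinarith)
    rw [hexpx] at this
    linarith
  have hs0 : 0 < √(n : ℝ) := Real.sqrt_pos.2 hn0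
  have hlogs : Real.log √(n : ℝ) = x / 2 := by rw [Real.log_sqrt hn0.le]
  have hlogv : Real.log (√n * √θ / 8) = x / 2 - D := by
    rw [mul_div_assoc, Real.log_mul (by positivity) (by positivity), hlogs, hD]; ring
  have hv0 : 0 < √n * √θ / 8 := by positivity
  have hv1 : 1 ≤ √n * √θ / 8 := by
    rw [← Real.exp_log hv0, hlogv]
    exact Real.one_le_exp (by linarith)
  obtain ⟨i, hi1, hi2⟩ := exists_nat_pow_near hv1 (by norm_num : (1 : ℝ) < 2)
  have l2' := Real.log_two_lt_d9
  have hix : x / 2 ≤ i := by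
    have := Real.log_le_log hv0 hi2.le
    rw [hlogv, Real.log_pow] at this
    push_cast at this
    have : ((i : ℝ) + 1) * Real.log 2 ≤ (i + 1) * 0.6931471808 := by gcongr
    nlinarith
  have hi192 : 192 ≤ i := by
    have : (192 : ℝ) ≤ i := by linarith
    exact_mod_cast this
  have hii₁ : i₁ ≤ i := by
    have : (i₁ : ℝ) ≤ i := by linarith
    exact_mod_cast this
  have hup : ∀ a, a ≤ √n / (4 * √θ) → a ≤ (⌈4 / θ⌉₊ : ℝ) * 2 ^ i := fun a ha => by
    refine ha.trans ?_
    calc √n / (4 * √θ) = 2 / θ * (√n * √θ / 8) := by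
          rw [show 2 / θ = 2 / (√θ * √θ) by rw [hττ]]; field_simp; norm_num
      _ ≤ 2 / θ * 2 ^ (i + 1) := by gcongr
      _ = 4 / θ * 2 ^ i := by rw [pow_succ]; ring
      _ ≤ _ := by gcongr; exact Nat.le_ceil _
  have hJ : x / 128 ≤ (i / 32 : ℕ) := by
    have : i ≤ 64 * (i / 32) := by omega
    have : (i : ℝ) ≤ 64 * (i / 32 : ℕ) := by exact_mod_cast this
    linarith
  have hlog1 : 1 ≤ 3 * x / (8 * i₀) := by
    rw [one_le_div (by positivity)]; linarith
  set B := 400 * Real.exp (alph * Real.log (3 * x / (8 * i₀)) ^ 2) with hB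
  have hB400 : 400 ≤ B := by
    have := Real.one_le_exp (show 0 ≤ alph * Real.log (3 * x / (8 * i₀)) ^ 2 from
      mul_nonneg alph_pos.le (sq_nonneg _))
    linarith
  refine hi₁ i hii₁ B hB400 (region_rect (X₀ := ⌈4 / θ⌉₊) hq hi192 (by linarith) (by linarith) (hup a ha') (hup b hb'))
    le_rfl (fun i' h1 _ => ?_) _ hΛ0 (n1.trans (Real.exp_le_exp.2 ?_)) (n2.trans ?_) t
  · have h1' : 3 * (i : ℝ) ≤ 4 * i' := by exact_mod_cast h1
    have hi'x : 3 * x / 8 ≤ i' := by linarith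
    have hi'₀ : i₀ ≤ i' := by
      have : (i₀ : ℝ) ≤ i' := by linarith
      exact_mod_cast this
    refine (hgood i' hi'₀).mono ?_
    rw [hB]
    have h2 : 3 * x / (8 * i₀) ≤ i' / i₀ := by
      rw [div_le_div_iff₀ (by positivity) (by positivity)]
      nlinarith
    have h3 := Real.log_nonneg hlog1
    have := alph_pos
    gcongr
  · nlinarith
  · gcongr

section Generic
set_option linter.unusedSectionVars false
variable {ι : Type*} [Fintype ι]

/-- Generic position of a finite configuration with respect to the rectangle `[-a, a] × [-b, b]`. -/
structure Gen (a b : ℝ) (y : ι → ℝ × ℝ) : Prop where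
  fst_ne : ∀ i j, i ≠ j → (y i).1 ≠ (y j).1
  snd_ne : ∀ i j, i ≠ j → (y i).2 ≠ (y j).2
  det_ne : ∀ i j k, i ≠ j → i ≠ k → j ≠ k →
    ((y j).1 - (y i).1) * ((y k).2 - (y i).2) - ((y j).2 - (y i).2) * ((y k).1 - (y i).1) ≠ 0
  edge : ∀ i j k, i ≠ j → i ≠ k → j ≠ k → ∀ p, sqDist p (y i) = sqDist p (y j) → sqDist p (y i) = sqDist p (y k) →
    |p.1| ≠ a ∧ |p.2| ≠ b
  corner : ∀ i j, i ≠ j → ∀ p : ℝ × ℝ, |p.1| = a → |p.2| = b → sqDist p (y i) ≠ sqDist p (y j)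
  four : ∀ i j k l, i ≠ j → i ≠ k → i ≠ l → j ≠ k → j ≠ l → k ≠ l → ∀ p, sqDist p (y i) = sqDist p (y j) →
    sqDist p (y i) = sqDist p (y k) → sqDist p (y i) ≠ sqDist p (y l)

theorem exists_dot_pos {u v : ℝ × ℝ} (h : u.1 * v.2 - u.2 * v.1 ≠ 0) :
    ∃ d : ℝ × ℝ, 0 < d.1 * u.1 + d.2 * u.2 ∧ 0 < d.1 * v.1 + d.2 * v.2 := by
  refine ⟨((v.2 - u.2) / (u.1 * v.2 - u.2 * v.1), (u.1 - v.1) / (u.1 * v.2 - u.2 * v.1)), ?_, ?_⟩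
  · have : (v.2 - u.2) / (u.1 * v.2 - u.2 * v.1) * u.1 + (u.1 - v.1) / (u.1 * v.2 - u.2 * v.1) * u.2 = 1 := by
      rw [div_mul_eq_mul_div, div_mul_eq_mul_div, ← add_div, div_eq_one_iff_eq h]; ring
    simp only [this]; exact one_pos
  · have : (v.2 - u.2) / (u.1 * v.2 - u.2 * v.1) * v.1 + (u.1 - v.1) / (u.1 * v.2 - u.2 * v.1) * v.2 = 1 := by
      rw [div_mul_eq_mul_div, div_mul_eq_mul_div, ← add_div, div_eq_one_iff_eq h]; ring
    simp only [this]; exact one_pos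

/-- A direction into the rectangle that prefers `i` and `i'` to all of the equidistant points of `r`. -/
theorem Gen.exists_dir {a b : ℝ} {y : ι → ℝ × ℝ} (H : Gen a b y) {p : ℝ × ℝ} (hp : p ∈ rect (-a) a (-b) b)
    {r : Set ι} {i i' : ι} (hi : i ∉ r) (hi' : i' ∉ r) (hii' : sqDist p (y i) = sqDist p (y i'))
    (hr : ∀ j ∈ r, sqDist p (y i) = sqDist p (y j)) :
    ∃ d : ℝ × ℝ, (|p.1| < a ∨ d.1 = 0) ∧ (|p.2| < b ∨ d.2 = 0) ∧ (|p.2| = b → d.2 = 0) ∧ ∀ j ∈ r,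
      0 < d.1 * ((y i).1 - (y j).1) + d.2 * ((y i).2 - (y j).2) ∧
      0 < d.1 * ((y i').1 - (y j).1) + d.2 * ((y i').2 - (y j).2) := by
  rcases r.eq_empty_or_nonempty with rfl | ⟨j, hj⟩
  · exact ⟨0, by simp⟩
  have ne : ∀ {i j}, i ∉ r → j ∈ r → i ≠ j := fun hi hj e => hi (e ▸ hj)
  have hij := ne hi hj
  have hi'j := ne hi' hj
  have h1 : |p.1| ≤ a := abs_le.2 (mem_rect.1 hp).1
  have h2 : |p.2| ≤ b := abs_le.2 (mem_rect.1 hp).2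
  have sq_pos' : ∀ {x y : ℝ}, x ≠ y → 0 < (x - y) * (x - y) := fun h => mul_self_pos.2 (sub_ne_zero.2 h)
  by_cases hbd : |p.1| < a ∧ |p.2| < b
  · have : ∃ d : ℝ × ℝ, ∀ j ∈ r, 0 < d.1 * ((y i).1 - (y j).1) + d.2 * ((y i).2 - (y j).2) ∧
      0 < d.1 * ((y i').1 - (y j).1) + d.2 * ((y i').2 - (y j).2) := by
      by_cases hne : i = i'
      · subst hne
        by_cases hj' : ∃ j' ∈ r, j' ≠ j
        · obtain ⟨j', hj', hjj⟩ := hj'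
          obtain ⟨d, hd1, hd2⟩ := exists_dot_pos (u := y i - y j) (v := y i - y j') (by
            have := H.det_ne i j j' hij (ne hi hj') hjj.symm
            contrapose! this
            simp only [Prod.fst_sub, Prod.snd_sub] at this
            linarith)
          refine ⟨d, fun l hl => ?_⟩
          have : l = j ∨ l = j' := by
            by_contra! hh
            exact H.four i j j' l hij (ne hi hj') (ne hi hl) hjj.symm hh.1.symm hh.2.symm p (hr _ hj) (hr _ hj') (hr _ hl)
          rcases this with rfl | rfl
          · exact ⟨hd1, hd1⟩
          · exact ⟨hd2, hd2⟩
        · push Not at hj'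
          refine ⟨y i - y j, fun l hl => ?_⟩
          rw [hj' l hl]
          have := sq_pos' (H.fst_ne i j hij)
          have := sq_pos' (H.snd_ne i j hij)
          simp only [Prod.fst_sub, Prod.snd_sub]
          exact ⟨by linarith, by linarith⟩
      · obtain ⟨d, hd1, hd2⟩ := exists_dot_pos (u := y i - y j) (v := y i' - y j) (by
          have := H.det_ne j i i' hij.symm hi'j.symm hne
          simpa only [Prod.fst_sub, Prod.snd_sub] using this)
        refine ⟨d, fun l hl => ?_⟩
        have : l = j := by
          by_contra hh
          exact H.four i i' j l hne hij (ne hi hl) hi'j (ne hi' hl) (Ne.symm hh) p hii' (hr _ hj) (hr _ hl)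
        subst this
        exact ⟨hd1, hd2⟩
    obtain ⟨d, hd⟩ := this
    exact ⟨d, Or.inl hbd.1, Or.inl hbd.2, fun h => absurd h hbd.2.ne, hd⟩
  · have hedge : |p.1| = a ∨ |p.2| = b := by
      by_contra! hh
      exact hbd ⟨lt_of_le_of_ne h1 hh.1, lt_of_le_of_ne h2 hh.2⟩
    have h3 : ∀ l m, i ≠ l → i ≠ m → l ≠ m → sqDist p (y i) = sqDist p (y l) → sqDist p (y i) = sqDist p (y m) → False :=
      fun l m e1 e2 e3 e4 e5 => by
        have := H.edge i l m e1 e2 e3 p e4 e5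
        rcases hedge with h | h
        exacts [this.1 h, this.2 h]
    have hne : i = i' := by
      by_contra hh
      exact h3 i' j hh hij hi'j hii' (hr _ hj)
    subst hne
    have hall : ∀ l ∈ r, l = j := fun l hl => by
      by_contra hh
      exact h3 l j (ne hi hl) hij hh (hr _ hl) (hr _ hj)
    have hc : ¬ (|p.1| = a ∧ |p.2| = b) := fun hh => H.corner i j hij p hh.1 hh.2 (hr _ hj)
    rcases hedge with h | h
    · have h2' : |p.2| < b := lt_of_le_of_ne h2 fun e => hc ⟨h, e⟩
      refine ⟨(0, (y i).2 - (y j).2), Or.inr rfl, Or.inl h2', fun e => absurd e h2'.ne, fun l hl => ?_⟩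
      rw [hall l hl]
      have := sq_pos' (H.snd_ne i j hij)
      simpa using this
    · have h1' : |p.1| < a := lt_of_le_of_ne h1 fun e => hc ⟨e, h⟩
      refine ⟨((y i).1 - (y j).1, 0), Or.inl h1', Or.inr rfl, fun e => rfl, fun l hl => ?_⟩
      rw [hall l hl]
      have := sq_pos' (H.fst_ne i j hij)
      simpa using this

theorem Gen.local_joined {a b : ℝ} {y : ι → ℝ × ℝ} (H : Gen a b y) [Nonempty ι] {p : ℝ × ℝ}
    (hp : p ∈ rect (-a) a (-b) b) {r : Set ι} (hF : p ∉ SR (y '' r) (y '' rᶜ)) :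
    (∃ V ∈ nhds p, ∀ z ∈ V ∩ (SR (y '' rᶜ) (y '' r) ∩ rect (-a) a (-b) b),
      ∀ w ∈ V ∩ (SR (y '' rᶜ) (y '' r) ∩ rect (-a) a (-b) b),
        JoinedIn (SR (y '' rᶜ) (y '' r) ∩ rect (-a) a (-b) b) z w) ∧
    ∀ V ∈ nhds p, ∃ z ∈ V ∩ (SR (y '' rᶜ) (y '' r) ∩ rect (-a) a (-b) b), |p.2| = b → z.2 = p.2 := by
  set K := rect (-a) a (-b) b
  set U := SR (y '' rᶜ) (y '' r)
  obtain ⟨i₀, hi₀⟩ := Finite.exists_min fun i => sqDist p (y i)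
  set T : Set ι := {i | sqDist p (y i) = sqDist p (y i₀)} with hT
  have hlt : ∀ i ∈ T, ∀ j ∉ T, sqDist p (y i) < sqDist p (y j) := fun i hi j hj =>
    lt_of_le_of_ne (hi.trans_le (hi₀ j)) fun e => hj (e.symm.trans hi)
  have hV : ∀ᶠ z in nhds p, ∀ i ∈ T, ∀ j ∉ T, sqDist z (y i) < sqDist z (y j) := by
    rw [Filter.eventually_all]; intro i
    by_cases hi : i ∈ T
    · refine (Filter.eventually_all.2 fun j => ?_).mono fun z hz _ => hz
      by_cases hj : j ∉ T
      · exact Filter.Eventually.mono ((isOpen_lt (continuous_sqDist_left _) (continuous_sqDist_left _)).mem_nhds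
          (hlt i hi j hj)) fun z hz _ => hz
      · exact Filter.Eventually.of_forall fun z h => absurd h hj
    · exact Filter.Eventually.of_forall fun z h => absurd h hi
  obtain ⟨δ, hδ, hδV⟩ := Metric.eventually_nhds_iff_ball.1 hV
  have hb : ∃ i ∈ T, i ∉ r := by
    by_contra! hh
    refine hF ⟨y i₀, ⟨i₀, hh i₀ rfl, rfl⟩, ?_⟩
    rintro _ ⟨j, hj, rfl⟩
    exact hlt i₀ rfl j fun hjT => hj (hh j hjT)
  set C : ι → Set (ℝ × ℝ) := fun i => {z | ∀ j ∈ T ∩ r,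
    0 < (z.1 - p.1) * ((y i).1 - (y j).1) + (z.2 - p.2) * ((y i).2 - (y j).2)} with hC
  have hCconv : ∀ i, Convex ℝ (C i) := fun i z hz w hw s t hs ht hst j hj => by
    have h1 := hz j hj
    have h2 := hw j hj
    have e1 : (s • z + t • w).1 - p.1 = s * (z.1 - p.1) + t * (w.1 - p.1) := by
      simp only [Prod.fst_add, Prod.smul_fst, smul_eq_mul]; linear_combination p.1 * hst
    have e2 : (s • z + t • w).2 - p.2 = s * (z.2 - p.2) + t * (w.2 - p.2) := by
      simp only [Prod.snd_add, Prod.smul_snd, smul_eq_mul]; linear_combination p.2 * hst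
    rw [e1, e2]
    rcases hs.eq_or_lt with rfl | hs
    · have : t = 1 := by linarith
      subst this; linarith
    · have := mul_pos hs h1
      have := mul_nonneg ht h2.le
      nlinarith
  have hell : ∀ i ∈ T, ∀ j ∈ T, ∀ z : ℝ × ℝ, sqDist z (y i) < sqDist z (y j) ↔
      0 < (z.1 - p.1) * ((y i).1 - (y j).1) + (z.2 - p.2) * ((y i).2 - (y j).2) := fun i hi j hj z => by
    have e : sqDist p (y i) = sqDist p (y j) := Eq.trans hi (Eq.symm hj)
    simp only [sqDist] at e ⊢
    constructor <;> intro h <;> nlinarith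
  have hUC : ∀ z ∈ Metric.ball p δ, z ∈ U ↔ ∃ i ∈ T, i ∉ r ∧ z ∈ C i := fun z hz => by
    constructor
    · rintro ⟨_, ⟨i, hi, rfl⟩, h⟩
      by_cases hTr : ∃ j ∈ T, j ∈ r
      · obtain ⟨j, hjT, hjr⟩ := hTr
        have hiT : i ∈ T := by
          by_contra hiT
          exact lt_asymm (h _ ⟨j, hjr, rfl⟩) (hδV z hz j hjT i hiT)
        exact ⟨i, hiT, hi, fun l hl => (hell i hiT l hl.1 z).1 (h _ ⟨l, hl.2, rfl⟩)⟩
      · push Not at hTr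
        obtain ⟨i', hi', hi'r⟩ := hb
        exact ⟨i', hi', hi'r, fun l hl => absurd hl.2 (hTr l hl.1)⟩
    · rintro ⟨i, hiT, hi, h⟩
      refine ⟨y i, ⟨i, hi, rfl⟩, ?_⟩
      rintro _ ⟨j, hj, rfl⟩
      by_cases hjT : j ∈ T
      · exact (hell i hiT j hjT z).2 (h j ⟨hjT, hj⟩)
      · exact hδV z hz i hiT j hjT
  have key : ∀ i ∈ T, i ∉ r → ∀ i' ∈ T, i' ∉ r → ∀ V ∈ nhds p, ∃ z ∈ V, z ∈ K ∧ z ∈ C i ∧ z ∈ C i' ∧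
      (|p.2| = b → z.2 = p.2) := fun i hiT hi i' hi'T hi' V hV => by
    obtain ⟨d, hd1, hd2, hd3, hd⟩ := H.exists_dir hp (r := T ∩ r) (i := i) (i' := i') (fun h => hi h.2) (fun h => hi' h.2)
      (Eq.trans hiT (Eq.symm hi'T)) (fun j hj => Eq.trans hiT (Eq.symm hj.1))
    have hcont : Continuous fun ε : ℝ => (p.1 + ε * d.1, p.2 + ε * d.2) := by fun_prop
    have ht : Filter.Tendsto (fun ε : ℝ => (p.1 + ε * d.1, p.2 + ε * d.2)) (nhds 0) (nhds p) := by
      simpa using hcont.tendsto 0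
    have hco : ∀ {u v c : ℝ}, |u| ≤ c → (|u| < c ∨ v = 0) → ∀ᶠ ε : ℝ in nhds 0, |u + ε * v| ≤ c := fun {u v c} h h' => by
      rcases h' with h' | rfl
      · have : Filter.Tendsto (fun ε : ℝ => |u + ε * v|) (nhds 0) (nhds |u|) := by
          have : Continuous fun ε : ℝ => |u + ε * v| := by fun_prop
          simpa using this.tendsto 0
        exact (this.eventually (gt_mem_nhds h')).mono fun _ h => h.le
      · simpa using h
    have e1 := hco (abs_le.2 (mem_rect.1 hp).1) hd1
    have e2 := hco (abs_le.2 (mem_rect.1 hp).2) hd2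
    have hev := ((ht.eventually hV).and (e1.and e2)).filter_mono (nhdsWithin_le_nhds (s := Ioi (0 : ℝ)))
    obtain ⟨ε, ⟨h1, h2, h3⟩, hε⟩ := (hev.and self_mem_nhdsWithin).exists
    have hε : 0 < ε := hε
    refine ⟨_, h1, ⟨abs_le.1 h2, abs_le.1 h3⟩, fun j hj => ?_, fun j hj => ?_, fun h => by simp [hd3 h]⟩
    · have := mul_pos hε (hd j hj).1
      simp only [add_sub_cancel_left]; linarith
    · have := mul_pos hε (hd j hj).2
      simp only [add_sub_cancel_left]; linarith
  refine ⟨⟨Metric.ball p δ, Metric.ball_mem_nhds _ hδ, ?_⟩, fun V hV => ?_⟩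
  · rintro z ⟨hzV, hzU, hzK⟩ w ⟨hwV, hwU, hwK⟩
    obtain ⟨i, hiT, hi, hzC⟩ := (hUC z hzV).1 hzU
    obtain ⟨i', hi'T, hi', hwC⟩ := (hUC w hwV).1 hwU
    obtain ⟨u, huV, huK, hu1, hu2, -⟩ := key i hiT hi i' hi'T hi' _ (Metric.ball_mem_nhds p hδ)
    have hj : ∀ i ∈ T, i ∉ r → ∀ z ∈ Metric.ball p δ, z ∈ K → z ∈ C i → u ∈ C i → JoinedIn (U ∩ K) z u :=
      fun i hiT hi z hzV hzK hzC huC => by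
        have hc : Convex ℝ (Metric.ball p δ ∩ K ∩ C i) := ((convex_ball p δ).inter (convex_rect ..)).inter (hCconv i)
        exact ((hc.isPathConnected ⟨u, ⟨huV, huK⟩, huC⟩).joinedIn z ⟨⟨hzV, hzK⟩, hzC⟩ u ⟨⟨huV, huK⟩, huC⟩).mono
          fun v hv => ⟨(hUC v hv.1.1).2 ⟨i, hiT, hi, hv.2⟩, hv.1.2⟩
    exact (hj i hiT hi z hzV hzK hzC hu1).trans (hj i' hi'T hi' w hwV hwK hwC hu2).symm
  · obtain ⟨i, hiT, hi⟩ := hb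
    obtain ⟨z, hzV, hzK, hzC, -, hz⟩ := key i hiT hi i hiT hi _ (Filter.inter_mem hV (Metric.ball_mem_nhds p hδ))
    exact ⟨z, ⟨hzV.1, (hUC z hzV.2).2 ⟨i, hiT, hi, hzC⟩, hzK⟩, hz⟩

/-- In generic position, a weak crossing yields a strict crossing. -/
theorem Gen.strict_of_weak {a b : ℝ} {y : ι → ℝ × ℝ} (H : Gen a b y) [Nonempty ι] (hb : 0 ≤ b) {r : Set ι} {P Q : ℝ × ℝ}
    (hP : P.2 = -b) (hQ : Q.2 = b) (h : JoinedIn (rect (-a) a (-b) b \ SR (y '' r) (y '' rᶜ)) P Q) :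
    ∃ P' Q' : ℝ × ℝ, P'.2 = -b ∧ Q'.2 = b ∧ JoinedIn (SR (y '' rᶜ) (y '' r) ∩ rect (-a) a (-b) b) P' Q' := by
  set W := SR (y '' rᶜ) (y '' r) ∩ rect (-a) a (-b) b with hW
  obtain ⟨γ, hγ⟩ := h
  have loc := fun t => H.local_joined (hγ t).1 (hγ t).2
  obtain ⟨⟨V₀, hV₀, hj₀⟩, hn₀⟩ := loc 0
  obtain ⟨P', hP'W, hP'⟩ := hn₀ V₀ hV₀
  rw [γ.source] at hP'
  have hP'b := hP' (by rw [hP, abs_neg, abs_of_nonneg hb])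
  set S : Set unitInterval := {t | ∃ V ∈ nhds (γ t), ∀ z ∈ V ∩ W, JoinedIn W P' z} with hS
  have near : ∀ t, ∃ V ∈ nhds t, ∀ s ∈ V, s ∈ S ↔ t ∈ S := fun t => by
    obtain ⟨⟨V, hV, hVj⟩, hVn⟩ := loc t
    refine ⟨γ ⁻¹' interior V, γ.continuous.continuousAt.preimage_mem_nhds (interior_mem_nhds.2 hV), fun s hs => ?_⟩
    have hVs : V ∈ nhds (γ s) := mem_interior_iff_mem_nhds.1 hs
    constructor
    · rintro ⟨V', hV', hj⟩
      obtain ⟨z, hz, -⟩ := (loc s).2 _ (Filter.inter_mem hVs hV')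
      exact ⟨V, hV, fun w hw => (hj z ⟨hz.1.2, hz.2⟩).trans (hVj z ⟨hz.1.1, hz.2⟩ w hw)⟩
    · rintro ⟨V', hV', hj⟩
      obtain ⟨z, hz, -⟩ := hVn _ (Filter.inter_mem hV hV')
      exact ⟨V, hVs, fun w hw => (hj z ⟨hz.1.2, hz.2⟩).trans (hVj z ⟨hz.1.1, hz.2⟩ w hw)⟩
  have hclopen : IsClopen S := by
    refine ⟨isOpen_compl_iff.1 (isOpen_iff_mem_nhds.2 fun t ht => ?_), isOpen_iff_mem_nhds.2 fun t ht => ?_⟩ <;>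
      obtain ⟨V, hV, h⟩ := near t
    · filter_upwards [hV] with s hs using fun hsS => ht ((h s hs).1 hsS)
    · filter_upwards [hV] with s hs using (h s hs).2 ht
  have h1 : (1 : unitInterval) ∈ S := by
    rw [hclopen.eq_univ ⟨0, V₀, hV₀, fun z hz => hj₀ P' hP'W z hz⟩]; trivial
  obtain ⟨V, hV, hVj⟩ := h1
  obtain ⟨Q', hQ'W, hQ'⟩ := (loc 1).2 V hV
  rw [γ.target] at hQ'
  exact ⟨P', Q', (hP'b).trans hP, (hQ' (by rw [hQ, abs_of_nonneg hb])).trans hQ, hVj Q' hQ'W⟩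

end Generic

section Stable
set_option linter.unusedSectionVars false
variable {ι : Type*} [Fintype ι]

theorem RS_true (y : ι → ℝ × ℝ) (c : ι → Bool) :
    RS y (fun i => (true, c i)) = SR (y '' {i | c i = true}) (y '' {i | c i = true}ᶜ) := by
  have h1 : {i | ((true, c i) : Bool × Bool) = (true, true)} = {i | c i = true} := by ext; simp
  have h2 : {i | ((true, c i) : Bool × Bool) = (true, false)} = {i | c i = true}ᶜ := by ext; simp
  rw [RS, h1, h2]

theorem RS_true_not (y : ι → ℝ × ℝ) (c : ι → Bool) :
    RS y (fun i => (true, !c i)) = SR (y '' {i | c i = true}ᶜ) (y '' {i | c i = true}) := by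
  have h : {i | (!c i) = true} = {i | c i = true}ᶜ := by ext; simp
  rw [RS_true y fun i => !c i, h, compl_compl]

theorem isOpen_RS_prod (ω : ι → Bool × Bool) : IsOpen {z : (ι → ℝ × ℝ) × (ℝ × ℝ) | z.2 ∈ RS z.1 ω} := by
  have e : {z : (ι → ℝ × ℝ) × (ℝ × ℝ) | z.2 ∈ RS z.1 ω} = ⋃ i ∈ {i | ω i = (true, true)},
      ⋂ j ∈ {j | ω j = (true, false)}, {z | sqDist z.2 (z.1 i) < sqDist z.2 (z.1 j)} := by
    ext z
    simp [RS, SR]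
  rw [e]
  refine isOpen_biUnion fun i _ => (toFinite _).isOpen_biInter fun j _ => ?_
  refine isOpen_lt ?_ ?_ <;> unfold sqDist <;> fun_prop

theorem joinedIn_RS_eventually {y : ι → ℝ × ℝ} {ω : ι → Bool × Bool} {K : Set (ℝ × ℝ)} {P Q : ℝ × ℝ}
    (h : JoinedIn (RS y ω ∩ K) P Q) : ∀ᶠ y' in nhds y, JoinedIn (RS y' ω ∩ K) P Q := by
  obtain ⟨γ, hγ⟩ := h
  obtain ⟨U, V, hU, -, hyU, hV, hUV⟩ := generalized_tube_lemma (isCompact_singleton (x := y))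
    (isCompact_range γ.continuous) (isOpen_RS_prod ω) (by
      rintro ⟨y', z⟩ ⟨hy', t, rfl⟩
      obtain rfl : y' = y := hy'
      exact (hγ t).1)
  filter_upwards [hU.mem_nhds (hyU rfl)] with y' hy'
  exact ⟨γ, fun t => ⟨hUV (mk_mem_prod hy' (hV (mem_range_self t))), (hγ t).2⟩⟩

theorem Gen.dichotomy {a b : ℝ} (ha : 0 < a) (hb : 0 < b) {y : ι → ℝ × ℝ} (H : Gen a b y) [Nonempty ι] (c : ι → Bool) :
    (∃ P Q : ℝ × ℝ, P.1 = -a ∧ Q.1 = a ∧ JoinedIn (RS y (fun i => (true, c i)) ∩ rect (-a) a (-b) b) P Q) ∨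
    ∃ P Q : ℝ × ℝ, P.2 = -b ∧ Q.2 = b ∧ JoinedIn (RS y (fun i => (true, !c i)) ∩ rect (-a) a (-b) b) P Q := by
  rw [RS_true, RS_true_not]
  by_contra! hh
  obtain ⟨P, Q, hP, hQ, hj⟩ := SR_duality (R := y '' {i | c i = true}) (B := y '' {i | c i = true}ᶜ)
    (show -a < a by linarith) (show -b < b by linarith)
    (fun _ => ((toFinite _).image y).inter_of_left _) (by
      rintro ⟨P, Q, hP, hQ, h⟩
      exact hh.1 P Q hP hQ h)
  obtain ⟨P', Q', hP', hQ', hj'⟩ := H.strict_of_weak hb.le hP hQ hj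
  exact hh.2 P' Q' hP' hQ' hj'

theorem false_of_cross {a b : ℝ} {V S : Set (ℝ × ℝ)} {P Q A B : ℝ × ℝ} (hP : P.2 ≤ -b) (hQ : b ≤ Q.2)
    (h : JoinedIn (V ∩ rect (-a) a (-b) b) P Q) (hS : S ⊆ rect (-a) a (-b) b) (hA : A.1 ≤ -a) (hB : a ≤ B.1)
    (h' : JoinedIn S A B) (hd : ∀ z ∈ S, z ∉ V) : False := by
  obtain ⟨z, hz, hz'⟩ := inter_nonempty_of_joinedIn h' h
    (fun z hz => ⟨hA.trans (mem_rect.1 hz.2).1.1, (mem_rect.1 hz.2).1.2.trans hB⟩)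
    (fun z hz => ⟨hP.trans (mem_rect.1 (hS hz)).2.1, (mem_rect.1 (hS hz)).2.2.trans hQ⟩)
  exact hd z hz hz'.1

theorem Gen.crossInd_eventually {n : ℕ} [NeZero n] {l α β : ℝ} (hl : 0 < l) (hα : 0 < α) (hβ : 0 < β) {R : Set (ℝ × ℝ)}
    (hR : rect (-α) α (-β) β ⊆ R) {η : Fin n → ℝ × ℝ} (H : Gen (l * α) (l * β) fun i => l • η i) (c : Fin n → Bool) :
    ∀ᶠ y in nhds (fun i => l • η i), crossInd y (rect (-(l * α)) (l * α) (-(l * β)) (l * β)) Prod.fst (-(l * α)) (l * α)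
      (fun i => (true, c i)) = if Crossing R (-α) α (-β) β η c then 1 else 0 := by
  have hsq : ∀ p x : ℝ × ℝ, sqDist (l • p) (l • x) = l ^ 2 * sqDist p x := fun p x => by
    simp only [sqDist, Prod.smul_fst, Prod.smul_snd, smul_eq_mul]; ring
  have hl2 : 0 < l ^ 2 := by positivity
  have hrect : ∀ p, l • p ∈ rect (-(l * α)) (l * α) (-(l * β)) (l * β) ↔ p ∈ rect (-α) α (-β) β := fun p => by
    simp only [mem_rect, Prod.smul_fst, Prod.smul_snd, smul_eq_mul, ← mul_neg, mul_le_mul_iff_right₀ hl]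
  have hinv : ∀ p : ℝ × ℝ, l • (l⁻¹ • p) = p := fun p => smul_inv_smul₀ hl.ne' p
  rcases H.dichotomy (by positivity) (by positivity) c with ⟨P, Q, hP, hQ, hj⟩ | ⟨P, Q, hP, hQ, hj⟩
  · have hcr : Crossing R (-α) α (-β) β η c := by
      obtain ⟨γ, hγ⟩ := hj
      refine ⟨fun t => l⁻¹ • γ.extend t, Continuous.continuousOn (by fun_prop), fun t _ => ?_, ?_, ?_⟩
      · obtain ⟨s, hs⟩ : γ.extend t ∈ range γ := by rw [← γ.extend_range]; exact mem_range_self t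
        obtain ⟨⟨_, ⟨i, hi, rfl⟩, hcl⟩, hK⟩ := hγ s
        rw [hs] at hcl hK
        rw [← hinv (γ.extend t), hrect] at hK
        have hi : ((true, c i) : Bool × Bool) = (true, true) := hi
        obtain ⟨k, hk, hmin⟩ := Finset.exists_min_image (Finset.univ.filter fun k => c k = true)
          (fun k => sqDist (l⁻¹ • γ.extend t) (η k)) ⟨i, by simpa using hi⟩
        have hck : c k = true := by simpa using hk
        refine ⟨mem_iUnion₂.2 ⟨k, hck, hR hK, fun j => ?_⟩, hK⟩
        by_cases hj : c j = true
        · exact hmin j (by simpa using hj)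
        · have h1 := hcl (l • η j) ⟨j, by simpa using hj, rfl⟩
          have h2 := hmin i (by simpa using hi)
          rw [← hinv (γ.extend t), hsq, hsq, mul_lt_mul_iff_right₀ hl2] at h1
          exact h2.trans h1.le
      · simp [hP, hl.ne']
      · simp [hQ, hl.ne']
    filter_upwards [joinedIn_RS_eventually hj] with y hy
    rw [if_pos hcr, crossInd, if_pos ⟨P, Q, hP.le, hQ.ge, hy⟩]
  · have hcr : ¬ Crossing R (-α) α (-β) β η c := by
      rintro ⟨γ, hγ, hγ', h0, h1⟩
      refine false_of_cross (A := l • γ 0) (B := l • γ 1) hP.le hQ.ge hj (S := (l • ·) '' (γ '' Icc 0 1)) ?_ ?_ ?_ ?_ ?_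
      · rintro _ ⟨_, ⟨t, ht, rfl⟩, rfl⟩
        exact (hrect _).2 (hγ' t ht).2
      · simp [h0]
      · simp [h1]
      · refine JoinedIn.ofLine (f := fun t => l • γ t) (hγ.const_smul l) rfl rfl ?_
        rintro _ ⟨t, ht, rfl⟩
        exact ⟨_, ⟨t, ht, rfl⟩, rfl⟩
      · rintro _ ⟨_, ⟨t, ht, rfl⟩, rfl⟩ ⟨_, ⟨i, hi, rfl⟩, hcl⟩
        obtain ⟨k, hk, hkc⟩ := mem_iUnion₂.1 (hγ' t ht).1
        have hk : c k = true := hk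
        have := hcl (l • η k) ⟨k, by simp [hk], rfl⟩
        simp only [hsq, mul_lt_mul_iff_right₀ hl2] at this
        exact absurd (hkc.2 i) (not_le.2 this)
    filter_upwards [joinedIn_RS_eventually hj] with y hy
    rw [if_neg hcr, crossInd, if_neg]
    rintro ⟨A, B, hA, hB, hAB⟩
    refine false_of_cross hP.le hQ.ge hy inter_subset_right hA hB hAB fun z hz hz' => ?_
    rw [RS_true] at hz
    rw [RS_true_not] at hz'
    obtain ⟨⟨x, hx, h1⟩, -⟩ := hz
    obtain ⟨x', hx', h2⟩ := hz'
    exact lt_asymm (h1 x' hx') (h2 x hx)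

theorem Gen.qcp_eventually {n : ℕ} [NeZero n] {l α β : ℝ} (hl : 0 < l) (hα : 0 < α) (hβ : 0 < β) {R : Set (ℝ × ℝ)}
    (hR : rect (-α) α (-β) β ⊆ R) {η : Fin n → ℝ × ℝ} (H : Gen (l * α) (l * β) fun i => l • η i) :
    ∀ᶠ y in nhds (fun i => l • η i), qcp y (rect (-(l * α)) (l * α) (-(l * β)) (l * β)) Prod.fst (-(l * α)) (l * α)
      (fun _ => true) = condProb R (-α) α (-β) β η := by
  filter_upwards [Filter.eventually_all.2 fun c => H.crossInd_eventually hl hα hβ hR c] with y hy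
  have hbw : ∀ s, bw (1 / 2) s = 1 / 2 := fun s => by cases s <;> norm_num [bw]
  rw [qcp, Ex, condProb]
  simp only [hy, hbw, Finset.prod_const, Finset.card_univ, Fintype.card_fin]
  rw [← Finset.mul_sum, Finset.sum_boole, one_div, inv_pow, inv_mul_eq_div]
  congr
  exact Subsingleton.elim _ _

end Stable

section AlmostEverywhere

theorem volume_quadric_eq_zero {E F G : ℝ} (K : ℝ) (h : E ≠ 0 ∨ F ≠ 0 ∨ G ≠ 0) :
    volume {x : ℝ × ℝ | E * (x.1 ^ 2 + x.2 ^ 2) + F * x.1 + G * x.2 + K = 0} = 0 := by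
  have hm : MeasurableSet {x : ℝ × ℝ | E * (x.1 ^ 2 + x.2 ^ 2) + F * x.1 + G * x.2 + K = 0} :=
    (isClosed_eq (by fun_prop) continuous_const).measurableSet
  rw [Measure.volume_eq_prod, Measure.measure_prod_null hm]
  by_cases hEG : E = 0 ∧ G = 0
  · obtain ⟨rfl, rfl⟩ := hEG
    have hF : F ≠ 0 := by simpa using h
    have : ∀ᵐ x : ℝ, x ≠ -K / F := by simp [ae_iff]
    filter_upwards [this] with x hx
    have : Prod.mk x ⁻¹' {x : ℝ × ℝ | 0 * (x.1 ^ 2 + x.2 ^ 2) + F * x.1 + 0 * x.2 + K = 0} = ∅ := by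
      refine eq_empty_of_forall_notMem fun y hy => hx ?_
      have hy : 0 * (x ^ 2 + y ^ 2) + F * x + 0 * y + K = 0 := hy
      field_simp; linarith
    rw [this]; simp
  · refine Filter.Eventually.of_forall fun x => ?_
    obtain ⟨c, hc⟩ : ∃ c, c = E * x ^ 2 + F * x + K := ⟨_, rfl⟩
    set p : Polynomial ℝ := Polynomial.C E * Polynomial.X ^ 2 + Polynomial.C G * Polynomial.X +
      Polynomial.C c with hp
    have hp0 : p ≠ 0 := fun h0 => hEG ⟨by
      have := congrArg (fun q => Polynomial.coeff q 2) h0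
      simpa [hp, Polynomial.coeff_X, Polynomial.coeff_C] using this, by
      have := congrArg (fun q => Polynomial.coeff q 1) h0
      simpa [hp, Polynomial.coeff_X, Polynomial.coeff_C] using this⟩
    refine ((Polynomial.finite_setOfPred_isRoot hp0).subset fun y hy => ?_).measure_zero _
    have hy : E * (x ^ 2 + y ^ 2) + F * x + G * y + K = 0 := hy
    simp only [mem_ofPred_eq, Polynomial.IsRoot, hp, Polynomial.eval_add, Polynomial.eval_mul, Polynomial.eval_C,
      Polynomial.eval_pow, Polynomial.eval_X]
    linarith

variable {n : ℕ} {ν : Measure (ℝ × ℝ)} [SigmaFinite ν]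

theorem pi_null_of_update {N : Set (Fin n → ℝ × ℝ)} (hN : MeasurableSet N) (i : Fin n)
    (h : ∀ η, ν {x | Function.update η i x ∈ N} = 0) : Measure.pi (fun _ : Fin n => ν) N = 0 := by
  rw [← lintegral_indicator_one hN, lintegral_eq_lmarginal_univ (fun _ => (0 : ℝ × ℝ)),
    lmarginal_erase' _ (measurable_one.indicator hN) (Finset.mem_univ i)]
  have : (fun x : Fin n → ℝ × ℝ => ∫⁻ xi, N.indicator (1 : (Fin n → ℝ × ℝ) → ℝ≥0∞) (Function.update x i xi) ∂ν) = 0 := by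
    funext η
    have e : (fun xi => N.indicator (1 : (Fin n → ℝ × ℝ) → ℝ≥0∞) (Function.update η i xi)) =
        {x | Function.update η i x ∈ N}.indicator 1 := rfl
    exact (congrArg _ e).trans ((lintegral_indicator_one
      (s := {x | Function.update η i x ∈ N}) (measurable_update η hN)).trans (h η))
  rw [this]
  simp [lmarginal]

variable (hν : ν ≪ volume)
include hν

theorem ae_quadric (i : Fin n) {E F G K : (Fin n → ℝ × ℝ) → ℝ} (hE : Measurable E) (hF : Measurable F)
    (hG : Measurable G) (hK : Measurable K) (hi : ∀ η x, E (Function.update η i x) = E η ∧ F (Function.update η i x) = F η ∧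
      G (Function.update η i x) = G η ∧ K (Function.update η i x) = K η) :
    ∀ᵐ η ∂Measure.pi (fun _ : Fin n => ν), (E η ≠ 0 ∨ F η ≠ 0 ∨ G η ≠ 0) →
      E η * ((η i).1 ^ 2 + (η i).2 ^ 2) + F η * (η i).1 + G η * (η i).2 + K η ≠ 0 := by
  have hN : MeasurableSet {η : Fin n → ℝ × ℝ | (E η ≠ 0 ∨ F η ≠ 0 ∨ G η ≠ 0) ∧
      E η * ((η i).1 ^ 2 + (η i).2 ^ 2) + F η * (η i).1 + G η * (η i).2 + K η = 0} := by
    have h1 : ∀ {f : (Fin n → ℝ × ℝ) → ℝ}, Measurable f → MeasurableSet {η | f η = 0} := fun hf =>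
      measurableSet_eq_fun hf measurable_const
    refine MeasurableSet.inter ((h1 hE).compl.union ((h1 hF).compl.union (h1 hG).compl)) (h1 ?_)
    fun_prop
  have := pi_null_of_update (ν := ν) hN i fun η => by
    by_cases h : E η ≠ 0 ∨ F η ≠ 0 ∨ G η ≠ 0
    · refine hν (measure_mono_null (fun x hx => ?_) (volume_quadric_eq_zero (K η) h))
      have := hx.2
      obtain ⟨e1, e2, e3, e4⟩ := hi η x
      rw [e1, e2, e3, e4, Function.update_self] at this
      exact this
    · refine measure_mono_null (fun x hx => ?_) measure_empty
      have := hx.1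
      obtain ⟨e1, e2, e3, e4⟩ := hi η x
      rw [e1, e2, e3] at this
      exact h this
  rw [ae_iff]
  refine measure_mono_null (fun η hη => ?_) this
  simpa [and_comm] using hη

theorem ae_circle (i : Fin n) {P : (Fin n → ℝ × ℝ) → ℝ × ℝ} {S : (Fin n → ℝ × ℝ) → ℝ} (hP : Measurable P) (hS : Measurable S)
    (hi : ∀ η x, P (Function.update η i x) = P η ∧ S (Function.update η i x) = S η) :
    ∀ᵐ η ∂Measure.pi (fun _ : Fin n => ν), sqDist (P η) (η i) ≠ S η := by
  filter_upwards [ae_quadric hν i (E := fun _ => 1) (F := fun η => -2 * (P η).1) (G := fun η => -2 * (P η).2)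
    (K := fun η => (P η).1 ^ 2 + (P η).2 ^ 2 - S η) (by fun_prop) (by fun_prop) (by fun_prop) (by fun_prop)
    (fun η x => by simp [hi η x])] with η hη
  have := hη (Or.inl one_ne_zero)
  contrapose! this
  rw [← this, sqDist]; ring

theorem ae_gen (a b : ℝ) : ∀ᵐ η ∂Measure.pi (fun _ : Fin n => ν), Gen a b η := by
  have h1 : ∀ᵐ η ∂Measure.pi (fun _ : Fin n => ν), ∀ i j, i ≠ j → (η i).1 ≠ (η j).1 := by
    refine ae_all_iff.2 fun i => ae_all_iff.2 fun j => ae_all_iff.2 fun hij => ?_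
    filter_upwards [ae_quadric hν i (E := fun _ => 0) (F := fun η => 1) (G := fun η => 0)
      (K := fun η => -(η j).1) (by fun_prop) (by fun_prop) (by fun_prop) (by fun_prop)
      (fun η x => by simp [Function.update_of_ne hij.symm])] with η hη
    have := hη (Or.inr (Or.inl one_ne_zero))
    contrapose! this
    simp [this]
  have h2 : ∀ᵐ η ∂Measure.pi (fun _ : Fin n => ν), ∀ i j, i ≠ j → (η i).2 ≠ (η j).2 := by
    refine ae_all_iff.2 fun i => ae_all_iff.2 fun j => ae_all_iff.2 fun hij => ?_
    filter_upwards [ae_quadric hν i (E := fun _ => 0) (F := fun η => 0) (G := fun η => 1)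
      (K := fun η => -(η j).2) (by fun_prop) (by fun_prop) (by fun_prop) (by fun_prop)
      (fun η x => by simp [Function.update_of_ne hij.symm])] with η hη
    have := hη (Or.inr (Or.inr one_ne_zero))
    contrapose! this
    simp [this]
  have h3 : ∀ᵐ η ∂Measure.pi (fun _ : Fin n => ν), ∀ i j k, i ≠ j → i ≠ k → j ≠ k →
      ((η j).1 - (η i).1) * ((η k).2 - (η i).2) - ((η j).2 - (η i).2) * ((η k).1 - (η i).1) ≠ 0 := by
    refine ae_all_iff.2 fun i => ae_all_iff.2 fun j => ae_all_iff.2 fun k => ae_all_iff.2 fun hij =>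
      ae_all_iff.2 fun hik => ae_all_iff.2 fun hjk => ?_
    filter_upwards [h1, ae_quadric hν k (E := fun _ => 0) (F := fun η => -((η j).2 - (η i).2))
      (G := fun η => (η j).1 - (η i).1)
      (K := fun η => -((η j).1 - (η i).1) * (η i).2 + ((η j).2 - (η i).2) * (η i).1)
      (by fun_prop) (by fun_prop) (by fun_prop) (by fun_prop)
      (fun η x => by simp [Function.update_of_ne hik, Function.update_of_ne hjk])] with η h1 hη
    have := hη (Or.inr (Or.inr (sub_ne_zero.2 (h1 j i hij.symm))))
    contrapose! this
    linarith
  have h4 : ∀ s : ℝ, ∀ᵐ η ∂Measure.pi (fun _ : Fin n => ν), ∀ i j k, i ≠ j → i ≠ k → j ≠ k →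
      ∀ p, sqDist p (η i) = sqDist p (η j) → sqDist p (η i) = sqDist p (η k) → p.1 ≠ s := fun s => by
    refine ae_all_iff.2 fun i => ae_all_iff.2 fun j => ae_all_iff.2 fun k => ae_all_iff.2 fun hij =>
      ae_all_iff.2 fun hik => ae_all_iff.2 fun hjk => ?_
    set V : (Fin n → ℝ × ℝ) → ℝ := fun η => ((η j).2 ^ 2 - (η i).2 ^ 2 + (s - (η j).1) ^ 2 - (s - (η i).1) ^ 2) /
      (2 * ((η j).2 - (η i).2)) with hV
    filter_upwards [h2, ae_circle hν k (P := fun η => (s, V η)) (S := fun η => sqDist (s, V η) (η i))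
      (by fun_prop) (by unfold sqDist; fun_prop)
      (fun η x => by simp [hV, Function.update_of_ne hik, Function.update_of_ne hjk])] with η h2 hη p e1 e2 hps
    have hd := sub_ne_zero.2 (h2 j i hij.symm)
    have hp : p = (s, V η) := by
      refine Prod.ext hps ?_
      simp only [hV]
      rw [eq_div_iff (by positivity)]
      simp only [sqDist, hps] at e1
      linarith
    rw [hp] at e2
    exact hη e2.symm
  have h5 : ∀ s : ℝ, ∀ᵐ η ∂Measure.pi (fun _ : Fin n => ν), ∀ i j k, i ≠ j → i ≠ k → j ≠ k →
      ∀ p, sqDist p (η i) = sqDist p (η j) → sqDist p (η i) = sqDist p (η k) → p.2 ≠ s := fun s => by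
    refine ae_all_iff.2 fun i => ae_all_iff.2 fun j => ae_all_iff.2 fun k => ae_all_iff.2 fun hij =>
      ae_all_iff.2 fun hik => ae_all_iff.2 fun hjk => ?_
    set V : (Fin n → ℝ × ℝ) → ℝ := fun η => ((η j).1 ^ 2 - (η i).1 ^ 2 + (s - (η j).2) ^ 2 - (s - (η i).2) ^ 2) /
      (2 * ((η j).1 - (η i).1)) with hV
    filter_upwards [h1, ae_circle hν k (P := fun η => (V η, s)) (S := fun η => sqDist (V η, s) (η i))
      (by fun_prop) (by unfold sqDist; fun_prop)
      (fun η x => by simp [hV, Function.update_of_ne hik, Function.update_of_ne hjk])] with η h1 hη p e1 e2 hps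
    have hd := sub_ne_zero.2 (h1 j i hij.symm)
    have hp : p = (V η, s) := by
      refine Prod.ext ?_ hps
      simp only [hV]
      rw [eq_div_iff (by positivity)]
      simp only [sqDist, hps] at e1
      linarith
    rw [hp] at e2
    exact hη e2.symm
  have h6 : ∀ q : ℝ × ℝ, ∀ᵐ η ∂Measure.pi (fun _ : Fin n => ν), ∀ i j, i ≠ j → sqDist q (η i) ≠ sqDist q (η j) := fun q => by
    refine ae_all_iff.2 fun i => ae_all_iff.2 fun j => ae_all_iff.2 fun hij => ?_
    exact ae_circle hν i (P := fun η => q) (S := fun η => sqDist q (η j)) (by fun_prop) (by unfold sqDist; fun_prop)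
      (fun η x => by simp [Function.update_of_ne hij.symm])
  have h7 : ∀ᵐ η ∂Measure.pi (fun _ : Fin n => ν), ∀ i j k l, i ≠ j → i ≠ k → i ≠ l → j ≠ k → j ≠ l → k ≠ l →
      ∀ p, sqDist p (η i) = sqDist p (η j) → sqDist p (η i) = sqDist p (η k) → sqDist p (η i) ≠ sqDist p (η l) := by
    refine ae_all_iff.2 fun i => ae_all_iff.2 fun j => ae_all_iff.2 fun k => ae_all_iff.2 fun l => ae_all_iff.2 fun hij =>
      ae_all_iff.2 fun hik => ae_all_iff.2 fun hil => ae_all_iff.2 fun hjk => ae_all_iff.2 fun hjl =>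
      ae_all_iff.2 fun hkl => ?_
    set D : (Fin n → ℝ × ℝ) → ℝ := fun η =>
      ((η j).1 - (η i).1) * ((η k).2 - (η i).2) - ((η j).2 - (η i).2) * ((η k).1 - (η i).1) with hD
    set M : Fin n → (Fin n → ℝ × ℝ) → ℝ := fun m η => (η m).1 ^ 2 + (η m).2 ^ 2 - (η i).1 ^ 2 - (η i).2 ^ 2 with hM
    set P : (Fin n → ℝ × ℝ) → ℝ × ℝ := fun η =>
      ((M j η * ((η k).2 - (η i).2) - M k η * ((η j).2 - (η i).2)) / (2 * D η),
        (((η j).1 - (η i).1) * M k η - ((η k).1 - (η i).1) * M j η) / (2 * D η)) with hP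
    have hPm : Measurable P := by
      simp only [hP, hM, hD]; fun_prop
    filter_upwards [h3, ae_circle hν l (P := P) (S := fun η => sqDist (P η) (η i)) hPm (by unfold sqDist; fun_prop)
      (fun η x => by simp [hP, hM, hD, Function.update_of_ne hil, Function.update_of_ne hjl, Function.update_of_ne hkl])]
      with η h3 hη p e1 e2 e3
    have hd : D η ≠ 0 := h3 i j k hij hik hjk
    have hp : p = P η := by
      simp only [sqDist] at e1 e2
      have u1 : 2 * (p.1 * ((η j).1 - (η i).1) + p.2 * ((η j).2 - (η i).2)) = M j η := by simp only [hM]; linarith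
      have u2 : 2 * (p.1 * ((η k).1 - (η i).1) + p.2 * ((η k).2 - (η i).2)) = M k η := by simp only [hM]; linarith
      refine Prod.ext ?_ ?_ <;> simp only [hP] <;> rw [eq_div_iff (by positivity), ← u1, ← u2] <;> simp only [hD] <;> ring
    rw [hp] at e3
    exact hη e3.symm
  filter_upwards [h1, h2, h3, h4 a, h4 (-a), h5 b, h5 (-b), h6 (a, b), h6 (a, -b), h6 (-a, b), h6 (-a, -b), h7]
    with η h1 h2 h3 h4 h4' h5 h5' h6 h6' h6'' h6''' h7
  refine ⟨h1, h2, h3, fun i j k e1 e2 e3 p e4 e5 => ⟨fun h => ?_, fun h => ?_⟩, fun i j e p h h' => ?_, h7⟩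
  · rcases abs_choice p.1 with e | e <;> rw [e] at h
    exacts [h4 i j k e1 e2 e3 p e4 e5 h, h4' i j k e1 e2 e3 p e4 e5 (by linarith)]
  · rcases abs_choice p.2 with e | e <;> rw [e] at h
    exacts [h5 i j k e1 e2 e3 p e4 e5 h, h5' i j k e1 e2 e3 p e4 e5 (by linarith)]
  · have h1 : p.1 = a ∨ p.1 = -a := by
      rcases abs_choice p.1 with e | e <;> rw [e] at h <;> [left; right] <;> linarith
    have h2 : p.2 = b ∨ p.2 = -b := by
      rcases abs_choice p.2 with e | e <;> rw [e] at h' <;> [left; right] <;> linarith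
    have hp : p = (p.1, p.2) := rfl
    rw [hp]
    rcases h1 with u | u <;> rcases h2 with v | v <;> rw [u, v]
    exacts [h6 i j e, h6' i j e, h6'' i j e, h6''' i j e]

end AlmostEverywhere

theorem sqDist_smul (l : ℝ) (p x : ℝ × ℝ) : sqDist (l • p) (l • x) = l ^ 2 * sqDist p x := by
  simp only [sqDist, Prod.smul_fst, Prod.smul_snd, smul_eq_mul]; ring

theorem Gen.smul {ι : Type*} {a b l : ℝ} (hl : 0 < l) {y : ι → ℝ × ℝ} (H : Gen a b y) :
    Gen (l * a) (l * b) fun i => l • y i := by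
  have hsq : ∀ (p : ℝ × ℝ) i j, sqDist p (l • y i) = sqDist p (l • y j) ↔
      sqDist (l⁻¹ • p) (y i) = sqDist (l⁻¹ • p) (y j) := fun p i j => by
    conv_lhs => rw [← smul_inv_smul₀ hl.ne' p, sqDist_smul, sqDist_smul]
    exact mul_right_inj' (by positivity)
  have hab : ∀ {u c : ℝ}, |u| = l * c ↔ |l⁻¹ * u| = c := fun {u c} => by
    rw [abs_mul, abs_inv, abs_of_pos hl, inv_mul_eq_iff_eq_mul₀ hl.ne']
  refine ⟨fun i j h => ?_, fun i j h => ?_, fun i j k h1 h2 h3 => ?_, fun i j k h1 h2 h3 p e1 e2 => ?_,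
    fun i j h p h1 h2 => ?_, fun i j k m h1 h2 h3 h4 h5 h6 p e1 e2 => ?_⟩
  · simpa [hl.ne'] using H.fst_ne i j h
  · simpa [hl.ne'] using H.snd_ne i j h
  · have := mul_ne_zero (pow_ne_zero 2 hl.ne') (H.det_ne i j k h1 h2 h3)
    contrapose! this
    simp only [Prod.smul_fst, Prod.smul_snd, smul_eq_mul] at this
    linarith
  · have := H.edge i j k h1 h2 h3 _ ((hsq p i j).1 e1) ((hsq p i k).1 e2)
    simp only [ne_eq, hab]
    simpa using this
  · rw [ne_eq, hsq]
    exact H.corner i j h _ (by simpa using hab.1 h1) (by simpa using hab.1 h2)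
  · rw [ne_eq, hsq]
    exact H.four i j k m h1 h2 h3 h4 h5 h6 _ ((hsq p i j).1 e1) ((hsq p i k).1 e2)

section Occupation
set_option linter.unusedSectionVars false
variable {n : ℕ} {W : Type*} [Fintype W]

/-- The set of occupied sites. -/
noncomputable def occ (ζ : Fin n → W) (w : W) : Bool := decide (∃ i, ζ i = w)

theorem occ_self (ζ : Fin n → W) (i : Fin n) : occ ζ (ζ i) = true := decide_eq_true ⟨i, rfl⟩

theorem card_occ {ζ : Fin n → W} (hζ : Function.Injective ζ) :
    (Finset.univ.filter fun w => occ ζ w = true).card = n := by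
  have : (Finset.univ.filter fun w => occ ζ w = true) = Finset.univ.image ζ := by
    ext w; simp [occ]
  rw [this, Finset.card_image_of_injective _ hζ, Finset.card_univ, Fintype.card_fin]

theorem card_injective_mul_le {p : ℝ} (h0 : 0 ≤ p) (h1 : p ≤ 1) (A : Set (W → Bool)) :
    ((Finset.univ.filter fun ζ : Fin n → W => Function.Injective ζ ∧ occ ζ ∈ A).card : ℝ) *
      (p ^ n * (1 - p) ^ Fintype.card W) ≤ n.factorial * Pro (bw p) A := by
  set S := Finset.univ.filter fun ζ : Fin n → W => Function.Injective ζ ∧ occ ζ ∈ A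
  have hcard : S.card ≤ n.factorial * (S.image occ).card := by
    refine Finset.card_le_mul_card_image S _ fun a ha => ?_
    obtain ⟨ζ₀, hζ₀, rfl⟩ := Finset.mem_image.1 ha
    have hζ₀ := (Finset.mem_filter.1 hζ₀).2.1
    have hT : Fintype.card {w // occ ζ₀ w = true} = n := by
      rw [Fintype.card_subtype]; exact card_occ hζ₀
    have hE : Fintype.card (Fin n ↪ {w // occ ζ₀ w = true}) = n.factorial := by
      rw [Fintype.card_embedding_eq, hT, Fintype.card_fin, Nat.descFactorial_self]
    rw [← hE, ← Finset.card_univ]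
    have hf : ∀ ζ ∈ S.filter (fun ζ => occ ζ = occ ζ₀), Function.Injective ζ ∧ ∀ i, occ ζ₀ (ζ i) = true := fun ζ hζ => by
      have hζ := Finset.mem_filter.1 hζ
      exact ⟨(Finset.mem_filter.1 hζ.1).2.1, fun i => hζ.2 ▸ occ_self ζ i⟩
    refine Finset.card_le_card_of_injOn
      (fun ζ => if h : Function.Injective ζ ∧ ∀ i, occ ζ₀ (ζ i) = true then
        ⟨fun i => ⟨ζ i, h.2 i⟩, fun i j hij => h.1 (Subtype.ext_iff.1 hij)⟩ else
        ⟨fun i => ⟨ζ₀ i, occ_self ζ₀ i⟩, fun i j hij => hζ₀ (Subtype.ext_iff.1 hij)⟩)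
      (fun _ _ => Finset.mem_coe.2 (Finset.mem_univ _)) fun ζ hζ ζ' hζ' e => ?_
    simp only [dif_pos (hf ζ hζ), dif_pos (hf ζ' hζ')] at e
    funext i
    exact Subtype.ext_iff.1 (DFunLike.congr_fun e i)
  have hq : 0 ≤ 1 - p := sub_nonneg.2 h1
  have hPro : ((S.image occ).card : ℝ) * (p ^ n * (1 - p) ^ Fintype.card W) ≤ Pro (bw p) A := by
    rw [Pro, Ex, ← nsmul_eq_mul, ← Finset.sum_const]
    refine (Finset.sum_le_sum fun a ha => ?_).trans (Finset.sum_le_sum_of_subset_of_nonneg (Finset.subset_univ _)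
      fun a _ _ => mul_nonneg (Finset.prod_nonneg fun i _ => (isWeight_bw h0 h1).nonneg _)
        (indicator_nonneg (fun _ _ => zero_le_one) _))
    obtain ⟨ζ, hζ, rfl⟩ := Finset.mem_image.1 ha
    have hζ := (Finset.mem_filter.1 hζ).2
    rw [indicator_of_mem hζ.2, Pi.one_apply, mul_one]
    have : ∀ w, bw p (occ ζ w) = if occ ζ w = true then p else 1 - p := fun w => rfl
    simp only [this]
    rw [Finset.prod_ite, Finset.prod_const, Finset.prod_const, card_occ hζ.1]
    refine mul_le_mul_of_nonneg_left (pow_le_pow_of_le_one hq (by linarith) ?_) (pow_nonneg h0 _)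
    exact (Finset.card_filter_le _ _).trans_eq Finset.card_univ
  calc (S.card : ℝ) * (p ^ n * (1 - p) ^ Fintype.card W)
      ≤ (n.factorial * (S.image occ).card : ℝ) * (p ^ n * (1 - p) ^ Fintype.card W) :=
        mul_le_mul_of_nonneg_right (by exact_mod_cast hcard) (mul_nonneg (pow_nonneg h0 _) (pow_nonneg hq _))
    _ ≤ n.factorial * Pro (bw p) A := by
        rw [mul_assoc]; exact mul_le_mul_of_nonneg_left hPro (Nat.cast_nonneg _)

theorem qcp_occ {ζ : Fin n → W} (hζ : Function.Injective ζ) (x : W → ℝ × ℝ) (K : Set (ℝ × ℝ)) (h : ℝ × ℝ → ℝ)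
    (h₀ h₁ : ℝ) : qcp x K h h₀ h₁ (occ ζ) = qcp (fun i => x (ζ i)) K h h₀ h₁ fun _ => true := by
  rw [qcp, qcp, ← Ex_comp isWeight_half hζ]
  congr 1; funext c
  have : ∀ s : Bool, x '' {w | (occ ζ w, c w) = (true, s)} =
      (fun i => x (ζ i)) '' {i | (true, (c ∘ ζ) i) = (true, s)} := fun s => by
    ext p
    constructor
    · rintro ⟨w, hw, rfl⟩
      obtain ⟨h1, h2⟩ := Prod.ext_iff.1 hw
      obtain ⟨i, rfl⟩ := of_decide_eq_true h1
      exact ⟨i, Prod.ext rfl h2, rfl⟩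
    · rintro ⟨i, hi, rfl⟩
      exact ⟨ζ i, Prod.ext (occ_self ζ i) (Prod.ext_iff.1 hi).2, rfl⟩
  simp only [crossInd, RS, this]
  congr

end Occupation

theorem factorial_mul_exp_le {n : ℕ} (hn : 1 ≤ n) :
    (n.factorial : ℝ) * Real.exp n ≤ Real.exp 1 * n * (n : ℝ) ^ n := by
  induction n, hn using Nat.le_induction with
  | base => simp
  | succ n hn ih =>
    have hn' : (0 : ℝ) < n := by exact_mod_cast hn
    have h1 : (n : ℝ) / (n + 1) ≤ Real.exp (-(1 / (n + 1))) := by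
      have := Real.add_one_le_exp (-(1 / ((n : ℝ) + 1)))
      refine le_trans (le_of_eq ?_) this
      field_simp; ring
    have h2 : (n : ℝ) ^ (n + 1) * Real.exp 1 ≤ ((n : ℝ) + 1) ^ (n + 1) := by
      have h3 := pow_le_pow_left₀ (by positivity) h1 (n + 1)
      rw [← Real.exp_nat_mul, div_pow, div_le_iff₀ (by positivity)] at h3
      have e : ((n + 1 : ℕ) : ℝ) * -(1 / ((n : ℝ) + 1)) = -1 := by push_cast; field_simp
      rw [e, Real.exp_neg, inv_mul_eq_div, le_div_iff₀ (Real.exp_pos _)] at h3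
      exact h3
    rw [Nat.factorial_succ]
    push_cast
    rw [Real.exp_add]
    calc ((n : ℝ) + 1) * n.factorial * (Real.exp n * Real.exp 1)
        = ((n : ℝ) + 1) * Real.exp 1 * (n.factorial * Real.exp n) := by ring
      _ ≤ ((n : ℝ) + 1) * Real.exp 1 * (Real.exp 1 * n * (n : ℝ) ^ n) :=
          mul_le_mul_of_nonneg_left ih (by positivity)
      _ = Real.exp 1 * (n + 1) * ((n : ℝ) ^ (n + 1) * Real.exp 1) := by ring
      _ ≤ Real.exp 1 * (n + 1) * ((n : ℝ) + 1) ^ (n + 1) := mul_le_mul_of_nonneg_left h2 (by positivity)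

theorem eventually_le_one_sub_act_pow (n : ℕ) :
    ∀ᶠ q : ℕ in Filter.atTop, Real.exp (-n) / 2 ≤ (1 - act q) ^ (n * q ^ 2) := by
  have h1 : Filter.Tendsto (fun q : ℕ => (1 + (-1 : ℝ) / ((q ^ 2 : ℕ) : ℝ)) ^ (q ^ 2)) Filter.atTop
      (nhds (Real.exp (-1))) :=
    (Real.tendsto_one_add_div_pow_exp (-1)).comp (Filter.tendsto_pow_atTop two_ne_zero)
  have h2 := h1.pow n
  rw [← Real.exp_nat_mul] at h2
  have h3 : Real.exp (-n) / 2 < Real.exp (n * -1) := by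
    rw [mul_neg_one]; exact half_lt_self (Real.exp_pos _)
  filter_upwards [h2.eventually_const_lt h3] with q hq
  refine hq.le.trans_eq ?_
  rw [← pow_mul, mul_comm, act]
  push_cast
  ring

section Discretisation
variable {n : ℕ} {ν : Measure (ℝ × ℝ)} [IsProbabilityMeasure ν]

/-- The lattice site of a point, in the lattice of mesh `1 / q` after scaling by `l`. -/
noncomputable def site (q : ℕ) (l : ℝ) (x : ℝ × ℝ) : ℤ × ℤ := (⌊q * l * x.1⌋, ⌊q * l * x.2⌋)

theorem measurable_site (q : ℕ) (l : ℝ) : Measurable (site q l) := by unfold site; fun_prop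

theorem volume_site {q : ℕ} {l : ℝ} (hq : 0 < q) (hl : 0 < l) (w : ℤ × ℤ) :
    volume {x | site q l x = w} = ENNReal.ofReal (1 / (q * l) ^ 2) := by
  have hql : (0 : ℝ) < q * l := by positivity
  have : {x | site q l x = w} = Ico (w.1 / (q * l)) ((w.1 + 1) / (q * l)) ×ˢ
      Ico (w.2 / (q * l)) ((w.2 + 1) / (q * l)) := by
    ext x
    simp only [mem_ofPred_eq, site, Prod.ext_iff, Int.floor_eq_iff, mem_prod, mem_Ico, div_le_iff₀ hql,
      lt_div_iff₀ hql, mul_comm (q * l : ℝ)]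
  rw [this, Measure.volume_eq_prod, Measure.prod_prod, Real.volume_Ico, Real.volume_Ico, ← ENNReal.ofReal_mul]
  · congr 1; field_simp; ring
  · rw [← sub_div]; refine div_nonneg ?_ hql.le; linarith

theorem pi_site_le (hν : ν ≤ volume) {q : ℕ} {l : ℝ} (hq : 0 < q) (hl : 0 < l) (W : Finset (ℤ × ℤ))
    (S : Finset (Fin n → W)) :
    Measure.pi (fun _ : Fin n => ν) {η | ∃ ζ ∈ S, ∀ i, site q l (η i) = ζ i} ≤
      ENNReal.ofReal (S.card * (1 / (q * l) ^ 2) ^ n) := by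
  have e : {η : Fin n → ℝ × ℝ | ∃ ζ ∈ S, ∀ i, site q l (η i) = ζ i} =
      ⋃ ζ ∈ S, univ.pi fun i => {x | site q l x = (ζ i : ℤ × ℤ)} := by
    ext η; simp
  rw [e]
  refine (measure_biUnion_finset_le _ _).trans ?_
  refine (Finset.sum_le_sum (g := fun _ => ENNReal.ofReal ((1 / (q * l) ^ 2) ^ n)) fun ζ _ => ?_).trans ?_
  · rw [Measure.pi_pi, ENNReal.ofReal_pow (by positivity)]
    refine (Finset.prod_le_prod' fun i _ => (hν _).trans_eq (volume_site hq hl _)).trans ?_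
    simp
  · rw [Finset.sum_const, nsmul_eq_mul, ENNReal.ofReal_mul (Nat.cast_nonneg _), ENNReal.ofReal_natCast]

/-- The law of the occupied sites is dominated by that of independent activities. -/
theorem eventually_pi_occ_le (hn : 1 ≤ n) (hν : ν ≤ volume) {a b : ℝ} (ha : 0 ≤ a) (hb : 0 ≤ b)
    (hab : 16 * a * b = n) : ∀ᶠ q : ℕ in Filter.atTop, ∀ A : Set (RW q a b → Bool),
      Measure.pi (fun _ : Fin n => ν) {η | ∃ ζ : Fin n → RW q a b, Function.Injective ζ ∧ occ ζ ∈ A ∧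
        ∀ i, site q √n (η i) = ζ i} ≤ ENNReal.ofReal (2 * Real.exp 1 * n * Pro (bw (act q)) A) := by
  filter_upwards [eventually_le_one_sub_act_pow n, Filter.eventually_gt_atTop 0] with q hq hq0 A
  have hn0 : (0 : ℝ) < n := by exact_mod_cast hn
  have hq0' : (0 : ℝ) < q := by exact_mod_cast hq0
  set S := Finset.univ.filter fun ζ : Fin n → RW q a b => Function.Injective ζ ∧ occ ζ ∈ A
  have h1 := card_injective_mul_le (n := n) (act_nonneg q) (act_le_one hq0) A
  have e : {η : Fin n → ℝ × ℝ | ∃ ζ : Fin n → RW q a b, Function.Injective ζ ∧ occ ζ ∈ A ∧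
      ∀ i, site q √n (η i) = ζ i} = {η | ∃ ζ ∈ S, ∀ i, site q √n (η i) = ζ i} := by
    ext η; simp [S, and_assoc]
  rw [e]
  refine (pi_site_le hν hq0 (Real.sqrt_pos.2 hn0) _ S).trans (ENNReal.ofReal_le_ofReal ?_)
  have hW : Fintype.card (RW q a b) ≤ n * q ^ 2 := by
    have := card_RW_le (q := q) ha hb
    rw [hab] at this
    rw [Fintype.card_coe]
    exact_mod_cast this
  have h2 : Real.exp (-n) / 2 ≤ (1 - act q) ^ Fintype.card (RW q a b) :=
    hq.trans (pow_le_pow_of_le_one (sub_nonneg.2 (act_le_one hq0)) (by linarith [act_nonneg q]) hW)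
  have h3 := factorial_mul_exp_le hn
  have hP := Pro_nonneg (isWeight_bw (act_nonneg q) (act_le_one hq0)) A
  have h4 : (S.card : ℝ) * act q ^ n * (Real.exp (-n) / 2) ≤ n.factorial * Pro (bw (act q)) A := by
    refine le_trans (mul_le_mul_of_nonneg_left h2 (mul_nonneg (Nat.cast_nonneg _) (pow_nonneg (act_nonneg q) _))) ?_
    rw [mul_assoc]
    refine le_trans (le_of_eq ?_) h1
    congr 3
    ext ζ
    simp [S]
  have h5 : (S.card : ℝ) * act q ^ n ≤ 2 * (n.factorial * Real.exp n) * Pro (bw (act q)) A := by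
    have h6 := mul_le_mul_of_nonneg_left h4 (Real.exp_pos n).le
    have h7 : Real.exp n * Real.exp (-n) = 1 := by rw [← Real.exp_add]; simp
    have : Real.exp n * ((S.card : ℝ) * act q ^ n * (Real.exp (-n) / 2)) = S.card * act q ^ n / 2 := by
      linear_combination (S.card * act q ^ n / 2) * h7
    linarith
  have h6 : (S.card : ℝ) * (1 / (q * √n) ^ 2) ^ n = S.card * act q ^ n / n ^ n := by
    rw [mul_pow, Real.sq_sqrt hn0.le, act, div_pow, div_pow, one_pow, mul_pow]
    field_simp
  rw [h6, div_le_iff₀ (by positivity)]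
  nlinarith [mul_le_mul_of_nonneg_right h3 hP]

end Discretisation

section Mean
variable {Ω : Type*} [MeasurableSpace Ω] {μ : Measure Ω} [IsProbabilityMeasure μ]

theorem abs_integral_sub_le {X : Ω → ℝ} (hX : Measurable X) (h0 : ∀ ω, 0 ≤ X ω) (h1 : ∀ ω, X ω ≤ 1) {m u : ℝ}
    (hm0 : 0 ≤ m) (hm1 : m ≤ 1) (hu : 0 ≤ u) : |∫ ω, X ω ∂μ - m| ≤ u + μ.real {ω | u ≤ |X ω - m|} := by
  have hS : MeasurableSet {ω | u ≤ |X ω - m|} := measurableSet_le measurable_const (by fun_prop)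
  have hb : ∀ ω, |X ω - m| ≤ 1 := fun ω => abs_le.2 ⟨by linarith [h0 ω], by linarith [h1 ω]⟩
  have hXi : Integrable X μ := Integrable.of_bound hX.aestronglyMeasurable 1
    (Filter.Eventually.of_forall fun ω => by rw [Real.norm_eq_abs, abs_of_nonneg (h0 ω)]; exact h1 ω)
  have hi : Integrable (fun ω => u + {ω | u ≤ |X ω - m|}.indicator (1 : Ω → ℝ) ω) μ :=
    (integrable_const u).add ((integrable_const 1).indicator hS)
  have e1 : ∫ ω, X ω ∂μ - m = ∫ ω, (X ω - m) ∂μ := by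
    rw [integral_sub hXi (integrable_const m)]; simp
  have hI : Integrable ({ω | u ≤ |X ω - m|}.indicator (1 : Ω → ℝ)) μ := (integrable_const (1 : ℝ)).indicator hS
  have e2 : ∫ ω, (u + {ω | u ≤ |X ω - m|}.indicator (1 : Ω → ℝ) ω) ∂μ = u + μ.real {ω | u ≤ |X ω - m|} := by
    rw [integral_add (integrable_const u) hI, integral_indicator_one hS]; simp
  rw [e1, ← e2]
  refine (abs_integral_le_integral_abs).trans
    (integral_mono (hXi.sub (integrable_const m)).abs hi fun ω => ?_)
  by_cases h : u ≤ |X ω - m|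
  · have : ω ∈ {ω | u ≤ |X ω - m|} := h
    simp only [indicator_of_mem this, Pi.one_apply]
    linarith [hb ω]
  · have : ω ∉ {ω | u ≤ |X ω - m|} := h
    simp only [indicator_of_notMem this]
    linarith

/-- Concentration around some constant, with a large prefactor and a larger rate, gives
concentration around the mean. -/
theorem tail_mean_le {X : Ω → ℝ} (hX : Measurable X) (h0 : ∀ ω, 0 ≤ X ω) (h1 : ∀ ω, X ω ≤ 1) {x G t : ℝ}
    (hx : 0 ≤ x) (hG : 0 < G) (hGx : 40 * G * (1 + x) ≤ Real.exp x) (ht : 0 < t)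
    (H : ∀ ε, 0 < ε → ∃ m, 0 ≤ m ∧ m ≤ 1 ∧ ∀ u, 0 ≤ u → μ.real {ω | u ≤ |X ω - m|} ≤
      ε + 8 * Real.exp (1 + x) * Real.exp (-(u * (40 * G * (1 + x))))) :
    μ.real {ω | t ≤ |X ω - ∫ ω, X ω ∂μ|} ≤ 4 * Real.exp (-(t * G)) := by
  rcases lt_or_ge (t * G) 1 with htG | htG
  · refine measureReal_le_one.trans ?_
    have h2 : Real.exp (-1) ≤ Real.exp (-(t * G)) := Real.exp_le_exp.2 (by linarith)
    have h3 : Real.exp (-1) * Real.exp 1 = 1 := by rw [← Real.exp_add]; simp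
    have h4 := Real.exp_one_lt_d9
    nlinarith [Real.exp_pos (-1)]
  obtain ⟨m, hm0, hm1, hm⟩ := H (min (t / 8) (2 * Real.exp (-(t * G)))) (by positivity)
  have hs : (1 : ℝ) ≤ 1 + x := by linarith
  have ht1 : 40 * (1 + x) ≤ t * Real.exp x := by
    nlinarith [mul_le_mul_of_nonneg_left hGx ht.le]
  have hE : 8 * Real.exp (1 + x) * Real.exp (-(t / 4 * (40 * G * (1 + x)))) ≤ t / 8 := by
    have h2 : Real.exp (1 + x) * Real.exp (-(t / 4 * (40 * G * (1 + x)))) ≤ Real.exp (-x - 2) := by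
      rw [← Real.exp_add, Real.exp_le_exp]
      nlinarith [mul_le_mul_of_nonneg_right htG (zero_le_one.trans hs)]
    have h3 : Real.exp (-x - 2) * (Real.exp x * Real.exp 2) = 1 := by
      rw [← Real.exp_add, ← Real.exp_add]; simp
    have h4 : 3 ≤ Real.exp 2 := by linarith [Real.add_one_le_exp (2 : ℝ)]
    have h5 : 40 * Real.exp (-x - 2) ≤ t * (Real.exp x * Real.exp (-x - 2)) := by
      nlinarith [Real.exp_pos (-x - 2)]
    have h6 : Real.exp x * Real.exp (-x - 2) ≤ 1 / 3 := by
      have : 0 < Real.exp x * Real.exp (-x - 2) := by positivity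
      nlinarith
    nlinarith [mul_le_mul_of_nonneg_left h6 ht.le]
  have hmean : |∫ ω, X ω ∂μ - m| ≤ t / 2 := by
    have := abs_integral_sub_le (μ := μ) hX h0 h1 hm0 hm1 (u := t / 4) (by positivity)
    have := hm (t / 4) (by positivity)
    have := min_le_left (t / 8) (2 * Real.exp (-(t * G)))
    linarith
  have hsub : {ω | t ≤ |X ω - ∫ ω, X ω ∂μ|} ⊆ {ω | t / 2 ≤ |X ω - m|} := fun ω hω => by
    have hω : t ≤ |X ω - ∫ ω, X ω ∂μ| := hω
    have h2 := abs_sub_le (X ω) m (∫ ω, X ω ∂μ)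
    rw [abs_sub_comm m] at h2
    show t / 2 ≤ |X ω - m|
    linarith
  refine (measureReal_mono hsub).trans ((hm (t / 2) (by positivity)).trans ?_)
  have h2 : Real.exp (1 + x) * Real.exp (-(t / 2 * (40 * G * (1 + x)))) ≤ Real.exp (-2) * Real.exp (-(t * G)) := by
    rw [← Real.exp_add, ← Real.exp_add, Real.exp_le_exp]
    nlinarith [mul_nonneg (sub_nonneg.2 htG) hx]
  have h3 : Real.exp (-2) * Real.exp 2 = 1 := by rw [← Real.exp_add]; simp
  have h4 : 4 ≤ Real.exp 2 := by
    have : Real.exp 2 = Real.exp 1 * Real.exp 1 := by rw [← Real.exp_add]; norm_num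
    nlinarith [Real.exp_one_gt_d9]
  have h5 : Real.exp (-2) ≤ 1 / 4 := by nlinarith [Real.exp_pos (-2)]
  have := min_le_right (t / 8) (2 * Real.exp (-(t * G)))
  nlinarith [Real.exp_pos (-(t * G))]

/-- Tail bounds for approximations pass to an almost sure eventual value. -/
theorem exists_tail_le {X : Ω → ℝ} (hX : Measurable X) (h1 : ∀ ω, X ω ≤ 1) {g : ℕ → Ω → ℝ}
    (hg : ∀ q, Measurable (g q)) (hgX : ∀ᵐ ω ∂μ, ∀ᶠ q in Filter.atTop, g q ω = X ω) {m : ℕ → ℝ} {T : ℝ → ℝ}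
    (hT : ∀ u, 0 ≤ T u) (H : ∀ᶠ q in Filter.atTop, ∀ u, μ {ω | g q ω ≤ 1 ∧ u ≤ |g q ω - m q|} ≤ ENNReal.ofReal (T u))
    {ε : ℝ} (hε : 0 < ε) : ∃ q, 0 < q ∧ ∀ u, μ.real {ω | u ≤ |X ω - m q|} ≤ ε + T u := by
  have h2 := tendsto_measure_of_ae_tendsto_indicator_of_isFiniteMeasure (μ := μ) Filter.atTop
    (A := ∅) (As := fun q => {ω | g q ω ≠ X ω}) MeasurableSet.empty
    (fun q => (measurableSet_eq_fun (hg q) hX).compl) (by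
      filter_upwards [hgX] with ω hω
      filter_upwards [hω] with q hq
      simp [hq])
  rw [measure_empty] at h2
  obtain ⟨q, ⟨hq1, hq2⟩, hq0⟩ := ((h2.eventually_lt_const (ENNReal.ofReal_pos.2 hε)).and H).and
    (Filter.eventually_gt_atTop 0) |>.exists
  refine ⟨q, hq0, fun u => ?_⟩
  refine ENNReal.toReal_le_of_le_ofReal (by linarith [hT u]) ?_
  rw [ENNReal.ofReal_add hε.le (hT u)]
  refine (measure_mono fun ω hω => ?_).trans ((measure_union_le _ _).trans (add_le_add hq1.le (hq2 u)))
  by_cases h : g q ω = X ω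
  · exact Or.inr ⟨h ▸ h1 ω, by rw [h]; exact hω⟩
  · exact Or.inl h

end Mean

/-- The rounded conditional crossing probability, as a function of the occupied lattice sites. -/
noncomputable def approx (q : ℕ) (a b : ℝ) {n : ℕ} (z : Fin n → ℤ × ℤ) : ℝ :=
  if Function.Injective z ∧ ∀ i, z i ∈ RW q a b then
    qcp (wpos q (RW q a b)) (rect (-a) a (-b) b) Prod.fst (-a) a fun w => decide (∃ i, z i = w) else 5

theorem approx_eq {q : ℕ} {a b : ℝ} {n : ℕ} {z : Fin n → ℤ × ℤ} {ζ : Fin n → RW q a b}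
    (hζ : Function.Injective ζ) (h : ∀ i, z i = ζ i) : approx q a b z =
      qcp (wpos q (RW q a b)) (rect (-a) a (-b) b) Prod.fst (-a) a (occ ζ) := by
  have hz : z = fun i => (ζ i : ℤ × ℤ) := funext h
  subst hz
  rw [approx, if_pos ⟨fun i j hij => hζ (Subtype.ext hij), fun i => (ζ i).2⟩]
  congr 1; funext w
  simp only [occ, Subtype.ext_iff]

theorem tendsto_pos_site (l : ℝ) (x : ℝ × ℝ) :
    Filter.Tendsto (fun q : ℕ => pos q (site q l x)) Filter.atTop (nhds (l • x)) := by
  have h : ∀ y : ℝ, Filter.Tendsto (fun q : ℕ => (⌊q * l * y⌋ : ℝ) / q) Filter.atTop (nhds (l * y)) := fun y => by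
    have h1 : Filter.Tendsto (fun q : ℕ => l * y - 1 / (q : ℝ)) Filter.atTop (nhds (l * y)) := by
      simpa using tendsto_one_div_atTop_nhds_zero_nat.const_sub (l * y)
    refine tendsto_of_tendsto_of_tendsto_of_le_of_le' h1 tendsto_const_nhds ?_ ?_ <;>
    · filter_upwards [Filter.eventually_gt_atTop 0] with q hq
      have hq : (0 : ℝ) < q := by exact_mod_cast hq
      have := Int.floor_le (q * l * y)
      have := Int.lt_floor_add_one (q * l * y)
      first
      | rw [le_div_iff₀ hq, sub_mul, one_div_mul_cancel hq.ne']; linarith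
      | rw [div_le_iff₀ hq]; linarith
  exact (h x.1).prodMk_nhds (h x.2)

theorem eventually_site_mem {l a b : ℝ} {x : ℝ × ℝ} (h1 : |l * x.1| < 2 * a) (h2 : |l * x.2| < 2 * b) :
    ∀ᶠ q : ℕ in Filter.atTop, site q l x ∈ RW q a b := by
  have ht := tendsto_pos_site l x
  have h : ∀ {f : ℕ → ℤ} {y c : ℝ}, Filter.Tendsto (fun q : ℕ => (f q : ℝ) / q) Filter.atTop (nhds y) → |y| < 2 * c →
      ∀ᶠ q : ℕ in Filter.atTop, -(2 * c) * q ≤ f q ∧ (f q + 1 : ℝ) ≤ 2 * c * q := fun {f y c} hf hy => by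
    rw [abs_lt] at hy
    have hf' := hf.add tendsto_one_div_atTop_nhds_zero_nat
    rw [add_zero] at hf'
    filter_upwards [hf.eventually_const_lt hy.1, hf'.eventually_lt_const hy.2, Filter.eventually_gt_atTop 0] with q e1 e2 hq
    have hq : (0 : ℝ) < q := by exact_mod_cast hq
    rw [← add_div, div_lt_iff₀ hq] at e2
    rw [lt_div_iff₀ hq] at e1
    exact ⟨e1.le, e2.le⟩
  filter_upwards [h ((continuous_fst.tendsto _).comp ht) h1, h ((continuous_snd.tendsto _).comp ht) h2] with q e1 e2
  exact mem_RW.2 ⟨e1, e2⟩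

theorem eventually_approx_eq {n : ℕ} [NeZero n] {l α β : ℝ} (hl : 0 < l) (hα : 0 < α) (hβ : 0 < β) {R : Set (ℝ × ℝ)}
    (hR : rect (-α) α (-β) β ⊆ R) {η : Fin n → ℝ × ℝ} (H : Gen α β η)
    (hη : ∀ i, |(η i).1| < 2 * α ∧ |(η i).2| < 2 * β) :
    ∀ᶠ q : ℕ in Filter.atTop, approx q (l * α) (l * β) (fun i => site q l (η i)) = condProb R (-α) α (-β) β η := by
  have hlim : ∀ i, Filter.Tendsto (fun q : ℕ => pos q (site q l (η i))) Filter.atTop (nhds (l • η i)) :=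
    fun i => tendsto_pos_site l (η i)
  have hc : ∀ {u c : ℝ}, |u| < 2 * c → |l * u| < 2 * (l * c) := fun {u c} h => by
    rw [abs_mul, abs_of_pos hl, mul_left_comm]
    exact mul_lt_mul_of_pos_left h hl
  have hinj : ∀ᶠ q : ℕ in Filter.atTop, ∀ i j, i ≠ j → site q l (η i) ≠ site q l (η j) := by
    refine Filter.eventually_all.2 fun i => Filter.eventually_all.2 fun j => ?_
    by_cases hij : i = j
    · exact Filter.Eventually.of_forall fun q h => absurd hij h
    · have hne : l • η i ≠ l • η j := fun h => H.fst_ne i j hij (by rw [smul_right_injective _ hl.ne' h])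
      filter_upwards [((hlim i).sub (hlim j)).eventually_ne (sub_ne_zero.2 hne)] with q hq _ h
      exact hq (by rw [h, sub_self])
  filter_upwards [hinj, Filter.eventually_all.2 fun i => eventually_site_mem (hc (hη i).1) (hc (hη i).2),
    (tendsto_pi_nhds.2 hlim).eventually ((H.smul hl).qcp_eventually hl hα hβ hR)] with q h1 h2 h3
  have hζ : Function.Injective fun i => (⟨site q l (η i), h2 i⟩ : RW q (l * α) (l * β)) := fun i j hij => by
    by_contra h
    exact h1 i j h (Subtype.ext_iff.1 hij)
  rw [approx_eq hζ fun _ => rfl, qcp_occ hζ]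
  exact h3

section Transfer
variable {n : ℕ} {α β : ℝ}

theorem volume_rect_two (hα : 0 < α) (hab : 16 * α * β = 1) :
    volume (rect (-(2 * α)) (2 * α) (-(2 * β)) (2 * β)) = 1 := by
  rw [rect, Measure.volume_eq_prod, Measure.prod_prod, Real.volume_Icc, Real.volume_Icc,
    ← ENNReal.ofReal_mul (by linarith), ← ENNReal.ofReal_one]
  congr 1; linarith

theorem condProb_tail (hn : 1 ≤ n) (hα : 0 < α) (hβ : 0 < β) (hab : 16 * α * β = 1) {G : ℝ} (hG : 0 < G)
    (hGn : 40 * G * (1 + Real.log n) ≤ n)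
    (H : ∀ q : ℕ, 0 < q → ∀ t, Pro (bw (act q))
        {σ | t ≤ |qcp (wpos q (RW q (√n * α) (√n * β))) (rect (-(√n * α)) (√n * α) (-(√n * β)) (√n * β)) Prod.fst
            (-(√n * α)) (√n * α) σ -
          Ex (bw (act q)) (qcp (wpos q (RW q (√n * α) (√n * β))) (rect (-(√n * α)) (√n * α) (-(√n * β)) (√n * β))
            Prod.fst (-(√n * α)) (√n * α))|} ≤
        4 * Real.exp (-(t * (40 * G * (1 + Real.log n))))) {t : ℝ} (ht : 0 < t) {R : Set (ℝ × ℝ)}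
    (hR : R = rect (-(2 * α)) (2 * α) (-(2 * β)) (2 * β)) :
    pts R n {η | t ≤ |condProb R (-α) α (-β) β η - annealed R (-α) α (-β) β n|} ≤
      ENNReal.ofReal (4 * Real.exp (-(t * G))) := by
  have hn0 : (0 : ℝ) < n := by exact_mod_cast hn
  have : NeZero n := ⟨by lia⟩
  set l := √(n : ℝ) with hl_def
  have hl : 0 < l := Real.sqrt_pos.2 hn0
  have hvol : volume R = 1 := by rw [hR]; exact volume_rect_two hα hab
  have hu : unif R = volume.restrict R := by rw [unif, hvol, inv_one, one_smul]
  have : IsProbabilityMeasure (unif R) := ⟨by rw [hu, Measure.restrict_apply_univ, hvol]⟩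
  have hle : unif R ≤ volume := hu ▸ Measure.restrict_le_self
  have : IsProbabilityMeasure (pts R n) := by unfold pts; infer_instance
  have hsub : rect (-α) α (-β) β ⊆ R := by
    rw [hR]
    exact prod_mono (Icc_subset_Icc (by linarith) (by linarith)) (Icc_subset_Icc (by linarith) (by linarith))
  have hbd : ∀ᵐ η ∂pts R n, ∀ i, |(η i).1| < 2 * α ∧ |(η i).2| < 2 * β := by
    refine ae_all_iff.2 fun i => ?_
    have h1 : ∀ᵐ x ∂unif R, |x.1| < 2 * α ∧ |x.2| < 2 * β := by
      have hconv : Convex ℝ R := by rw [hR]; exact (convex_Icc _ _).prod (convex_Icc _ _)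
      have hm : MeasurableSet R := by rw [hR]; exact measurableSet_Icc.prod measurableSet_Icc
      have h2 : ∀ᵐ x ∂unif R, x ∉ frontier R :=
        measure_eq_zero_iff_ae_notMem.1 ((hle.absolutelyContinuous) (hconv.addHaar_frontier _))
      have h3 : ∀ᵐ x ∂unif R, x ∈ R := by rw [hu]; exact ae_restrict_mem hm
      filter_upwards [h2, h3] with x e2 e3
      have e4 : x ∈ interior R := by
        by_contra h
        exact e2 ⟨subset_closure e3, h⟩
      rw [hR, rect, interior_prod_eq, interior_Icc, interior_Icc] at e4
      exact ⟨abs_lt.2 e4.1, abs_lt.2 e4.2⟩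
    exact (Measure.quasiMeasurePreserving_eval (μ := fun _ : Fin n => unif R) i).ae h1
  have hgen : ∀ᵐ η ∂pts R n, Gen α β η := ae_gen hle.absolutelyContinuous α β
  set g : ℕ → (Fin n → ℝ × ℝ) → ℝ := fun q η => approx q (l * α) (l * β) fun i => site q l (η i)
  have hg : ∀ q, Measurable (g q) := fun q =>
    (Measurable.of_discrete (f := approx q (l * α) (l * β) (n := n))).comp
      (measurable_pi_lambda _ fun i => (measurable_site q l).comp (measurable_pi_apply i))
  have hlim : ∀ᵐ η ∂pts R n, ∀ᶠ q in Filter.atTop, g q η = condProb R (-α) α (-β) β η := by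
    filter_upwards [hbd, hgen] with η e1 e2
    exact eventually_approx_eq hl hα hβ hsub e2 e1
  set cp : (Fin n → ℝ × ℝ) → ℝ := fun η => condProb R (-α) α (-β) β η
  have hcp : AEMeasurable cp (pts R n) := by
    refine aemeasurable_of_tendsto_metrizable_ae Filter.atTop (fun q => (hg q).aemeasurable) ?_
    filter_upwards [hlim] with η hη
    exact tendsto_const_nhds.congr' (hη.mono fun q hq => hq.symm)
  have hcp0 : ∀ η, 0 ≤ cp η := fun η => by simp only [cp, condProb]; positivity
  have hcp1 : ∀ η, cp η ≤ 1 := fun η => by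
    simp only [cp, condProb]
    rw [div_le_one (by positivity)]
    have := Finset.card_filter_le (Finset.univ : Finset (Fin n → Bool)) fun c => Crossing R (-α) α (-β) β η c
    have e : (Finset.univ : Finset (Fin n → Bool)).card = 2 ^ n := by simp
    rw [e] at this
    exact_mod_cast this
  set X : (Fin n → ℝ × ℝ) → ℝ := fun η => max 0 (min 1 (hcp.mk cp η))
  have hX : Measurable X := measurable_const.max (measurable_const.min hcp.measurable_mk)
  have hXcp : X =ᵐ[pts R n] cp := by
    filter_upwards [hcp.ae_eq_mk] with η hη
    simp only [X, ← hη, min_eq_right (hcp1 η), max_eq_right (hcp0 η)]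
  have hX1 : ∀ η, X η ≤ 1 := fun η => max_le zero_le_one (min_le_left _ _)
  have hX0 : ∀ η, 0 ≤ X η := fun η => le_max_left _ _
  have hexp : Real.exp (Real.log n) = n := Real.exp_log hn0
  have key := tail_mean_le (μ := pts R n) hX hX0 hX1 (x := Real.log n) (G := G) (t := t)
    (Real.log_nonneg (by exact_mod_cast hn)) hG (by rw [hexp]; exact hGn) ht fun ε hε => by
      set F : ∀ q, (RW q (l * α) (l * β) → Bool) → ℝ := fun q =>
        qcp (wpos q (RW q (l * α) (l * β))) (rect (-(l * α)) (l * α) (-(l * β)) (l * β)) Prod.fst (-(l * α)) (l * α)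
      obtain ⟨q, hq, h⟩ := exists_tail_le (μ := pts R n) hX hX1 hg
        (by filter_upwards [hlim, hXcp] with η e1 e2 using by rw [e2]; exact e1) (m := fun q => Ex (bw (act q)) (F q))
        (T := fun u => 8 * Real.exp (1 + Real.log n) * Real.exp (-(u * (40 * G * (1 + Real.log n)))))
        (fun u => by positivity) (by
          have h16 : 16 * (l * α) * (l * β) = n := by
            have := Real.mul_self_sqrt hn0.le
            rw [← hl_def] at this
            linear_combination (n : ℝ) * hab + 16 * α * β * this
          filter_upwards [eventually_pi_occ_le (ν := unif R) hn hle (by positivity) (by positivity) h16,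
            Filter.eventually_gt_atTop 0] with q hq hq0 u
          refine (measure_mono ?_).trans ((hq {σ | u ≤ |F q σ - Ex (bw (act q)) (F q)|}).trans
            (ENNReal.ofReal_le_ofReal ?_))
          · rintro η ⟨h1, h2⟩
            by_cases hz : Function.Injective (fun i => site q l (η i)) ∧ ∀ i, site q l (η i) ∈ RW q (l * α) (l * β)
            · have hζ : Function.Injective fun i => (⟨site q l (η i), hz.2 i⟩ : RW q (l * α) (l * β)) :=
                fun i j hij => hz.1 (Subtype.ext_iff.1 hij)
              refine ⟨_, hζ, ?_, fun i => rfl⟩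
              simp only [g, approx_eq hζ fun _ => rfl] at h2
              exact h2
            · simp only [g, approx, if_neg hz] at h1
              norm_num at h1
          · have := mul_le_mul_of_nonneg_left (H q hq0 u) (show 0 ≤ 2 * Real.exp 1 * n by positivity)
            rw [Real.exp_add, hexp]
            linarith) hε
      have hw := isWeight_bw (act_nonneg q) (act_le_one hq)
      exact ⟨Ex (bw (act q)) (F q), Ex_nonneg hw fun _ => qcp_nonneg .., Ex_le_of_le hw fun _ => qcp_le_one ..,
        fun u _ => h u⟩
  have hmean : annealed R (-α) α (-β) β n = ∫ η, X η ∂pts R n := integral_congr_ae hXcp.symm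
  have e : (pts R n) {η | t ≤ |condProb R (-α) α (-β) β η - annealed R (-α) α (-β) β n|} =
      (pts R n) {η | t ≤ |X η - ∫ η, X η ∂pts R n|} := by
    rw [hmean]
    refine measure_congr ?_
    filter_upwards [hXcp] with η hη
    have hη : X η = condProb R (-α) α (-β) β η := hη
    refine propext ?_
    show t ≤ _ ↔ t ≤ _
    rw [hη]
  rw [e, ← ofReal_measureReal]
  exact ENNReal.ofReal_le_ofReal key

end Transfer

/-- For every `θ > 0` there exist `γ > 0` and `N ≥ 1` such that, with
`γ_k = γ^(k-1)` and `N_k = N^(2^(k-1))`, for every `k ≥ 1`, `ρ ∈ (θ, 1/θ)`, `n ≥ N_k` and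
`t > 0`: `P_{R(ρ)}(|P(H_{R(ρ,1/4)} | η) - P_{R(ρ)}(H_{R(ρ,1/4)})| ≥ t)
  ≤ 4 exp(-t γ_k (log n)^k)`. -/
theorem bulk_iterated_bound (θ : ℝ) (hθ : 0 < θ) :
    ∃ γ : ℝ, 0 < γ ∧ ∃ N : ℕ, 1 ≤ N ∧
      ∀ k : ℕ, 1 ≤ k → ∀ ρ : ℝ, ρ ∈ Ioo θ (1/θ) → ∀ n : ℕ, N ^ 2 ^ (k - 1) ≤ n →
        ∀ t : ℝ, 0 < t →
          pts (Rrect ρ 1) n {η : Fin n → ℝ × ℝ |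
              t ≤ |condProb (Rrect ρ 1) (Rco ρ (1/4)).1 (Rco ρ (1/4)).2.1
                    (Rco ρ (1/4)).2.2.1 (Rco ρ (1/4)).2.2.2 η -
                  annealed (Rrect ρ 1) (Rco ρ (1/4)).1 (Rco ρ (1/4)).2.1
                    (Rco ρ (1/4)).2.2.1 (Rco ρ (1/4)).2.2.2 n|}
            ≤ ENNReal.ofReal (4 * Real.exp (-(t * γ ^ (k - 1) * Real.log n ^ k))) := by
  rcases le_or_gt 1 θ with h1 | h1
  · refine ⟨1, one_pos, 1, le_rfl, fun k _ ρ hρ => ?_⟩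
    have := (div_le_one hθ).2 h1
    linarith [hρ.1, hρ.2]
  obtain ⟨γ, hγ, N, hN, H⟩ := lattice_tail hθ h1
  refine ⟨γ, hγ, N, by lia, fun k hk ρ hρ n hn t ht => ?_⟩
  obtain ⟨hb, hH⟩ := H k hk n hn
  have hn3 : 3 ≤ n := hN.trans ((Nat.le_self_pow (by positivity) N).trans hn)
  have hn1 : (1 : ℝ) < n := by exact_mod_cast (by lia : 1 < n)
  have hρ0 : 0 < ρ := hθ.trans hρ.1
  have hsρ : 0 < √ρ := Real.sqrt_pos.2 hρ0
  have hsθ : 0 < √θ := Real.sqrt_pos.2 hθ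
  have e4 : √(1 / 4 : ℝ) = 1 / 2 := by
    rw [show (1 / 4 : ℝ) = (1 / 2) ^ 2 by norm_num]; exact Real.sqrt_sq (by norm_num)
  have ea : √(ρ * (1 / 4)) / 2 = √ρ / 4 := by rw [Real.sqrt_mul hρ0.le, e4]; ring
  have eb : √(1 / 4 / ρ) / 2 = 1 / (4 * √ρ) := by rw [Real.sqrt_div (by norm_num), e4]; field_simp; norm_num
  have hR : Rrect ρ 1 = rect (-(2 * (√ρ / 4))) (2 * (√ρ / 4)) (-(2 * (1 / (4 * √ρ)))) (2 * (1 / (4 * √ρ))) := by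
    simp only [Rrect, Rco, neg_div, mul_one, one_div, Real.sqrt_inv]
    congr 1 <;> field_simp <;> norm_num
  have h2 : √θ ≤ √ρ := Real.sqrt_le_sqrt hρ.1.le
  have h3 : √ρ * √θ ≤ 1 := by
    rw [← Real.sqrt_mul hρ0.le, Real.sqrt_le_one]
    have := hρ.2.le
    rwa [le_div_iff₀ hθ] at this
  have hs := Real.sqrt_nonneg (n : ℝ)
  have key := condProb_tail (n := n) (α := √ρ / 4) (β := 1 / (4 * √ρ)) (by lia) (by positivity) (by positivity)
    (by field_simp; norm_num) (G := γ ^ (k - 1) * Real.log n ^ k)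
    (mul_pos (pow_pos hγ _) (pow_pos (Real.log_pos hn1) _)) hb
    (hH _ _ (by rw [mul_div_assoc]; gcongr)
      (by
        rw [mul_div_assoc]
        refine mul_le_mul_of_nonneg_left ?_ hs
        rw [div_le_div_iff₀ (by norm_num) (by positivity)]
        linarith)
      (by
        rw [div_eq_mul_one_div √(n : ℝ)]
        refine mul_le_mul_of_nonneg_left ?_ hs
        rw [div_le_div_iff₀ (by norm_num) (by positivity)]
        linarith)
      (by
        rw [div_eq_mul_one_div (√(n : ℝ))]
        gcongr)) ht hR
  simp only [Rco, neg_div, ea, eb]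
  rwa [← mul_assoc] at key

end VoronoiTest
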